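/- Let n ≥ 2 and let c ⊂ ℝ^n be a compact connected smooth embedded hypersurface (an (n−1)-dimensional smooth embedded submanifold of ℝ^n). Then there exist λ > 0, N ∈ ℕ, unit vectors ξ_1, …, ξ_N ∈ S^{n−1}, real constants α_1, …, α_N, β_1, …, β_N, and a diffeomorphism Ψ : ℝ^n → ℝ^n, such that the trigonometric polynomial f(x) = Σ_{j=1}^N ( α_j cos⟨x, ξ_j⟩ + β_j sin⟨x, ξ_j⟩ ) has Ψ(λc) as a connected component of its zero set f^{−1}(0), where λc = { λx : x ∈ c }. In particular, f^{−1}(0) has a connected component diffeomorphic to c. -/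

import Mathlib

open MeasureTheory Real
open scoped RealInnerProductSpace

noncomputable section

/-- `c` is a smooth embedded hypersurface of `ℝ^n`: near each of its points it is a regular
level set of a smooth function. -/
def IsSmoothHypersurface {n : ℕ} (c : Set (EuclideanSpace ℝ (Fin n))) : Prop :=
  ∀ x ∈ c, ∃ (U : Set (EuclideanSpace ℝ (Fin n))) (F : EuclideanSpace ℝ (Fin n) → ℝ),
    IsOpen U ∧ x ∈ U ∧ ContDiffOn ℝ (⊤ : ℕ∞) F U ∧ (∀ y ∈ U, fderiv ℝ F y ≠ 0) ∧
    c ∩ U = {y ∈ U | F y = 0}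

namespace Mono
open scoped ContDiff Topology
open Filter Set

abbrev Eu (n : ℕ) := EuclideanSpace ℝ (Fin n)

variable {n : ℕ}

/-- The `i`-th standard basis vector. -/
def bv (i : Fin n) : Eu n := EuclideanSpace.single i (1 : ℝ)

/-- The `i`-th partial derivative. -/
def pd (i : Fin n) (f : Eu n → ℝ) (x : Eu n) : ℝ := fderiv ℝ f x (bv i)

/-- The Laplacian. -/
def lap (f : Eu n → ℝ) (x : Eu n) : ℝ := ∑ i, pd i (pd i f) x

/-- `f` is smooth on a neighbourhood of `x`. -/
def SmAt (f : Eu n → ℝ) (x : Eu n) : Prop := ∀ᶠ y in 𝓝 x, ContDiffAt ℝ ∞ f y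

lemma SmAt.cda {f : Eu n → ℝ} {x : Eu n} (hf : SmAt f x) : ContDiffAt ℝ ∞ f x :=
  Eventually.self_of_nhds hf

lemma SmAt.ev {f : Eu n → ℝ} {x : Eu n} (hf : SmAt f x) : ∀ᶠ y in 𝓝 x, SmAt f y :=
  eventually_eventually_nhds.2 hf

lemma SmAt.diff {f : Eu n → ℝ} {x : Eu n} (hf : SmAt f x) : DifferentiableAt ℝ f x :=
  hf.cda.differentiableAt (by simp)

lemma SmAt.cont {f : Eu n → ℝ} {x : Eu n} (hf : SmAt f x) : ContinuousAt f x :=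
  hf.cda.continuousAt

lemma smAt_of_contDiff {f : Eu n → ℝ} (hf : ContDiff ℝ ∞ f) (x : Eu n) : SmAt f x :=
  Eventually.of_forall fun _ => hf.contDiffAt

lemma smAt_of_contDiffOn {f : Eu n → ℝ} {U : Set (Eu n)} (hU : IsOpen U)
    (hf : ContDiffOn ℝ ∞ f U) {x : Eu n} (hx : x ∈ U) : SmAt f x := by
  filter_upwards [hU.mem_nhds hx] with y hy using hf.contDiffAt (hU.mem_nhds hy)

lemma smAt_const (c : ℝ) (x : Eu n) : SmAt (fun _ => c) x := smAt_of_contDiff contDiff_const x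

lemma SmAt.add {f g : Eu n → ℝ} {x : Eu n} (hf : SmAt f x) (hg : SmAt g x) :
    SmAt (fun y => f y + g y) x := by
  filter_upwards [hf, hg] with y h1 h2 using h1.add h2

lemma SmAt.sub {f g : Eu n → ℝ} {x : Eu n} (hf : SmAt f x) (hg : SmAt g x) :
    SmAt (fun y => f y - g y) x := by
  filter_upwards [hf, hg] with y h1 h2 using h1.sub h2

lemma SmAt.mul {f g : Eu n → ℝ} {x : Eu n} (hf : SmAt f x) (hg : SmAt g x) :
    SmAt (fun y => f y * g y) x := by
  filter_upwards [hf, hg] with y h1 h2 using h1.mul h2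

lemma SmAt.comp {φ : ℝ → ℝ} {f : Eu n → ℝ} {x : Eu n} (hφ : ContDiff ℝ ∞ φ) (hf : SmAt f x) :
    SmAt (fun y => φ (f y)) x := by
  filter_upwards [hf] with y h1 using hφ.contDiffAt.comp y h1

lemma SmAt.congr {f g : Eu n → ℝ} {x : Eu n} (hf : SmAt f x) (h : f =ᶠ[𝓝 x] g) : SmAt g x := by
  filter_upwards [hf, h.eventually_nhds] with y h1 h2
  exact h1.congr_of_eventuallyEq (EventuallyEq.symm h2)

lemma contDiff_of_smAt {f : Eu n → ℝ} (h : ∀ x, SmAt f x) : ContDiff ℝ ∞ f :=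
  contDiff_iff_contDiffAt.2 fun x => (h x).cda

lemma SmAt.pd {f : Eu n → ℝ} {x : Eu n} (hf : SmAt f x) (i : Fin n) : SmAt (pd i f) x := by
  filter_upwards [hf] with y h
  exact (h.fderiv_right (m := ∞) (by simp)).clm_apply contDiffAt_const

lemma SmAt.lap {f : Eu n → ℝ} {x : Eu n} (hf : SmAt f x) : SmAt (lap f) x := by
  filter_upwards [eventually_all.2 fun i => (hf.pd i).pd i] with y h
  exact ContDiffAt.sum fun i _ => h i

lemma contDiff_pd {f : Eu n → ℝ} (hf : ContDiff ℝ ∞ f) (i : Fin n) : ContDiff ℝ ∞ (pd i f) :=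
  contDiff_of_smAt fun x => (smAt_of_contDiff hf x).pd i

lemma contDiff_lap {f : Eu n → ℝ} (hf : ContDiff ℝ ∞ f) : ContDiff ℝ ∞ (lap f) :=
  contDiff_of_smAt fun x => (smAt_of_contDiff hf x).lap

lemma pd_congr {f g : Eu n → ℝ} {x : Eu n} (h : f =ᶠ[𝓝 x] g) (i : Fin n) :
    pd i f =ᶠ[𝓝 x] pd i g := by
  filter_upwards [EventuallyEq.fderiv (𝕜 := ℝ) h] with y hy
  simp [pd, hy]

lemma lap_congr {f g : Eu n → ℝ} {x : Eu n} (h : f =ᶠ[𝓝 x] g) :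
    lap f =ᶠ[𝓝 x] lap g := by
  have := eventually_all.2 fun i => pd_congr (pd_congr h i) i
  filter_upwards [this] with y hy
  exact Finset.sum_congr rfl fun i _ => hy i

lemma pd_add {f g : Eu n → ℝ} {x : Eu n} (hf : DifferentiableAt ℝ f x)
    (hg : DifferentiableAt ℝ g x) (i : Fin n) :
    pd i (fun y => f y + g y) x = pd i f x + pd i g x := by
  simp [pd, fderiv_fun_add hf hg]

lemma pd_const (c : ℝ) (i : Fin n) (x : Eu n) : pd i (fun _ => c) x = 0 := by
  simp [pd]

lemma pd_mul {f g : Eu n → ℝ} {x : Eu n} (hf : DifferentiableAt ℝ f x)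
    (hg : DifferentiableAt ℝ g x) (i : Fin n) :
    pd i (fun y => f y * g y) x = f x * pd i g x + g x * pd i f x := by
  simp [pd, fderiv_fun_mul hf hg]

lemma pd_const_mul {f : Eu n → ℝ} {x : Eu n} (c : ℝ) (i : Fin n) :
    pd i (fun y => c * f y) x = c * pd i f x := by
  have : (fun y => c * f y) = c • f := rfl
  rw [pd, this, fderiv_const_smul_field]; rfl

lemma pd_comp {φ : ℝ → ℝ} {f : Eu n → ℝ} {x : Eu n} (hφ : DifferentiableAt ℝ φ (f x))
    (hf : DifferentiableAt ℝ f x) (i : Fin n) :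
    pd i (fun y => φ (f y)) x = deriv φ (f x) * pd i f x := by
  have := (hφ.hasDerivAt.comp_hasFDerivAt x hf.hasFDerivAt).fderiv
  have h2 : (fun y => φ (f y)) = φ ∘ f := rfl
  rw [pd, h2, this]; simp [pd]

lemma lap_const_mul {f : Eu n → ℝ} {x : Eu n} (c : ℝ) :
    lap (fun y => c * f y) x = c * lap f x := by
  have : ∀ i, pd i (fun y => c * f y) = fun y => c * pd i f y := fun i =>
    funext fun y => pd_const_mul c i
  simp [lap, this, pd_const_mul, Finset.mul_sum]

lemma lap_const (c : ℝ) (x : Eu n) : lap (fun _ => c) x = 0 := by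
  have : ∀ i, pd i (fun _ : Eu n => c) = fun _ => 0 := fun i => funext fun y => pd_const c i y
  simp [lap, this, pd_const]

lemma lap_add {f g : Eu n → ℝ} {x : Eu n} (hf : SmAt f x) (hg : SmAt g x) :
    lap (fun y => f y + g y) x = lap f x + lap g x := by
  rw [lap, lap, lap, ← Finset.sum_add_distrib]
  refine Finset.sum_congr rfl fun i _ => ?_
  have h : pd i (fun y => f y + g y) =ᶠ[𝓝 x] fun y => pd i f y + pd i g y := by
    filter_upwards [hf.ev, hg.ev] with y h1 h2
    exact pd_add h1.diff h2.diff i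
  rw [(pd_congr h i).self_of_nhds, pd_add (hf.pd i).diff (hg.pd i).diff]

lemma lap_sub {f g : Eu n → ℝ} {x : Eu n} (hf : SmAt f x) (hg : SmAt g x) :
    lap (fun y => f y - g y) x = lap f x - lap g x := by
  have h := lap_add hf (g := fun y => (-1) * g y) ((smAt_const _ _).mul hg)
  rw [lap_const_mul] at h
  have e : (fun y => f y - g y) = fun y => f y + (-1) * g y := by ext; ring
  rw [e, h]; ring

lemma lap_comp {φ : ℝ → ℝ} {f : Eu n → ℝ} {x : Eu n} (hφ : ContDiff ℝ ∞ φ)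
    (hf : SmAt f x) :
    lap (fun y => φ (f y)) x
      = deriv φ (f x) * lap f x + deriv (deriv φ) (f x) * ∑ i, pd i f x ^ 2 := by
  have hφ' : ContDiff ℝ ∞ (deriv φ) := (contDiff_infty_iff_deriv.1 hφ).2
  have key : ∀ i, pd i (pd i (fun y => φ (f y))) x = deriv φ (f x) * pd i (pd i f) x
      + deriv (deriv φ) (f x) * pd i f x ^ 2 := by
    intro i
    have h : pd i (fun y => φ (f y)) =ᶠ[𝓝 x] fun y => deriv φ (f y) * pd i f y := by
      filter_upwards [hf.ev] with y h1
      exact pd_comp (hφ.differentiable (by simp) _) h1.diff i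
    have h3 : SmAt (fun y => deriv φ (f y)) x := SmAt.comp hφ' hf
    rw [(pd_congr h i).self_of_nhds, pd_mul h3.diff (hf.pd i).diff,
      pd_comp (hφ'.differentiable (by simp) _) hf.diff]
    ring
  simp only [lap, key, Finset.sum_add_distrib, Finset.mul_sum]

lemma deriv_line {f : Eu n → ℝ} {x v : Eu n} {t : ℝ} (hf : DifferentiableAt ℝ f (x + t • v)) :
    HasDerivAt (fun s : ℝ => f (x + s • v)) (fderiv ℝ f (x + t • v) v) t := by
  have h1 : HasDerivAt (fun s : ℝ => x + s • v) v t := by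
    simpa using ((hasDerivAt_id t).smul_const v).const_add x
  exact hf.hasFDerivAt.comp_hasDerivAt t h1

lemma lap_nonpos_of_isLocalMax {f : Eu n → ℝ} {x : Eu n} (hf : SmAt f x)
    (hx : IsLocalMax f x) : lap f x ≤ 0 := by
  refine Finset.sum_nonpos fun i _ => ?_
  by_contra! hpos
  set φ : ℝ → ℝ := fun s => f (x + s • bv i) with hφ
  have htend : Tendsto (fun s : ℝ => x + s • bv i) (𝓝 0) (𝓝 x) := by
    have : Continuous (fun s : ℝ => x + s • bv i) := by fun_prop
    simpa using this.tendsto 0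
  have hd : deriv φ =ᶠ[𝓝 0] fun s => pd i f (x + s • bv i) := by
    filter_upwards [htend.eventually (hf.ev)] with s hs
    exact (deriv_line hs.diff).deriv
  have hmax : IsLocalMax φ 0 := by
    have := htend.eventually hx
    simpa [IsLocalMax, IsMaxFilter, hφ] using this
  have hdd : deriv (deriv φ) 0 = pd i (pd i f) x := by
    rw [hd.deriv_eq]
    have := (deriv_line (f := pd i f) (x := x) (v := bv i) (t := 0)
      (by simpa using (hf.pd i).diff)).deriv
    rw [this]; simp [pd]
  have hc : ContinuousAt φ 0 := by
    have : ContinuousAt f (x + (0:ℝ) • bv i) := by simpa using hf.cont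
    exact ContinuousAt.comp (f := fun s : ℝ => x + s • bv i) this (by fun_prop)
  have hmin := isLocalMin_of_deriv_deriv_pos (hdd ▸ hpos) hmax.deriv_eq_zero hc
  have hconst : φ =ᶠ[𝓝 0] fun _ => φ 0 := by
    filter_upwards [hmin, hmax] with s h1 h2 using le_antisymm h2 h1
  have : deriv (deriv φ) 0 = 0 := by
    rw [hconst.deriv.deriv_eq]; simp
  linarith

/-- Smooth compactly supported functions. -/
structure Tst (k : Eu n → ℝ) : Prop where
  smooth : ContDiff ℝ ∞ k
  cs : HasCompactSupport k

lemma Tst.cont {k : Eu n → ℝ} (hk : Tst k) : Continuous k := hk.smooth.continuous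

lemma Tst.int {k : Eu n → ℝ} (hk : Tst k) : Integrable k :=
  hk.cont.integrable_of_hasCompactSupport hk.cs

lemma Tst.pd {k : Eu n → ℝ} (hk : Tst k) (i : Fin n) : Tst (pd i k) :=
  ⟨contDiff_pd hk.smooth i, hk.cs.fderiv_apply ℝ (bv i)⟩

lemma Tst.mul_left {f k : Eu n → ℝ} (hf : ContDiff ℝ ∞ f) (hk : Tst k) :
    Tst (fun x => f x * k x) := ⟨hf.mul hk.smooth, hk.cs.mul_left⟩

lemma Tst.const_mul {k : Eu n → ℝ} (c : ℝ) (hk : Tst k) :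
    Tst (fun x => c * k x) := Tst.mul_left contDiff_const hk

lemma Tst.add {f k : Eu n → ℝ} (hf : Tst f) (hk : Tst k) :
    Tst (fun x => f x + k x) := ⟨hf.smooth.add hk.smooth, hf.cs.add hk.cs⟩

lemma tst_zero : Tst (fun _ : Eu n => 0) := ⟨contDiff_const, HasCompactSupport.zero⟩

lemma Tst.sum {ι : Type*} (s : Finset ι) {f : ι → Eu n → ℝ} (hf : ∀ i ∈ s, Tst (f i)) :
    Tst (fun x => ∑ i ∈ s, f i x) := by
  classical
  induction s using Finset.induction_on with
  | empty => simpa using tst_zero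
  | insert a s ha ih =>
    simp only [Finset.sum_insert ha]
    exact (hf a (by simp)).add (ih fun i hi => hf i (by simp [hi]))

lemma Tst.lap {k : Eu n → ℝ} (hk : Tst k) : Tst (lap k) :=
  Tst.sum _ fun i _ => (hk.pd i).pd i

lemma Tst.comp_sub {k : Eu n → ℝ} (hk : Tst k) (x : Eu n) : Tst (fun y => k (x - y)) :=
  ⟨hk.smooth.comp (contDiff_const.sub contDiff_id),
    hk.cs.comp_homeomorph (Homeomorph.subLeft x)⟩

lemma tsupport_pd_subset (k : Eu n → ℝ) (i : Fin n) : tsupport (pd i k) ⊆ tsupport k :=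
  tsupport_fderiv_apply_subset ℝ (bv i)

lemma tsupport_lap_subset (k : Eu n → ℝ) : tsupport (lap k) ⊆ tsupport k := by
  intro x hx
  by_contra hnot
  have h0 : k =ᶠ[𝓝 x] fun _ => 0 := notMem_tsupport_iff_eventuallyEq.1 hnot
  have : lap k =ᶠ[𝓝 x] 0 := (lap_congr h0).trans (Eventually.of_forall fun y => lap_const 0 y)
  exact (notMem_tsupport_iff_eventuallyEq.2 this) hx

lemma exists_bump {K U : Set (Eu n)} (hK : IsCompact K) (hU : IsOpen U) (hKU : K ⊆ U) :
    ∃ χ : Eu n → ℝ, Tst χ ∧ tsupport χ ⊆ U ∧ (∀ x ∈ K, χ =ᶠ[𝓝 x] fun _ => 1) ∧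
      ∀ x, χ x ∈ Icc (0:ℝ) 1 := by
  obtain ⟨L, hL, hKL, hLU⟩ := exists_compact_between hK hU hKU
  obtain ⟨f, h1, h0, h01⟩ := exists_contMDiffMap_one_nhds_of_subset_interior (n := ⊤)
    (modelWithCornersSelf ℝ (Eu n)) hK.isClosed hKL
  have hsupp : tsupport f ⊆ L :=
    closure_minimal (fun x hx => by by_contra h; exact hx (h0 x h)) hL.isClosed
  refine ⟨f, ⟨f.contMDiff.contDiff, hL.of_isClosed_subset (isClosed_tsupport _) hsupp⟩,
    hsupp.trans hLU, fun x hx => ?_, h01⟩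
  exact eventually_nhdsSet_iff_forall.1 h1 x hx

/-- Localisation: a function smooth on an open set agrees near a compact subset with a
test function. -/
lemma exists_localisation {f : Eu n → ℝ} {K U : Set (Eu n)} (hK : IsCompact K) (hU : IsOpen U)
    (hKU : K ⊆ U) (hf : ∀ x ∈ U, SmAt f x) :
    ∃ F : Eu n → ℝ, Tst F ∧ tsupport F ⊆ U ∧ ∀ x ∈ K, F =ᶠ[𝓝 x] f := by
  obtain ⟨χ, hχ, hs, h1, -⟩ := exists_bump hK hU hKU
  have hts : tsupport (fun x => χ x * f x) ⊆ tsupport χ := tsupport_mul_subset_left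
  refine ⟨fun x => χ x * f x, ⟨contDiff_of_smAt fun x => ?_, hχ.cs.mul_right⟩, hts.trans hs,
    fun x hx => ?_⟩
  · by_cases hx : x ∈ tsupport χ
    · exact (smAt_of_contDiff hχ.smooth x).mul (hf x (hs hx))
    · have : (fun _ => 0) =ᶠ[𝓝 x] fun x => χ x * f x := by
        filter_upwards [notMem_tsupport_iff_eventuallyEq.1 hx] with y hy
        simp [hy]
      exact (smAt_const 0 x).congr this
  · filter_upwards [h1 x hx] with y hy
    simp [hy]

lemma integral_mul_pd {f k : Eu n → ℝ} (hf : ContDiff ℝ ∞ f) (hk : Tst k) (i : Fin n) :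
    ∫ x, f x * pd i k x = - ∫ x, pd i f x * k x :=
  integral_mul_fderiv_eq_neg_fderiv_mul_of_integrable
    (Tst.mul_left (contDiff_pd hf i) hk).int (Tst.mul_left hf (hk.pd i)).int
    (Tst.mul_left hf hk).int (fun x _ => hf.differentiable (by simp) x)
    (fun x _ => hk.smooth.differentiable (by simp) x)

lemma integral_mul_lap {f k : Eu n → ℝ} (hf : ContDiff ℝ ∞ f) (hk : Tst k) :
    ∫ x, f x * lap k x = - ∑ i, ∫ x, pd i f x * pd i k x := by
  have : ∀ x, f x * lap k x = ∑ i, f x * pd i (pd i k) x := fun x => by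
    simp [lap, Finset.mul_sum]
  simp_rw [this]
  rw [integral_finsetSum _ fun i _ => (Tst.mul_left hf ((hk.pd i).pd i)).int,
    ← Finset.sum_neg_distrib]
  exact Finset.sum_congr rfl fun i _ => integral_mul_pd hf (hk.pd i) i

lemma integral_mul_lap_comm {f k : Eu n → ℝ} (hf : ContDiff ℝ ∞ f) (hk : Tst k) :
    ∫ x, f x * lap k x = ∫ x, lap f x * k x := by
  rw [integral_mul_lap hf hk]
  have : ∀ x, lap f x * k x = ∑ i, pd i (pd i f) x * k x := fun x => by
    simp [lap, Finset.sum_mul]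
  simp_rw [this]
  rw [integral_finsetSum _ fun i _ =>
    (Tst.mul_left (contDiff_pd (contDiff_pd hf i) i) hk).int, ← Finset.sum_neg_distrib]
  refine Finset.sum_congr rfl fun i _ => ?_
  rw [integral_mul_pd (contDiff_pd hf i) hk i, neg_neg]

/-- Convolution of a function with a kernel. -/
def cv (u k : Eu n → ℝ) (x : Eu n) : ℝ := ∫ y, u y * k (x - y)

lemma cv_eq (u k : Eu n → ℝ) : cv u k = convolution u k (ContinuousLinearMap.mul ℝ ℝ) volume := rfl

lemma cv_contDiff {u k : Eu n → ℝ} (hu : LocallyIntegrable u) (hk : Tst k) :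
    ContDiff ℝ ∞ (cv u k) := by
  rw [cv_eq]; exact hk.cs.contDiff_convolution_right (n := ⊤) _ hu hk.smooth

lemma pd_cv {u k : Eu n → ℝ} (hu : LocallyIntegrable u) (hk : Tst k) (i : Fin n) :
    pd i (cv u k) = cv u (pd i k) := by
  funext x
  have h := hk.cs.hasFDerivAt_convolution_right (ContinuousLinearMap.mul ℝ ℝ) hu
    (hk.smooth.of_le (by simp)) x
  rw [pd, cv_eq, h.fderiv, convolution_precompR_apply _ hu (hk.cs.fderiv ℝ)
    (hk.smooth.continuous_fderiv (by simp))]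
  rfl

lemma cv_integrable {u k : Eu n → ℝ} (hu : LocallyIntegrable u) (hk : Continuous k)
    (hk' : HasCompactSupport k) (x : Eu n) : Integrable fun y => u y * k (x - y) :=
  hk'.convolutionExists_right (ContinuousLinearMap.mul ℝ ℝ) hu hk x

lemma lap_cv {u k : Eu n → ℝ} (hu : LocallyIntegrable u) (hk : Tst k) :
    lap (cv u k) = cv u (lap k) := by
  funext x
  have : ∀ i, pd i (pd i (cv u k)) x = ∫ y, u y * pd i (pd i k) (x - y) := fun i => by
    rw [pd_cv hu hk, pd_cv hu (hk.pd i)]; rfl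
  simp only [lap, this, cv, Finset.mul_sum]
  rw [integral_finsetSum]
  exact fun i _ => cv_integrable hu ((hk.pd i).pd i).cont ((hk.pd i).pd i).cs x

lemma cv_sub_eq (u k : Eu n → ℝ) (x : Eu n) : cv u k x = ∫ z, u (x - z) * k z := by
  rw [cv, ← integral_sub_left_eq_self _ _ x]
  simp

lemma cv_comm (u k : Eu n → ℝ) : cv u k = cv k u := by
  funext x
  rw [cv_sub_eq, cv]
  simp [mul_comm]

lemma cv_cs {u k : Eu n → ℝ} (hu : HasCompactSupport u) (hk : HasCompactSupport k) :
    HasCompactSupport (cv u k) := by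
  rw [cv_eq]; exact HasCompactSupport.convolution _ hu hk

lemma cv_assoc {u k l : Eu n → ℝ} (hu : LocallyIntegrable u) (hk : Continuous k)
    (hk' : HasCompactSupport k) (hl : Continuous l) (hl' : HasCompactSupport l) :
    cv (cv u k) l = cv u (cv k l) := by
  funext x
  have hkk := hk'.norm
  have hll := hl'.norm
  have hkl : Continuous (cv (fun x => ‖k x‖) fun x => ‖l x‖) :=
    cv_eq (fun x => ‖k x‖) (fun x => ‖l x‖) ▸ hll.continuous_convolution_right _ hk.norm.locallyIntegrable hl.norm
  have hkl' : HasCompactSupport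
      (cv (fun x => ‖k x‖) fun x => ‖l x‖) := cv_cs hkk hll
  let m := ContinuousLinearMap.mul ℝ ℝ
  refine convolution_assoc m m m m (fun x y z => mul_assoc x y z) hu.aestronglyMeasurable
    hk.aestronglyMeasurable hl.aestronglyMeasurable ?_ ?_ ?_
  · exact Eventually.of_forall fun y => cv_integrable hu hk hk' y
  · exact Eventually.of_forall fun y =>
      cv_integrable hk.norm.locallyIntegrable hl.norm hll y
  · exact cv_integrable (fun y => (hu y).norm) hkl hkl' x

lemma cv_swap {u k l : Eu n → ℝ} (hu : LocallyIntegrable u) (hk : Continuous k)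
    (hk' : HasCompactSupport k) (hl : Continuous l) (hl' : HasCompactSupport l) :
    cv (cv u k) l = cv (cv u l) k := by
  rw [cv_assoc hu hk hk' hl hl', cv_comm k l, cv_assoc hu hl hl' hk hk']

lemma fderiv_eq_sum (f : Eu n → ℝ) (x v : Eu n) : fderiv ℝ f x v = ∑ i, v i * pd i f x := by
  have hv : v = ∑ i, v i • bv i := by
    ext j
    simp [bv, Finset.sum_apply, Pi.single_apply]
  conv_lhs => rw [hv, map_sum]
  simp [pd]

lemma Tst.bdd {f : Eu n → ℝ} (hf : Tst f) : ∃ C, 0 ≤ C ∧ ∀ x, |f x| ≤ C := by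
  obtain ⟨C, hC⟩ := hf.cs.exists_bound_of_continuous hf.cont
  exact ⟨C, (norm_nonneg _).trans (hC 0), hC⟩

lemma Tst.fderiv_bdd {f : Eu n → ℝ} (hf : Tst f) : ∃ C, 0 ≤ C ∧ ∀ x, ‖fderiv ℝ f x‖ ≤ C := by
  obtain ⟨C, hC⟩ := (hf.cs.fderiv ℝ).exists_bound_of_continuous
    (hf.smooth.continuous_fderiv (by simp))
  exact ⟨C, (norm_nonneg _).trans (hC 0), hC⟩

/-- Profiles of radial kernels, as functions of the squared radius. -/
structure Prof (S : ℝ → ℝ) : Prop where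
  smooth : ContDiff ℝ ∞ S
  zero : ∀ t, 1 ≤ t → S t = 0
  nonneg : ∀ t, 0 ≤ t → 0 ≤ S t
  le_one : ∀ t, 0 ≤ t → S t ≤ 1

def rad (S : ℝ → ℝ) (z : Eu n) : ℝ := S (‖z‖ ^ 2)

def nxt (S : ℝ → ℝ) (t : ℝ) : ℝ := ∫ s in t..1, S s

lemma Prof.rad_eq_zero {S : ℝ → ℝ} (hS : Prof S) {z : Eu n} (hz : 1 ≤ ‖z‖) : rad S z = 0 :=
  hS.zero _ (by nlinarith)

lemma Prof.tst {S : ℝ → ℝ} (hS : Prof S) : Tst (rad S : Eu n → ℝ) := by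
  refine ⟨hS.smooth.comp (contDiff_norm_sq ℝ), ?_⟩
  refine HasCompactSupport.intro (isCompact_closedBall 0 1) fun x hx => ?_
  simp only [Metric.mem_closedBall, dist_zero_right, not_le] at hx
  exact hS.rad_eq_zero hx.le

lemma Prof.rad_nonneg {S : ℝ → ℝ} (hS : Prof S) (z : Eu n) : 0 ≤ rad S z :=
  hS.nonneg _ (by positivity)

lemma nxt_hasDerivAt {S : ℝ → ℝ} (hS : Continuous S) (t : ℝ) : HasDerivAt (nxt S) (-S t) t :=
  intervalIntegral.integral_hasDerivAt_left (hS.intervalIntegrable _ _)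
    hS.stronglyMeasurable.stronglyMeasurableAtFilter hS.continuousAt

lemma Prof.nxt {S : ℝ → ℝ} (hS : Prof S) : Prof (nxt S) := by
  have hc := hS.smooth.continuous
  have hd : deriv (Mono.nxt S) = fun t => -S t := funext fun t => (nxt_hasDerivAt hc t).deriv
  refine ⟨contDiff_infty_iff_deriv.2 ⟨fun t => (nxt_hasDerivAt hc t).differentiableAt, ?_⟩,
    fun t ht => ?_, fun t ht => ?_, fun t ht => ?_⟩
  · rw [hd]; exact hS.smooth.neg
  · rw [Mono.nxt, intervalIntegral.integral_symm, neg_eq_zero]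
    exact intervalIntegral.integral_zero_ae (Eventually.of_forall fun s hs => hS.zero s (by
      rw [uIoc_of_le ht] at hs; exact hs.1.le))
  all_goals
    rcases le_total t 1 with h1 | h1
    swap
    · rw [Mono.nxt, intervalIntegral.integral_symm]
      have : ∫ s in (1:ℝ)..t, S s = 0 :=
        intervalIntegral.integral_zero_ae (Eventually.of_forall fun s hs => hS.zero s (by
          rw [uIoc_of_le h1] at hs; exact hs.1.le))
      rw [this]; norm_num
  · exact intervalIntegral.integral_nonneg h1 fun s hs => hS.nonneg s (ht.trans hs.1)
  · have := intervalIntegral.integral_mono_on h1 (hc.intervalIntegrable _ _)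
      (continuous_const.intervalIntegrable (μ := volume) _ _ : IntervalIntegrable (fun _ => (1:ℝ)) volume t 1)
      fun s hs => hS.le_one s (ht.trans hs.1)
    simp at this
    rw [Mono.nxt]; linarith

lemma pd_normSq (i : Fin n) (z : Eu n) : pd i (fun y : Eu n => ‖y‖ ^ 2) z = 2 * z i := by
  have := (hasStrictFDerivAt_norm_sq (F := Eu n) z).hasFDerivAt.fderiv
  rw [pd, this]
  simp [bv, EuclideanSpace.inner_single_right]

lemma pd_rad_nxt {S : ℝ → ℝ} (hS : Prof S) (i : Fin n) (z : Eu n) :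
    pd i (rad (nxt S)) z = -2 * (z i * rad S z) := by
  have h := pd_comp (φ := nxt S) (f := fun y : Eu n => ‖y‖ ^ 2) (x := z)
    (nxt_hasDerivAt hS.smooth.continuous _).differentiableAt
    ((contDiff_norm_sq ℝ (n := ∞)).differentiable (by simp) z) i
  rw [(nxt_hasDerivAt hS.smooth.continuous _).deriv, pd_normSq] at h
  show pd i (fun y : Eu n => nxt S (‖y‖ ^ 2)) z = _
  rw [h, rad]; ring

def avg (S : ℝ → ℝ) (F : Eu n → ℝ) (x : Eu n) (r : ℝ) : ℝ := ∫ z, F (x + r • z) * rad S z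

lemma pd_affine {f : Eu n → ℝ} (hf : ContDiff ℝ ∞ f) (i : Fin n) (x z : Eu n) (r : ℝ) :
    pd i (fun y => f (x + r • y)) z = r * pd i f (x + r • z) := by
  have h1 : HasFDerivAt (fun y : Eu n => x + r • y) (r • ContinuousLinearMap.id ℝ (Eu n)) z :=
    ((hasFDerivAt_id z).const_smul r).const_add x
  have h2 := ((hf.differentiable (by simp) (x + r • z)).hasFDerivAt.comp z h1).fderiv
  have h3 : (fun y => f (x + r • y)) = f ∘ fun y => x + r • y := rfl
  rw [pd, h3, h2]
  simp [pd]

lemma contDiff_affine {f : Eu n → ℝ} (hf : ContDiff ℝ ∞ f) (x : Eu n) (r : ℝ) :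
    ContDiff ℝ ∞ (fun y => f (x + r • y)) :=
  hf.comp (contDiff_const.add (contDiff_id.const_smul r))

lemma avg_hasDerivAt {S : ℝ → ℝ} (hS : Prof S) {F : Eu n → ℝ} (hF : Tst F) (x : Eu n) (r : ℝ) :
    HasDerivAt (avg S F x) (r / 2 * ∫ z, lap F (x + r • z) * rad (nxt S) z) r := by
  obtain ⟨C, hC0, hC⟩ := hF.fderiv_bdd
  have hT := hS.tst (n := n)
  have hcts : ∀ r : ℝ, Continuous fun z : Eu n => x + r • z := fun r => by fun_prop
  have main := (hasDerivAt_integral_of_dominated_loc_of_deriv_le (μ := volume)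
    (F := fun r z => F (x + r • z) * rad S z)
    (F' := fun r z => fderiv ℝ F (x + r • z) z * rad S z) (x₀ := r)
    (bound := fun z => C * ‖z‖ * rad S z) (s := univ) univ_mem
    (Eventually.of_forall fun r => ((hF.cont.comp (hcts r)).mul hT.cont).aestronglyMeasurable)
    (Tst.mul_left (contDiff_affine hF.smooth x r) hT).int
    ((((hF.smooth.continuous_fderiv (by simp)).comp (hcts r)).clm_apply
      continuous_id).mul hT.cont).aestronglyMeasurable
    (Eventually.of_forall fun z s _ => by
      rw [norm_mul, Real.norm_of_nonneg (hS.rad_nonneg z)]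
      exact mul_le_mul_of_nonneg_right (((fderiv ℝ F _).le_opNorm z).trans
        (mul_le_mul_of_nonneg_right (hC _) (norm_nonneg z))) (hS.rad_nonneg z))
    (((continuous_const.mul continuous_norm).mul hT.cont).integrable_of_hasCompactSupport
      hT.cs.mul_left)
    (Eventually.of_forall fun z s _ => by
      exact (deriv_line (hF.smooth.differentiable (by simp) _)).mul_const _)).2
  refine HasDerivAt.congr_deriv (f := avg S F x) main ?_
  have e1 : ∀ z : Eu n, fderiv ℝ F (x + r • z) z * rad S z
      = ∑ i, (-1 / 2) * (pd i F (x + r • z) * pd i (rad (nxt S)) z) := fun z => by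
    rw [fderiv_eq_sum, Finset.sum_mul]
    refine Finset.sum_congr rfl fun i _ => ?_
    rw [pd_rad_nxt hS]; ring
  have hN := hS.nxt.tst (n := n)
  have e2 : ∀ i : Fin n, ∫ z, pd i F (x + r • z) * pd i (rad (nxt S)) z
      = -(r * ∫ z, pd i (pd i F) (x + r • z) * rad (nxt S) z) := fun i => by
    rw [integral_mul_pd (f := fun z => pd i F (x + r • z))
      (contDiff_affine (hF.pd i).smooth x r) hN i, ← integral_const_mul]
    congr 2; funext z
    rw [pd_affine (hF.pd i).smooth]; ring
  have i1 : ∀ i : Fin n, Integrable fun z => pd i F (x + r • z) * pd i (rad (nxt S)) z := fun i =>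
    (Tst.mul_left (contDiff_affine (hF.pd i).smooth x r) (hN.pd i)).int
  have i2 : ∀ i : Fin n, Integrable fun z => pd i (pd i F) (x + r • z) * rad (nxt S) z := fun i =>
    (Tst.mul_left (contDiff_affine ((hF.pd i).pd i).smooth x r) hN).int
  rw [integral_congr_ae (Eventually.of_forall e1)]
  rw [integral_finsetSum _ fun i _ => (i1 i).const_mul _]
  simp_rw [integral_const_mul, e2, lap, Finset.sum_mul]
  rw [integral_finsetSum _ fun i _ => i2 i, Finset.mul_sum]
  exact Finset.sum_congr rfl fun i _ => by ring

lemma avg_hasDerivAt_of_helmholtz {S : ℝ → ℝ} (hS : Prof S) {F : Eu n → ℝ} (hF : Tst F)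
    {x : Eu n} {r Λ : ℝ} (hr : 0 ≤ r) (h : ∀ y ∈ Metric.closedBall x r, lap F y = -Λ * F y) :
    HasDerivAt (avg S F x) (-(Λ * r / 2) * avg (nxt S) F x r) r := by
  refine (avg_hasDerivAt hS hF x r).congr_deriv ?_
  have : ∀ z, lap F (x + r • z) * rad (nxt S) z = (-Λ) * (F (x + r • z) * rad (nxt S) z) := by
    intro z
    rcases le_total 1 ‖z‖ with hz | hz
    · rw [hS.nxt.rad_eq_zero hz]; ring
    · rw [h]
      · ring
      · simp only [Metric.mem_closedBall, dist_self_add_left, norm_smul, Real.norm_eq_abs,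
          abs_of_nonneg hr]
        nlinarith
  rw [integral_congr_ae (Eventually.of_forall this), integral_const_mul, avg]
  ring

lemma avg_bdd {S : ℝ → ℝ} (hS : Prof S) {F : Eu n → ℝ} {C : ℝ} (hC : ∀ x, |F x| ≤ C)
    (x : Eu n) (r : ℝ) : |avg S F x r| ≤ C * volume.real (Metric.closedBall (0 : Eu n) 1) := by
  have hC0 : 0 ≤ C := (abs_nonneg _).trans (hC 0)
  have h1 : ∫ z, (Metric.closedBall (0 : Eu n) 1).indicator (fun _ => C) z
      = C * volume.real (Metric.closedBall (0 : Eu n) 1) := by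
    rw [integral_indicator Metric.isClosed_closedBall.measurableSet, setIntegral_const,
      smul_eq_mul, mul_comm]
  rw [← h1, avg, ← Real.norm_eq_abs]
  refine norm_integral_le_of_norm_le (μ := (volume : Measure (Eu n))) ?_ (Eventually.of_forall fun z => ?_)
  · exact (integrable_indicator_iff Metric.isClosed_closedBall.measurableSet).2
      (integrableOn_const (isCompact_closedBall (0 : Eu n) 1).measure_ne_top)
  · by_cases hz : z ∈ Metric.closedBall (0 : Eu n) 1
    · rw [indicator_of_mem hz, norm_mul, Real.norm_of_nonneg (hS.rad_nonneg z)]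
      have hz' : rad S z ≤ 1 := hS.le_one _ (by positivity)
      calc _ ≤ ‖F (x + r • z)‖ * 1 := by gcongr
        _ ≤ C := by simpa using hC _
    · rw [indicator_of_notMem hz, hS.rad_eq_zero (by simp at hz; exact hz.le)]
      simp

lemma avg_zero_radius (S : ℝ → ℝ) (F : Eu n → ℝ) (x : Eu n) :
    avg S F x 0 = F x * ∫ z : Eu n, rad S z := by
  simp [avg, integral_const_mul]

lemma avg_unique {F J : Eu n → ℝ} (hF : Tst F) (hJ : Tst J) {x y : Eu n} {r₀ Λ : ℝ}
    (hΛ : 0 ≤ Λ) (hr₀ : Λ * r₀ ^ 2 ≤ 1)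
    (h1 : ∀ z ∈ Metric.closedBall x r₀, lap F z = -Λ * F z)
    (h2 : ∀ z ∈ Metric.closedBall y r₀, lap J z = -Λ * J z) (hJy : J y = 1)
    {S : ℝ → ℝ} (hS : Prof S) {r : ℝ} (hr : r ∈ Icc 0 r₀) :
    avg S F x r = F x * avg S J y r := by
  obtain ⟨CF, -, hCF⟩ := hF.bdd
  obtain ⟨CJ, -, hCJ⟩ := hJ.bdd
  set V := volume.real (Metric.closedBall (0 : Eu n) 1)
  set M := CF * V + |F x| * (CJ * V)
  have key : ∀ N : ℕ, ∀ S, Prof S → ∀ r ∈ Icc 0 r₀,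
      ‖avg S F x r - F x * avg S J y r‖ ≤ M / 2 ^ N := by
    intro N
    induction N with
    | zero =>
      intro S hS r _
      rw [pow_zero, div_one]
      refine (norm_sub_le _ _).trans (add_le_add (avg_bdd hS hCF x r) ?_)
      rw [norm_mul]
      exact mul_le_mul_of_nonneg_left (avg_bdd hS hCJ y r) (norm_nonneg _)
    | succ N ih =>
      intro S hS r hr
      have hd : ∀ s ∈ Icc 0 r, HasDerivWithinAt (fun s => avg S F x s - F x * avg S J y s)
          (-(Λ * s / 2) * (avg (nxt S) F x s - F x * avg (nxt S) J y s)) (Icc 0 r) s := by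
        intro s hs
        have hs' : s ≤ r₀ := hs.2.trans hr.2
        refine HasDerivAt.hasDerivWithinAt ?_
        refine ((avg_hasDerivAt_of_helmholtz hS hF hs.1 fun z hz => h1 z
          (Metric.closedBall_subset_closedBall hs' hz)).sub
          ((avg_hasDerivAt_of_helmholtz hS hJ hs.1 fun z hz => h2 z
          (Metric.closedBall_subset_closedBall hs' hz)).const_mul (F x))).congr_deriv ?_
        ring
      have hb : ∀ s ∈ Ico 0 r,
          ‖-(Λ * s / 2) * (avg (nxt S) F x s - F x * avg (nxt S) J y s)‖
            ≤ Λ * r / 2 * (M / 2 ^ N) := by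
        intro s hs
        rw [norm_mul, norm_neg, Real.norm_of_nonneg (by have := hs.1; positivity)]
        have h3 := ih _ hS.nxt s ⟨hs.1, hs.2.le.trans hr.2⟩
        have : Λ * s / 2 ≤ Λ * r / 2 := by have := hs.2.le; gcongr
        exact mul_le_mul this h3 (norm_nonneg _) (by have := hr.1; positivity)
      have := norm_image_sub_le_of_norm_deriv_le_segment' hd hb r ⟨hr.1, le_rfl⟩
      simp only [avg_zero_radius, hJy, one_mul, sub_self, sub_zero] at this
      refine this.trans ?_
      have hM : 0 ≤ M / 2 ^ N := (norm_nonneg _).trans (ih S hS r hr)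
      have h4 : Λ * r ^ 2 ≤ 1 := (mul_le_mul_of_nonneg_left
        (pow_le_pow_left₀ hr.1 hr.2 2) hΛ).trans hr₀
      calc _ = (Λ * r ^ 2) / 2 * (M / 2 ^ N) := by ring
        _ ≤ 1 / 2 * (M / 2 ^ N) := by gcongr
        _ = M / 2 ^ (N + 1) := by rw [pow_succ]; ring
  have hlim : Tendsto (fun N : ℕ => M / 2 ^ N) atTop (𝓝 0) :=
    tendsto_const_nhds.div_atTop (tendsto_pow_atTop_atTop_of_one_lt (by norm_num))
  have := ge_of_tendsto' hlim fun N => key N S hS r hr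
  exact sub_eq_zero.1 (norm_le_zero_iff.1 this)

lemma pd_inner (v : Eu n) (i : Fin n) (x : Eu n) : pd i (fun y => ⟪y, v⟫) x = v i := by
  have h : HasFDerivAt (fun y : Eu n => ⟪y, v⟫) (innerSL ℝ v) x := by
    have := (innerSL ℝ v).hasFDerivAt (x := x)
    refine this.congr_of_eventuallyEq (Eventually.of_forall fun y => ?_)
    simp [real_inner_comm]
  rw [pd, h.fderiv]
  simp [bv, EuclideanSpace.inner_single_right]

lemma lap_inner (v : Eu n) (x : Eu n) : lap (fun y => ⟪y, v⟫) x = 0 := by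
  have : ∀ i, pd i (fun y : Eu n => ⟪y, v⟫) = fun _ => v i := fun i => funext fun y => pd_inner v i y
  simp [lap, this, pd_const]

lemma smAt_inner (v x : Eu n) : SmAt (fun y => ⟪y, v⟫) x :=
  smAt_of_contDiff (contDiff_id.inner ℝ contDiff_const) x

lemma lap_comp_inner {φ : ℝ → ℝ} (hφ : ContDiff ℝ ∞ φ) (v x : Eu n) :
    lap (fun y => φ ⟪y, v⟫) x = deriv (deriv φ) ⟪x, v⟫ * ‖v‖ ^ 2 := by
  rw [lap_comp hφ (smAt_inner v x), lap_inner, EuclideanSpace.real_norm_sq_eq]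
  simp [pd_inner]

lemma lap_cos_inner (v x : Eu n) :
    lap (fun y => Real.cos ⟪y, v⟫) x = -‖v‖ ^ 2 * Real.cos ⟪x, v⟫ := by
  rw [lap_comp_inner Real.contDiff_cos]
  have : deriv Real.cos = fun x => -Real.sin x := Real.deriv_cos'
  rw [this]; simp; ring

lemma lap_sin_inner (v x : Eu n) :
    lap (fun y => Real.sin ⟪y, v⟫) x = -‖v‖ ^ 2 * Real.sin ⟪x, v⟫ := by
  rw [lap_comp_inner Real.contDiff_sin]
  simp [Real.deriv_sin]; ring

lemma exists_prof : ∃ S, Prof S ∧ 0 < S 0 := by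
  let b : ContDiffBump (0 : ℝ) := ⟨1 / 2, 1, by norm_num, by norm_num⟩
  refine ⟨b, ⟨b.contDiff, fun t ht => b.zero_of_le_dist ?_, fun t _ => b.nonneg,
    fun t _ => b.le_one⟩, ?_⟩
  · rw [Real.dist_eq, sub_zero, abs_of_nonneg (by linarith)]; exact ht
  · rw [b.one_of_mem_closedBall (by simp [b])]; norm_num

lemma integral_scale (f : Eu n → ℝ) {r : ℝ} (hr : 0 < r) :
    ∫ z, f (r⁻¹ • z) = r ^ n * ∫ z, f z := by
  rw [Measure.integral_comp_smul]
  simp only [finrank_euclideanSpace, Fintype.card_fin, smul_eq_mul, inv_pow, inv_inv]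
  rw [abs_of_pos (by positivity)]

/-- Compactly supported kernels that reproduce solutions of the Helmholtz equation. -/
structure Ker (Λ r : ℝ) (k : Eu n → ℝ) : Prop where
  pos : 0 < r
  tst : Tst k
  zero : ∀ z, r ≤ ‖z‖ → k z = 0
  nonneg : ∀ z, 0 ≤ k z
  pos_zero : 0 < k 0
  repr : ∀ F : Eu n → ℝ, Tst F → ∀ x, (∀ y ∈ Metric.closedBall x r, lap F y = -Λ * F y) →
    cv F k x = F x

theorem exists_ker (i₀ : Fin n) : ∃ C > 0, ∀ Λ r : ℝ, 0 ≤ Λ → 0 < r → Λ * r ^ 2 ≤ 1 →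
    ∃ k : Eu n → ℝ, Ker Λ r k ∧ ∀ i, ∫ z, |pd i k z| ≤ C / r := by
  obtain ⟨S, hS, hS0⟩ := exists_prof
  have hT := hS.tst (n := n)
  set I := ∫ z : Eu n, rad S z
  have hI : 0 < I := by
    refine Continuous.integral_pos_of_hasCompactSupport_nonneg_nonzero (x := 0) hT.cont hT.cs
      (fun z => hS.rad_nonneg z) ?_
    simp only [rad, norm_zero]; norm_num; exact hS0.ne'
  have hc1 : 0 < Real.cos 1 := Real.cos_one_pos
  set D := ∑ i, ∫ z : Eu n, |pd i (rad S) z|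
  have hD : ∀ i, ∫ z : Eu n, |pd i (rad S) z| ≤ D := fun i =>
    Finset.single_le_sum (f := fun i => ∫ z : Eu n, |pd i (rad S) z|)
      (fun i _ => integral_nonneg fun z => abs_nonneg _) (Finset.mem_univ i)
  have hD0 : 0 ≤ D := (integral_nonneg fun z => abs_nonneg _).trans (hD i₀)
  refine ⟨(D + 1) / (Real.cos 1 * I), by positivity, fun Λ r hΛ hr hΛr => ?_⟩
  set v : Eu n := √Λ • bv i₀
  have hv : ‖v‖ = √Λ := by simp [v, norm_smul, bv, abs_of_nonneg (Real.sqrt_nonneg Λ)]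
  have hv2 : ‖v‖ ^ 2 = Λ := by rw [hv, Real.sq_sqrt hΛ]
  obtain ⟨J, hJ, -, hJe⟩ := exists_localisation (f := fun y : Eu n => Real.cos ⟪y, v⟫)
    (isCompact_closedBall (0 : Eu n) r) isOpen_univ (subset_univ _)
    (fun x _ => SmAt.comp Real.contDiff_cos (smAt_inner v x))
  have hJ0 : J 0 = 1 := by
    rw [(hJe 0 (Metric.mem_closedBall_self hr.le)).eq_of_nhds]; simp
  have hJl : ∀ z ∈ Metric.closedBall (0 : Eu n) r, lap J z = -Λ * J z := fun z hz => by
    rw [(lap_congr (hJe z hz)).eq_of_nhds, (hJe z hz).eq_of_nhds, lap_cos_inner, hv2]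
  set m := avg S J 0 r
  have hm : Real.cos 1 * I ≤ m := by
    rw [← integral_const_mul]
    refine integral_mono (hT.const_mul _).int (Tst.mul_left (contDiff_affine hJ.smooth 0 r) hT).int
      fun z => ?_
    rcases le_total 1 ‖z‖ with hz | hz
    · simp [hS.rad_eq_zero hz]
    · refine mul_le_mul_of_nonneg_right ?_ (hS.rad_nonneg z)
      have hmem : 0 + r • z ∈ Metric.closedBall (0 : Eu n) r := by
        simp only [zero_add, Metric.mem_closedBall, dist_zero_right, norm_smul,
          Real.norm_of_nonneg hr.le]
        nlinarith
      rw [(hJe _ hmem).eq_of_nhds, ← Real.cos_abs ⟪_, _⟫]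
      have h5 : √Λ * r ≤ 1 := by
        have : (√Λ * r) ^ 2 ≤ 1 ^ 2 := by rw [mul_pow, Real.sq_sqrt hΛ]; simpa using hΛr
        exact le_of_sq_le_sq this (by norm_num)
      have h6 : |⟪(0 : Eu n) + r • z, v⟫| ≤ 1 := by
        refine (abs_real_inner_le_norm _ _).trans ?_
        rw [hv, zero_add, norm_smul, Real.norm_of_nonneg hr.le]
        have h7 : r * ‖z‖ * √Λ ≤ r * 1 * √Λ := by gcongr
        linarith
      exact Real.cos_le_cos_of_nonneg_of_le_pi (abs_nonneg _) (by linarith [Real.pi_gt_three]) h6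
  have hm0 : 0 < m := lt_of_lt_of_le (by positivity) hm
  have hrn : 0 < r ^ n := by positivity
  have hk : Tst (fun z : Eu n => (r ^ n * m)⁻¹ * rad S (r⁻¹ • z)) := by
    refine Tst.const_mul _ ⟨hT.smooth.comp (contDiff_id.const_smul _), ?_⟩
    exact hT.cs.comp_smul (inv_ne_zero hr.ne')
  refine ⟨_, ⟨hr, hk, fun z hz => ?_, fun z => mul_nonneg (by positivity) (hS.rad_nonneg _), ?_, fun F hF x hx => ?_⟩, fun i => ?_⟩
  · rw [hS.rad_eq_zero, mul_zero]
    rw [norm_smul, norm_inv, Real.norm_of_nonneg hr.le, ← div_eq_inv_mul, le_div_iff₀ hr]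
    simpa using hz
  · simp only [rad, smul_zero, norm_zero]
    norm_num
    positivity
  · have h1 := avg_unique hF hJ hΛ hΛr hx hJl hJ0 hS ⟨hr.le, le_rfl⟩
    rw [cv_sub_eq]
    have h2 := Measure.integral_comp_smul (volume : Measure (Eu n)) (fun z => F (x + r • z) * rad S z) (-r⁻¹)
    have h3 : ∀ z : Eu n, F (x - z) * ((r ^ n * m)⁻¹ * rad S (r⁻¹ • z))
        = (r ^ n * m)⁻¹ * (F (x + r • (-r⁻¹) • z) * rad S ((-r⁻¹) • z)) := fun z => by
      rw [smul_smul, mul_neg, mul_inv_cancel₀ hr.ne', neg_smul, one_smul, ← sub_eq_add_neg]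
      simp only [rad, neg_smul, norm_neg]; ring
    rw [integral_congr_ae (Eventually.of_forall h3), integral_const_mul, h2]
    change (r ^ n * m)⁻¹ * (|(((-r⁻¹) ^ _)⁻¹ : ℝ)| • avg S F x r) = F x
    rw [h1]
    simp only [finrank_euclideanSpace, Fintype.card_fin, smul_eq_mul, abs_inv, abs_pow, abs_neg,
      inv_pow, inv_inv, abs_of_pos hr]
    field_simp
    rw [mul_comm]
  · have h1 : ∀ z : Eu n, |pd i (fun z : Eu n => (r ^ n * m)⁻¹ * rad S (r⁻¹ • z)) z|
        = (r ^ n * m)⁻¹ * r⁻¹ * |pd i (rad S) (r⁻¹ • z)| := fun z => by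
      rw [pd_const_mul]
      have := pd_affine hT.smooth i 0 z r⁻¹
      simp only [zero_add] at this
      rw [this, abs_mul, abs_mul, abs_of_pos (by positivity : 0 < (r ^ n * m)⁻¹),
        abs_of_pos (inv_pos.2 hr), mul_assoc]
    rw [integral_congr_ae (Eventually.of_forall h1), integral_const_mul,
      integral_scale (fun z => |pd i (rad S) z|) hr]
    have h2 : (r ^ n * m)⁻¹ * r⁻¹ * (r ^ n * ∫ z : Eu n, |pd i (rad S) z|)
        = (∫ z : Eu n, |pd i (rad S) z|) / m / r := by field_simp
    rw [h2]
    have : ∫ z : Eu n, |pd i (rad S) z| ≤ D + 1 := (hD i).trans (by linarith)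
    have h9 : (0:ℝ) ≤ ∫ z : Eu n, |pd i (rad S) z| := integral_nonneg fun z => abs_nonneg _
    gcongr

/-- `f` is a smooth solution of the Helmholtz equation on `U`. -/
structure Helm (Λ : ℝ) (U : Set (Eu n)) (f : Eu n → ℝ) : Prop where
  sm : ∀ x ∈ U, SmAt f x
  eq : ∀ x ∈ U, lap f x = -Λ * f x

lemma Helm.congr {Λ : ℝ} {U : Set (Eu n)} {f g : Eu n → ℝ} (hf : Helm Λ U f)
    (h : ∀ x ∈ U, f =ᶠ[𝓝 x] g) : Helm Λ U g :=
  ⟨fun x hx => (hf.sm x hx).congr (h x hx), fun x hx => by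
    rw [← (lap_congr (h x hx)).eq_of_nhds, ← (h x hx).eq_of_nhds]; exact hf.eq x hx⟩

lemma SmAt.pd_comm {f : Eu n → ℝ} {x : Eu n} (hf : SmAt f x) (i j : Fin n) :
    Mono.pd j (Mono.pd i f) x = Mono.pd i (Mono.pd j f) x := by
  have h2 : DifferentiableAt ℝ (fderiv ℝ f) x :=
    (hf.cda.fderiv_right (m := 1) (by norm_cast)).differentiableAt (by norm_num)
  have hs : IsSymmSndFDerivAt ℝ f x :=
    hf.cda.isSymmSndFDerivAt (by simp only [minSmoothness_of_isRCLikeNormedField]; norm_cast)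
  have e : ∀ i j, Mono.pd j (Mono.pd i f) x = fderiv ℝ (fderiv ℝ f) x (bv j) (bv i) := by
    intro i j
    have : Mono.pd i f = fun z => fderiv ℝ f z (bv i) := rfl
    rw [Mono.pd, this, fderiv_clm_apply h2 (differentiableAt_const _)]
    simp
  rw [e, e]; exact hs _ _

lemma Helm.pd {Λ : ℝ} {U : Set (Eu n)} {f : Eu n → ℝ} (hU : IsOpen U) (hf : Helm Λ U f)
    (i : Fin n) : Helm Λ U (pd i f) := by
  refine ⟨fun x hx => (hf.sm x hx).pd i, fun x hx => ?_⟩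
  have h1 : lap (Mono.pd i f) x = Mono.pd i (lap f) x := by
    have hsum : ∀ j ∈ Finset.univ, DifferentiableAt ℝ (Mono.pd j (Mono.pd j f)) x := fun j _ =>
      (((hf.sm x hx).pd j).pd j).diff
    have e : Mono.pd i (lap f) x = ∑ j, Mono.pd i (Mono.pd j (Mono.pd j f)) x := by
      have : lap f = fun x => ∑ j, Mono.pd j (Mono.pd j f) x := rfl
      rw [this, Mono.pd, fderiv_fun_sum hsum]; simp [Mono.pd]
    rw [e, lap]
    refine Finset.sum_congr rfl fun j _ => ?_
    have hc : Mono.pd j (Mono.pd i f) =ᶠ[𝓝 x] Mono.pd i (Mono.pd j f) := by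
      filter_upwards [(hf.sm x hx).ev] with y hy using hy.pd_comm i j
    rw [(pd_congr hc j).eq_of_nhds, ((hf.sm x hx).pd j).pd_comm]
  rw [h1]
  have h2 : lap f =ᶠ[𝓝 x] fun y => -Λ * f y := by
    filter_upwards [hU.mem_nhds hx] with y hy using hf.eq y hy
  rw [(pd_congr h2 i).eq_of_nhds, pd_const_mul]

lemma Ker.cv_eq {Λ r : ℝ} {k : Eu n → ℝ} (hk : Ker Λ r k) {U : Set (Eu n)} (hU : IsOpen U)
    {f : Eu n → ℝ} (hf : Helm Λ U f) {x : Eu n} (hx : Metric.closedBall x r ⊆ U) :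
    cv f k x = f x ∧ ∀ i, pd i f x = cv f (pd i k) x := by
  obtain ⟨F, hF, -, hFe⟩ := exists_localisation (isCompact_closedBall x r) hU hx hf.sm
  have hcv : ∀ l : Eu n → ℝ, (∀ w, r < ‖w‖ → l w = 0) → cv F l x = cv f l x := fun l hl => by
    refine integral_congr_ae (Eventually.of_forall fun y => ?_)
    by_cases hy : y ∈ Metric.closedBall x r
    · simp only [(hFe y hy).eq_of_nhds]
    · have : l (x - y) = 0 := hl _ (by
        rw [Metric.mem_closedBall, dist_comm, dist_eq_norm, not_le] at hy; exact hy)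
      simp [this]
  have hO : IsOpen {y | y ∈ U ∧ F =ᶠ[𝓝 y] f} :=
    hU.inter (isOpen_setOfPred_eventually_nhds (p := fun y => F y = f y))
  obtain ⟨δ, hδ, hδO⟩ := (isCompact_closedBall x r).exists_thickening_subset_open hO
    fun y hy => ⟨hx hy, hFe y hy⟩
  have hloc : F =ᶠ[𝓝 x] cv F k := by
    filter_upwards [Metric.ball_mem_nhds x hδ] with x' hx'
    refine (hk.repr F hF x' fun y hy => ?_).symm
    have hyO : y ∈ {y | y ∈ U ∧ F =ᶠ[𝓝 y] f} := hδO (Metric.mem_thickening_iff.2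
      ⟨y - (x' - x), by
        rw [Metric.mem_closedBall, dist_eq_norm] at hy ⊢
        convert hy using 2; abel, by
        rw [Metric.mem_ball, dist_eq_norm] at hx'
        simpa [dist_eq_norm] using hx'⟩)
    rw [(lap_congr hyO.2).eq_of_nhds, hyO.2.eq_of_nhds, hf.eq y hyO.1]
  have hFx := hFe x (Metric.mem_closedBall_self hk.pos.le)
  constructor
  · rw [← hcv k fun w hw => hk.zero w hw.le, ← hFx.eq_of_nhds, ← hloc.eq_of_nhds]
  · intro i
    rw [← (pd_congr hFx i).eq_of_nhds, (pd_congr hloc i).eq_of_nhds,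
      pd_cv hF.cont.locallyIntegrable hk.tst, hcv]
    intro w hw
    have : k =ᶠ[𝓝 w] fun _ => 0 := by
      filter_upwards [continuous_norm.continuousAt.eventually (lt_mem_nhds hw)] with z hz
        using hk.zero z hz.le
    rw [(pd_congr this i).eq_of_nhds, pd_const]

lemma integral_pd_eq_zero {k : Eu n → ℝ} (hk : Tst k) (i : Fin n) : ∫ z, pd i k z = 0 := by
  have := integral_mul_pd (f := fun _ => (1:ℝ)) contDiff_const hk i
  simpa [pd_const] using this

lemma Ker.pd_zero {Λ r : ℝ} {k : Eu n → ℝ} (hk : Ker Λ r k) (i : Fin n) {w : Eu n}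
    (hw : r < ‖w‖) : pd i k w = 0 := by
  have : k =ᶠ[𝓝 w] fun _ => 0 := by
    filter_upwards [continuous_norm.continuousAt.eventually (lt_mem_nhds hw)] with z hz
      using hk.zero z hz.le
  rw [(pd_congr this i).eq_of_nhds, pd_const]

theorem exists_gradient_bound (i₀ : Fin n) : ∃ C > 0, ∀ Λ r : ℝ, 0 ≤ Λ → 0 < r → Λ * r ^ 2 ≤ 1 →
    ∀ (U : Set (Eu n)) (f : Eu n → ℝ), IsOpen U → Helm Λ U f → ∀ x : Eu n,
    Metric.closedBall x r ⊆ U → ∀ a M : ℝ, (∀ y ∈ Metric.closedBall x r, |f y - a| ≤ M) →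
    ∀ i, |pd i f x| ≤ C / r * M := by
  obtain ⟨C, hC, hk⟩ := exists_ker i₀
  refine ⟨C, hC, fun Λ r hΛ hr hΛr U f hU hf x hx a M hM i => ?_⟩
  obtain ⟨k, hk, hki⟩ := hk Λ r hΛ hr hΛr
  obtain ⟨F, hF, -, hFe⟩ := exists_localisation (isCompact_closedBall x r) hU hx hf.sm
  have hM0 : 0 ≤ M := (abs_nonneg _).trans (hM x (Metric.mem_closedBall_self hr.le))
  rw [(hk.cv_eq hU hf hx).2 i]
  have hT := (hk.tst.pd i).comp_sub x
  have h0 : ∫ y, a * pd i k (x - y) = 0 := by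
    rw [integral_const_mul, integral_sub_left_eq_self (fun y => pd i k y), integral_pd_eq_zero hk.tst,
      mul_zero]
  have hInt : Integrable fun y => f y * pd i k (x - y) := by
    refine (Tst.mul_left hF.smooth hT).int.congr (Eventually.of_forall fun y => ?_)
    by_cases hy : y ∈ Metric.closedBall x r
    · simp only [(hFe y hy).eq_of_nhds]
    · rw [Metric.mem_closedBall, dist_comm, dist_eq_norm, not_le] at hy
      simp [hk.pd_zero i hy]
  have h1 : cv f (pd i k) x = ∫ y, (f y - a) * pd i k (x - y) := by
    simp only [sub_mul]
    rw [integral_sub hInt (hT.int.const_mul a), h0, sub_zero, cv]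
  rw [h1, ← Real.norm_eq_abs]
  have h2 : ∫ y, M * |pd i k (x - y)| ≤ C / r * M := by
    rw [integral_const_mul, integral_sub_left_eq_self (fun y => |pd i k y|), mul_comm]
    exact mul_le_mul_of_nonneg_right (hki i) hM0
  refine (norm_integral_le_of_norm_le (hT.int.abs.const_mul M) (Eventually.of_forall fun y => ?_)).trans h2
  by_cases hy : y ∈ Metric.closedBall x r
  · rw [norm_mul]
    exact mul_le_mul_of_nonneg_right (hM y hy) (norm_nonneg _)
  · rw [Metric.mem_closedBall, dist_comm, dist_eq_norm, not_le] at hy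
    simp [hk.pd_zero i hy]

def mollBump (n : ℕ) (j : ℕ) : ContDiffBump (0 : Eu n) :=
  ⟨1 / (2 * (j + 1)), 1 / (j + 1), by positivity,
    one_div_lt_one_div_of_lt (by positivity) (by linarith [(Nat.cast_nonneg j : (0:ℝ) ≤ j)])⟩

/-- A standard sequence of mollifiers. -/
def moll (j : ℕ) : Eu n → ℝ := (mollBump n j).normed volume

lemma moll_tst (j : ℕ) : Tst (moll j : Eu n → ℝ) :=
  ⟨(mollBump n j).contDiff_normed, (mollBump n j).hasCompactSupport_normed⟩

lemma moll_nonneg (j : ℕ) (z : Eu n) : 0 ≤ moll j z := (mollBump n j).nonneg_normed z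

lemma moll_integral (j : ℕ) : ∫ z : Eu n, moll j z = 1 := (mollBump n j).integral_normed

lemma moll_zero (j : ℕ) {z : Eu n} (hz : 1 / (j + 1 : ℝ) ≤ ‖z‖) : moll j z = 0 := by
  have : z ∉ Function.support (moll j : Eu n → ℝ) := by
    rw [moll, ContDiffBump.support_normed_eq]
    simpa [mollBump] using hz
  exact Function.notMem_support.1 this

lemma cv_moll_eq (u : Eu n → ℝ) (j : ℕ) (x : Eu n) : cv u (moll j) x
    = convolution ((mollBump n j).normed volume) u (ContinuousLinearMap.lsmul ℝ ℝ) volume x := by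
  rw [cv_comm]; rfl

lemma mollBump_rOut : Tendsto (fun j => (mollBump n j).rOut) atTop (𝓝 0) :=
  tendsto_one_div_add_atTop_nhds_zero_nat

lemma cv_moll_tendsto {u : Eu n → ℝ} (hu : Continuous u) (x : Eu n) :
    Tendsto (fun j => cv u (moll j) x) atTop (𝓝 (u x)) := by
  simp_rw [cv_moll_eq]
  exact ContDiffBump.convolution_tendsto_right_of_continuous mollBump_rOut hu x

lemma cv_moll_ae_tendsto {u : Eu n → ℝ} (hu : LocallyIntegrable u) :
    ∀ᵐ x, Tendsto (fun j => cv u (moll j) x) atTop (𝓝 (u x)) := by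
  simp_rw [cv_moll_eq]
  refine ContDiffBump.ae_convolution_tendsto_right_of_locallyIntegrable (K := 2) mollBump_rOut
    (Eventually.of_forall fun j => ?_) hu
  simp only [mollBump]
  apply le_of_eq; field_simp

lemma lap_comp_sub {k : Eu n → ℝ} (hk : Tst k) (x y : Eu n) :
    lap (fun y => k (x - y)) y = lap k (x - y) := by
  have e : ∀ (f : Eu n → ℝ), Tst f → ∀ i y, pd i (fun y => f (x - y)) y = -pd i f (x - y) :=
    fun f hf i y => by
      have := pd_affine hf.smooth i x y (-1)
      simp only [neg_smul, one_smul, ← sub_eq_add_neg] at this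
      rw [this]; ring
  rw [lap, lap]
  refine Finset.sum_congr rfl fun i _ => ?_
  have h1 : pd i (fun y => k (x - y)) = fun y => (-1) * pd i k (x - y) := funext fun y => by
    rw [e k hk]; ring
  rw [h1, pd_const_mul, e _ (hk.pd i)]; ring

lemma tsupport_comp_sub_subset {k : Eu n → ℝ} {r : ℝ} (h : ∀ z, r ≤ ‖z‖ → k z = 0) (x : Eu n) :
    tsupport (fun y => k (x - y)) ⊆ Metric.closedBall x r := by
  refine closure_minimal (fun y hy => ?_) Metric.isClosed_closedBall
  rw [Metric.mem_closedBall, dist_comm, dist_eq_norm]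
  by_contra! hlt
  exact hy (h _ hlt.le)

/-- `u` is a distributional solution of the Helmholtz equation on `U`. -/
def WHelm (Λ : ℝ) (U : Set (Eu n)) (u : Eu n → ℝ) : Prop :=
  ∀ z : Eu n → ℝ, Tst z → tsupport z ⊆ U → ∫ y, u y * (lap z y + Λ * z y) = 0

lemma WHelm.cv_helm {Λ r : ℝ} {U V : Set (Eu n)} {u k : Eu n → ℝ} (hu : LocallyIntegrable u)
    (h : WHelm Λ U u) (hk : Tst k) (hk0 : ∀ z, r ≤ ‖z‖ → k z = 0)
    (hV : ∀ x ∈ V, Metric.closedBall x r ⊆ U) : Helm Λ V (cv u k) := by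
  refine ⟨fun x _ => smAt_of_contDiff (cv_contDiff hu hk) x, fun x hx => ?_⟩
  have := h _ (hk.comp_sub x) ((tsupport_comp_sub_subset hk0 x).trans (hV x hx))
  simp_rw [lap_comp_sub hk, mul_add] at this
  rw [integral_add (cv_integrable hu hk.lap.cont hk.lap.cs x)] at this
  · rw [lap_cv hu hk]
    have e : ∫ y, u y * (Λ * k (x - y)) = Λ * cv u k x := by
      rw [cv, ← integral_const_mul]; congr 1; funext y; ring
    rw [e] at this
    change cv u (lap k) x + _ = 0 at this
    linarith
  · exact ((cv_integrable hu hk.cont hk.cs x).const_mul Λ).congr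
      (Eventually.of_forall fun y => by ring)

theorem weyl_local (i₀ : Fin n) {Λ : ℝ} (hΛ : 0 ≤ Λ) {U : Set (Eu n)} (hU : IsOpen U)
    {u : Eu n → ℝ} (hu : LocallyIntegrable u) (h : WHelm Λ U u) {x₀ : Eu n} (hx₀ : x₀ ∈ U) :
    ∃ r > 0, ∃ G : Eu n → ℝ, ContDiff ℝ ∞ G ∧ Metric.ball x₀ r ⊆ U ∧ Helm Λ (Metric.ball x₀ r) G ∧
      ∀ᵐ x, x ∈ Metric.ball x₀ r → u x = G x := by
  obtain ⟨ρ, hρ, hρU⟩ := Metric.isOpen_iff.1 hU x₀ hx₀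
  obtain ⟨C, -, hC⟩ := exists_ker i₀
  obtain ⟨r, hr, hr4, hrΛ⟩ : ∃ r > 0, 4 * r < ρ ∧ Λ * r ^ 2 ≤ 1 := by
    refine ⟨min (ρ / 8) (1 / (1 + Λ)), lt_min (by positivity) (by positivity), ?_, ?_⟩
    · linarith [min_le_left (ρ / 8) (1 / (1 + Λ))]
    · have h1 : min (ρ / 8) (1 / (1 + Λ)) ≤ 1 / (1 + Λ) := min_le_right _ _
      have h0 : 0 ≤ min (ρ / 8) (1 / (1 + Λ)) := le_min (by positivity) (by positivity)
      calc _ ≤ Λ * (1 / (1 + Λ)) ^ 2 := by gcongr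
        _ ≤ 1 := by
          rw [div_pow, one_pow, mul_one_div, div_le_one (by positivity)]
          nlinarith
  obtain ⟨k, hk, -⟩ := hC Λ r hΛ hr hrΛ
  have hsub : ∀ {x : Eu n} {s : ℝ}, dist x x₀ + s ≤ 4 * r → Metric.closedBall x s ⊆ U := by
    intro x s hs y hy
    apply hρU
    rw [Metric.mem_ball]
    have := dist_triangle y x x₀
    rw [Metric.mem_closedBall] at hy
    linarith
  refine ⟨r, hr, cv u k, cv_contDiff hu hk.tst, fun y hy => hsub (s := 0) (x := y)
    (by rw [Metric.mem_ball] at hy; linarith) (by simp), h.cv_helm hu hk.tst hk.zero fun x hx =>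
      hsub (by rw [Metric.mem_ball] at hx; linarith), ?_⟩
  filter_upwards [cv_moll_ae_tendsto hu] with x hx hxr
  have h2 := cv_moll_tendsto (cv_contDiff hu hk.tst).continuous x
  refine tendsto_nhds_unique hx (h2.congr' ?_)
  have hev : ∀ᶠ j : ℕ in atTop, 1 / (j + 1 : ℝ) < r :=
    tendsto_one_div_add_atTop_nhds_zero_nat.eventually (gt_mem_nhds hr)
  filter_upwards [hev] with j hj
  rw [cv_swap hu hk.tst.cont hk.tst.cs (moll_tst j).cont (moll_tst j).cs]
  refine (hk.cv_eq (U := Metric.ball x₀ (2 * r)) Metric.isOpen_ball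
    (h.cv_helm hu (moll_tst j) (fun z hz => moll_zero j hz) fun y hy => hsub ?_)
    fun y hy => ?_).1
  · rw [Metric.mem_ball] at hy; linarith
  · rw [Metric.mem_ball] at hxr ⊢
    rw [Metric.mem_closedBall] at hy
    linarith [dist_triangle y x x₀]

theorem weyl (i₀ : Fin n) {Λ : ℝ} (hΛ : 0 ≤ Λ) {U : Set (Eu n)} (hU : IsOpen U)
    {u : Eu n → ℝ} (hu : LocallyIntegrable u) (h : WHelm Λ U u) :
    ∃ f : Eu n → ℝ, Helm Λ U f ∧ ∀ᵐ x, x ∈ U → u x = f x := by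
  choose! r hr G hGc hGU hGH hGe using fun x (hx : x ∈ U) => weyl_local i₀ hΛ hU hu h hx
  have hloc : ∀ x ∈ U, ∀ y ∈ Metric.ball x (r x), G y y = G x y := by
    intro x hx y hy
    have hyU := hGU x hx hy
    set W := Metric.ball x (r x) ∩ Metric.ball y (r y)
    have hW : IsOpen W := Metric.isOpen_ball.inter Metric.isOpen_ball
    have hae : G y =ᵐ[volume.restrict W] G x := by
      rw [Filter.EventuallyEq, ae_restrict_iff' hW.measurableSet]
      filter_upwards [hGe x hx, hGe y hyU] with z h1 h2 hz
      rw [← h1 hz.1, ← h2 hz.2]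
    exact Measure.eqOn_open_of_ae_eq hae hW (hGc y hyU).continuous.continuousOn
      (hGc x hx).continuous.continuousOn ⟨hy, Metric.mem_ball_self (hr y hyU)⟩
  have hev : ∀ x ∈ U, G x =ᶠ[𝓝 x] fun y => G y y := fun x hx => by
    filter_upwards [Metric.ball_mem_nhds x (hr x hx)] with y hy using (hloc x hx y hy).symm
  refine ⟨fun x => G x x, ⟨fun x hx => (smAt_of_contDiff (hGc x hx) x).congr (hev x hx),
    fun x hx => ?_⟩, ?_⟩
  · rw [← (lap_congr (hev x hx)).eq_of_nhds]
    exact (hGH x hx).eq x (Metric.mem_ball_self (hr x hx))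
  · rw [ae_iff]
    refine measure_null_of_locally_null _ fun x hx => ?_
    have hxU : x ∈ U := by by_contra hn; exact hx fun h => absurd h hn
    refine ⟨_, inter_mem_nhdsWithin _ (Metric.ball_mem_nhds x (hr x hxU)), ?_⟩
    refine measure_mono_null ?_ (ae_iff.1 (hGe x hxU))
    rintro y ⟨hy1, hy2⟩ h3
    refine hy1 fun hyU => ?_
    exact (h3 hy2).trans (hloc x hxU y hy2).symm

/-- Directional derivative. -/
def dv (v : Eu n) (f : Eu n → ℝ) (x : Eu n) : ℝ := fderiv ℝ f x v

lemma dv_eq (v : Eu n) (f : Eu n → ℝ) : dv v f = fun x => ∑ i, v i * pd i f x :=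
  funext fun x => fderiv_eq_sum f x v

lemma Helm.zero (Λ : ℝ) (U : Set (Eu n)) : Helm Λ U fun _ => (0:ℝ) :=
  ⟨fun x _ => smAt_const 0 x, fun x _ => by simp [lap_const]⟩

lemma Helm.add {Λ : ℝ} {U : Set (Eu n)} {f g : Eu n → ℝ} (hf : Helm Λ U f) (hg : Helm Λ U g) :
    Helm Λ U fun x => f x + g x :=
  ⟨fun x hx => (hf.sm x hx).add (hg.sm x hx), fun x hx => by
    rw [lap_add (hf.sm x hx) (hg.sm x hx), hf.eq x hx, hg.eq x hx]; ring⟩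

lemma Helm.const_mul {Λ : ℝ} {U : Set (Eu n)} {f : Eu n → ℝ} (hf : Helm Λ U f) (c : ℝ) :
    Helm Λ U fun x => c * f x :=
  ⟨fun x hx => (smAt_const c x).mul (hf.sm x hx), fun x hx => by
    rw [lap_const_mul, hf.eq x hx]; ring⟩

lemma Helm.sub {Λ : ℝ} {U : Set (Eu n)} {f g : Eu n → ℝ} (hf : Helm Λ U f) (hg : Helm Λ U g) :
    Helm Λ U fun x => f x - g x := by
  have := hf.add (hg.const_mul (-1))
  simpa [← sub_eq_add_neg] using this

lemma Helm.sum {Λ : ℝ} {U : Set (Eu n)} {ι : Type*} (s : Finset ι) {f : ι → Eu n → ℝ}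
    (h : ∀ i ∈ s, Helm Λ U (f i)) : Helm Λ U fun x => ∑ i ∈ s, f i x := by
  classical
  induction s using Finset.induction_on with
  | empty => simpa using Helm.zero Λ U
  | insert a s ha ih =>
    simp_rw [Finset.sum_insert ha]
    exact (h a (by simp)).add (ih fun i hi => h i (by simp [hi]))

lemma Helm.dv {Λ : ℝ} {U : Set (Eu n)} {f : Eu n → ℝ} (hU : IsOpen U) (hf : Helm Λ U f)
    (v : Eu n) : Helm Λ U (dv v f) := by
  rw [dv_eq]; exact Helm.sum _ fun i _ => (hf.pd hU i).const_mul _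

lemma Helm.dv_iterate {Λ : ℝ} {U : Set (Eu n)} (hU : IsOpen U) (v : Eu n) (m : ℕ) :
    ∀ {f : Eu n → ℝ}, Helm Λ U f → Helm Λ U ((Mono.dv v)^[m] f) := by
  induction m with
  | zero => exact fun h => h
  | succ m ih => intro f h; rw [Function.iterate_succ_apply]; exact ih (h.dv hU v)

lemma taylor_bound {g : ℕ → ℝ → ℝ} {A : ℝ} (N : ℕ)
    (hd : ∀ m s, s ∈ Icc (0:ℝ) 1 → HasDerivAt (g m) (g (m + 1) s) s) (h0 : ∀ m, g m 0 = 0)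
    (hA : ∀ s ∈ Icc (0:ℝ) 1, |g N s| ≤ A) :
    |g 0 1| ≤ A / N.factorial := by
  have key : ∀ j ≤ N, ∀ s ∈ Icc (0:ℝ) 1, |g (N - j) s| ≤ A * s ^ j / j.factorial := by
    intro j
    induction j with
    | zero => intro _ s hs; simpa using hA s hs
    | succ j ih =>
      intro hj s hs
      have ih' := ih (by omega)
      have e : N - j = N - (j + 1) + 1 := by omega
      have := image_norm_le_of_norm_deriv_right_le_deriv_boundary
        (f := g (N - (j + 1))) (f' := g (N - j)) (a := 0) (b := 1)
        (B := fun s => A * s ^ (j + 1) / (j + 1).factorial) (B' := fun s => A * s ^ j / j.factorial)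
        (fun s hs => (hd _ s hs).continuousAt.continuousWithinAt)
        (fun s hs => by rw [e]; exact (hd _ s ⟨hs.1, hs.2.le⟩).hasDerivWithinAt)
        (by rw [h0]; simp) (fun s => by
          refine (((hasDerivAt_pow (j + 1) s).const_mul A).div_const _).congr_deriv ?_
          rw [Nat.factorial_succ]; push_cast; field_simp)
        (fun s hs => ih' s ⟨hs.1, hs.2.le⟩)
      exact this hs
  simpa using key N le_rfl 1 (by simp)

theorem exists_flat_radius (i₀ : Fin n) : ∃ c > 0, ∀ Λ r : ℝ, 0 ≤ Λ → 0 < r → Λ * r ^ 2 ≤ 1 →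
    ∀ (U : Set (Eu n)) (f : Eu n → ℝ), IsOpen U → Helm Λ U f → ∀ z : Eu n,
    Metric.closedBall z (2 * r) ⊆ U → (f =ᶠ[𝓝 z] fun _ => 0) → ∀ y ∈ Metric.ball z (c * r), f y = 0 := by
  obtain ⟨C, hC, hgrad⟩ := exists_gradient_bound i₀
  set B := (n : ℝ) * C with hB
  have hB0 : 0 ≤ B := by positivity
  have hstep : ∀ Λ r : ℝ, 0 ≤ Λ → 0 < r → Λ * r ^ 2 ≤ 1 → ∀ (U : Set (Eu n)), IsOpen U →
      ∀ (v : Eu n) (x : Eu n) (M : ℝ) (m : ℕ) (f : Eu n → ℝ), Helm Λ U f →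
      Metric.closedBall x (m * r) ⊆ U → (∀ y ∈ Metric.closedBall x (m * r), |f y| ≤ M) →
      |(dv v)^[m] f x| ≤ (B * ‖v‖ / r) ^ m * M := by
    intro Λ r hΛ hr hΛr U hU v x M m
    induction m generalizing M with
    | zero => intro f _ _ h; simpa using h x (by simp)
    | succ m ih =>
      intro f hf hx hM
      rw [Function.iterate_succ_apply]
      have hsub : Metric.closedBall x (m * r) ⊆ Metric.closedBall x ((m + 1 : ℕ) * r) :=
        Metric.closedBall_subset_closedBall (by push_cast; linarith)
      refine (ih (B * ‖v‖ / r * M) _ (hf.dv hU v) (hsub.trans hx) fun y hy => ?_).trans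
        (by rw [pow_succ]; linarith)
      have hyr : Metric.closedBall y r ⊆ Metric.closedBall x ((m + 1 : ℕ) * r) := fun w hw => by
        rw [Metric.mem_closedBall] at *
        push_cast
        linarith [dist_triangle w y x]
      have h1 := hgrad Λ r hΛ hr hΛr U f hU hf y (hyr.trans hx) 0 M
        fun w hw => by rw [sub_zero]; exact hM w (hyr hw)
      have hM0 : 0 ≤ M := (abs_nonneg _).trans (hM y (hyr (Metric.mem_closedBall_self hr.le)))
      rw [dv_eq]
      refine (Finset.abs_sum_le_sum_abs _ _).trans ?_
      calc ∑ i, |v i * pd i f y| ≤ ∑ _i : Fin n, ‖v‖ * (C / r * M) := by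
            refine Finset.sum_le_sum fun i _ => ?_
            rw [abs_mul]
            exact mul_le_mul (PiLp.norm_apply_le v i) (h1 i) (abs_nonneg _) (norm_nonneg _)
        _ = B * ‖v‖ / r * M := by
            simp only [Finset.sum_const, Finset.card_univ, Fintype.card_fin, nsmul_eq_mul, hB]; ring
  set c := 1 / (2 * Real.exp 1 * (B + 1)) with hc
  have hc0 : 0 < c := by positivity
  have hc1 : c ≤ 1 := by
    rw [hc, div_le_one (by positivity)]
    have : 1 ≤ Real.exp 1 := Real.one_le_exp (by norm_num)
    nlinarith
  refine ⟨c, hc0, fun Λ r hΛ hr hΛr U f hU hf z hz h0 y hy => ?_⟩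
  obtain ⟨v, rfl⟩ : ∃ v, y = z + v := ⟨y - z, by abel⟩
  have hv : ‖v‖ < c * r := by simpa using hy
  have hvr : ‖v‖ ≤ r := by nlinarith
  have hcont : ContinuousOn f (Metric.closedBall z (2 * r)) := fun x hx =>
    (hf.sm x (hz hx)).cont.continuousWithinAt
  obtain ⟨M, hM⟩ := (isCompact_closedBall z (2 * r)).exists_bound_of_continuousOn hcont
  have hM0 : 0 ≤ M := (norm_nonneg _).trans (hM z (Metric.mem_closedBall_self (by positivity)))
  have hseg : ∀ s ∈ Icc (0:ℝ) 1, Metric.closedBall (z + s • v) r ⊆ Metric.closedBall z (2 * r) := by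
    intro s hs w hw
    rw [Metric.mem_closedBall] at *
    have h1 : dist (z + s • v) z ≤ r := by
      rw [dist_self_add_left, norm_smul, Real.norm_of_nonneg hs.1]
      nlinarith [hs.2, norm_nonneg v]
    linarith [dist_triangle w (z + s • v) z]
  have hflat : ∀ m, (dv v)^[m] f z = 0 := by
    intro m
    have : (dv v)^[m] f =ᶠ[𝓝 z] fun _ => 0 := by
      induction m with
      | zero => exact h0
      | succ m ih =>
        rw [Function.iterate_succ_apply']
        filter_upwards [EventuallyEq.fderiv (𝕜 := ℝ) ih] with w hw
        rw [dv, hw]; simp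
    exact this.eq_of_nhds
  have hN : ∀ N : ℕ, |f (z + v)| ≤ M * (1 / 2) ^ N := by
    intro N
    rcases Nat.eq_zero_or_pos N with rfl | hNpos
    · simpa using hM (z + v) (by simpa using hvr.trans (by linarith))
    have hNR : (0:ℝ) < N := by exact_mod_cast hNpos
    have hN1 : (1:ℝ) ≤ N := by exact_mod_cast hNpos
    have hrN : r / N ≤ r := div_le_self hr.le hN1
    have := taylor_bound (g := fun m s => (dv v)^[m] f (z + s • v)) (A := (B * ‖v‖ / (r / N)) ^ N * M)
      N (fun m s hs => by
        have hmem : z + s • v ∈ U := hz (hseg s hs (Metric.mem_closedBall_self hr.le))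
        have := deriv_line ((hf.dv_iterate hU v m).sm _ hmem).diff (v := v)
        simp only [Function.iterate_succ_apply']
        exact this)
      (fun m => by simpa using hflat m) (fun s hs => by
        have hb : Metric.closedBall (z + s • v) (N * (r / N)) ⊆ Metric.closedBall z (2 * r) := by
          rw [mul_div_cancel₀ _ hNR.ne']; exact hseg s hs
        refine hstep Λ (r / N) hΛ (by positivity) ?_ U hU v _ M N f hf (hb.trans hz)
          fun y hy => hM y (hb hy)
        exact (mul_le_mul_of_nonneg_left (pow_le_pow_left₀ (by positivity) hrN 2) hΛ).trans hΛr)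
    simp only [Function.iterate_zero, id, one_smul] at this
    refine this.trans ?_
    have hfac : (N:ℝ) ^ N / N.factorial ≤ Real.exp 1 ^ N := by
      rw [← Real.exp_nat_mul, mul_one]
      exact Real.pow_div_factorial_le_exp (N:ℝ) (by positivity) N
    have hq : B * ‖v‖ / r * Real.exp 1 ≤ 1 / 2 := by
      have h1 : ‖v‖ / r ≤ c := by rw [div_le_iff₀ hr]; exact hv.le
      calc B * ‖v‖ / r * Real.exp 1 = B * (‖v‖ / r) * Real.exp 1 := by ring
        _ ≤ (B + 1) * c * Real.exp 1 := by gcongr; linarith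
        _ = 1 / 2 := by rw [hc]; field_simp
    calc (B * ‖v‖ / (r / N)) ^ N * M / N.factorial
        = (B * ‖v‖ / r) ^ N * ((N:ℝ) ^ N / N.factorial) * M := by
          rw [show B * ‖v‖ / (r / N) = B * ‖v‖ / r * N by field_simp, mul_pow]; ring
      _ ≤ (B * ‖v‖ / r) ^ N * Real.exp 1 ^ N * M := by gcongr
      _ = (B * ‖v‖ / r * Real.exp 1) ^ N * M := by rw [mul_pow]
      _ ≤ (1 / 2) ^ N * M := by gcongr
      _ = _ := mul_comm _ _
  have hlim : Tendsto (fun N : ℕ => M * (1 / 2 : ℝ) ^ N) atTop (𝓝 (M * 0)) :=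
    (tendsto_pow_atTop_nhds_zero_of_lt_one (by norm_num) (by norm_num)).const_mul M
  have := ge_of_tendsto' hlim hN
  rw [mul_zero] at this
  exact abs_nonpos_iff.1 this

lemma exists_small_radius {Λ ρ : ℝ} (hΛ : 0 ≤ Λ) (hρ : 0 < ρ) :
    ∃ r > 0, 4 * r < ρ ∧ Λ * r ^ 2 ≤ 1 := by
  refine ⟨min (ρ / 8) (1 / (1 + Λ)), lt_min (by positivity) (by positivity), ?_, ?_⟩
  · linarith [min_le_left (ρ / 8) (1 / (1 + Λ))]
  · have h1 : min (ρ / 8) (1 / (1 + Λ)) ≤ 1 / (1 + Λ) := min_le_right _ _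
    have h0 : 0 ≤ min (ρ / 8) (1 / (1 + Λ)) := le_min (by positivity) (by positivity)
    calc _ ≤ Λ * (1 / (1 + Λ)) ^ 2 := by gcongr
      _ ≤ 1 := by
        rw [div_pow, one_pow, mul_one_div, div_le_one (by positivity)]
        nlinarith

/-- Unique continuation for the Helmholtz equation. -/
theorem Helm.unique_continuation (i₀ : Fin n) {Λ : ℝ} (hΛ : 0 ≤ Λ) {U : Set (Eu n)} (hU : IsOpen U)
    (hUc : IsPreconnected U) {f : Eu n → ℝ} (hf : Helm Λ U f) {x₀ : Eu n} (hx₀ : x₀ ∈ U)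
    (h0 : f =ᶠ[𝓝 x₀] fun _ => 0) : ∀ x ∈ U, f x = 0 := by
  obtain ⟨c, hc, hflat⟩ := exists_flat_radius i₀
  set Z := {x : Eu n | f =ᶠ[𝓝 x] fun _ => 0}
  have hZ : IsOpen Z := isOpen_setOfPred_eventually_nhds (p := fun y => f y = 0)
  have := hUc.subset_of_closure_inter_subset hZ ⟨x₀, hx₀, h0⟩ ?_
  · exact fun x hx => (this hx : f =ᶠ[𝓝 x] fun _ => 0).eq_of_nhds
  rintro x ⟨hx, hxU⟩
  obtain ⟨ρ, hρ, hρU⟩ := Metric.isOpen_iff.1 hU x hxU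
  obtain ⟨r, hr, hr4, hrΛ⟩ := exists_small_radius hΛ hρ
  obtain ⟨z, hz, hxz⟩ := Metric.mem_closure_iff.1 hx (min r (c * r)) (lt_min hr (by positivity))
  have h1 : dist x z < r := hxz.trans_le (min_le_left _ _)
  have h2 : x ∈ Metric.ball z (c * r) := hxz.trans_le (min_le_right _ _)
  filter_upwards [Metric.isOpen_ball.mem_nhds h2] with y hy
  refine hflat Λ r hΛ hr hrΛ U f hU hf z (fun w hw => hρU ?_) hz y hy
  rw [Metric.mem_closedBall] at hw
  rw [Metric.mem_ball]
  linarith [dist_triangle w z x, dist_comm x z]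

/-- Strong minimum principle for nonnegative solutions. -/
theorem Helm.strong_min (i₀ : Fin n) {Λ : ℝ} (hΛ : 0 ≤ Λ) {U : Set (Eu n)} (hU : IsOpen U)
    (hUc : IsPreconnected U) {f : Eu n → ℝ} (hf : Helm Λ U f) (hpos : ∀ x ∈ U, 0 ≤ f x)
    {x₀ : Eu n} (hx₀ : x₀ ∈ U) (h0 : f x₀ = 0) : ∀ x ∈ U, f x = 0 := by
  refine hf.unique_continuation i₀ hΛ hU hUc hx₀ ?_
  obtain ⟨ρ, hρ, hρU⟩ := Metric.isOpen_iff.1 hU x₀ hx₀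
  obtain ⟨r, hr, hr4, hrΛ⟩ := exists_small_radius hΛ hρ
  obtain ⟨C, -, hC⟩ := exists_ker i₀
  obtain ⟨k, hk, -⟩ := hC Λ r hΛ hr hrΛ
  have hsub : Metric.closedBall x₀ r ⊆ U := fun y hy => hρU (by
    rw [Metric.mem_closedBall] at hy; rw [Metric.mem_ball]; linarith)
  have h1 := (hk.cv_eq hU hf hsub).1
  obtain ⟨F, hF, -, hFe⟩ := exists_localisation (isCompact_closedBall x₀ r) hU hsub hf.sm
  have hT := Tst.mul_left hF.smooth (hk.tst.comp_sub x₀)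
  have hkz : ∀ y, y ∉ Metric.closedBall x₀ r → k (x₀ - y) = 0 := fun y hy => hk.zero _ (by
    rw [Metric.mem_closedBall, dist_comm, dist_eq_norm, not_le] at hy; exact hy.le)
  have heq : ∀ y, F y * k (x₀ - y) = f y * k (x₀ - y) := fun y => by
    by_cases hy : y ∈ Metric.closedBall x₀ r
    · rw [(hFe y hy).eq_of_nhds]
    · simp [hkz y hy]
  have hnn : ∀ y, 0 ≤ F y * k (x₀ - y) := fun y => by
    rw [heq]
    by_cases hy : y ∈ Metric.closedBall x₀ r
    · exact mul_nonneg (hpos y (hsub hy)) (hk.nonneg _)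
    · simp [hkz y hy]
  have hInt : ∫ y, F y * k (x₀ - y) = 0 := by
    rw [integral_congr_ae (Eventually.of_forall heq)]; exact h1.trans h0
  have hz : (fun y => F y * k (x₀ - y)) = fun _ => 0 :=
    (Continuous.ae_eq_iff_eq volume hT.cont continuous_const).1
      ((integral_eq_zero_iff_of_nonneg hnn hT.int).1 hInt)
  have hk0 : ∀ᶠ y in 𝓝 x₀, 0 < k (x₀ - y) := by
    have : ContinuousAt (fun y => k (x₀ - y)) x₀ := (hk.tst.comp_sub x₀).cont.continuousAt
    exact this.eventually (lt_mem_nhds (by simpa using hk.pos_zero))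
  filter_upwards [hk0, Metric.closedBall_mem_nhds x₀ hr] with y hy hyr
  have h3 : F y * k (x₀ - y) = 0 := congrFun hz y
  rw [heq] at h3
  exact (mul_eq_zero.1 h3).resolve_right hy.ne'

/-- Weak maximum principle on a compact set. -/
lemma max_principle {K O : Set (Eu n)} (hK : IsCompact K) (hO : IsOpen O) (hOK : O ⊆ K)
    {φ : Eu n → ℝ} (hc : ContinuousOn φ K) (hs : ∀ x ∈ O, SmAt φ x) (hl : ∀ x ∈ O, 0 < lap φ x)
    (hb : ∀ x ∈ K, x ∉ O → φ x ≤ 0) : ∀ x ∈ K, φ x ≤ 0 := by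
  intro x hx
  obtain ⟨m, hm, hmax⟩ := hK.exists_isMaxOn ⟨x, hx⟩ hc
  refine (hmax hx).trans ?_
  by_cases hmO : m ∈ O
  · have : IsLocalMax φ m := by
      filter_upwards [hO.mem_nhds hmO] with y hy using hmax (hOK hy)
    exact absurd (lap_nonpos_of_isLocalMax (hs m hmO) this) (not_le.2 (hl m hmO))
  · exact hb m hm hmO

/-- A smooth self-map of `ℝ^n` with smooth inverse. -/
def IsDiffeo (Ψ : Eu n → Eu n) : Prop :=
  ContDiff ℝ ∞ Ψ ∧ ∃ Φ : Eu n → Eu n, ContDiff ℝ ∞ Φ ∧ Function.LeftInverse Φ Ψ ∧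
    Function.RightInverse Φ Ψ

lemma IsDiffeo.comp {Ψ Ψ' : Eu n → Eu n} (h : IsDiffeo Ψ) (h' : IsDiffeo Ψ') :
    IsDiffeo (fun x => Ψ (Ψ' x)) := by
  obtain ⟨h1, Φ, h2, h3, h4⟩ := h
  obtain ⟨h1', Φ', h2', h3', h4'⟩ := h'
  exact ⟨h1.comp h1', fun x => Φ' (Φ x), h2'.comp h2, h3.comp h3', h4.comp h4'⟩

lemma isDiffeo_of_small {u : Eu n → Eu n} (hu : ContDiff ℝ ∞ u) (hb : ∀ x, ‖fderiv ℝ u x‖ ≤ 1 / 2) :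
    IsDiffeo (fun x => x + u x) := by
  have hd : Differentiable ℝ u := hu.differentiable (by simp)
  have hL : LipschitzWith (1 / 2) u := lipschitzWith_of_nnnorm_fderiv_le hd fun x => by
    rw [← NNReal.coe_le_coe]; simpa using hb x
  have hA : ApproximatesLinearOn (fun x => x + u x)
      ((ContinuousLinearEquiv.refl ℝ (Eu n) : Eu n ≃L[ℝ] Eu n) : Eu n →L[ℝ] Eu n) univ (1 / 2) := by
    rw [ApproximatesLinearOn.approximatesLinearOn_iff_lipschitzOnWith]
    have : (fun x => x + u x) - ⇑((ContinuousLinearEquiv.refl ℝ (Eu n) : Eu n ≃L[ℝ] Eu n) :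
        Eu n →L[ℝ] Eu n) = u := by funext x; simp
    rw [this]
    exact hL.lipschitzOnWith
  have hc : Subsingleton (Eu n) ∨ (1 / 2 : NNReal) <
      ‖((ContinuousLinearEquiv.refl ℝ (Eu n)).symm : Eu n →L[ℝ] Eu n)‖₊⁻¹ := by
    rcases subsingleton_or_nontrivial (Eu n) with h | h
    · exact Or.inl h
    · right
      have : ‖((ContinuousLinearEquiv.refl ℝ (Eu n)).symm : Eu n →L[ℝ] Eu n)‖₊ = 1 := by
        have : ((ContinuousLinearEquiv.refl ℝ (Eu n)).symm : Eu n →L[ℝ] Eu n)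
          = ContinuousLinearMap.id ℝ (Eu n) := rfl
        rw [this, ← NNReal.coe_inj]; simp
      rw [this, inv_one]
      exact NNReal.half_lt_self one_ne_zero
  set h := hA.toHomeomorph _ hc with hh
  have hcoe : ∀ x, h x = x + u x := fun x => rfl
  have hC : ContDiff ℝ ∞ (fun x => x + u x) := contDiff_id.add hu
  let U : Eu n → (Eu n →L[ℝ] Eu n)ˣ := fun x => Units.oneSub (-(fderiv ℝ u x)) (by
    rw [norm_neg]; exact (hb x).trans_lt (by norm_num))
  have hS : ContDiff ℝ ∞ h.symm := by
    refine h.contDiff_symm (f₀' := fun x => ContinuousLinearEquiv.unitsEquiv ℝ (Eu n) (U x))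
      (fun x => ?_) hC
    have : HasFDerivAt (fun x => x + u x) (ContinuousLinearMap.id ℝ (Eu n) + fderiv ℝ u x) x :=
      (hasFDerivAt_id x).add (hd x).hasFDerivAt
    refine this.congr_fderiv ?_
    ext1 v
    simp [U]
  exact ⟨hC, h.symm, hS, fun x => h.symm_apply_apply x, fun x => h.apply_symm_apply x⟩

/-- Implicit functions near a compact set of zeros. -/
lemma exists_implicit {P : Type*} [NormedAddCommGroup P] [NormedSpace ℝ P] [CompleteSpace P]
    {G : P × ℝ → ℝ} (hG : ContDiff ℝ ∞ G) {K : Set P} (hK : IsCompact K)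
    (h0 : ∀ p ∈ K, G (p, 0) = 0) (h1 : ∀ p ∈ K, fderiv ℝ G (p, 0) (0, 1) ≠ 0) :
    ∃ s : P → ℝ, ∀ p ∈ K, ∀ᶠ q in 𝓝 p, ContDiffAt ℝ ∞ s q ∧ G (q, s q) = 0 ∧
      (G (q, 0) = 0 → s q = 0) := by
  have hcd : Continuous fun z => fderiv ℝ G z (0, 1) :=
    (hG.continuous_fderiv (by simp)).clm_apply continuous_const
  obtain ⟨O, V, hO, hV, hKO, h0V, hOV⟩ := generalized_tube_lemma hK (isCompact_singleton (x := (0 : ℝ)))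
    (isOpen_ne_fun hcd continuous_const : IsOpen {z : P × ℝ | fderiv ℝ G z (0, 1) ≠ 0})
    (by rintro ⟨p, t⟩ ⟨hp, ht⟩; obtain rfl : t = 0 := ht; exact h1 p hp)
  obtain ⟨τ, hτ, hτV⟩ := Metric.isOpen_iff.1 hV 0 (h0V rfl)
  have hline : ∀ p t, HasDerivAt (fun t => G (p, t)) (fderiv ℝ G (p, t) (0, 1)) t := fun p t => by
    have h := (hG.differentiable (by simp) (p, t)).hasFDerivAt.comp_hasDerivAt t
      ((hasDerivAt_const t p).prodMk (hasDerivAt_id t))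
    exact h
  have huniq : ∀ p ∈ O, ∀ t₁ ∈ Metric.ball (0 : ℝ) τ, ∀ t₂ ∈ Metric.ball (0 : ℝ) τ, t₁ < t₂ →
      G (p, t₁) ≠ G (p, t₂) := by
    intro p hp t₁ ht₁ t₂ ht₂ hlt he
    obtain ⟨t, ht, h⟩ := exists_hasDerivAt_eq_zero hlt
      (fun t _ => (hline p t).continuousAt.continuousWithinAt) he (fun t _ => hline p t)
    refine hOV (⟨hp, hτV ?_⟩ : (p, t) ∈ O ×ˢ V) h
    rw [Real.ball_eq_Ioo] at *
    exact ⟨ht₁.1.trans ht.1, ht.2.trans ht₂.2⟩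
  have huniq' : ∀ p ∈ O, ∀ t₁ ∈ Metric.ball (0 : ℝ) τ, ∀ t₂ ∈ Metric.ball (0 : ℝ) τ,
      G (p, t₁) = G (p, t₂) → t₁ = t₂ := by
    intro p hp t₁ ht₁ t₂ ht₂ he
    rcases lt_trichotomy t₁ t₂ with h | h | h
    · exact absurd he (huniq p hp t₁ ht₁ t₂ ht₂ h)
    · exact h
    · exact absurd he.symm (huniq p hp t₂ ht₂ t₁ ht₁ h)
  -- local solutions
  have hloc : ∀ p ∈ O, ∀ t ∈ Metric.ball (0 : ℝ) τ, G (p, t) = 0 → ∃ ψ : P → ℝ,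
      ContDiffAt ℝ ∞ ψ p ∧ ψ p = t ∧ ∀ᶠ q in 𝓝 p, G (q, ψ q) = 0 ∧ ψ q ∈ Metric.ball (0 : ℝ) τ := by
    intro p hp t ht hz
    have hne : fderiv ℝ G (p, t) (0, 1) ≠ 0 := hOV (⟨hp, hτV ht⟩ : (p, t) ∈ O ×ˢ V)
    have hinv : (fderiv ℝ G (p, t) ∘L .inr ℝ P ℝ).IsInvertible := by
      refine ⟨ContinuousLinearEquiv.unitsEquivAut ℝ (Units.mk0 _ hne), ?_⟩
      ext
      simp
    have cdf : ContDiffAt ℝ ∞ G (p, t) := hG.contDiffAt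
    have e1 := cdf.contDiffAt_implicitFunction (by simp) hinv
    have e2 := cdf.implicitFunction_apply_self (by simp) hinv
    have e3 := cdf.eventually_apply_implicitFunction (by simp) hinv
    refine ⟨_, e1, e2, ?_⟩
    filter_upwards [e3, e1.continuousAt.eventually (Metric.isOpen_ball.mem_nhds
      (by rw [e2]; exact ht))] with q h1 h2
    exact ⟨h1.trans hz, h2⟩
  classical
  let s : P → ℝ := fun q => if h : ∃ t ∈ Metric.ball (0 : ℝ) τ, G (q, t) = 0 then h.choose else 0
  have hs : ∀ q, (∃ t ∈ Metric.ball (0 : ℝ) τ, G (q, t) = 0) →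
      s q ∈ Metric.ball (0 : ℝ) τ ∧ G (q, s q) = 0 := fun q h => by
    simp only [s, dif_pos h]; exact h.choose_spec
  refine ⟨s, fun p hp => ?_⟩
  obtain ⟨ψ, -, -, hψ⟩ := hloc p (hKO hp) 0 (Metric.mem_ball_self hτ) (h0 p hp)
  filter_upwards [hψ, hO.mem_nhds (hKO hp)] with q hq hqO
  obtain ⟨hq1, hq2⟩ := hs q ⟨ψ q, hq.2, hq.1⟩
  refine ⟨?_, hq2, fun hz => huniq' q hqO _ hq1 _ (Metric.mem_ball_self hτ) (by rw [hq2, hz])⟩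
  obtain ⟨ψ', h1, h2, h3⟩ := hloc q hqO _ hq1 hq2
  refine h1.congr_of_eventuallyEq ?_
  filter_upwards [h3, hO.mem_nhds hqO] with q' h4 h5
  obtain ⟨h6, h7⟩ := hs q' ⟨_, h4.2, h4.1⟩
  exact huniq' q' h5 _ h6 _ h4.2 (by rw [h7, h4.1])

/-- Convex combinations. -/
def cvx (q₀ q₁ : Eu n → ℝ) (θ : ℝ) (x : Eu n) : ℝ := (1 - θ) * q₀ x + θ * q₁ x

lemma contDiff_cvx {q₀ q₁ : Eu n → ℝ} (h₀ : ContDiff ℝ ∞ q₀) (h₁ : ContDiff ℝ ∞ q₁) :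
    ContDiff ℝ ∞ fun p : ℝ × Eu n => cvx q₀ q₁ p.1 p.2 := by
  unfold cvx
  have a := h₀.comp (contDiff_snd (𝕜 := ℝ) (E := ℝ) (F := Eu n))
  have b := h₁.comp (contDiff_snd (𝕜 := ℝ) (E := ℝ) (F := Eu n))
  exact ((contDiff_const.sub contDiff_fst).mul a).add (contDiff_fst.mul b)

lemma isotopy_step {q₀ q₁ : Eu n → ℝ} (h₀ : ContDiff ℝ ∞ q₀) (h₁ : ContDiff ℝ ∞ q₁)
    {W : Eu n → Eu n} (hW : ContDiff ℝ ∞ W) {O K : Set (Eu n)} (hO : IsOpen O) (hK : IsCompact K)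
    (hKO : K ⊆ O) (hz : ∀ θ ∈ Icc (0 : ℝ) 1, ∀ x ∈ O, cvx q₀ q₁ θ x = 0 → x ∈ K)
    (hd₀ : ∀ x ∈ K, 0 < fderiv ℝ q₀ x (W x)) (hd₁ : ∀ x ∈ K, 0 < fderiv ℝ q₁ x (W x))
    {θ₀ : ℝ} (hθ₀ : θ₀ ∈ Icc (0 : ℝ) 1) : ∀ᶠ θ in 𝓝[Icc 0 1] θ₀, ∃ Ψ : Eu n → Eu n, IsDiffeo Ψ ∧
      Ψ '' {x ∈ O | cvx q₀ q₁ θ₀ x = 0} = {x ∈ O | cvx q₀ q₁ θ x = 0} := by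
  have hq := contDiff_cvx h₀ h₁
  let G : (Eu n × ℝ) × ℝ → ℝ := fun z =>
    cvx q₀ q₁ z.1.2 (z.1.1 + z.2 • W z.1.1) - cvx q₀ q₁ θ₀ z.1.1
  have hz11 : ContDiff ℝ ∞ fun z : (Eu n × ℝ) × ℝ => z.1.1 := contDiff_fst.comp contDiff_fst
  have hz12 : ContDiff ℝ ∞ fun z : (Eu n × ℝ) × ℝ => z.1.2 := contDiff_snd.comp contDiff_fst
  have hG : ContDiff ℝ ∞ G :=
    (hq.comp (hz12.prodMk (hz11.add (contDiff_snd.smul (hW.comp hz11))))).sub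
      (hq.comp (contDiff_const.prodMk hz11))
  have hqd : ∀ θ x, HasFDerivAt (cvx q₀ q₁ θ) ((1 - θ) • fderiv ℝ q₀ x + θ • fderiv ℝ q₁ x) x :=
    fun θ x => ((h₀.differentiable (by simp) x).hasFDerivAt.const_mul _).add
      ((h₁.differentiable (by simp) x).hasFDerivAt.const_mul _)
  have hpos : ∀ x ∈ K, 0 < ((1 - θ₀) • fderiv ℝ q₀ x + θ₀ • fderiv ℝ q₁ x) (W x) := by
    intro x hx
    have a := hd₀ x hx
    have b := hd₁ x hx
    simp only [add_apply, smul_apply, smul_eq_mul]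
    rcases eq_or_lt_of_le hθ₀.1 with h | h
    · rw [← h]; simpa using a
    · have := mul_pos h b
      have := mul_nonneg (sub_nonneg.2 hθ₀.2) a.le
      linarith
  obtain ⟨s, hs⟩ := exists_implicit hG (hK.prod (isCompact_singleton (x := θ₀)))
    (by rintro ⟨x, θ⟩ ⟨hx, hθ⟩; obtain rfl : θ = θ₀ := hθ; simp [G])
    (by
      rintro ⟨x, θ⟩ ⟨hx, hθ⟩
      obtain rfl : θ = θ₀ := hθ
      have e1 : HasDerivAt (fun t : ℝ => G ((x, θ), t)) (fderiv ℝ G ((x, θ), 0) (0, 1)) 0 :=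
        (hG.differentiable (by simp) ((x, θ), 0)).hasFDerivAt.comp_hasDerivAt (0 : ℝ)
          ((hasDerivAt_const (0 : ℝ) (x, θ)).prodMk (hasDerivAt_id (0 : ℝ)))
      have e2 : HasDerivAt (fun t : ℝ => x + t • W x) (W x) 0 := by
        simpa using ((hasDerivAt_id (0 : ℝ)).smul_const (W x)).const_add x
      have e3 := ((by simpa using hqd θ x : HasFDerivAt (cvx q₀ q₁ θ) _
        (x + (0 : ℝ) • W x)).comp_hasDerivAt (0 : ℝ) e2).sub_const (cvx q₀ q₁ θ x)
      have := e1.unique e3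
      rw [this]
      exact (hpos x hx).ne')
  obtain ⟨U, I, hU, hI, hKU, hθI, hUI⟩ := generalized_tube_lemma hK (isCompact_singleton (x := θ₀))
    (isOpen_interior (s := {q : Eu n × ℝ | ContDiffAt ℝ ∞ s q ∧ G (q, s q) = 0 ∧
      (G (q, 0) = 0 → s q = 0)})) fun p hp => mem_interior_iff_mem_nhds.2 (hs p hp)
  have hUI' : ∀ x ∈ U, ∀ θ ∈ I, ContDiffAt ℝ ∞ s (x, θ) ∧ G ((x, θ), s (x, θ)) = 0 ∧
      (G ((x, θ), 0) = 0 → s (x, θ) = 0) := fun x hx θ hθ => by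
    have := interior_subset (hUI (⟨hx, hθ⟩ : (x, θ) ∈ U ×ˢ I))
    exact this
  replace hθI : θ₀ ∈ I := hθI rfl
  obtain ⟨d, hdpos, hd⟩ := hK.exists_cthickening_subset_open (hU.inter hO) (subset_inter hKU hKO)
  obtain ⟨χ, hχ, hχU, hχ1, -⟩ := exists_bump (hK.cthickening (r := d)) hU (hd.trans inter_subset_left)
  let u : Eu n × ℝ → Eu n := fun p => (χ p.1 * s p) • W p.1
  have hu0 : ∀ p : Eu n × ℝ, p.1 ∉ tsupport χ → u =ᶠ[𝓝 p] fun _ => 0 := by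
    intro p hp
    have : ∀ᶠ x in 𝓝 p.1, χ x = 0 := by
      filter_upwards [(isClosed_tsupport χ).isOpen_compl.mem_nhds hp] with x hx
        using image_eq_zero_of_notMem_tsupport hx
    filter_upwards [continuousAt_fst.eventually this] with q hq
    simp [u, hq]
  have huC : ∀ p : Eu n × ℝ, p.2 ∈ I → ContDiffAt ℝ ∞ u p := by
    rintro ⟨x, θ⟩ hp
    by_cases hx : x ∈ tsupport χ
    · exact ((hχ.smooth.comp contDiff_fst).contDiffAt.mul (hUI' x (hχU hx) θ hp).1).smul
        (hW.comp contDiff_fst).contDiffAt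
    · exact contDiffAt_const.congr_of_eventuallyEq (hu0 (x, θ) hx)
  have huθ : ∀ x, u (x, θ₀) = 0 := by
    intro x
    by_cases hx : x ∈ tsupport χ
    · have := (hUI' x (hχU hx) θ₀ hθI).2.2 (by simp [G])
      simp [u, this]
    · exact (hu0 (x, θ₀) hx).eq_of_nhds
  have hsl : ∀ θ ∈ I, ContDiff ℝ ∞ (fun x => u (x, θ)) := fun θ hθ =>
    contDiff_iff_contDiffAt.2 fun x => ContDiffAt.comp (g := u) (f := fun x : Eu n => (x, θ)) x
      (huC (x, θ) hθ) (contDiff_id.prodMk contDiff_const).contDiffAt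
  have hfd : ∀ x, ∀ θ ∈ I, fderiv ℝ (fun x => u (x, θ)) x =
      (fderiv ℝ u (x, θ)).comp (ContinuousLinearMap.inl ℝ (Eu n) ℝ) := by
    intro x θ hθ
    have e : HasFDerivAt (fun x : Eu n => (x, θ)) (ContinuousLinearMap.inl ℝ (Eu n) ℝ) x := by
      have := (hasFDerivAt_id (𝕜 := ℝ) x).prodMk (hasFDerivAt_const (𝕜 := ℝ) θ x)
      exact this
    exact (((huC (x, θ) hθ).differentiableAt (by simp)).hasFDerivAt.comp x e).fderiv
  have hsmall : ∀ᶠ θ in 𝓝 θ₀, ∀ x ∈ tsupport χ, ‖u (x, θ)‖ < d ∧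
      ‖(fderiv ℝ u (x, θ)).comp (ContinuousLinearMap.inl ℝ (Eu n) ℝ)‖ < 1 / 2 := by
    refine IsCompact.eventually_forall_of_forall_eventually hχ.cs.isCompact fun x _ => ?_
    have c1 : ContinuousAt (fun z : ℝ × Eu n => ‖u (z.2, z.1)‖) (θ₀, x) :=
      ((huC (x, θ₀) hθI).continuousAt.comp (f := fun z : ℝ × Eu n => (z.2, z.1))
        (x := (θ₀, x)) (by fun_prop)).norm
    have c2 : ContinuousAt (fun z : ℝ × Eu n => ‖(fderiv ℝ u (z.2, z.1)).comp
        (ContinuousLinearMap.inl ℝ (Eu n) ℝ)‖) (θ₀, x) := by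
      have c : ContinuousAt (fderiv ℝ u) (x, θ₀) :=
        ((huC (x, θ₀) hθI).fderiv_right (m := 0) (by simp)).continuousAt
      have c' : ContinuousAt (fun z : ℝ × Eu n => fderiv ℝ u (z.2, z.1)) (θ₀, x) :=
        ContinuousAt.comp (f := fun z : ℝ × Eu n => (z.2, z.1)) (x := (θ₀, x)) c (by fun_prop)
      exact (c'.clm_comp continuousAt_const).norm
    refine (c1.eventually (gt_mem_nhds ?_)).and (c2.eventually (gt_mem_nhds ?_))
    · simp [huθ, hdpos]
    · have : (fun x => u (x, θ₀)) = fun _ => 0 := funext huθ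
      simp only [← hfd x θ₀ hθI]
      rw [this]; simp
  filter_upwards [self_mem_nhdsWithin, nhdsWithin_le_nhds hsmall,
    nhdsWithin_le_nhds (hI.mem_nhds hθI)] with θ hθ hsm hθI'
  refine ⟨fun x => x + u (x, θ), isDiffeo_of_small (hsl θ hθI') fun x => ?_, ?_⟩
  · by_cases hx : x ∈ tsupport χ
    · rw [hfd x θ hθI']; exact (hsm x hx).2.le
    · have : (fun x => u (x, θ)) =ᶠ[𝓝 x] fun _ => 0 :=
        (show Tendsto (fun x : Eu n => (x, θ)) (𝓝 x) (𝓝 (x, θ)) from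
          Continuous.tendsto (by fun_prop) x).eventually (hu0 (x, θ) hx)
      rw [this.fderiv_eq]; simp
  · have hdist : ∀ x, ‖u (x, θ)‖ < d := fun x => by
      by_cases hx : x ∈ tsupport χ
      · exact (hsm x hx).1
      · rw [(hu0 (x, θ) hx).eq_of_nhds]; simpa using hdpos
    have key : ∀ x ∈ Metric.cthickening d K, cvx q₀ q₁ θ (x + u (x, θ)) = cvx q₀ q₁ θ₀ x := by
      intro x hx
      have h1 := (hUI' x (hd hx).1 θ hθI').2.1
      have h2 : χ x = 1 := (hχ1 x hx).eq_of_nhds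
      have h3 : u (x, θ) = s (x, θ) • W x := by simp [u, h2]
      rw [h3]
      exact sub_eq_zero.1 h1
    have hthick : ∀ x y : Eu n, y ∈ K → ‖x - y‖ < d → x ∈ Metric.cthickening d K := fun x y hy h =>
      Metric.mem_cthickening_of_dist_le x y d K hy (by rw [dist_eq_norm]; exact h.le)
    ext y
    constructor
    · rintro ⟨x, ⟨hxO, hx0⟩, rfl⟩
      have hxK := hz θ₀ hθ₀ x hxO hx0
      refine ⟨(hd (hthick _ x hxK ?_)).2, ?_⟩
      · simpa using hdist x
      · exact (key x (Metric.self_subset_cthickening K hxK)).trans hx0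
    · rintro ⟨hyO, hy0⟩
      have hyK := hz θ hθ y hyO hy0
      obtain ⟨-, Φ, -, -, hΦ⟩ := isDiffeo_of_small (hsl θ hθI') fun x => (by
        by_cases hx : x ∈ tsupport χ
        · rw [hfd x θ hθI']; exact (hsm x hx).2.le
        · have : (fun x => u (x, θ)) =ᶠ[𝓝 x] fun _ => 0 :=
            (show Tendsto (fun x : Eu n => (x, θ)) (𝓝 x) (𝓝 (x, θ)) from
          Continuous.tendsto (by fun_prop) x).eventually (hu0 (x, θ) hx)
          rw [this.fderiv_eq]; simp)
      have hy : Φ y + u (Φ y, θ) = y := hΦ y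
      have hxc : Φ y ∈ Metric.cthickening d K := hthick _ y hyK (by
        have : Φ y - y = - u (Φ y, θ) := by nth_rewrite 2 [← hy]; abel
        rw [this, norm_neg]; exact hdist _)
      exact ⟨Φ y, ⟨(hd hxc).2, by rw [← key _ hxc, hy, hy0]⟩, hy⟩

/-- Zero sets of transversally monotone functions are ambient diffeomorphic. -/
theorem exists_isotopy {q₀ q₁ : Eu n → ℝ} (h₀ : ContDiff ℝ ∞ q₀) (h₁ : ContDiff ℝ ∞ q₁)
    {W : Eu n → Eu n} (hW : ContDiff ℝ ∞ W) {O K : Set (Eu n)} (hO : IsOpen O) (hK : IsCompact K)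
    (hKO : K ⊆ O) (hz : ∀ θ ∈ Icc (0 : ℝ) 1, ∀ x ∈ O, cvx q₀ q₁ θ x = 0 → x ∈ K)
    (hd₀ : ∀ x ∈ K, 0 < fderiv ℝ q₀ x (W x)) (hd₁ : ∀ x ∈ K, 0 < fderiv ℝ q₁ x (W x)) :
    ∃ Ψ : Eu n → Eu n, IsDiffeo Ψ ∧ Ψ '' {x ∈ O | q₀ x = 0} = {x ∈ O | q₁ x = 0} := by
  have := isPreconnected_Icc.induction₂ (s := Icc (0 : ℝ) 1)
    (fun a b => ∃ Ψ : Eu n → Eu n, IsDiffeo Ψ ∧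
      Ψ '' {x ∈ O | cvx q₀ q₁ a x = 0} = {x ∈ O | cvx q₀ q₁ b x = 0})
    (fun θ hθ => isotopy_step h₀ h₁ hW hO hK hKO hz hd₀ hd₁ hθ)
    (fun a b c _ _ _ ⟨Ψ, h, h'⟩ ⟨Ψ', k, k'⟩ => ⟨_, k.comp h, by
      rw [← k', ← h', image_image]⟩)
    (fun a b _ _ ⟨Ψ, ⟨h1, Φ, h2, h3, h4⟩, h'⟩ => ⟨Φ, ⟨h2, Ψ, h1, h4, h3⟩, by
      rw [← h', image_image]; simp [h3 _]⟩)
    (left_mem_Icc.2 zero_le_one) (right_mem_Icc.2 zero_le_one)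
  simpa [cvx] using this

/-- Uniform strict monotonicity near `x` along a direction of increase. -/
lemma exists_slide {F : Eu n → ℝ} {x V : Eu n} (hF : SmAt F x) (hV : 0 < fderiv ℝ F x V)
    {P : Eu n → Prop} (hP : ∀ᶠ z in 𝓝 x, P z) :
    ∃ m > 0, ∃ δ₀ > 0, ∀ δ : ℝ, 0 < δ → δ ≤ δ₀ → ∀ᶠ y in 𝓝 x,
      (∀ t ∈ Icc (-δ) δ, P (y + t • V)) ∧
      (∀ s ∈ Icc (-δ) δ, ∀ t ∈ Icc (-δ) δ, s ≤ t → m * (t - s) ≤ F (y + t • V) - F (y + s • V)) ∧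
      ContinuousOn (fun t : ℝ => F (y + t • V)) (Icc (-δ) δ) ∧
      F (y + (-δ) • V) < F x ∧ F x < F (y + δ • V) := by
  set m := fderiv ℝ F x V / 2 with hm
  have hmpos : 0 < m := half_pos hV
  have hcd : ContinuousAt (fun z => fderiv ℝ F z V) x :=
    ((hF.cda.fderiv_right (m := 0) (by simp)).continuousAt).clm_apply continuousAt_const
  have hev : ∀ᶠ z in 𝓝 x, P z ∧ SmAt F z ∧ m < fderiv ℝ F z V :=
    hP.and (hF.ev.and (hcd.eventually (lt_mem_nhds (half_lt_self hV))))
  obtain ⟨ρ, hρ, hball⟩ := Metric.eventually_nhds_iff_ball.1 hev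
  have hV0 : 0 < ‖V‖ := norm_pos_iff.2 fun h => by rw [h] at hV; simp at hV
  refine ⟨m, hmpos, ρ / 2 / (2 * ‖V‖), by positivity, fun δ hδ hδ₀ => ?_⟩
  have hδV : δ * ‖V‖ < ρ / 2 := by
    have := mul_le_mul_of_nonneg_right hδ₀ hV0.le
    have e : ρ / 2 / (2 * ‖V‖) * ‖V‖ = ρ / 4 := by field_simp; norm_num
    rw [e] at this; linarith
  have hin : ∀ y ∈ Metric.ball x (ρ / 2), ∀ t ∈ Icc (-δ) δ, y + t • V ∈ Metric.ball x ρ := by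
    intro y hy t ht
    rw [Metric.mem_ball, dist_eq_norm] at *
    have h1 : ‖t • V‖ ≤ δ * ‖V‖ := by
      rw [norm_smul]; exact mul_le_mul_of_nonneg_right (abs_le.2 ht) hV0.le
    calc ‖y + t • V - x‖ = ‖(y - x) + t • V‖ := by congr 1; abel
      _ ≤ ‖y - x‖ + ‖t • V‖ := norm_add_le _ _
      _ < ρ := by linarith
  have hdt : ∀ y ∈ Metric.ball x (ρ / 2), ∀ t ∈ Icc (-δ) δ,
      HasDerivAt (fun t : ℝ => F (y + t • V)) (fderiv ℝ F (y + t • V) V) t := by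
    intro y hy t ht
    have e2 : HasDerivAt (fun t : ℝ => y + t • V) V t := by
      simpa using ((hasDerivAt_id t).smul_const V).const_add y
    exact ((hball _ (hin y hy t ht)).2.1.diff.hasFDerivAt).comp_hasDerivAt t e2
  have hmono : ∀ y ∈ Metric.ball x (ρ / 2), ∀ s ∈ Icc (-δ) δ, ∀ t ∈ Icc (-δ) δ, s ≤ t →
      m * (t - s) ≤ F (y + t • V) - F (y + s • V) := by
    intro y hy
    refine (convex_Icc (-δ) δ).mul_sub_le_image_sub_of_le_deriv
      (fun t ht => (hdt y hy t ht).continuousAt.continuousWithinAt)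
      (fun t ht => (hdt y hy t (interior_subset ht)).differentiableAt.differentiableWithinAt)
      fun t ht => ?_
    rw [(hdt y hy t (interior_subset ht)).deriv]
    exact (hball _ (hin y hy t (interior_subset ht))).2.2.le
  have hx : x ∈ Metric.ball x (ρ / 2) := Metric.mem_ball_self (half_pos hρ)
  have hl : -δ ∈ Icc (-δ) δ := ⟨le_rfl, by linarith⟩
  have h0 : (0 : ℝ) ∈ Icc (-δ) δ := ⟨by linarith, hδ.le⟩
  have hr : δ ∈ Icc (-δ) δ := ⟨by linarith, le_rfl⟩
  have c : ∀ t ∈ Icc (-δ) δ, ContinuousAt (fun y => F (y + t • V)) x := fun t ht =>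
    ContinuousAt.comp (g := F) (hball _ (hin x hx t ht)).2.1.cont (by fun_prop)
  have m1 := hmono x hx _ hl _ h0 (by linarith)
  have m2 := hmono x hx _ h0 _ hr hδ.le
  have := mul_pos hmpos hδ
  rw [zero_smul, add_zero] at m1 m2
  filter_upwards [Metric.ball_mem_nhds x (half_pos hρ),
    (c _ hl).eventually (gt_mem_nhds (show F (x + (-δ) • V) < F x by linarith)),
    (c _ hr).eventually (lt_mem_nhds (show F x < F (x + δ • V) by linarith))] with y hy h1 h2
  exact ⟨fun t ht => (hball _ (hin y hy t ht)).1, hmono y hy,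
    fun t ht => (hdt y hy t ht).continuousAt.continuousWithinAt, h1, h2⟩

lemma exists_common_direction {f g : Eu n →L[ℝ] ℝ} (hf : f ≠ 0) (hg : g ≠ 0) :
    ∃ V, 0 < f V ∧ g V ≠ 0 := by
  have pos : ∀ V, f V ≠ 0 → g V ≠ 0 → ∃ V, 0 < f V ∧ g V ≠ 0 := by
    intro V h1 h2
    rcases h1.lt_or_gt with h | h
    · exact ⟨-V, by simpa using h, by simpa using h2⟩
    · exact ⟨V, h, h2⟩
  obtain ⟨a, ha⟩ : ∃ a, f a ≠ 0 := by by_contra! h; exact hf (ContinuousLinearMap.ext h)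
  obtain ⟨b, hb⟩ : ∃ b, g b ≠ 0 := by by_contra! h; exact hg (ContinuousLinearMap.ext h)
  by_cases h1 : g a = 0
  · by_cases h2 : f b = 0
    · exact pos (a + b) (by simpa [h2] using ha) (by simpa [h1] using hb)
    · exact pos b h2 hb
  · exact pos a ha h1

/-- `F` is a local defining function of `c` at `x` whose sign is `s`. -/
structure LocDef (c : Set (Eu n)) (s : Eu n → SignType) (x : Eu n) (F : Eu n → ℝ) : Prop where
  sm : SmAt F x
  reg : F x = 0 → fderiv ℝ F x ≠ 0
  zero : ∀ᶠ y in 𝓝 x, (y ∈ c ↔ F y = 0)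
  sign : ∀ᶠ y in 𝓝 x, s y = SignType.sign (F y)

/-- `s` is locally the sign of a defining function of `c`. -/
def Val (c : Set (Eu n)) (s : Eu n → SignType) (x : Eu n) : Prop := ∃ F, LocDef c s x F

lemma fderiv_neg_fun (F : Eu n → ℝ) (x : Eu n) : fderiv ℝ (fun y => -F y) x = -fderiv ℝ F x :=
  fderiv_neg

lemma Val.neg {c : Set (Eu n)} {s : Eu n → SignType} {x : Eu n} (h : Val c s x) :
    Val c (fun y => - s y) x := by
  obtain ⟨F, h1, h2, h3, h4⟩ := h
  refine ⟨fun y => - F y, ?_, fun h => ?_, ?_, ?_⟩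
  · filter_upwards [h1] with y hy using hy.neg
  · rw [fderiv_neg_fun]; simpa using h2 (by simpa using h)
  · simpa using h3
  · filter_upwards [h4] with y hy; rw [hy, Left.sign_neg]

lemma Val.congr {c : Set (Eu n)} {s s' : Eu n → SignType} {x : Eu n} (h : Val c s x)
    (hs : s =ᶠ[𝓝 x] s') : Val c s' x := by
  obtain ⟨F, h1, h2, h3, h4⟩ := h
  exact ⟨F, h1, h2, h3, by filter_upwards [hs, h4] with y a b; rw [← a, b]⟩

lemma sign_ev {F : Eu n → ℝ} {x : Eu n} (hF : ContinuousAt F x) (h : F x ≠ 0) :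
    ∀ᶠ y in 𝓝 x, SignType.sign (F y) = SignType.sign (F x) := by
  have := (ContinuousAt.comp (continuousAt_sign_of_ne_zero h) hF)
  exact this ((isOpen_discrete {SignType.sign (F x)}).mem_nhds rfl)

lemma Val.unique {c : Set (Eu n)} {s s' : Eu n → SignType} {x : Eu n} (h : Val c s x)
    (h' : Val c s' x) : (∀ᶠ y in 𝓝 x, s y = s' y) ∨ (∀ᶠ y in 𝓝 x, s y = - s' y) := by
  obtain ⟨F, h1, h2, h3, h4⟩ := h
  by_cases hx : F x = 0
  · have key : ∀ V : Eu n, 0 < fderiv ℝ F x V → ∀ (s' : Eu n → SignType) (F' : Eu n → ℝ),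
        LocDef c s' x F' → 0 < fderiv ℝ F' x V → ∀ᶠ y in 𝓝 x, s y = s' y := by
      intro V hV s' F' ⟨k1, k2, k3, k4⟩ hV'
      have hiff : ∀ᶠ z in 𝓝 x, (F z = 0 ↔ F' z = 0) := by
        filter_upwards [h3, k3] with z a b using a.symm.trans b
      obtain ⟨m, hm, δ, hδ, H⟩ := exists_slide h1 hV hiff
      obtain ⟨m', hm', δ', hδ', H'⟩ := exists_slide k1 hV' hiff
      have hδ'' : 0 < min δ δ' := lt_min hδ hδ'
      filter_upwards [H _ hδ'' (min_le_left _ _), H' _ hδ'' (min_le_right _ _), h4, k4] with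
        y ⟨a1, a2, a3, a4, a5⟩ ⟨b1, b2, b3, b4, b5⟩ e e'
      rw [e, e']
      set d := min δ δ'
      rw [hx] at a4 a5
      obtain ⟨t, ht, ht0⟩ := intermediate_value_Icc (by linarith) a3 ⟨a4.le, a5.le⟩
      have ht0' : F' (y + t • V) = 0 := (a1 t ht).1 ht0
      simp only at ht0
      have h0 : (0 : ℝ) ∈ Icc (-d) d := ⟨by linarith, hδ''.le⟩
      rcases lt_trichotomy t 0 with h | h | h
      · have p := a2 t ht 0 h0 h.le
        have p' := b2 t ht 0 h0 h.le
        have q := mul_pos hm (sub_pos.2 h)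
        have q' := mul_pos hm' (sub_pos.2 h)
        rw [zero_smul, add_zero] at p p'
        rw [_root_.sign_pos (by linarith), _root_.sign_pos (by linarith)]
      · subst h
        rw [zero_smul, add_zero] at ht0 ht0'
        rw [ht0, ht0']
      · have p := a2 0 h0 t ht h.le
        have p' := b2 0 h0 t ht h.le
        have q := mul_pos hm (sub_pos.2 h)
        have q' := mul_pos hm' (sub_pos.2 h)
        rw [zero_smul, add_zero] at p p'
        rw [_root_.sign_neg (by linarith), _root_.sign_neg (by linarith)]
    obtain ⟨F', hF'⟩ := h'
    have hx' : F' x = 0 := hF'.zero.self_of_nhds.1 (h3.self_of_nhds.2 hx)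
    obtain ⟨V, hV, hV'⟩ := exists_common_direction (h2 hx) (hF'.reg hx')
    rcases hV'.lt_or_gt with h | h
    · right
      refine key V hV (fun y => - s' y) (fun y => - F' y) ⟨?_, fun h => ?_, ?_, ?_⟩
        (by rw [fderiv_neg_fun]; simpa using h)
      · filter_upwards [hF'.sm] with y hy using hy.neg
      · rw [fderiv_neg_fun]; simpa using hF'.reg (by simpa using h)
      · simpa using hF'.zero
      · filter_upwards [hF'.sign] with y hy; rw [hy, Left.sign_neg]
    · exact Or.inl (key V hV s' F' hF' h)
  · obtain ⟨F', k1, k2, k3, k4⟩ := h'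
    have hx' : F' x ≠ 0 := fun h => hx (h3.self_of_nhds.1 (k3.self_of_nhds.2 h))
    rcases sign_eq_sign_or_eq_neg hx hx' with e | e
    · left
      filter_upwards [sign_ev h1.cont hx, sign_ev k1.cont hx', h4, k4] with y a b c d
      rw [c, d, a, b, e]
    · right
      filter_upwards [sign_ev h1.cont hx, sign_ev k1.cont hx', h4, k4] with y a b c d
      rw [c, d, a, b, e]

lemma Val.ne_zero_iff {c : Set (Eu n)} {s : Eu n → SignType} {x : Eu n} (h : Val c s x) :
    s x = 0 ↔ x ∈ c := by
  obtain ⟨F, -, -, h3, h4⟩ := h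
  rw [h4.self_of_nhds, _root_.sign_eq_zero_iff, h3.self_of_nhds]

/-- A section is not locally zero. -/
lemma Val.frequently {c : Set (Eu n)} {s : Eu n → SignType} {x : Eu n} (h : Val c s x) :
    ¬ ∀ᶠ y in 𝓝 x, s y = 0 := by
  obtain ⟨F, h1, h2, h3, h4⟩ := h
  intro h
  have h0 : F =ᶠ[𝓝 x] fun _ => 0 := by
    filter_upwards [h, h4] with y a b
    rw [a] at b; exact _root_.sign_eq_zero_iff.1 b.symm
  refine h2 h0.eq_of_nhds ?_
  rw [h0.fderiv_eq]; simp

lemma Val.eq_or_neg {c : Set (Eu n)} {s s' : Eu n → SignType} {S : Set (Eu n)} (hS : IsOpen S)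
    (hpc : IsPreconnected S) (h : ∀ x ∈ S, Val c s x) (h' : ∀ x ∈ S, Val c s' x) :
    (∀ x ∈ S, s x = s' x) ∨ (∀ x ∈ S, s x = - s' x) := by
  by_contra! hcon
  obtain ⟨⟨x, hx, hxne⟩, y, hy, hyne⟩ := hcon
  let A := {x | x ∈ S ∧ ∀ᶠ z in 𝓝 x, s z = s' z}
  let B := {x | x ∈ S ∧ ∀ᶠ z in 𝓝 x, s z = - s' z}
  have hA : IsOpen A := isOpen_iff_eventually.2 fun x ⟨h1, h2⟩ =>
    (hS.eventually_mem h1).and (eventually_eventually_nhds.2 h2)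
  have hB : IsOpen B := isOpen_iff_eventually.2 fun x ⟨h1, h2⟩ =>
    (hS.eventually_mem h1).and (eventually_eventually_nhds.2 h2)
  have hcov : ∀ x ∈ S, x ∈ A ∨ x ∈ B := fun x hx =>
    ((h x hx).unique (h' x hx)).imp (fun k => ⟨hx, k⟩) fun k => ⟨hx, k⟩
  have hyA : y ∈ A := (hcov y hy).resolve_right fun k => hyne k.2.self_of_nhds
  have hxB : x ∈ B := (hcov x hx).resolve_left fun k => hxne k.2.self_of_nhds
  obtain ⟨z, -, ⟨hzS, hzA⟩, -, hzB⟩ := hpc A B hA hB hcov ⟨y, hy, hyA⟩ ⟨x, hx, hxB⟩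
  refine (h z hzS).frequently ?_
  filter_upwards [hzA, hzB] with w a b
  rw [a] at b ⊢
  revert b; cases s' w <;> decide

lemma Val.ev {c : Set (Eu n)} {s : Eu n → SignType} {x : Eu n} (h : Val c s x) :
    ∀ᶠ y in 𝓝 x, Val c s y := by
  obtain ⟨F, h1, h2, h3, h4⟩ := h
  have hr : ∀ᶠ y in 𝓝 x, F y = 0 → fderiv ℝ F y ≠ 0 := by
    by_cases hx : F x = 0
    · have : ContinuousAt (fderiv ℝ F) x := (h1.cda.fderiv_right (m := 0) (by simp)).continuousAt
      filter_upwards [this.eventually_ne (h2 hx)] with y hy _ using hy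
    · filter_upwards [h1.cont.eventually_ne hx] with y hy h0 using absurd h0 hy
  filter_upwards [h1.ev, hr, eventually_eventually_nhds.2 h3, eventually_eventually_nhds.2 h4] with
    y a b c d using ⟨F, a, b, c, d⟩

lemma val_const {c : Set (Eu n)} (hc : IsClosed c) {x : Eu n} (hx : x ∉ c) :
    Val c (fun _ => 1) x := by
  refine ⟨fun _ => 1, smAt_const 1 x, fun h => absurd h one_ne_zero, ?_, ?_⟩
  · filter_upwards [hc.isOpen_compl.mem_nhds hx] with y hy
    simpa using hy
  · simp

lemma exists_val {c : Set (Eu n)} (hc : IsClosed c) (h : IsSmoothHypersurface c) (x : Eu n) :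
    ∃ s, Val c s x := by
  by_cases hx : x ∈ c
  · obtain ⟨U, F, hU, hxU, hF, hd, hz⟩ := h x hx
    refine ⟨fun y => SignType.sign (F y), F, smAt_of_contDiffOn hU hF hxU, fun _ => hd x hxU, ?_,
      by simp⟩
    filter_upwards [hU.mem_nhds hxU] with y hy
    have := Set.ext_iff.1 hz y
    simpa [hy] using this
  · exact ⟨_, val_const hc hx⟩

lemma exists_uniform_val {c : Set (Eu n)} (hc : IsCompact c) (h : IsSmoothHypersurface c) :
    ∃ δ > 0, ∀ x, ∃ s, ∀ y ∈ Metric.ball x δ, Val c s y := by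
  obtain ⟨δ, hδ, H⟩ := lebesgue_number_lemma_of_metric (hc.cthickening (r := 1))
    (c := fun s => {x | Val c s x}) (fun s => isOpen_iff_eventually.2 fun x hx => Val.ev hx)
    (fun x _ => by
      obtain ⟨s, hs⟩ := exists_val hc.isClosed h x
      exact mem_iUnion.2 ⟨s, hs⟩)
  refine ⟨min δ 1, lt_min hδ one_pos, fun x => ?_⟩
  by_cases hx : x ∈ Metric.cthickening 1 c
  · obtain ⟨s, hs⟩ := H x hx
    exact ⟨s, fun y hy => hs (Metric.ball_subset_ball (min_le_left _ _) hy)⟩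
  · refine ⟨fun _ => 1, fun y hy => val_const hc.isClosed fun hyc => hx ?_⟩
    refine Metric.mem_cthickening_of_dist_le x y 1 c hyc ?_
    rw [dist_comm]
    exact (Metric.mem_ball.1 hy).le.trans (min_le_right _ _)

lemma Val.agree {c : Set (Eu n)} {s s' : Eu n → SignType} {S : Set (Eu n)} (hS : IsOpen S)
    (hpc : IsPreconnected S) (h : ∀ x ∈ S, Val c s x) (h' : ∀ x ∈ S, Val c s' x) {p : Eu n}
    (hp : p ∈ S) (he : ∀ᶠ y in 𝓝 p, s y = s' y) : ∀ x ∈ S, s x = s' x := by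
  refine (Val.eq_or_neg hS hpc h h').resolve_right fun hn => (h p hp).frequently ?_
  filter_upwards [he, hS.mem_nhds hp] with y a b
  have := hn y b
  rw [a] at this ⊢
  revert this; cases s' y <;> decide

lemma exists_val_ball {c : Set (Eu n)} {δ : ℝ} (hδ : 0 < δ)
    (H : ∀ x, ∃ s, ∀ y ∈ Metric.ball x δ, Val c s y) (k : ℕ) :
    ∃ s, ∀ x ∈ Metric.ball (0 : Eu n) (δ + k * (δ / 4)), Val c s x := by
  induction k with
  | zero => simpa using H 0
  | succ k ih =>
    obtain ⟨s, hs⟩ := ih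
    set ρ := δ + k * (δ / 4) with hρ
    have hρ0 : 0 < ρ := by positivity
    have hρ' : δ + (k + 1 : ℕ) * (δ / 4) = ρ + δ / 4 := by rw [hρ]; push_cast; ring
    rw [hρ']
    have hρ1 : 0 < ρ + δ / 4 := by positivity
    have hloc : ∀ y, y ∈ Metric.ball (0 : Eu n) ρ → ∃ s', (∀ z ∈ Metric.ball y δ, Val c s' z) ∧
        ∀ z ∈ Metric.ball y δ ∩ Metric.ball 0 ρ, s' z = s z := by
      intro y hy
      obtain ⟨s', hs'⟩ := H y
      rcases Val.eq_or_neg (Metric.isOpen_ball.inter Metric.isOpen_ball)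
        ((convex_ball y δ).inter (convex_ball 0 ρ)).isPreconnected (fun z hz => hs' z hz.1)
        (fun z hz => hs z hz.2) with h | h
      · exact ⟨s', hs', h⟩
      · exact ⟨fun y => - s' y, fun z hz => (hs' z hz).neg, fun z hz => by
          show - s' z = s z
          rw [h z hz, neg_neg]⟩
    classical
    let S : Eu n → Eu n → SignType := fun y =>
      if hy : y ∈ Metric.ball (0 : Eu n) ρ then (hloc y hy).choose else fun _ => 0
    have hS : ∀ y ∈ Metric.ball (0 : Eu n) ρ, (∀ z ∈ Metric.ball y δ, Val c (S y) z) ∧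
        ∀ z ∈ Metric.ball y δ ∩ Metric.ball 0 ρ, S y z = s z := fun y hy => by
      simp only [S, dif_pos hy]; exact (hloc y hy).choose_spec
    let q : Eu n → Eu n := fun y => (ρ / (ρ + δ / 4)) • y
    have hq1 : ∀ y ∈ Metric.ball (0 : Eu n) (ρ + δ / 4), q y ∈ Metric.ball (0 : Eu n) ρ := by
      intro y hy
      rw [mem_ball_zero_iff] at *
      rw [norm_smul, Real.norm_of_nonneg (by positivity), div_mul_eq_mul_div, div_lt_iff₀ hρ1]
      exact mul_lt_mul_of_pos_left hy hρ0
    have hq2 : ∀ y ∈ Metric.ball (0 : Eu n) (ρ + δ / 4), dist y (q y) < δ / 4 := by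
      intro y hy
      rw [mem_ball_zero_iff] at hy
      have e : y - q y = (δ / 4 / (ρ + δ / 4)) • y := by
        have : y - q y = (1 - ρ / (ρ + δ / 4)) • y := by rw [sub_smul, one_smul]
        rw [this]; congr 1; field_simp; ring
      rw [dist_eq_norm, e, norm_smul, Real.norm_of_nonneg (by positivity), div_mul_eq_mul_div,
        div_lt_iff₀ hρ1]
      exact mul_lt_mul_of_pos_left hy (by positivity)
    refine ⟨fun y => S (q y) y, fun y hy => ?_⟩
    have hyq : y ∈ Metric.ball (q y) δ := (hq2 y hy).trans (by linarith)
    refine ((hS _ (hq1 y hy)).1 y hyq).congr ?_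
    have hqc : Continuous q := continuous_const_smul _
    filter_upwards [Metric.isOpen_ball.mem_nhds hy, Metric.isOpen_ball.mem_nhds hyq,
      hqc.continuousAt.eventually (Metric.ball_mem_nhds (q y) hδ)] with z hz hzy hqz
    have hzq : z ∈ Metric.ball (q z) δ := (hq2 z hz).trans (by linarith)
    refine Val.agree (S := Metric.ball (q y) δ ∩ Metric.ball (q z) δ) (p := q y)
      (Metric.isOpen_ball.inter Metric.isOpen_ball)
      ((convex_ball _ _).inter (convex_ball _ _)).isPreconnected
      (fun w hw => (hS _ (hq1 y hy)).1 w hw.1) (fun w hw => (hS _ (hq1 z hz)).1 w hw.2)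
      ⟨Metric.mem_ball_self hδ, Metric.mem_ball_comm.1 hqz⟩ ?_ z ⟨hzy, hzq⟩
    filter_upwards [Metric.ball_mem_nhds (q y) hδ, Metric.isOpen_ball.mem_nhds (hq1 y hy),
      Metric.isOpen_ball.mem_nhds (Metric.mem_ball_comm.1 hqz)] with w h1 h2 h3
    rw [(hS _ (hq1 y hy)).2 w ⟨h1, h2⟩, (hS _ (hq1 z hz)).2 w ⟨h3, h2⟩]

lemma isPreconnected_annulus (hn : 2 ≤ n) (a b : ℝ) (ha : 0 < a) :
    IsPreconnected {x : Eu n | a < ‖x‖ ∧ ‖x‖ < b} := by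
  have hr : 1 < Module.rank ℝ (Eu n) := by
    rw [← Module.finrank_eq_rank, finrank_euclideanSpace_fin]; exact_mod_cast hn
  have h := ((isPreconnected_sphere hr (0 : Eu n) 1).prod (isPreconnected_Ioo (a := a) (b := b))).image
    (fun p : Eu n × ℝ => p.2 • p.1) (by fun_prop)
  convert h using 1
  ext x
  simp only [mem_image, mem_prod, mem_sphere_zero_iff_norm, mem_Ioo, Prod.exists, mem_ofPred_eq]
  constructor
  · rintro ⟨h1, h2⟩
    have hx : ‖x‖ ≠ 0 := (ha.trans h1).ne'
    exact ⟨‖x‖⁻¹ • x, ‖x‖, ⟨by rw [norm_smul, norm_inv, norm_norm, inv_mul_cancel₀ hx], h1, h2⟩,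
      by rw [smul_smul, mul_inv_cancel₀ hx, one_smul]⟩
  · rintro ⟨v, r, ⟨h1, h2, h3⟩, rfl⟩
    rw [norm_smul, h1, mul_one, Real.norm_of_nonneg (ha.trans h2).le]
    exact ⟨h2, h3⟩

lemma exists_global_sign (hn : 2 ≤ n) {c : Set (Eu n)} (hc : IsCompact c)
    (h : IsSmoothHypersurface c) : ∃ σ, (∀ x, Val c σ x) ∧ ∃ R, ∀ x, R ≤ ‖x‖ → σ x = -1 := by
  obtain ⟨δ, hδ, H⟩ := exists_uniform_val hc h
  obtain ⟨R, hR, hcR⟩ := hc.isBounded.subset_closedBall_lt 0 0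
  obtain ⟨k, hk⟩ := exists_nat_gt ((R + 2) / (δ / 4))
  rw [div_lt_iff₀ (by positivity)] at hk
  obtain ⟨s, hs⟩ := exists_val_ball hδ H k
  replace hs : ∀ x : Eu n, ‖x‖ < R + 2 → Val c s x := fun x hx =>
    hs x (by rw [mem_ball_zero_iff]; linarith)
  have hout : ∀ x : Eu n, R < ‖x‖ → x ∉ c := fun x hx hxc => by
    have := hcR hxc; rw [mem_closedBall_zero_iff] at this; linarith
  obtain ⟨s', hs', hs1⟩ : ∃ s', (∀ x : Eu n, ‖x‖ < R + 2 → Val c s' x) ∧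
      ∀ x : Eu n, R < ‖x‖ → ‖x‖ < R + 2 → s' x = -1 := by
    have ho : IsOpen {x : Eu n | R < ‖x‖ ∧ ‖x‖ < R + 2} :=
      (isOpen_lt continuous_const continuous_norm).inter (isOpen_lt continuous_norm continuous_const)
    rcases Val.eq_or_neg ho (isPreconnected_annulus hn R (R + 2) hR) (fun x hx => hs x hx.2)
      (fun x hx => (val_const hc.isClosed (hout x hx.1))) with e | e
    · exact ⟨fun y => - s y, fun x hx => (hs x hx).neg, fun x h1 h2 => by
        show - s x = -1
        rw [e x ⟨h1, h2⟩]⟩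
    · exact ⟨s, hs, fun x h1 h2 => e x ⟨h1, h2⟩⟩
  refine ⟨fun x => if ‖x‖ < R + 1 then s' x else -1, fun x => ?_, R + 1, fun x hx =>
    if_neg (not_lt.2 hx)⟩
  rcases lt_or_ge ‖x‖ (R + 1) with hx | hx
  · refine (hs' x (by linarith)).congr ?_
    filter_upwards [continuous_norm.continuousAt.eventually (gt_mem_nhds hx)] with y hy
    rw [if_pos hy]
  · refine (val_const hc.isClosed (hout x (by linarith))).neg.congr ?_
    filter_upwards [continuous_norm.continuousAt.eventually
      (lt_mem_nhds (show R < ‖x‖ by linarith))] with y hy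
    split_ifs with h1
    · rw [hs1 y hy (by linarith)]
    · rfl

/-- A smooth function with regular zero set `c`, negative near infinity, which grows at least as
fast as the distance to `c`. -/
structure DefFn (c : Set (Eu n)) (g : Eu n → ℝ) : Prop where
  sm : ContDiff ℝ ∞ g
  zero : ∀ x, g x = 0 ↔ x ∈ c
  reg : ∀ x, g x = 0 → fderiv ℝ g x ≠ 0
  dist : ∀ x, Metric.infDist x c ≤ |g x|
  neg : ∃ R, ∀ x, R ≤ ‖x‖ → g x < 0

lemma exists_pos_dir {f : Eu n →L[ℝ] ℝ} (hf : f ≠ 0) : ∃ V, 0 < f V := by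
  obtain ⟨V, hV, _⟩ := exists_common_direction hf hf
  exact ⟨V, hV⟩

lemma LocDef.infDist_le {c : Set (Eu n)} {s : Eu n → SignType} {x : Eu n} {F : Eu n → ℝ}
    (h : LocDef c s x F) (hx : F x = 0) :
    ∃ K > 0, ∀ᶠ y in 𝓝 x, Metric.infDist y c ≤ K * |F y| := by
  obtain ⟨V, hV⟩ := exists_pos_dir (h.reg hx)
  have hV0 : V ≠ 0 := fun h0 => by simp [h0] at hV
  obtain ⟨m, hm, δ, hδ, H⟩ := exists_slide h.sm hV h.zero
  refine ⟨‖V‖ / m, div_pos (norm_pos_iff.2 hV0) hm, ?_⟩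
  filter_upwards [H δ hδ le_rfl] with y ⟨a1, a2, a3, a4, a5⟩
  rw [hx] at a4 a5
  obtain ⟨t, ht, ht0⟩ := intermediate_value_Icc (by linarith) a3 ⟨a4.le, a5.le⟩
  simp only at ht0
  have hc := (a1 t ht).2 ht0
  have h0 : (0 : ℝ) ∈ Icc (-δ) δ := ⟨by linarith, hδ.le⟩
  have h1 : Metric.infDist y c ≤ |t| * ‖V‖ := by
    refine (Metric.infDist_le_dist_of_mem hc).trans ?_
    rw [dist_eq_norm, sub_add_cancel_left, norm_neg, norm_smul, Real.norm_eq_abs]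
  have h2 : m * |t| ≤ |F y| := by
    rcases le_total t 0 with h | h
    · have := a2 t ht 0 h0 h
      rw [zero_smul, add_zero, ht0] at this
      rw [abs_of_nonpos h]; exact le_trans (by linarith) (le_abs_self _)
    · have := a2 0 h0 t ht h
      rw [zero_smul, add_zero, ht0] at this
      rw [abs_of_nonneg h]; exact le_trans (by linarith) (neg_le_abs _)
  refine h1.trans ?_
  rw [div_mul_eq_mul_div, le_div_iff₀ hm]
  nlinarith [norm_nonneg V]

lemma exists_defFn (hn : 2 ≤ n) {c : Set (Eu n)} (hc : IsCompact c) (hne : c.Nonempty)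
    (h : IsSmoothHypersurface c) : ∃ g, DefFn c g := by
  obtain ⟨σ, hσ, R, hR⟩ := exists_global_sign hn hc h
  have hσ0 : ∀ x, σ x = 0 ↔ x ∈ c := fun x => (hσ x).ne_zero_iff
  let t : Eu n → Set ℝ := fun y => {v | (σ y = 0 → v = 0) ∧ (σ y = 1 → Metric.infDist y c ≤ v) ∧
    (σ y = -1 → v ≤ - Metric.infDist y c)}
  have ht : ∀ x, Convex ℝ (t x) := by
    intro x u ⟨u1, u2, u3⟩ v ⟨v1, v2, v3⟩ a b ha hb hab
    refine ⟨fun h => by simp [u1 h, v1 h], fun h => ?_, fun h => ?_⟩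
    · have e : Metric.infDist x c = a * Metric.infDist x c + b * Metric.infDist x c := by
        rw [← add_mul, hab, one_mul]
      rw [e]; exact add_le_add (mul_le_mul_of_nonneg_left (u2 h) ha)
        (mul_le_mul_of_nonneg_left (v2 h) hb)
    · have e : -Metric.infDist x c = a * -Metric.infDist x c + b * -Metric.infDist x c := by
        rw [← add_mul, hab, one_mul]
      rw [e]; exact add_le_add (mul_le_mul_of_nonneg_left (u3 h) ha)
        (mul_le_mul_of_nonneg_left (v3 h) hb)
  obtain ⟨g, hg⟩ := exists_contMDiffMap_forall_mem_convex_of_local (n := ⊤)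
    (modelWithCornersSelf ℝ (Eu n)) ht (by
    intro x
    by_cases hx : x ∈ c
    · obtain ⟨F, hF⟩ := hσ x
      have hFx := hF.zero.self_of_nhds.1 hx
      obtain ⟨K, hK, hd⟩ := hF.infDist_le hFx
      obtain ⟨U, hU, hUo, hxU⟩ := eventually_nhds_iff.1 (hd.and (hF.sign.and hF.sm))
      refine ⟨U, hUo.mem_nhds hxU, fun y => K * F y, ?_, fun y hy => ?_⟩
      · rw [contMDiffOn_iff_contDiffOn]
        exact contDiffOn_const.mul fun y hy => (hU y hy).2.2.contDiffWithinAt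
      · obtain ⟨h1, h2, -⟩ := hU y hy
        refine ⟨fun h => ?_, fun h => ?_, fun h => ?_⟩
        · rw [h2, _root_.sign_eq_zero_iff] at h; simp [h]
        · rw [h2, _root_.sign_eq_one_iff] at h; rwa [abs_of_pos h] at h1
        · rw [h2, _root_.sign_eq_neg_one_iff] at h; rw [abs_of_neg h] at h1; linarith
    · obtain ⟨F, hF⟩ := hσ x
      have hFx : F x ≠ 0 := fun h => hx (hF.zero.self_of_nhds.2 h)
      have h1 : ∀ᶠ y in 𝓝 x, σ y = σ x := by
        filter_upwards [hF.sign, sign_ev hF.sm.cont hFx] with y a b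
        rw [a, b, hF.sign.self_of_nhds]
      have h2 : ∀ᶠ y in 𝓝 x, Metric.infDist y c < Metric.infDist x c + 1 :=
        (Metric.continuous_infDist_pt c).continuousAt.eventually (gt_mem_nhds (by linarith))
      have h3 : σ x ≠ 0 := fun h => hx ((hσ0 x).1 h)
      refine ⟨_, h1.and h2, fun _ => if σ x = 1 then Metric.infDist x c + 1 else
        - (Metric.infDist x c + 1), contMDiffOn_const, fun y ⟨a, b⟩ => ?_⟩
      refine ⟨fun h => absurd (a ▸ h) h3, fun h => ?_, fun h => ?_⟩
      · rw [if_pos (a ▸ h)]; exact b.le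
      · rw [if_neg (by rw [← a, h]; decide)]; linarith)
  have hgs : ContDiff ℝ ∞ g := contMDiff_iff_contDiff.1 g.contMDiff
  have hpos : ∀ x, x ∉ c → 0 < Metric.infDist x c := fun x hx =>
    (hc.isClosed.notMem_iff_infDist_pos hne).1 hx
  have hdist : ∀ x, Metric.infDist x c ≤ |g x| := by
    intro x
    obtain ⟨h1, h2, h3⟩ := hg x
    rcases hs : σ x with _ | _ | _
    · rw [Metric.infDist_zero_of_mem ((hσ0 x).1 hs)]; exact abs_nonneg _
    · exact (by linarith [h3 hs] : _ ≤ - g x).trans (neg_le_abs _)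
    · exact (h2 hs).trans (le_abs_self _)
  have hz : ∀ x, g x = 0 ↔ x ∈ c := by
    refine fun x => ⟨fun h0 => by_contra fun hx => ?_, fun hx => (hg x).1 ((hσ0 x).2 hx)⟩
    have := hdist x
    rw [h0, abs_zero] at this
    exact absurd (hpos x hx) (not_lt.2 this)
  refine ⟨g, hgs, hz, fun x hx0 h0 => ?_, hdist, max R ((hc.isBounded.subset_closedBall_lt 0 0).choose + 1), fun x hx => ?_⟩
  · have hx := (hz x).1 hx0
    obtain ⟨F, hF⟩ := hσ x
    have hFx := hF.zero.self_of_nhds.1 hx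
    refine hF.reg hFx (HasFDerivAt.fderiv (f' := 0) ?_)
    have hg' : HasFDerivAt g (0 : Eu n →L[ℝ] ℝ) x := by
      rw [← h0]; exact (hgs.differentiable (by simp) x).hasFDerivAt
    rw [hasFDerivAt_iff_isLittleO] at hg' ⊢
    obtain ⟨K, S, hS, hK⟩ := (hF.sm.cda.of_le (by simp : (1 : WithTop ℕ∞) ≤ ∞)).exists_lipschitzOnWith
    have hS' := hS
    obtain ⟨ε, hε, hεS⟩ := Metric.mem_nhds_iff.1 (inter_mem hS hF.zero)
    refine Asymptotics.IsBigO.trans_isLittleO (Asymptotics.IsBigO.of_bound K ?_) hg'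
    filter_upwards [Metric.ball_mem_nhds x (half_pos hε)] with y hy
    simp only [hx0, hFx, zero_apply, sub_zero, Real.norm_eq_abs]
    obtain ⟨p, hp, hyp⟩ := hc.exists_infDist_eq_dist hne y
    have hyx : dist y p ≤ dist y x := hyp ▸ Metric.infDist_le_dist_of_mem hx
    rw [Metric.mem_ball] at hy
    have hpS := hεS (show p ∈ Metric.ball x ε from by
      rw [Metric.mem_ball]
      linarith [dist_triangle_left p x y])
    have hyS := hεS (show y ∈ Metric.ball x ε from by rw [Metric.mem_ball]; linarith)
    have := hK.dist_le_mul y hyS.1 p hpS.1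
    rw [hpS.2.1 hp, Real.dist_eq, sub_zero, ← hyp] at this
    exact this.trans (mul_le_mul_of_nonneg_left (hdist y) K.2)
  · have hspec := (hc.isBounded.subset_closedBall_lt 0 0).choose_spec
    have hxc : x ∉ c := fun hxc => by
      have h1 := hspec.2 hxc
      rw [mem_closedBall_zero_iff] at h1
      linarith [le_max_right R ((hc.isBounded.subset_closedBall_lt 0 0).choose + 1)]
    linarith [(hg x).2.2 (hR x ((le_max_left _ _).trans hx)), hpos x hxc]

lemma isPreconnected_pos {g : Eu n → ℝ} (hg : ContDiff ℝ ∞ g)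
    (hreg : ∀ x, g x = 0 → fderiv ℝ g x ≠ 0) (hc : IsPreconnected {x | g x = 0}) :
    IsPreconnected {x | 0 < g x} := by
  have hgc := hg.continuous
  have hDo : IsOpen {x | 0 < g x} := isOpen_lt continuous_const hgc
  have hloc : ∀ x, g x = 0 → x ∈ closure {x | 0 < g x} ∧ ∃ p, ∀ᶠ y in 𝓝 x, 0 < g y →
      ∃ S, IsPreconnected S ∧ S ⊆ {x | 0 < g x} ∧ p ∈ S ∧ y ∈ S := by
    intro x hx
    obtain ⟨V, hV⟩ := exists_pos_dir (hreg x hx)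
    obtain ⟨m, hm, δ, hδ, H⟩ := exists_slide (smAt_of_contDiff hg x) hV (P := fun _ => True) (by simp)
    refine ⟨?_, x + δ • V, ?_⟩
    · have hlim : Tendsto (fun t : ℝ => x + t • V) (𝓝[>] 0) (𝓝 x) := by
        have : Continuous fun t : ℝ => x + t • V := by fun_prop
        simpa using (this.tendsto 0).mono_left nhdsWithin_le_nhds
      refine mem_closure_of_tendsto hlim ?_
      filter_upwards [Ioc_mem_nhdsGT hδ] with t ht
      have := (H δ hδ le_rfl).self_of_nhds.2.1 0 ⟨by linarith, hδ.le⟩ t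
        ⟨by linarith [ht.1], ht.2⟩ ht.1.le
      rw [zero_smul, add_zero, hx] at this
      show 0 < g (x + t • V)
      nlinarith [ht.1, mul_pos hm ht.1]
    · have hp : x + δ • V ∈ {x | 0 < g x} := by
        have := (H δ hδ le_rfl).self_of_nhds.2.2.2.2
        rwa [hx] at this
      obtain ⟨ε, hε, hball⟩ := Metric.isOpen_iff.1 hDo _ hp
      have hcon : ContinuousAt (fun y : Eu n => y + δ • V) x := by fun_prop
      filter_upwards [H δ hδ le_rfl, hcon.eventually (Metric.ball_mem_nhds _ hε)] with y hy hyb hy0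
      refine ⟨(fun t : ℝ => y + t • V) '' Icc 0 δ ∪ Metric.ball (x + δ • V) ε, ?_, ?_,
        Or.inr (Metric.mem_ball_self hε), Or.inl ⟨0, ⟨le_rfl, hδ.le⟩, by simp⟩⟩
      · exact IsPreconnected.union (y + δ • V) ⟨δ, ⟨hδ.le, le_rfl⟩, rfl⟩ hyb
          (isPreconnected_Icc.image _ (by fun_prop)) (convex_ball _ _).isPreconnected
      · refine union_subset ?_ hball
        rintro _ ⟨t, ht, rfl⟩
        have := hy.2.1 0 ⟨by linarith, hδ.le⟩ t ⟨by linarith [ht.1], ht.2⟩ ht.1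
        rw [zero_smul, add_zero] at this
        show 0 < g (y + t • V)
        nlinarith [ht.1, mul_nonneg hm.le ht.1]
  rw [isPreconnected_iff_subset_of_disjoint]
  intro u v hu hv huv hdisj
  set D := {x | 0 < g x} with hD
  have key : ∀ u v : Set (Eu n), IsOpen u → IsOpen v → D ⊆ u ∪ v → D ∩ (u ∩ v) = ∅ →
      {x | g x = 0} ∩ closure (D ∩ v) = ∅ → D ⊆ u ∨ D ⊆ v := by
    intro u v hu hv huv hdisj hemp
    have hcl : IsClosed (D ∩ v) := by
      refine isClosed_of_closure_subset fun x hx => ?_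
      have hx0 : 0 ≤ g x := closure_minimal (fun y hy => (show 0 < g y from hy.1).le)
        (isClosed_le continuous_const hgc) hx
      have hxD : x ∈ D := lt_of_le_of_ne hx0 fun h => by
        have : x ∈ {x | g x = 0} ∩ closure (D ∩ v) := ⟨h.symm, hx⟩
        rw [hemp] at this; exact this
      refine ⟨hxD, (huv hxD).resolve_left fun hxu => ?_⟩
      obtain ⟨y, hy, hy'⟩ := mem_closure_iff.1 hx u hu hxu
      have : y ∈ D ∩ (u ∩ v) := ⟨hy'.1, hy, hy'.2⟩
      rw [hdisj] at this; exact this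
    rcases isClopen_iff.1 ⟨hcl, hDo.inter hv⟩ with h | h
    · left
      intro x hx
      refine (huv hx).resolve_right fun hxv => ?_
      have : x ∈ D ∩ v := ⟨hx, hxv⟩
      rw [h] at this; exact this
    · right
      intro x _
      exact (h.symm ▸ mem_univ x : x ∈ D ∩ v).2
  have hcov : {x | g x = 0} ⊆ closure (D ∩ u) ∪ closure (D ∩ v) := by
    intro x hx
    rw [← closure_union, ← inter_union_distrib_left, inter_eq_left.2 huv]
    exact (hloc x hx).1
  have hsep : {x | g x = 0} ∩ (closure (D ∩ u) ∩ closure (D ∩ v)) = ∅ := by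
    rw [eq_empty_iff_forall_notMem]
    rintro x ⟨hx, hxu, hxv⟩
    obtain ⟨-, p, hp⟩ := hloc x hx
    obtain ⟨N, hN, hNo, hxN⟩ := eventually_nhds_iff.1 hp
    obtain ⟨y, hyN, hyD, hyu⟩ := mem_closure_iff.1 hxu N hNo hxN
    obtain ⟨z, hzN, hzD, hzv⟩ := mem_closure_iff.1 hxv N hNo hxN
    obtain ⟨S, hS, hSD, hpS, hyS⟩ := hN y hyN hyD
    obtain ⟨T, hT, hTD, hpT, hzT⟩ := hN z hzN hzD
    have hST := IsPreconnected.union p hpS hpT hS hT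
    have hSTD := union_subset hSD hTD
    obtain ⟨w, hw, hw'⟩ := hST u v hu hv (hSTD.trans huv) ⟨y, Or.inl hyS, hyu⟩ ⟨z, Or.inr hzT, hzv⟩
    have : w ∈ D ∩ (u ∩ v) := ⟨hSTD hw, hw'⟩
    rw [hdisj] at this; exact this
  rcases (isPreconnected_iff_subset_of_disjoint_closed.1 hc) _ _ isClosed_closure isClosed_closure
    hcov hsep with h | h
  · refine key u v hu hv huv hdisj ?_
    rw [eq_empty_iff_forall_notMem] at hsep ⊢
    exact fun x hx => hsep x ⟨hx.1, h hx.1, hx.2⟩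
  · refine (key v u hv hu (by rwa [union_comm]) (by rwa [inter_comm v u]) ?_).symm
    rw [eq_empty_iff_forall_notMem] at hsep ⊢
    exact fun x hx => hsep x ⟨hx.1, hx.2, h hx.1⟩

namespace DefFn
variable {c : Set (Eu n)} {g : Eu n → ℝ}

lemma zeroSet (hg : DefFn c g) : {x | g x = 0} = c := by
  ext x; exact hg.zero x

lemma isPreconnected_pos (hg : DefFn c g) (hc : IsConnected c) : IsPreconnected {x | 0 < g x} :=
  Mono.isPreconnected_pos hg.sm hg.reg (by rw [hg.zeroSet]; exact hc.isPreconnected)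

lemma isPreconnected_neg (hg : DefFn c g) (hc : IsConnected c) : IsPreconnected {x | g x < 0} := by
  have := Mono.isPreconnected_pos (g := fun x => - g x) hg.sm.neg (fun x hx => by
    rw [fderiv_neg_fun]; simpa using hg.reg x (by simpa using hx))
    (by simpa [hg.zeroSet] using hc.isPreconnected)
  simpa using this

lemma exists_pos (hg : DefFn c g) (hc : c.Nonempty) : ∃ x, 0 < g x := by
  obtain ⟨x, hx⟩ := hc
  have hx0 := (hg.zero x).2 hx
  obtain ⟨V, hV⟩ := exists_pos_dir (hg.reg x hx0)
  obtain ⟨m, hm, δ, hδ, H⟩ := exists_slide (smAt_of_contDiff hg.sm x) hV (P := fun _ => True)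
    (by simp)
  exact ⟨_, hx0 ▸ (H δ hδ le_rfl).self_of_nhds.2.2.2.2⟩

lemma exists_neg (i₀ : Fin n) (hg : DefFn c g) : ∃ x, g x < 0 := by
  obtain ⟨R, hR⟩ := hg.neg
  refine ⟨|R| • bv i₀, hR _ ?_⟩
  rw [norm_smul, Real.norm_eq_abs, abs_abs]
  simp [bv, le_abs_self]

lemma exists_collar (hg : DefFn c g) (hc : IsCompact c) (hne : c.Nonempty) {N : Set (Eu n)}
    (hN : IsOpen N) (hcN : c ⊆ N) : ∃ t > 0, ∀ x, |g x| ≤ t → x ∈ N := by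
  obtain ⟨δ, hδ, h⟩ := hc.exists_cthickening_subset_open hN hcN
  refine ⟨δ, hδ, fun x hx => h ?_⟩
  obtain ⟨p, hp, he⟩ := hc.exists_infDist_eq_dist hne x
  exact Metric.mem_cthickening_of_dist_le x p δ c hp (he ▸ (hg.dist x).trans hx)

lemma isPreconnected_lt (i₀ : Fin n) (hg : DefFn c g) (hc : IsCompact c) (hcc : IsConnected c) :
    ∃ s₁ > 0, ∀ s, 0 ≤ s → s ≤ s₁ → IsPreconnected {x | g x < s} := by
  have hN : c ⊆ interior {y | ∃ S, IsPreconnected S ∧ y ∈ S ∧ (∃ z ∈ S, g z < 0) ∧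
      ∀ z ∈ S, g z ≤ g y} := by
    intro x hx
    have hx0 := (hg.zero x).2 hx
    obtain ⟨V, hV⟩ := exists_pos_dir (hg.reg x hx0)
    obtain ⟨m, hm, δ, hδ, H⟩ := exists_slide (smAt_of_contDiff hg.sm x) hV (P := fun _ => True)
      (by simp)
    rw [mem_interior_iff_mem_nhds]
    filter_upwards [H δ hδ le_rfl] with y hy
    have h0 : (0 : ℝ) ∈ Icc (-δ) 0 := ⟨by linarith, le_rfl⟩
    refine ⟨(fun t : ℝ => y + t • V) '' Icc (-δ) 0, isPreconnected_Icc.image _ (by fun_prop),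
      ⟨0, h0, by simp⟩, ⟨_, ⟨-δ, ⟨le_rfl, h0.1⟩, rfl⟩, hx0 ▸ hy.2.2.2.1⟩, ?_⟩
    rintro _ ⟨t, ht, rfl⟩
    have := hy.2.1 t ⟨ht.1, by linarith [ht.2]⟩ 0 ⟨h0.1, hδ.le⟩ ht.2
    rw [zero_smul, add_zero] at this
    show g (y + t • V) ≤ g y
    nlinarith [ht.2, mul_nonneg hm.le (sub_nonneg.2 ht.2)]
  obtain ⟨s₁, hs₁, h⟩ := hg.exists_collar hc hcc.nonempty isOpen_interior hN
  obtain ⟨p, hp⟩ := hg.exists_neg i₀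
  refine ⟨s₁, hs₁, fun s hs0 hs => isPreconnected_of_forall p fun y hy => ?_⟩
  have hy' : g y < s := hy
  rcases lt_or_ge (g y) 0 with hneg | hnn
  · exact ⟨{x | g x < 0}, fun x hx => lt_of_lt_of_le hx hs0, hp, hneg, hg.isPreconnected_neg hcc⟩
  · obtain ⟨S, hS, hyS, ⟨z, hzS, hz⟩, hSg⟩ := interior_subset (h y (by
      rw [abs_of_nonneg hnn]; linarith))
    exact ⟨{x | g x < 0} ∪ S, union_subset (fun x hx => lt_of_lt_of_le hx hs0)
      (fun x hx => (hSg x hx).trans_lt hy'), Or.inl hp, Or.inr hyS,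
      IsPreconnected.union z hz hzS (hg.isPreconnected_neg hcc) hS⟩

end DefFn

section

/-- The half-open unit cube. -/
def cube (n : ℕ) : Set (Eu n) := {x | ∀ i, x i ∈ Ioc (0 : ℝ) 1}

/-- The open unit cube. -/
def ocube (n : ℕ) : Set (Eu n) := {x | ∀ i, x i ∈ Ioo (0 : ℝ) 1}

/-- Lebesgue measure on the unit cube. -/
def cm (n : ℕ) : Measure (Eu n) := volume.restrict (cube n)

/-- The frequency vector `2πk`. -/
def fv (k : Fin n → ℤ) : Eu n := WithLp.toLp 2 fun i => 2 * π * k i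

/-- The complex plane wave with real frequency vector `v`. -/
def pw (v x : Eu n) : ℂ := Complex.exp ((⟪x, v⟫ : ℝ) * Complex.I)

lemma measurableSet_cube : MeasurableSet (cube n) := by
  have : cube n = ⋂ i, {x : Eu n | x i ∈ Ioc (0 : ℝ) 1} := by ext; simp [cube]
  rw [this]
  exact MeasurableSet.iInter fun i =>
    measurableSet_Ioc.preimage (by fun_prop : Continuous fun x : Eu n => x i).measurable

lemma ocube_subset_cube : ocube n ⊆ cube n := fun _ hx i => ⟨(hx i).1, (hx i).2.le⟩

lemma isOpen_ocube : IsOpen (ocube n) := by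
  have : ocube n = ⋂ i, {x : Eu n | x i ∈ Ioo (0 : ℝ) 1} := by ext; simp [ocube]
  rw [this]
  exact isOpen_iInter_of_finite fun i =>
    isOpen_Ioo.preimage (by fun_prop : Continuous fun x : Eu n => x i)

lemma isBounded_cube : Bornology.IsBounded (cube n) := by
  refine Metric.isBounded_closedBall.subset (s := cube n) (t := Metric.closedBall 0 (√ n)) fun x hx => ?_
  rw [mem_closedBall_zero_iff, EuclideanSpace.norm_eq]
  refine Real.sqrt_le_sqrt ?_
  calc ∑ i, ‖x i‖ ^ 2 ≤ ∑ _i : Fin n, (1 : ℝ) := Finset.sum_le_sum fun i _ => by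
        rw [Real.norm_of_nonneg (hx i).1.le]
        exact pow_le_one₀ (hx i).1.le (hx i).2
    _ = n := by simp

instance : IsFiniteMeasure (cm n) :=
  ⟨by rw [cm, Measure.restrict_apply_univ]; exact isBounded_cube.measure_lt_top⟩

lemma continuous_pw (v : Eu n) : Continuous (pw v) := by unfold pw; fun_prop

lemma norm_pw (v x : Eu n) : ‖pw v x‖ = 1 := Complex.norm_exp_ofReal_mul_I _

@[reducible] def circleMeasureSpace : MeasureSpace UnitAddCircle := ⟨AddCircle.haarAddCircle⟩

attribute [local instance] circleMeasureSpace

/-- The unit cube chart of the torus. -/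
def torusChart (n : ℕ) (τ : UnitAddTorus (Fin n)) : Eu n :=
  WithLp.toLp 2 (UnitAddTorus.measurableEquivPiIoc (fun _ => 0) τ).1

lemma measurePreserving_torusChart : MeasurePreserving (torusChart n) volume (cm n) := by
  have h1 := UnitAddTorus.measurePreserving_equivPiIoc (d := Fin n) (fun _ => 0)
  have h2 := measurePreserving_subtype_coe (μa := (volume : Measure (Fin n → ℝ)))
    (s := {x | ∀ i, x i ∈ Ioc ((fun _ : Fin n => (0 : ℝ)) i) ((fun _ : Fin n => (0 : ℝ)) i + 1)})
    (MeasurableSet.univ_pi' (fun i => measurableSet_Ioc))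
  have h3 := (PiLp.volume_preserving_toLp (Fin n)).restrict_preimage (measurableSet_cube (n := n))
  have e : WithLp.toLp 2 ⁻¹' (cube n) = {x : Fin n → ℝ | ∀ i, x i ∈
      Ioc ((fun _ : Fin n => (0 : ℝ)) i) ((fun _ : Fin n => (0 : ℝ)) i + 1)} := by
    ext x; simp [cube]
  rw [e] at h3
  exact h3.comp (h2.comp h1)

lemma pw_torusChart (k : Fin n → ℤ) (τ : UnitAddTorus (Fin n)) :
    pw (fv k) (torusChart n τ) = UnitAddTorus.mFourier k τ := by
  have hτ : ∀ i, τ i = ((torusChart n τ i : ℝ) : UnitAddCircle) := fun i =>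
    ((AddCircle.equivIoc 1 0).symm_apply_apply (τ i)).symm
  have : UnitAddTorus.mFourier k τ = ∏ i, fourier (k i) (τ i) := rfl
  rw [this]
  have h2 : ∀ i, fourier (k i) (τ i) = Complex.exp (2 * π * k i * (torusChart n τ i) * Complex.I) := by
    intro i
    rw [hτ i, fourier_coe_apply]
    congr 1; push_cast; ring
  simp_rw [h2]
  rw [← Complex.exp_sum, pw]
  congr 1
  simp only [PiLp.inner_apply, fv, RCLike.inner_apply, conj_trivial]
  push_cast
  rw [Finset.sum_mul]

lemma memLp_pw (k : Fin n → ℤ) : MemLp (pw (fv k)) 2 (cm n) :=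
  MemLp.of_bound (continuous_pw _).aestronglyMeasurable 1 (Eventually.of_forall fun x => (norm_pw _ x).le)

/-- The plane waves with frequencies in `2πℤⁿ` as elements of `L²` of the cube. -/
def pwLp (k : Fin n → ℤ) : Lp ℂ 2 (cm n) := (memLp_pw k).toLp

lemma exists_fourier_basis (n : ℕ) :
    ∃ b : HilbertBasis (Fin n → ℤ) ℂ (Lp ℂ 2 (cm n)), ∀ k, b k = pwLp k := by
  let T := Lp.compMeasurePreservingₗᵢ (p := 2) (E := ℂ) ℂ (torusChart n) measurePreserving_torusChart
  have hT : ∀ k, T (pwLp k) = UnitAddTorus.mFourierLp 2 k := by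
    intro k
    refine Lp.ext ?_
    refine (Lp.coeFn_compMeasurePreserving _ measurePreserving_torusChart).trans ?_
    refine EventuallyEq.trans ?_ (UnitAddTorus.coeFn_mFourierLp 2 k).symm
    have := measurePreserving_torusChart.quasiMeasurePreserving.ae_eq_comp (memLp_pw k).coeFn_toLp
    refine this.trans (Eventually.of_forall fun τ => pw_torusChart k τ)
  have ho : Orthonormal ℂ (pwLp (n := n)) := by
    have := UnitAddTorus.orthonormal_mFourier (d := Fin n)
    rw [orthonormal_iff_ite] at this ⊢
    intro i j
    rw [← this i j, ← hT, ← hT, LinearIsometry.inner_map_map]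
  refine ⟨HilbertBasis.mkOfOrthogonalEqBot ho ?_, fun k => by
    rw [HilbertBasis.coe_mkOfOrthogonalEqBot]⟩
  rw [Submodule.eq_bot_iff]
  intro x hx
  rw [Submodule.mem_orthogonal] at hx
  have h0 : ∀ k, inner ℂ (UnitAddTorus.mFourierLp 2 k) (T x) = 0 := fun k => by
    rw [← hT, LinearIsometry.inner_map_map]
    exact hx _ (Submodule.subset_span ⟨k, rfl⟩)
  have : UnitAddTorus.mFourierBasis.repr (T x) = 0 := by
    ext k
    rw [HilbertBasis.repr_apply_apply, UnitAddTorus.coe_mFourierBasis, h0]; rfl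
  rw [LinearIsometryEquiv.map_eq_zero_iff] at this
  exact T.injective (this.trans T.map_zero.symm)

/-- The Fourier basis of `L²` of the unit cube. -/
def fb (n : ℕ) : HilbertBasis (Fin n → ℤ) ℂ (Lp ℂ 2 (cm n)) := (exists_fourier_basis n).choose

lemma fb_apply (k : Fin n → ℤ) : fb n k = pwLp k := (exists_fourier_basis n).choose_spec k

lemma fb_repr_toLp {f : Eu n → ℂ} (hf : MemLp f 2 (cm n)) (k : Fin n → ℤ) :
    (fb n).repr hf.toLp k = ∫ x, (starRingEnd ℂ) (pw (fv k) x) * f x ∂cm n := by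
  rw [HilbertBasis.repr_apply_apply, L2.inner_def, fb_apply]
  refine integral_congr_ae ?_
  filter_upwards [hf.coeFn_toLp, (memLp_pw k).coeFn_toLp] with x h1 h2
  rw [h1, pwLp, h2]
  simp [mul_comm]

lemma hasSum_sq_repr {ι H : Type*} [NormedAddCommGroup H] [InnerProductSpace ℂ H]
    (b : HilbertBasis ι ℂ H) (x : H) : HasSum (fun k => ‖b.repr x k‖ ^ 2) (‖x‖ ^ 2) := by
  have := RCLike.hasSum_re ℂ (b.hasSum_inner_mul_inner x x)
  rw [inner_self_eq_norm_sq] at this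
  refine this.congr_fun fun k => ?_
  rw [HilbertBasis.repr_apply_apply, ← inner_conj_symm x, RCLike.conj_mul]
  norm_cast

lemma norm_sq_toLp {α : Type*} [MeasurableSpace α] {μ : Measure α} {f : α → ℂ} (hf : MemLp f 2 μ) :
    ‖hf.toLp‖ ^ 2 = ∫ x, ‖f x‖ ^ 2 ∂μ := by
  have h := L2.inner_def (𝕜 := ℂ) (hf.toLp f) (hf.toLp f)
  rw [inner_self_eq_norm_sq_to_K] at h
  have h2 : (∫ a, inner ℂ (hf.toLp f a) (hf.toLp f a) ∂μ) = ((∫ x, ‖f x‖ ^ 2 ∂μ : ℝ) : ℂ) := by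
    rw [← integral_complex_ofReal]
    refine integral_congr_ae ?_
    filter_upwards [hf.coeFn_toLp] with x h1
    rw [h1, inner_self_eq_norm_sq_to_K]; norm_cast
  rw [h2] at h
  refine Complex.ofReal_injective ?_
  rw [← h]; norm_cast

lemma Tst.memLp {z : Eu n → ℝ} (hz : Tst z) {μ : Measure (Eu n)} [IsFiniteMeasureOnCompacts μ] :
    MemLp (fun x => (z x : ℂ)) 2 μ :=
  Continuous.memLp_of_hasCompactSupport (by have := hz.cont; fun_prop)
    (hz.cs.comp_left (g := fun t : ℝ => (t : ℂ)) rfl)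

/-- A test function as an element of `L²` of the cube. -/
def Tst.lp {z : Eu n → ℝ} (hz : Tst z) : Lp ℂ 2 (cm n) := (hz.memLp (μ := cm n)).toLp

lemma setIntegral_cube {E : Type*} [NormedAddCommGroup E] [NormedSpace ℝ E] {f : Eu n → E}
    (hf : ∀ x, x ∉ cube n → f x = 0) : ∫ x, f x ∂cm n = ∫ x, f x :=
  setIntegral_eq_integral_of_forall_compl_eq_zero hf

lemma Tst.notMem {z : Eu n → ℝ} {U : Set (Eu n)} (h : tsupport z ⊆ U) {x : Eu n} (hx : x ∉ U) :
    z x = 0 := image_eq_zero_of_notMem_tsupport fun h' => hx (h h')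

lemma contDiff_cos_inner (v : Eu n) : ContDiff ℝ ∞ fun x : Eu n => Real.cos ⟪x, v⟫ :=
  Real.contDiff_cos.comp (contDiff_id.inner ℝ contDiff_const)

lemma contDiff_sin_inner (v : Eu n) : ContDiff ℝ ∞ fun x : Eu n => Real.sin ⟪x, v⟫ :=
  Real.contDiff_sin.comp (contDiff_id.inner ℝ contDiff_const)

lemma Tst.repr_lp {z : Eu n → ℝ} (hz : Tst z) (hs : tsupport z ⊆ ocube n) (k : Fin n → ℤ) :
    (fb n).repr hz.lp k = (∫ x, Real.cos ⟪x, fv k⟫ * z x : ℝ) - (∫ x, Real.sin ⟪x, fv k⟫ * z x : ℝ) * Complex.I := by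
  rw [Tst.lp, fb_repr_toLp, setIntegral_cube fun x hx => by
    rw [Tst.notMem hs fun h => hx (ocube_subset_cube h)]; simp]
  have hc : Integrable fun x => Real.cos ⟪x, fv k⟫ * z x :=
    (Tst.mul_left (contDiff_cos_inner _) hz).int
  have hsn : Integrable fun x => Real.sin ⟪x, fv k⟫ * z x :=
    (Tst.mul_left (contDiff_sin_inner _) hz).int
  rw [← integral_complex_ofReal, ← integral_complex_ofReal, ← integral_mul_const, ← integral_sub]
  · refine integral_congr_ae (Eventually.of_forall fun x => ?_)
    simp only [pw, Complex.exp_mul_I, ← Complex.ofReal_cos, ← Complex.ofReal_sin, map_add, map_mul,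
      Complex.conj_ofReal, Complex.conj_I]
    push_cast; ring
  · exact hc.ofReal
  · exact hsn.ofReal.mul_const _

lemma pd_cos_inner (v : Eu n) (i : Fin n) (x : Eu n) :
    pd i (fun y => Real.cos ⟪y, v⟫) x = - v i * Real.sin ⟪x, v⟫ := by
  have := pd_comp (φ := Real.cos) Real.differentiable_cos.differentiableAt (smAt_inner v x).diff i
  rw [this, pd_inner]; simp; ring

lemma pd_sin_inner (v : Eu n) (i : Fin n) (x : Eu n) :
    pd i (fun y => Real.sin ⟪y, v⟫) x = v i * Real.cos ⟪x, v⟫ := by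
  have := pd_comp (φ := Real.sin) Real.differentiable_sin.differentiableAt (smAt_inner v x).diff i
  rw [this, pd_inner]; simp; ring

lemma Tst.repr_pd {z : Eu n → ℝ} (hz : Tst z) (hs : tsupport z ⊆ ocube n) (i : Fin n) (k : Fin n → ℤ) :
    (fb n).repr (hz.pd i).lp k = (fv k i : ℝ) * Complex.I * (fb n).repr hz.lp k := by
  rw [(hz.pd i).repr_lp ((tsupport_pd_subset z i).trans hs), hz.repr_lp hs,
    integral_mul_pd (contDiff_cos_inner _) hz, integral_mul_pd (contDiff_sin_inner _) hz]
  simp_rw [pd_cos_inner, pd_sin_inner, mul_assoc, integral_const_mul]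
  push_cast
  linear_combination ((fv k i : ℂ) * (∫ x, Real.sin ⟪x, fv k⟫ * z x : ℝ)) * Complex.I_sq

lemma Tst.norm_sq_lp {z : Eu n → ℝ} (hz : Tst z) (hs : tsupport z ⊆ ocube n) :
    ‖hz.lp‖ ^ 2 = ∫ x, z x ^ 2 := by
  rw [Tst.lp, norm_sq_toLp, setIntegral_cube fun x hx => by
    rw [Tst.notMem hs fun h => hx (ocube_subset_cube h)]; simp]
  simp

lemma Tst.hasSum_energy {z : Eu n → ℝ} (hz : Tst z) (hs : tsupport z ⊆ ocube n) :
    HasSum (fun k => (1 + ‖fv k‖ ^ 2) * ‖(fb n).repr hz.lp k‖ ^ 2)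
      ((∫ x, z x ^ 2) + ∑ i, ∫ x, Mono.pd i z x ^ 2) := by
  have h0 := hasSum_sq_repr (fb n) hz.lp
  have h1 : ∀ i ∈ Finset.univ, HasSum (fun k => (fv k i) ^ 2 * ‖(fb n).repr hz.lp k‖ ^ 2)
      (∫ x, Mono.pd i z x ^ 2) := fun i _ => by
    have := hasSum_sq_repr (fb n) (hz.pd i).lp
    rw [Tst.norm_sq_lp _ ((tsupport_pd_subset z i).trans hs)] at this
    refine this.congr_fun fun k => ?_
    rw [hz.repr_pd hs, norm_mul, norm_mul, Complex.norm_I, mul_one, Complex.norm_real, mul_pow,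
      Real.norm_eq_abs, sq_abs]
  rw [hz.norm_sq_lp hs] at h0
  refine (h0.add (hasSum_sum h1)).congr_fun fun k => ?_
  rw [EuclideanSpace.real_norm_sq_eq, add_mul, one_mul, Finset.sum_mul]

end

lemma HilbertBasis.exists_subseq {ι H : Type*} [NormedAddCommGroup H] [InnerProductSpace ℂ H]
    [CompleteSpace H] (b : HilbertBasis ι ℂ H) {w : ι → ℝ} (hw0 : ∀ k, 0 ≤ w k)
    (hw : ∀ M, {k | w k ≤ M}.Finite) {C : ℝ} {x : ℕ → H}
    (hx : ∀ j, ∃ s ≤ C, HasSum (fun k => (1 + w k) * ‖b.repr (x j) k‖ ^ 2) s) :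
    ∃ X, ∃ θ : ℕ → ℕ, StrictMono θ ∧ Tendsto (x ∘ θ) atTop (𝓝 X) := by
  have hC : 0 ≤ C := by
    obtain ⟨s, hs, h⟩ := hx 0
    exact (h.nonneg fun k => by have := hw0 k; positivity).trans hs
  have htb : TotallyBounded (range x) := by
    rw [Metric.totallyBounded_iff]
    intro ε hε
    obtain ⟨M, hM⟩ : ∃ M : ℝ, 0 < M ∧ C / M < (ε / 2) ^ 2 := by
      refine ⟨C / (ε / 2) ^ 2 + 1, by positivity, ?_⟩
      rw [div_lt_iff₀ (by positivity), mul_add, mul_div_cancel₀ _ (by positivity)]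
      have : 0 < (ε / 2) ^ 2 := by positivity
      linarith
    set F := (hw M).toFinset with hF
    let A : (F → ℂ) → H := fun a => ∑ k, a k • b k
    have hA : Continuous A := by fun_prop
    have hK := ((isCompact_closedBall (0 : F → ℂ) (√C)).image hA).totallyBounded
    obtain ⟨t, ht, htK⟩ := Metric.totallyBounded_iff.1 hK (ε / 2) (half_pos hε)
    refine ⟨t, ht, ?_⟩
    rintro _ ⟨j, rfl⟩
    obtain ⟨s, hs, hsum⟩ := hx j
    let a : F → ℂ := fun k => b.repr (x j) k
    have hcoef : ∀ k, ‖b.repr (x j) k‖ ≤ √C := fun k => by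
      refine Real.le_sqrt_of_sq_le (le_trans ?_ (le_trans (le_hasSum hsum k fun i _ => ?_) hs))
      · have := hw0 k; nlinarith [sq_nonneg ‖b.repr (x j) k‖]
      · have := hw0 i; positivity
    have ha : A a ∈ A '' Metric.closedBall 0 (√C) := by
      refine ⟨a, ?_, rfl⟩
      rw [mem_closedBall_zero_iff, pi_norm_le_iff_of_nonneg (Real.sqrt_nonneg _)]
      exact fun k => hcoef k
    obtain ⟨y, hy, hyA⟩ := mem_iUnion₂.1 (htK ha)
    refine mem_iUnion₂.2 ⟨y, hy, ?_⟩
    classical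
    have hres : ∀ k, b.repr (x j - A a) k = if k ∈ F then 0 else b.repr (x j) k := by
      intro k
      have h1 : b.repr (A a) k = if k ∈ F then b.repr (x j) k else 0 := by
        rw [HilbertBasis.repr_apply_apply, inner_sum]
        simp_rw [inner_smul_right, orthonormal_iff_ite.1 b.orthonormal k]
        by_cases hk : k ∈ F
        · rw [if_pos hk, Finset.sum_eq_single ⟨k, hk⟩]
          · simp [a]
          · intro i _ hi
            rw [if_neg fun h => hi (Subtype.ext h.symm), mul_zero]
          · simp
        · rw [if_neg hk]
          refine Finset.sum_eq_zero fun i _ => ?_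
          rw [if_neg fun h => hk (by rw [h]; exact i.2), mul_zero]
      rw [map_sub, lp.coeFn_sub, Pi.sub_apply, h1]
      split_ifs <;> simp
    have hn : ‖x j - A a‖ ^ 2 ≤ C / M := by
      refine hasSum_le (fun k => ?_) (hasSum_sq_repr b (x j - A a)) (hsum.div_const M) |>.trans
        (div_le_div_of_nonneg_right hs hM.1.le)
      rw [hres]
      split_ifs with hk
      · have := hw0 k
        have := hM.1
        rw [norm_zero, zero_pow two_ne_zero]; positivity
      · have hk' : M < w k := by simpa [hF] using hk
        rw [le_div_iff₀ hM.1]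
        nlinarith [sq_nonneg ‖b.repr (x j) k‖]
    have hn' : ‖x j - A a‖ < ε / 2 := by
      exact lt_of_pow_lt_pow_left₀ 2 (half_pos hε).le (hn.trans_lt hM.2)
    rw [Metric.mem_ball] at hyA ⊢
    have : dist (x j) (A a) < ε / 2 := by rwa [dist_eq_norm]
    linarith [dist_triangle (x j) (A a) y]
  have hcomp : IsCompact (closure (range x)) := htb.closure.isCompact_of_isComplete isClosed_closure.isComplete
  obtain ⟨X, -, θ, hθ, h⟩ := hcomp.tendsto_subseq fun j => subset_closure (mem_range_self j)
  exact ⟨X, θ, hθ, h⟩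

lemma finite_fv (M : ℝ) : {k : Fin n → ℤ | ‖fv k‖ ^ 2 ≤ M}.Finite := by
  obtain ⟨m, hm⟩ := exists_nat_gt M
  refine (finite_Icc (fun _ : Fin n => -(m + 1 : ℤ)) (fun _ => (m + 1 : ℤ))).subset fun k hk => ?_
  have h : ∀ i, (k i : ℝ) ^ 2 ≤ (m + 1 : ℝ) ^ 2 := fun i => by
    have h1 : (fv k i) ^ 2 ≤ M := by
      refine le_trans ?_ hk
      rw [EuclideanSpace.real_norm_sq_eq]
      exact Finset.single_le_sum (f := fun i => fv k i ^ 2) (fun i _ => sq_nonneg _) (Finset.mem_univ i)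
    have h2 : (1 : ℝ) ≤ (2 * π) ^ 2 := by nlinarith [Real.pi_gt_three]
    have h3 : fv k i = 2 * π * k i := rfl
    rw [h3, mul_pow] at h1
    nlinarith [sq_nonneg (k i : ℝ), (m.cast_nonneg : (0 : ℝ) ≤ m)]
  constructor <;> intro i
  · have := abs_le_of_sq_le_sq' (h i) (by positivity)
    have h4 := this.1
    show -(m + 1 : ℤ) ≤ k i
    exact_mod_cast h4
  · have := abs_le_of_sq_le_sq' (h i) (by positivity)
    have h4 := this.2
    show k i ≤ (m + 1 : ℤ)
    exact_mod_cast h4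

lemma rellich_cube {φ : ℕ → Eu n → ℝ} (hφ : ∀ j, Tst (φ j)) (hs : ∀ j, tsupport (φ j) ⊆ ocube n)
    {C : ℝ} (hC : ∀ j, (∫ x, φ j x ^ 2) + ∑ i, ∫ x, pd i (φ j) x ^ 2 ≤ C) :
    ∃ u : Eu n → ℝ, MemLp u 2 ∧ ∃ θ : ℕ → ℕ, StrictMono θ ∧
      Tendsto (fun j => ∫ x, (φ (θ j) x - u x) ^ 2) atTop (𝓝 0) := by
  obtain ⟨X, θ, hθ, h⟩ := HilbertBasis.exists_subseq (fb n) (w := fun k => ‖fv k‖ ^ 2)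
    (fun k => sq_nonneg _) finite_fv (x := fun j => (hφ j).lp)
    (fun j => ⟨_, hC j, (hφ j).hasSum_energy (hs j)⟩)
  have hX := Lp.memLp X
  refine ⟨(cube n).indicator fun x => (X x).re, ?_, θ, hθ, ?_⟩
  · rw [memLp_indicator_iff_restrict measurableSet_cube]
    exact hX.re
  · have h2 : Tendsto (fun j => ‖(hφ (θ j)).lp - X‖ ^ 2) atTop (𝓝 0) := by
      have := ((tendsto_iff_norm_sub_tendsto_zero.1 h).pow 2)
      simpa using this
    refine squeeze_zero (fun j => integral_nonneg fun x => sq_nonneg _) (fun j => ?_) h2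
    have hm := ((hφ (θ j)).memLp (μ := cm n)).sub hX
    have e : (hφ (θ j)).lp - X = hm.toLp := by
      rw [show hm.toLp = _ from MemLp.toLp_sub ((hφ (θ j)).memLp (μ := cm n)) hX, Lp.toLp_coeFn]; rfl
    rw [e, norm_sq_toLp, ← setIntegral_cube fun x hx => by
      rw [indicator_of_notMem hx, Tst.notMem (hs _) fun h => hx (ocube_subset_cube h)]; simp]
    refine integral_mono_of_nonneg (Eventually.of_forall fun x => sq_nonneg _) ?_ ?_
    · exact hm.integrable_norm_pow (by norm_num)
    · filter_upwards [ae_restrict_mem measurableSet_cube] with x hx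
      simp only [indicator_of_mem hx, Pi.sub_apply]
      have := Complex.abs_re_le_norm ((φ (θ j) x : ℂ) - X x)
      rw [Complex.sub_re, Complex.ofReal_re] at this
      exact sq_le_sq' (by linarith [neg_abs_le (φ (θ j) x - (X x).re)]) ((le_abs_self _).trans this)

lemma pd_scale {f : Eu n → ℝ} (a : ℝ) (v : Eu n) (i : Fin n) (hf : ContDiff ℝ ∞ f) (x : Eu n) :
    pd i (fun y => f (a • y + v)) x = a * pd i f (a • x + v) := by
  have h1 : HasFDerivAt (fun y : Eu n => a • y + v) (a • ContinuousLinearMap.id ℝ (Eu n)) x :=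
    ((hasFDerivAt_id x).const_smul a).add_const v
  have h2 := ((hf.differentiable (by simp) (a • x + v)).hasFDerivAt.comp x h1).fderiv
  unfold pd
  rw [show (fun y => f (a • y + v)) = f ∘ fun y : Eu n => a • y + v from rfl, h2]
  simp

lemma integral_affine (f : Eu n → ℝ) {r : ℝ} (hr : 0 < r) (v : Eu n) :
    ∫ z, f (r • z + v) = (r ^ n)⁻¹ * ∫ z, f z := by
  have := Measure.integral_comp_smul (volume : Measure (Eu n)) (fun z => f (z + v)) r
  rw [this, integral_add_right_eq_self (fun z => f z)]
  simp only [finrank_euclideanSpace, Fintype.card_fin, smul_eq_mul]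
  rw [abs_of_pos (by positivity)]

/-- A bounded set is mapped into the unit cube by a suitable dilation. -/
lemma exists_affine_cube {B : Set (Eu n)} (hB : Bornology.IsBounded B) :
    ∃ r₀ : ℝ, 0 < r₀ ∧ ∀ r : ℝ, r₀ ≤ r → ∀ x ∈ closure B, r⁻¹ • x + WithLp.toLp 2 (fun _ => (1 / 2 : ℝ)) ∈ ocube n := by
  obtain ⟨R, hR, hBR⟩ := hB.closure.subset_closedBall_lt 0 0
  refine ⟨4 * R, by positivity, fun r hr x hx i => ?_⟩
  have hr0 : 0 < r := lt_of_lt_of_le (by positivity) hr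
  have h1 : |x i| ≤ R := by
    have := hBR hx
    rw [mem_closedBall_zero_iff] at this
    exact (PiLp.norm_apply_le x i).trans this
  have h2 : |r⁻¹ * x i| ≤ 1 / 4 := by
    rw [abs_mul, abs_inv, abs_of_pos hr0, inv_mul_le_iff₀ hr0]
    linarith
  have h3 := abs_le.1 h2
  have : (r⁻¹ • x + WithLp.toLp 2 (fun _ => (1 / 2 : ℝ)) : Eu n) i = r⁻¹ * x i + 1 / 2 := by simp
  rw [this]
  constructor <;> linarith [h3.1, h3.2]

lemma rellich {B : Set (Eu n)} (hB : Bornology.IsBounded B) {φ : ℕ → Eu n → ℝ}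
    (hφ : ∀ j, Tst (φ j)) (hs : ∀ j, tsupport (φ j) ⊆ B)
    {C : ℝ} (hC : ∀ j, (∫ x, φ j x ^ 2) ≤ C) (hC' : ∀ j, ∑ i, ∫ x, pd i (φ j) x ^ 2 ≤ C) :
    ∃ u : Eu n → ℝ, MemLp u 2 ∧ ∃ θ : ℕ → ℕ, StrictMono θ ∧
      Tendsto (fun j => ∫ x, (φ (θ j) x - u x) ^ 2) atTop (𝓝 0) := by
  obtain ⟨r, hr, hcube⟩ := exists_affine_cube hB
  set p : Eu n := WithLp.toLp 2 (fun _ => (1 / 2 : ℝ)) with hp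
  have hcube' := hcube r le_rfl
  have hr' : r ≠ 0 := hr.ne'
  let ψ : ℕ → Eu n → ℝ := fun j x => φ j (r • x + -(r • p))
  have hcd : ContDiff ℝ ∞ fun x : Eu n => r • x + -(r • p) := by fun_prop
  let e : Eu n ≃ₜ Eu n := (Homeomorph.smulOfNeZero r hr').trans (Homeomorph.addRight (-(r • p)))
  have he : ∀ x, e x = r • x + -(r • p) := fun x => rfl
  have hψs : ∀ j, tsupport (ψ j) = e ⁻¹' tsupport (φ j) := fun j =>
    tsupport_comp_eq_preimage (φ j) e
  have hψ : ∀ j, Tst (ψ j) := fun j => ⟨(hφ j).smooth.comp hcd, by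
    have := (hφ j).cs.comp_homeomorph e
    exact this⟩
  have hψc : ∀ j, tsupport (ψ j) ⊆ ocube n := fun j x hx => by
    rw [hψs] at hx
    have := hcube' _ (subset_closure (hs j hx))
    rw [he] at this
    convert this using 1
    rw [smul_add, smul_neg, smul_smul, smul_smul, inv_mul_cancel₀ hr', one_smul, one_smul]
    abel
  obtain ⟨u, hu, θ, hθ, h⟩ := rellich_cube hψ hψc (C := (r ^ n)⁻¹ * C + r ^ 2 * ((r ^ n)⁻¹ * C)) (fun j => by
    have hpos : 0 ≤ (r ^ n)⁻¹ := by positivity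
    refine add_le_add ?_ ?_
    · rw [show (∫ x, ψ j x ^ 2) = _ from integral_affine (fun x => φ j x ^ 2) hr _]
      exact mul_le_mul_of_nonneg_left (hC j) hpos
    · have e2 : ∀ i, ∫ x, pd i (ψ j) x ^ 2 = r ^ 2 * ((r ^ n)⁻¹ * ∫ x, pd i (φ j) x ^ 2) := fun i => by
        rw [← integral_affine (fun x => pd i (φ j) x ^ 2) hr (-(r • p)), ← integral_const_mul]
        refine integral_congr_ae (Eventually.of_forall fun x => ?_)
        show pd i (fun y => φ j (r • y + -(r • p))) x ^ 2 = _
        rw [pd_scale _ _ _ (hφ j).smooth, mul_pow]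
      simp_rw [e2, ← Finset.mul_sum]
      have := hC' j
      gcongr)
  have hc2 : ∀ x : Eu n, r • (r⁻¹ • x + p) + -(r • p) = x := fun x => by
    rw [smul_add, smul_smul, mul_inv_cancel₀ hr', one_smul]; abel
  refine ⟨fun x => u (r⁻¹ • x + p), ?_, θ, hθ, ?_⟩
  · have h1 : AEStronglyMeasurable (fun x => u (r⁻¹ • x + p)) volume := by
      refine hu.1.comp_quasiMeasurePreserving (f := fun x : Eu n => r⁻¹ • x + p) ?_
      have a1 := (measurePreserving_add_right (volume : Measure (Eu n)) p).quasiMeasurePreserving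
      exact a1.comp (Measure.quasiMeasurePreserving_smul volume (inv_ne_zero hr'))
    rw [memLp_two_iff_integrable_sq h1]
    have h2 := hu.integrable_sq
    have h3 := (h2.comp_add_right p).comp_smul (inv_ne_zero hr')
    exact h3
  · have : ∀ j, ∫ x, (φ (θ j) x - u (r⁻¹ • x + p)) ^ 2 = ((r⁻¹ ^ n)⁻¹) * ∫ x, (ψ (θ j) x - u x) ^ 2 := by
      intro j
      rw [← integral_affine _ (inv_pos.2 hr) p]
      refine integral_congr_ae (Eventually.of_forall fun x => ?_)
      show _ = (φ (θ j) (r • (r⁻¹ • x + p) + -(r • p)) - _) ^ 2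
      rw [hc2]
    simp_rw [this]
    simpa using h.const_mul ((r⁻¹ ^ n)⁻¹)

lemma integrable_add {f g : Eu n → ℝ} (hf : Integrable f) (hg : Integrable g) :
    Integrable fun x => f x + g x := hf.add hg

lemma integrable_sq_sub {f g : Eu n → ℝ} (hf : MemLp f 2) (hg : MemLp g 2) :
    Integrable fun x => (f x - g x) ^ 2 := (hf.sub hg).integrable_sq

lemma sq_integral_mul_le {f g : Eu n → ℝ} (hf : MemLp f 2) (hg : MemLp g 2) :
    (∫ x, f x * g x) ^ 2 ≤ (∫ x, f x ^ 2) * ∫ x, g x ^ 2 := by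
  have h1 := hf.integrable_sq
  have h2 := hg.integrable_sq
  have h3 : Integrable fun x => f x * g x := hf.integrable_mul hg
  have key : ∀ t : ℝ, 0 ≤ (∫ x, g x ^ 2) * (t * t) + (2 * ∫ x, f x * g x) * t + ∫ x, f x ^ 2 := by
    intro t
    have : ∫ x, (f x + t * g x) ^ 2
        = (∫ x, g x ^ 2) * (t * t) + (2 * ∫ x, f x * g x) * t + ∫ x, f x ^ 2 := by
      have e : ∀ x, (f x + t * g x) ^ 2 = (t * t) * g x ^ 2 + (2 * t) * (f x * g x) + f x ^ 2 :=
        fun x => by ring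
      simp_rw [e]
      rw [integral_add (integrable_add (h2.const_mul _) (h3.const_mul _)) h1,
        integral_add (h2.const_mul _) (h3.const_mul _), integral_const_mul, integral_const_mul]
      ring
    rw [← this]
    exact integral_nonneg fun x => sq_nonneg _
  have := discrim_le_zero key
  unfold discrim at this
  nlinarith

/-- Convergence in `L²`. -/
def L2T (φ : ℕ → Eu n → ℝ) (u : Eu n → ℝ) : Prop :=
  (∀ k, MemLp (φ k) 2) ∧ MemLp u 2 ∧ Tendsto (fun k => ∫ x, (φ k x - u x) ^ 2) atTop (𝓝 0)

lemma L2T.sub_mul {φ : ℕ → Eu n → ℝ} {u g : Eu n → ℝ} (h : L2T φ u) (hg : MemLp g 2) :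
    Tendsto (fun k => ∫ x, (φ k x - u x) * g x) atTop (𝓝 0) := by
  have h1 : Tendsto (fun k => √((∫ x, (φ k x - u x) ^ 2) * ∫ x, g x ^ 2)) atTop (𝓝 0) := by
    have := (h.2.2.mul_const (∫ x, g x ^ 2)).sqrt
    simpa using this
  refine squeeze_zero_norm (fun k => ?_) h1
  rw [Real.norm_eq_abs]
  exact Real.abs_le_sqrt (sq_integral_mul_le ((h.1 k).sub h.2.1) hg)

lemma L2T.mul {φ : ℕ → Eu n → ℝ} {u g : Eu n → ℝ} (h : L2T φ u) (hg : MemLp g 2) :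
    Tendsto (fun k => ∫ x, φ k x * g x) atTop (𝓝 (∫ x, u x * g x)) := by
  have h1 := (h.sub_mul hg).add_const (∫ x, u x * g x)
  rw [zero_add] at h1
  refine h1.congr fun k => ?_
  have a : Integrable fun x => φ k x * g x := (h.1 k).integrable_mul hg
  have b : Integrable fun x => u x * g x := h.2.1.integrable_mul hg
  simp_rw [_root_.sub_mul]
  rw [integral_sub a b]
  ring

lemma L2T.sq {φ : ℕ → Eu n → ℝ} {u : Eu n → ℝ} (h : L2T φ u) :
    Tendsto (fun k => ∫ x, φ k x ^ 2) atTop (𝓝 (∫ x, u x ^ 2)) := by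
  have h1 := (h.2.2.add ((h.sub_mul h.2.1).const_mul 2)).add_const (∫ x, u x ^ 2)
  simp only [mul_zero, zero_add] at h1
  refine h1.congr fun k => ?_
  have a := integrable_sq_sub (h.1 k) h.2.1
  have b : Integrable fun x => (φ k x - u x) * u x := ((h.1 k).sub h.2.1).integrable_mul h.2.1
  have c := h.2.1.integrable_sq
  rw [← integral_const_mul, ← integral_add a (b.const_mul 2), ← integral_add (integrable_add a (b.const_mul 2)) c]
  refine integral_congr_ae (Eventually.of_forall fun x => ?_)
  show (φ k x - u x) ^ 2 + 2 * ((φ k x - u x) * u x) + u x ^ 2 = φ k x ^ 2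
  ring

lemma L2T.of_le {φ ψ : ℕ → Eu n → ℝ} {u w : Eu n → ℝ} (h : L2T φ u) (hψ : ∀ k, MemLp (ψ k) 2)
    (hw : MemLp w 2) (hle : ∀ k x, |ψ k x - w x| ≤ |φ k x - u x|) : L2T ψ w := by
  refine ⟨hψ, hw, squeeze_zero (fun k => integral_nonneg fun x => sq_nonneg _) (fun k => ?_) h.2.2⟩
  exact integral_mono ((hψ k).sub hw).integrable_sq ((h.1 k).sub h.2.1).integrable_sq
    fun x => sq_le_sq.2 (hle k x)

lemma L2T.abs {φ : ℕ → Eu n → ℝ} {u : Eu n → ℝ} (h : L2T φ u) :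
    L2T (fun k x => |φ k x|) (fun x => |u x|) :=
  h.of_le (fun k => (h.1 k).norm) h.2.1.norm fun _ _ => abs_abs_sub_abs_le_abs_sub _ _

/-- Replacing the approximating sequence by a nearby one. -/
lemma L2T.trans {φ ψ : ℕ → Eu n → ℝ} {u : Eu n → ℝ} (h : L2T φ u) (hψ : ∀ k, MemLp (ψ k) 2)
    (hd : Tendsto (fun k => ∫ x, (ψ k x - φ k x) ^ 2) atTop (𝓝 0)) : L2T ψ u := by
  refine ⟨hψ, h.2.1, ?_⟩
  have := (hd.const_mul 2).add (h.2.2.const_mul 2)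
  simp only [mul_zero, add_zero] at this
  refine squeeze_zero (fun k => integral_nonneg fun x => sq_nonneg _) (fun k => ?_) this
  have a := integrable_sq_sub (hψ k) (h.1 k)
  have b := integrable_sq_sub (h.1 k) h.2.1
  rw [← integral_const_mul, ← integral_const_mul, ← integral_add (a.const_mul 2) (b.const_mul 2)]
  refine integral_mono ((hψ k).sub h.2.1).integrable_sq (integrable_add (a.const_mul 2) (b.const_mul 2))
    fun x => ?_
  show (ψ k x - u x) ^ 2 ≤ 2 * (ψ k x - φ k x) ^ 2 + 2 * (φ k x - u x) ^ 2
  nlinarith [sq_nonneg ((ψ k x - φ k x) - (φ k x - u x))]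

lemma L2T.unique {φ : ℕ → Eu n → ℝ} {u w : Eu n → ℝ} (h : L2T φ u) (h' : L2T φ w) : u =ᵐ[volume] w := by
  have h3 : L2T (fun _ => w) u := h.trans (fun _ => h'.2.1) (by
    refine h'.2.2.congr fun k => integral_congr_ae (Eventually.of_forall fun x => ?_)
    show (φ k x - w x) ^ 2 = (w x - φ k x) ^ 2
    ring)
  have h4 : ∫ x, (w x - u x) ^ 2 = 0 := tendsto_nhds_unique tendsto_const_nhds h3.2.2
  rw [integral_eq_zero_iff_of_nonneg (fun x => sq_nonneg _) (integrable_sq_sub h'.2.1 h.2.1)] at h4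
  filter_upwards [h4] with x hx
  have : (w x - u x) ^ 2 = 0 := hx
  linarith [pow_eq_zero_iff (two_ne_zero) |>.1 this]

lemma L2T.eq_zero_of_notMem {φ : ℕ → Eu n → ℝ} {u : Eu n → ℝ} (h : L2T φ u) {Ω : Set (Eu n)}
    (hΩ : MeasurableSet Ω) (hφ : ∀ k, ∀ x, x ∉ Ω → φ k x = 0) : ∀ᵐ x, x ∉ Ω → u x = 0 := by
  have hi : MemLp (Ω.indicator u) 2 := h.2.1.indicator hΩ
  have h' : L2T φ (Ω.indicator u) := h.of_le h.1 hi fun k x => by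
    by_cases hx : x ∈ Ω
    · rw [indicator_of_mem hx]
    · rw [indicator_of_notMem hx, hφ k x hx]; simp
  filter_upwards [h.unique h'] with x hx hxΩ
  rw [hx, indicator_of_notMem hxΩ]

/-- Test functions supported in `Ω`. -/
structure Adm (Ω : Set (Eu n)) (φ : Eu n → ℝ) : Prop where
  tst : Tst φ
  sub : tsupport φ ⊆ Ω

lemma Adm.zero {Ω : Set (Eu n)} {φ : Eu n → ℝ} (h : Adm Ω φ) {x : Eu n} (hx : x ∉ Ω) : φ x = 0 :=
  Tst.notMem h.sub hx

lemma Adm.add {Ω : Set (Eu n)} {φ ψ : Eu n → ℝ} (h : Adm Ω φ) (h' : Adm Ω ψ) :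
    Adm Ω fun x => φ x + ψ x :=
  ⟨h.tst.add h'.tst, (tsupport_add φ ψ).trans (union_subset h.sub h'.sub)⟩

lemma Adm.mul_left {Ω : Set (Eu n)} {f φ : Eu n → ℝ} (hf : ContDiff ℝ ∞ f) (h : Adm Ω φ) :
    Adm Ω fun x => f x * φ x :=
  ⟨Tst.mul_left hf h.tst, (tsupport_mul_subset_right).trans h.sub⟩

lemma Adm.const_mul {Ω : Set (Eu n)} {φ : Eu n → ℝ} (h : Adm Ω φ) (c : ℝ) :
    Adm Ω fun x => c * φ x := h.mul_left contDiff_const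

lemma Adm.comp {Ω : Set (Eu n)} {φ : Eu n → ℝ} (h : Adm Ω φ) {H : ℝ → ℝ} (hH : ContDiff ℝ ∞ H)
    (h0 : H 0 = 0) : Adm Ω fun x => H (φ x) :=
  ⟨⟨hH.comp h.tst.smooth, h.tst.cs.comp_left h0⟩, by
    refine (closure_mono ?_).trans h.sub
    intro x hx hx'
    exact hx (by show H (φ x) = 0; rw [hx', h0])⟩

lemma Tst.memLp2 {φ : Eu n → ℝ} (h : Tst φ) : MemLp φ 2 := h.cont.memLp_of_hasCompactSupport h.cs

/-- The bilinear form `∫ ∇φ·∇ψ + τ ∫φ ∫ψ - Λ ∫φψ`. -/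
def Q (τ Λ : ℝ) (φ ψ : Eu n → ℝ) : ℝ :=
  (∑ i, ∫ x, pd i φ x * pd i ψ x) + τ * (∫ x, φ x) * (∫ x, ψ x) - Λ * ∫ x, φ x * ψ x

lemma Tst.int_mul {φ ψ : Eu n → ℝ} (h : Tst φ) (h' : Tst ψ) : Integrable fun x => φ x * ψ x :=
  (Tst.mul_left h.smooth h').int

lemma Q_add_smul {τ Λ : ℝ} {φ ψ : Eu n → ℝ} (h : Tst φ) (h' : Tst ψ) (t : ℝ) :
    Q τ Λ (fun x => φ x + t * ψ x) (fun x => φ x + t * ψ x)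
      = Q τ Λ ψ ψ * (t * t) + 2 * Q τ Λ φ ψ * t + Q τ Λ φ φ := by
  have e1 : ∀ f g : Eu n → ℝ, Tst f → Tst g → ∫ x, (f x + t * g x) * (f x + t * g x)
      = (∫ x, f x * f x) + 2 * t * (∫ x, f x * g x) + t * t * ∫ x, g x * g x := by
    intro f g hf hg
    have e : ∀ x, (f x + t * g x) * (f x + t * g x)
        = f x * f x + 2 * t * (f x * g x) + t * t * (g x * g x) := fun x => by ring
    simp_rw [e]
    rw [integral_add (integrable_add (hf.int_mul hf) ((hf.int_mul hg).const_mul _)) ((hg.int_mul hg).const_mul _),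
      integral_add (hf.int_mul hf) ((hf.int_mul hg).const_mul _), integral_const_mul, integral_const_mul]
  have e2 : ∀ i x, pd i (fun x => φ x + t * ψ x) x = pd i φ x + t * pd i ψ x := fun i x => by
    rw [pd_add (h.smooth.differentiable (by simp) x)
      ((h'.const_mul t).smooth.differentiable (by simp) x), pd_const_mul]
  unfold Q
  simp_rw [e2, e1 _ _ (h.pd _) (h'.pd _), e1 _ _ h h']
  rw [integral_add h.int (h'.int.const_mul t), integral_const_mul]
  simp_rw [Finset.sum_add_distrib, ← Finset.mul_sum]
  ring

lemma Q_cauchy {τ Λ : ℝ} {Ω : Set (Eu n)} (hQ : ∀ φ, Adm Ω φ → 0 ≤ Q τ Λ φ φ)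
    {φ ψ : Eu n → ℝ} (h : Adm Ω φ) (h' : Adm Ω ψ) :
    Q τ Λ φ ψ ^ 2 ≤ Q τ Λ φ φ * Q τ Λ ψ ψ := by
  have := discrim_le_zero (fun t => by
    have := hQ _ (h.add (h'.const_mul t))
    rwa [Q_add_smul h.tst h'.tst] at this)
  unfold discrim at this
  nlinarith

lemma pd_int_sq_le {φ : Eu n → ℝ} (h : Tst φ) (i : Fin n) {R : ℝ} (hR : ∀ x, φ x ≠ 0 → |x i| ≤ R) :
    ∫ x, φ x ^ 2 ≤ 4 * R ^ 2 * ∫ x, pd i φ x ^ 2 := by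
  have hc : ContDiff ℝ ∞ fun x : Eu n => ⟪x, bv i⟫ := contDiff_id.inner ℝ contDiff_const
  have hx : ∀ x : Eu n, ⟪x, bv i⟫ = x i := fun x => by simp [bv, EuclideanSpace.inner_single_right]
  have h1 : ∫ x, ⟪x, bv i⟫ * pd i (fun x => φ x * φ x) x = - ∫ x, φ x * φ x := by
    rw [integral_mul_pd hc (Tst.mul_left h.smooth h)]
    simp_rw [pd_inner]
    simp [bv]
  have h2 : ∫ x, φ x * φ x = ∫ x, (-2 * x i * φ x) * pd i φ x := by
    rw [← neg_eq_iff_eq_neg.2 h1, ← integral_neg]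
    refine integral_congr_ae (Eventually.of_forall fun x => ?_)
    have hd := h.smooth.differentiable (by simp) x
    simp only [hx]
    rw [pd_mul hd hd]
    ring
  have hm : Tst fun x : Eu n => (-2 * x i * φ x) := Tst.mul_left (by simp_rw [← hx]; fun_prop) h
  have h3 := sq_integral_mul_le hm.memLp2 (h.pd i).memLp2
  have h4 : ∫ x, (-2 * x i * φ x) ^ 2 ≤ 4 * R ^ 2 * ∫ x, φ x ^ 2 := by
    rw [← integral_const_mul]
    refine integral_mono hm.memLp2.integrable_sq (h.memLp2.integrable_sq.const_mul _) fun x => ?_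
    show (-2 * x i * φ x) ^ 2 ≤ 4 * R ^ 2 * φ x ^ 2
    by_cases h0 : φ x = 0
    · simp [h0]
    · have h5 : (x i) ^ 2 ≤ R ^ 2 := sq_le_sq' (by linarith [neg_abs_le (x i), hR x h0]) ((le_abs_self _).trans (hR x h0))
      nlinarith [sq_nonneg (φ x)]
  rw [← h2] at h3
  have h0 : 0 ≤ ∫ x, φ x ^ 2 := integral_nonneg fun x => sq_nonneg _
  have h0' : 0 ≤ ∫ x, pd i φ x ^ 2 := integral_nonneg fun x => sq_nonneg _
  simp_rw [← pow_two] at h3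
  rcases h0.eq_or_lt with h6 | h6
  · rw [← h6]; positivity
  · have := h3.trans (mul_le_mul_of_nonneg_right h4 h0')
    nlinarith

lemma Q_self (τ Λ : ℝ) (φ : Eu n → ℝ) : Q τ Λ φ φ
    = (∑ i, ∫ x, pd i φ x ^ 2) + τ * (∫ x, φ x) ^ 2 - Λ * ∫ x, φ x ^ 2 := by
  unfold Q
  simp_rw [pow_two]
  ring

lemma Q_zero_nonneg {τ : ℝ} (hτ : 0 ≤ τ) (φ : Eu n → ℝ) : 0 ≤ Q τ 0 φ φ := by
  rw [Q_self, zero_mul, sub_zero]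
  exact add_nonneg (Finset.sum_nonneg fun i _ => integral_nonneg fun x => sq_nonneg _)
    (mul_nonneg hτ (sq_nonneg _))

lemma Q_smul (τ Λ t : ℝ) (φ : Eu n → ℝ) :
    Q τ Λ (fun x => t * φ x) (fun x => t * φ x) = t ^ 2 * Q τ Λ φ φ := by
  have e : ∀ i x, pd i (fun x => t * φ x) x = t * pd i φ x := fun i x => pd_const_mul t i
  simp_rw [Q_self, e, mul_pow, integral_const_mul, ← Finset.mul_sum]
  ring

lemma exists_adm {Ω : Set (Eu n)} (hΩ : IsOpen Ω) (hne : Ω.Nonempty) :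
    ∃ φ, Adm Ω φ ∧ ∫ x, φ x ^ 2 = 1 := by
  obtain ⟨x₀, hx₀⟩ := hne
  obtain ⟨χ, h1, h2, h3, -⟩ := exists_bump isCompact_singleton hΩ (singleton_subset_iff.2 hx₀)
  have hpos : 0 < ∫ x, χ x ^ 2 := by
    have hc : Continuous fun x => χ x ^ 2 := h1.cont.pow 2
    refine hc.integral_pos_of_hasCompactSupport_nonneg_nonzero ?_ (fun x => sq_nonneg _) (x := x₀) ?_
    · have : HasCompactSupport fun x => χ x * χ x := h1.cs.mul_left
      simpa [pow_two] using this
    · rw [(h3 x₀ rfl).self_of_nhds]; norm_num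
  have ha : Adm Ω χ := ⟨h1, h2⟩
  refine ⟨_, ha.const_mul (√(∫ x, χ x ^ 2))⁻¹, ?_⟩
  simp_rw [mul_pow, integral_const_mul, inv_pow, Real.sq_sqrt hpos.le]
  exact inv_mul_cancel₀ hpos.ne'

/-- The lowest level of `φ ↦ ∫ |∇φ|² + τ (∫φ)²` on the unit sphere of `L²`. -/
def ev (Ω : Set (Eu n)) (τ : ℝ) : ℝ :=
  sInf {b | ∃ φ, Adm Ω φ ∧ ∫ x, φ x ^ 2 = 1 ∧ b = Q τ 0 φ φ}

lemma ev_bddBelow (Ω : Set (Eu n)) {τ : ℝ} (hτ : 0 ≤ τ) :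
    BddBelow {b | ∃ φ, Adm Ω φ ∧ ∫ x, φ x ^ 2 = 1 ∧ b = Q τ 0 φ φ} := by
  refine ⟨0, ?_⟩
  rintro _ ⟨φ, -, -, rfl⟩
  exact Q_zero_nonneg hτ φ

lemma le_ev {Ω : Set (Eu n)} (hΩ : IsOpen Ω) (hne : Ω.Nonempty) {τ m : ℝ}
    (h : ∀ φ, Adm Ω φ → ∫ x, φ x ^ 2 = 1 → m ≤ Q τ 0 φ φ) : m ≤ ev Ω τ := by
  obtain ⟨φ, h1, h2⟩ := exists_adm hΩ hne
  refine le_csInf ⟨_, φ, h1, h2, rfl⟩ ?_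
  rintro _ ⟨φ, h1, h2, rfl⟩
  exact h φ h1 h2

lemma Q_sub_level (τ Λ : ℝ) (φ : Eu n → ℝ) : Q τ Λ φ φ = Q τ 0 φ φ - Λ * ∫ x, φ x ^ 2 := by
  rw [Q_self, Q_self]; ring

lemma Q_ev_nonneg {Ω : Set (Eu n)} {τ : ℝ} (hτ : 0 ≤ τ) (φ : Eu n → ℝ) (h : Adm Ω φ) :
    0 ≤ Q τ (ev Ω τ) φ φ := by
  have h0 : 0 ≤ ∫ x, φ x ^ 2 := integral_nonneg fun x => sq_nonneg _
  rw [Q_sub_level]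
  rcases h0.eq_or_lt with h1 | h1
  · rw [← h1, mul_zero, sub_zero]
    exact Q_zero_nonneg hτ φ
  · have h2 : ev Ω τ ≤ Q τ 0 (fun x => (√(∫ x, φ x ^ 2))⁻¹ * φ x) (fun x => (√(∫ x, φ x ^ 2))⁻¹ * φ x) := by
      refine csInf_le (ev_bddBelow Ω hτ) ⟨_, h.const_mul _, ?_, rfl⟩
      simp_rw [mul_pow, integral_const_mul, inv_pow, Real.sq_sqrt h1.le]
      exact inv_mul_cancel₀ h1.ne'
    rw [Q_smul, inv_pow, Real.sq_sqrt h1.le, inv_mul_eq_div, le_div_iff₀ h1] at h2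
    linarith

lemma exists_almost_min {Ω : Set (Eu n)} (hΩ : IsOpen Ω) (hne : Ω.Nonempty) (τ : ℝ) {ε : ℝ}
    (hε : 0 < ε) : ∃ φ, Adm Ω φ ∧ ∫ x, φ x ^ 2 = 1 ∧ Q τ (ev Ω τ) φ φ < ε := by
  obtain ⟨φ₀, h1, h2⟩ := exists_adm hΩ hne
  obtain ⟨_, ⟨φ, h3, h4, rfl⟩, h5⟩ := exists_lt_of_csInf_lt
    (s := {b | ∃ φ, Adm Ω φ ∧ ∫ x, φ x ^ 2 = 1 ∧ b = Q τ 0 φ φ}) ⟨_, φ₀, h1, h2, rfl⟩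
    (show sInf _ < ev Ω τ + ε by unfold ev; linarith)
  refine ⟨φ, h3, h4, ?_⟩
  rw [Q_sub_level, h4]
  linarith

lemma exists_cutoff {Ω : Set (Eu n)} (hb : Bornology.IsBounded Ω) :
    ∃ χ : Eu n → ℝ, Tst χ ∧ ∀ x ∈ Ω, χ x = 1 := by
  obtain ⟨χ, h1, -, h3, -⟩ := exists_bump hb.isCompact_closure isOpen_univ (subset_univ _)
  exact ⟨χ, h1, fun x hx => (h3 x (subset_closure hx)).self_of_nhds⟩

lemma Adm.mul_cutoff {Ω : Set (Eu n)} {φ χ : Eu n → ℝ} (h : Adm Ω φ) (hχ : ∀ x ∈ Ω, χ x = 1) (x : Eu n) :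
    φ x * χ x = φ x := by
  by_cases hx : x ∈ Ω
  · rw [hχ x hx, mul_one]
  · rw [h.zero hx, zero_mul]

lemma exists_mean_bound {Ω : Set (Eu n)} (hb : Bornology.IsBounded Ω) :
    ∃ V, 0 ≤ V ∧ ∀ φ, Adm Ω φ → (∫ x, φ x) ^ 2 ≤ V * ∫ x, φ x ^ 2 := by
  obtain ⟨χ, h1, h2⟩ := exists_cutoff hb
  refine ⟨∫ x, χ x ^ 2, integral_nonneg fun x => sq_nonneg _, fun φ h => ?_⟩
  have := sq_integral_mul_le h.tst.memLp2 h1.memLp2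
  simp_rw [h.mul_cutoff h2] at this
  linarith

lemma ev_zero_le {Ω : Set (Eu n)} (hΩ : IsOpen Ω) (hne : Ω.Nonempty) {τ : ℝ} (hτ : 0 ≤ τ) :
    ev Ω 0 ≤ ev Ω τ := by
  refine le_ev hΩ hne fun φ h h1 => ?_
  have h2 := Q_ev_nonneg le_rfl φ h
  rw [Q_self, h1] at h2
  rw [Q_self]
  have := mul_nonneg hτ (sq_nonneg (∫ x, φ x))
  linarith

lemma ev_le_add {Ω : Set (Eu n)} (hΩ : IsOpen Ω) (hne : Ω.Nonempty) {V : ℝ}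
    (hV : ∀ φ, Adm Ω φ → (∫ x, φ x) ^ 2 ≤ V * ∫ x, φ x ^ 2) {τ : ℝ} (hτ : 0 ≤ τ) :
    ev Ω τ ≤ ev Ω 0 + τ * V := by
  rw [← sub_le_iff_le_add]
  refine le_ev hΩ hne fun φ h h1 => ?_
  have h2 := Q_ev_nonneg hτ φ h
  have h3 := mul_le_mul_of_nonneg_left (hV φ h) hτ
  rw [Q_self, h1] at h2
  rw [h1] at h3
  rw [Q_self]
  linarith

lemma ev_pos (i₀ : Fin n) {Ω : Set (Eu n)} (hΩ : IsOpen Ω) (hne : Ω.Nonempty)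
    (hb : Bornology.IsBounded Ω) {τ : ℝ} (hτ : 0 ≤ τ) : 0 < ev Ω τ := by
  obtain ⟨R, hR, hΩR⟩ := hb.subset_closedBall_lt 0 0
  refine lt_of_lt_of_le (show 0 < (4 * R ^ 2)⁻¹ by positivity) (le_ev hΩ hne fun φ h h1 => ?_)
  have h2 := pd_int_sq_le h.tst i₀ (R := R) fun x hx => by
    have : x ∈ Ω := by by_contra h3; exact hx (h.zero h3)
    exact (PiLp.norm_apply_le x i₀).trans (mem_closedBall_zero_iff.1 (hΩR this))
  rw [h1] at h2
  have h3 : ∫ x, pd i₀ φ x ^ 2 ≤ ∑ i, ∫ x, pd i φ x ^ 2 :=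
    Finset.single_le_sum (f := fun i => ∫ x, pd i φ x ^ 2)
      (fun i _ => integral_nonneg fun x => sq_nonneg _) (Finset.mem_univ i₀)
  rw [Q_self, inv_le_iff_one_le_mul₀' (by positivity)]
  have h4 := mul_nonneg hτ (sq_nonneg (∫ x, φ x))
  refine h2.trans (mul_le_mul_of_nonneg_left ?_ (by positivity))
  linarith

/-- `u` is an `L²` limit of a minimising sequence. -/
def IsMin (Ω : Set (Eu n)) (τ : ℝ) (u : Eu n → ℝ) : Prop :=
  ∃ φ : ℕ → Eu n → ℝ, (∀ k, Adm Ω (φ k)) ∧ L2T φ u ∧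
    Tendsto (fun k => Q τ (ev Ω τ) (φ k) (φ k)) atTop (𝓝 0)

lemma rellich_adm {Ω : Set (Eu n)} (hb : Bornology.IsBounded Ω) {φ : ℕ → Eu n → ℝ}
    (hφ : ∀ k, Adm Ω (φ k)) {C C' : ℝ} (hC : ∀ k, (∫ x, φ k x ^ 2) ≤ C)
    (hC' : ∀ k, ∑ i, ∫ x, pd i (φ k) x ^ 2 ≤ C') :
    ∃ u, ∃ θ : ℕ → ℕ, StrictMono θ ∧ L2T (fun k => φ (θ k)) u := by
  obtain ⟨u, hu, θ, hθ, h⟩ := rellich hb (fun k => (hφ k).tst) (fun k => (hφ k).sub)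
    (C := max C C') (fun k => (hC k).trans (le_max_left _ _)) fun k => (hC' k).trans (le_max_right _ _)
  exact ⟨u, θ, hθ, fun k => (hφ _).tst.memLp2, hu, h⟩

lemma exists_isMin {Ω : Set (Eu n)} (hΩ : IsOpen Ω) (hne : Ω.Nonempty) (hb : Bornology.IsBounded Ω)
    {τ : ℝ} (hτ : 0 ≤ τ) : ∃ u, IsMin Ω τ u ∧ ∫ x, u x ^ 2 = 1 := by
  choose φ h1 h2 h3 using fun k : ℕ => exists_almost_min hΩ hne τ (ε := 1 / (k + 1)) (by positivity)
  have hk : ∀ k : ℕ, 1 / ((k : ℝ) + 1) ≤ 1 := fun k => by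
    rw [div_le_one (by positivity)]; linarith [(k.cast_nonneg : (0 : ℝ) ≤ k)]
  obtain ⟨u, θ, hθ, h⟩ := rellich_adm hb h1 (fun k => (h2 k).le) (C' := ev Ω τ + 1) fun k => by
    have := h3 k
    rw [Q_self, h2] at this
    have := mul_nonneg hτ (sq_nonneg (∫ x, φ k x))
    linarith [hk k]
  refine ⟨u, ⟨_, fun k => h1 _, h, ?_⟩, ?_⟩
  · exact squeeze_zero (fun k => Q_ev_nonneg hτ _ (h1 _)) (fun k => (h3 _).le)
      (tendsto_one_div_add_atTop_nhds_zero_nat.comp hθ.tendsto_atTop)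
  · have := h.sq
    simp_rw [h2] at this
    exact tendsto_nhds_unique this tendsto_const_nhds

lemma IsMin.memLp {Ω : Set (Eu n)} {τ : ℝ} {u : Eu n → ℝ} (h : IsMin Ω τ u) : MemLp u 2 := by
  obtain ⟨φ, -, h, -⟩ := h
  exact h.2.1

lemma IsMin.eq_zero {Ω : Set (Eu n)} (hΩ : IsOpen Ω) {τ : ℝ} {u : Eu n → ℝ} (h : IsMin Ω τ u) :
    ∀ᵐ x, x ∉ Ω → u x = 0 := by
  obtain ⟨φ, h1, h, -⟩ := h
  exact h.eq_zero_of_notMem hΩ.measurableSet fun k x hx => (h1 k).zero hx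

lemma IsMin.tendsto_Q {Ω : Set (Eu n)} {τ : ℝ} (hτ : 0 ≤ τ) {φ ψ : ℕ → Eu n → ℝ}
    (hφ : ∀ k, Adm Ω (φ k)) (h : Tendsto (fun k => Q τ (ev Ω τ) (φ k) (φ k)) atTop (𝓝 0))
    (hψ : ∀ k, Adm Ω (ψ k)) {C : ℝ} (hC : ∀ k, Q τ (ev Ω τ) (ψ k) (ψ k) ≤ C) :
    Tendsto (fun k => Q τ (ev Ω τ) (φ k) (ψ k)) atTop (𝓝 0) := by
  have h1 : Tendsto (fun k => √(Q τ (ev Ω τ) (φ k) (φ k) * C)) atTop (𝓝 0) := by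
    have := (h.mul_const C).sqrt
    simpa using this
  refine squeeze_zero_norm (fun k => ?_) h1
  rw [Real.norm_eq_abs]
  refine Real.abs_le_sqrt ((Q_cauchy (Q_ev_nonneg hτ) (hφ k) (hψ k)).trans ?_)
  exact mul_le_mul_of_nonneg_left (hC k) (Q_ev_nonneg hτ _ (hφ k))

lemma Adm.energy_eq {Ω : Set (Eu n)} {τ Λ : ℝ} {φ ψ : Eu n → ℝ} (h : Adm Ω φ) (h' : Adm Ω ψ) :
    Q τ Λ φ ψ = τ * (∫ x, φ x) * (∫ x, ψ x) - ∫ x, φ x * (lap ψ x + Λ * ψ x) := by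
  unfold Q
  have e1 := integral_mul_lap h.tst.smooth h'.tst
  simp_rw [mul_add]
  rw [integral_add (h.tst.int_mul h'.tst.lap) (h.tst.int_mul (h'.tst.const_mul Λ)), e1]
  have e2 : ∀ x, φ x * (Λ * ψ x) = Λ * (φ x * ψ x) := fun x => by ring
  simp_rw [e2, integral_const_mul]
  ring

theorem IsMin.weak {Ω : Set (Eu n)} {τ : ℝ} (hτ : 0 ≤ τ) {u : Eu n → ℝ} (h : IsMin Ω τ u)
    {χ : Eu n → ℝ} (hχ : Tst χ) (hχ1 : ∀ x ∈ Ω, χ x = 1) {ψ : Eu n → ℝ} (hψ : Adm Ω ψ) :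
    ∫ x, u x * (lap ψ x + ev Ω τ * ψ x) = τ * (∫ x, u x * χ x) * ∫ x, ψ x := by
  obtain ⟨φ, h1, h2, h3⟩ := h
  have h4 := IsMin.tendsto_Q hτ h1 h3 (fun _ => hψ) (fun _ => le_rfl)
  have h5 := (((h2.mul hχ.memLp2).const_mul τ).mul_const (∫ x, ψ x)).sub
    (h2.mul (hψ.tst.lap.add (hψ.tst.const_mul (ev Ω τ))).memLp2)
  have h6 := tendsto_nhds_unique (h4.congr fun k => by
    rw [(h1 k).energy_eq hψ, ← integral_congr_ae (Eventually.of_forall ((h1 k).mul_cutoff hχ1))]) h5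
  linarith

/-- A smooth regularisation of the absolute value. -/
def reg (ε t : ℝ) : ℝ := √(t ^ 2 + ε ^ 2) - ε

def dreg (ε t : ℝ) : ℝ := t / √(t ^ 2 + ε ^ 2)

lemma sqrt_reg_pos {ε : ℝ} (hε : 0 < ε) (t : ℝ) : 0 < √(t ^ 2 + ε ^ 2) :=
  Real.sqrt_pos.2 (by positivity)

lemma contDiff_reg {ε : ℝ} (hε : 0 < ε) : ContDiff ℝ ∞ (reg ε) := by
  refine ContDiff.sub (ContDiff.sqrt (by fun_prop) fun t => ?_) contDiff_const
  positivity

lemma contDiff_dreg {ε : ℝ} (hε : 0 < ε) : ContDiff ℝ ∞ (dreg ε) := by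
  refine contDiff_id.div (ContDiff.sqrt (by fun_prop) fun t => ?_) fun t => (sqrt_reg_pos hε t).ne'
  positivity

lemma hasDerivAt_sqrt_reg {ε : ℝ} (hε : 0 < ε) (t : ℝ) :
    HasDerivAt (fun t => √(t ^ 2 + ε ^ 2)) (dreg ε t) t := by
  have h1 : HasDerivAt (fun t : ℝ => t ^ 2 + ε ^ 2) (2 * t) t := by
    simpa using (hasDerivAt_pow 2 t).add_const (ε ^ 2)
  have := h1.sqrt (by positivity)
  convert this using 1
  unfold dreg
  rw [mul_div_mul_left _ _ two_ne_zero]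

lemma deriv_reg {ε : ℝ} (hε : 0 < ε) (t : ℝ) : deriv (reg ε) t = dreg ε t :=
  ((hasDerivAt_sqrt_reg hε t).sub_const ε).deriv

lemma deriv_dreg {ε : ℝ} (hε : 0 < ε) (t : ℝ) :
    0 ≤ deriv (dreg ε) t ∧ deriv (dreg ε) t ≤ 1 / ε := by
  have hs := sqrt_reg_pos hε t
  have hsq : √(t ^ 2 + ε ^ 2) ^ 2 = t ^ 2 + ε ^ 2 := Real.sq_sqrt (by positivity)
  have h1 := ((hasDerivAt_id t).div (hasDerivAt_sqrt_reg hε t) hs.ne').deriv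
  have h2 : deriv (dreg ε) t = ε ^ 2 / √(t ^ 2 + ε ^ 2) ^ 3 := by
    rw [show dreg ε = id / fun t => √(t ^ 2 + ε ^ 2) from rfl, h1]
    unfold dreg
    set s := √(t ^ 2 + ε ^ 2)
    field_simp
    rw [hsq]; simp; ring
  have h3 : ε ≤ √(t ^ 2 + ε ^ 2) := Real.le_sqrt_of_sq_le (by nlinarith [sq_nonneg t])
  rw [h2]
  refine ⟨by positivity, ?_⟩
  rw [div_le_div_iff₀ (by positivity) hε]
  have := pow_le_pow_left₀ hε.le h3 3
  nlinarith

lemma abs_dreg_le {ε : ℝ} (hε : 0 < ε) (t : ℝ) : |dreg ε t| ≤ 1 := by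
  unfold dreg
  rw [abs_div, abs_of_pos (sqrt_reg_pos hε t), div_le_one (sqrt_reg_pos hε t)]
  exact Real.abs_le_sqrt (by nlinarith [sq_nonneg ε])

lemma abs_reg_sub {ε : ℝ} (hε : 0 < ε) (t : ℝ) : |reg ε t - (|t|)| ≤ ε := by
  have h1 : |t| ≤ √(t ^ 2 + ε ^ 2) := Real.abs_le_sqrt (by nlinarith [sq_nonneg ε])
  have h2 : √(t ^ 2 + ε ^ 2) ≤ |t| + ε := by
    rw [Real.sqrt_le_left (by positivity)]
    nlinarith [sq_abs t, abs_nonneg t]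
  unfold reg
  rw [abs_le]
  constructor <;> linarith

lemma reg_zero {ε : ℝ} (hε : 0 < ε) : reg ε 0 = 0 := by
  unfold reg; rw [zero_pow two_ne_zero, zero_add, Real.sqrt_sq hε.le, sub_self]

lemma dreg_zero (ε : ℝ) : dreg ε 0 = 0 := by unfold dreg; simp

lemma IsMin.energy_bdd {Ω : Set (Eu n)} {τ : ℝ} (hτ : 0 ≤ τ) {u : Eu n → ℝ} {φ : ℕ → Eu n → ℝ}
    (h : L2T φ u) (hQ : Tendsto (fun k => Q τ (ev Ω τ) (φ k) (φ k)) atTop (𝓝 0)) :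
    ∃ C, 0 ≤ C ∧ ∀ k, ∑ i, ∫ x, pd i (φ k) x ^ 2 ≤ C := by
  obtain ⟨C, hC⟩ := (hQ.add (h.sq.const_mul (ev Ω τ))).bddAbove_range
  have key : ∀ k, ∑ i, ∫ x, pd i (φ k) x ^ 2 ≤ C := fun k => by
    have h1 := hC (mem_range_self k)
    simp only [Q_self] at h1
    have := mul_nonneg hτ (sq_nonneg (∫ x, φ k x))
    linarith
  exact ⟨C, (Finset.sum_nonneg fun i _ => integral_nonneg fun x => sq_nonneg _).trans (key 0), key⟩

lemma pd_comp_tst {φ : Eu n → ℝ} (h : Tst φ) {H : ℝ → ℝ} (hH : ContDiff ℝ ∞ H) (i : Fin n) (x : Eu n) :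
    pd i (fun y => H (φ y)) x = deriv H (φ x) * pd i φ x :=
  pd_comp (hH.differentiable (by simp) _) (h.smooth.differentiable (by simp) x) i

lemma Adm.test_energy {Ω : Set (Eu n)} {φ ψ : Eu n → ℝ} (h : Adm Ω φ) (hψ : Tst ψ)
    {C ε V τ Λ : ℝ} (hC : ∀ x, |ψ x| ≤ C) (hε : 0 < ε) (hτ : 0 ≤ τ) (hΛ : 0 ≤ Λ) (hV0 : 0 ≤ V)
    (hV : ∀ φ, Adm Ω φ → (∫ x, φ x) ^ 2 ≤ V * ∫ x, φ x ^ 2) :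
    Q τ Λ (fun x => ψ x * dreg ε (φ x)) (fun x => ψ x * dreg ε (φ x))
      ≤ 2 * (C / ε) ^ 2 * (∑ i, ∫ x, pd i φ x ^ 2) + 2 * (∑ i, ∫ x, pd i ψ x ^ 2)
        + τ * (V * ∫ x, ψ x ^ 2) := by
  have ha : Adm Ω fun x => ψ x * dreg ε (φ x) :=
    (h.comp (contDiff_dreg hε) (dreg_zero ε)).mul_left hψ.smooth
  have h1 : ∫ x, (ψ x * dreg ε (φ x)) ^ 2 ≤ ∫ x, ψ x ^ 2 := by
    refine integral_mono ha.tst.memLp2.integrable_sq hψ.memLp2.integrable_sq fun x => ?_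
    show (ψ x * dreg ε (φ x)) ^ 2 ≤ ψ x ^ 2
    have := sq_le_one_iff_abs_le_one _ |>.2 (abs_dreg_le hε (φ x))
    rw [mul_pow]
    nlinarith [sq_nonneg (ψ x)]
  have h2 : ∀ i, ∫ x, pd i (fun x => ψ x * dreg ε (φ x)) x ^ 2
      ≤ 2 * (C / ε) ^ 2 * (∫ x, pd i φ x ^ 2) + 2 * ∫ x, pd i ψ x ^ 2 := fun i => by
    have a := (h.tst.pd i).memLp2.integrable_sq.const_mul (2 * (C / ε) ^ 2)
    have b := (hψ.pd i).memLp2.integrable_sq.const_mul 2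
    rw [← integral_const_mul, ← integral_const_mul, ← integral_add a b]
    refine integral_mono (ha.tst.pd i).memLp2.integrable_sq (integrable_add a b) fun x => ?_
    show pd i (fun x => ψ x * dreg ε (φ x)) x ^ 2 ≤ 2 * (C / ε) ^ 2 * pd i φ x ^ 2 + 2 * pd i ψ x ^ 2
    have hd : DifferentiableAt ℝ (fun x => dreg ε (φ x)) x :=
      ((contDiff_dreg hε).comp h.tst.smooth).differentiable (by simp) x
    rw [pd_mul (hψ.smooth.differentiable (by simp) x) hd,
      pd_comp_tst h.tst (contDiff_dreg hε)]
    have d1 := deriv_dreg hε (φ x)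
    have e1 : |ψ x * (deriv (dreg ε) (φ x) * pd i φ x)| ≤ |C / ε * pd i φ x| := by
      rw [abs_mul, abs_mul, abs_mul, ← mul_assoc]
      refine mul_le_mul_of_nonneg_right ?_ (abs_nonneg _)
      have hC0 : 0 ≤ C := (abs_nonneg _).trans (hC x)
      rw [abs_of_nonneg d1.1, abs_of_nonneg (show 0 ≤ C / ε by positivity), div_eq_mul_one_div C ε]
      exact mul_le_mul (hC x) d1.2 d1.1 hC0
    have e2 : |dreg ε (φ x) * pd i ψ x| ≤ |pd i ψ x| := by
      rw [abs_mul]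
      exact mul_le_of_le_one_left (abs_nonneg _) (abs_dreg_le hε _)
    have e1' := sq_le_sq.2 e1
    have e2' := sq_le_sq.2 e2
    rw [mul_pow (C / ε)] at e1'
    nlinarith [sq_nonneg (ψ x * (deriv (dreg ε) (φ x) * pd i φ x) - dreg ε (φ x) * pd i ψ x)]
  rw [Q_self]
  have h3 := Finset.sum_le_sum fun i (_ : i ∈ Finset.univ) => h2 i
  rw [Finset.sum_add_distrib, ← Finset.mul_sum, ← Finset.mul_sum] at h3
  have h4 := mul_le_mul_of_nonneg_left ((hV _ ha).trans (mul_le_mul_of_nonneg_left h1 hV0)) hτ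
  have h5 : 0 ≤ Λ * ∫ x, (ψ x * dreg ε (φ x)) ^ 2 :=
    mul_nonneg hΛ (integral_nonneg fun x => sq_nonneg _)
  linarith

lemma Adm.test_lower {Ω : Set (Eu n)} {φ ψ : Eu n → ℝ} (h : Adm Ω φ) (hψ : Tst ψ) (hψ0 : ∀ x, 0 ≤ ψ x)
    {ε τ Λ : ℝ} (hε : 0 < ε) (hΛ : 0 ≤ Λ) :
    -|τ * ∫ x, φ x| * (∫ x, ψ x) - ε * (∫ x, |lap ψ x|) - ∫ x, |φ x| * (lap ψ x + Λ * ψ x)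
      ≤ Q τ Λ φ (fun x => ψ x * dreg ε (φ x)) := by
  have ha : Adm Ω fun x => ψ x * dreg ε (φ x) :=
    (h.comp (contDiff_dreg hε) (dreg_zero ε)).mul_left hψ.smooth
  have hr := h.comp (contDiff_reg hε) (reg_zero hε)
  have h1 : -∫ x, reg ε (φ x) * lap ψ x ≤ ∑ i, ∫ x, pd i φ x * pd i (fun x => ψ x * dreg ε (φ x)) x := by
    rw [integral_mul_lap hr.tst.smooth hψ, neg_neg]
    refine Finset.sum_le_sum fun i _ => ?_
    refine integral_mono ((hr.tst.pd i).int_mul (hψ.pd i)) ((h.tst.pd i).int_mul (ha.tst.pd i)) fun x => ?_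
    show pd i (fun x => reg ε (φ x)) x * pd i ψ x ≤ pd i φ x * pd i (fun x => ψ x * dreg ε (φ x)) x
    have hd : DifferentiableAt ℝ (fun x => dreg ε (φ x)) x :=
      ((contDiff_dreg hε).comp h.tst.smooth).differentiable (by simp) x
    rw [pd_mul (hψ.smooth.differentiable (by simp) x) hd,
      pd_comp_tst h.tst (contDiff_dreg hε), pd_comp_tst h.tst (contDiff_reg hε), deriv_reg hε]
    have := mul_nonneg (mul_nonneg (hψ0 x) (deriv_dreg hε (φ x)).1) (sq_nonneg (pd i φ x))
    nlinarith
  have h2 : ∫ x, reg ε (φ x) * lap ψ x ≤ (∫ x, |φ x| * lap ψ x) + ε * ∫ x, |lap ψ x| := by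
    have a : Integrable fun x => |φ x| * lap ψ x := MemLp.integrable_mul h.tst.memLp2.norm hψ.lap.memLp2
    have b : Integrable fun x => ε * |lap ψ x| := hψ.lap.int.abs.const_mul ε
    rw [← integral_const_mul, ← integral_add a b]
    refine integral_mono (hr.tst.int_mul hψ.lap) (integrable_add a b) fun x => ?_
    show reg ε (φ x) * lap ψ x ≤ |φ x| * lap ψ x + ε * |lap ψ x|
    have : (reg ε (φ x) - |φ x|) * lap ψ x ≤ ε * |lap ψ x| := by
      refine (le_abs_self _).trans ?_
      rw [abs_mul]
      exact mul_le_mul_of_nonneg_right (abs_reg_sub hε _) (abs_nonneg _)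
    linarith
  have h3 : ∫ x, φ x * (ψ x * dreg ε (φ x)) ≤ ∫ x, |φ x| * ψ x := by
    have a : Integrable fun x => |φ x| * ψ x := MemLp.integrable_mul h.tst.memLp2.norm hψ.memLp2
    refine integral_mono (h.tst.int_mul ha.tst) a fun x => ?_
    show φ x * (ψ x * dreg ε (φ x)) ≤ |φ x| * ψ x
    have : φ x * dreg ε (φ x) ≤ |φ x| := by
      refine (le_abs_self _).trans ?_
      rw [abs_mul]
      exact mul_le_of_le_one_right (abs_nonneg _) (abs_dreg_le hε _)
    nlinarith [hψ0 x]
  have h4 : -|τ * ∫ x, φ x| * (∫ x, ψ x) ≤ τ * (∫ x, φ x) * ∫ x, ψ x * dreg ε (φ x) := by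
    have a : |∫ x, ψ x * dreg ε (φ x)| ≤ ∫ x, ψ x := by
      refine abs_integral_le_integral_abs.trans (integral_mono ha.tst.int.abs hψ.int fun x => ?_)
      show |ψ x * dreg ε (φ x)| ≤ ψ x
      rw [abs_mul, abs_of_nonneg (hψ0 x)]
      exact mul_le_of_le_one_right (hψ0 x) (abs_dreg_le hε _)
    have b := neg_abs_le (τ * (∫ x, φ x) * ∫ x, ψ x * dreg ε (φ x))
    rw [abs_mul] at b
    have := mul_le_mul_of_nonneg_left a (abs_nonneg (τ * ∫ x, φ x))
    linarith
  have h5 : ∫ x, |φ x| * (lap ψ x + Λ * ψ x) = (∫ x, |φ x| * lap ψ x) + Λ * ∫ x, |φ x| * ψ x := by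
    have a : Integrable fun x => |φ x| * lap ψ x := MemLp.integrable_mul h.tst.memLp2.norm hψ.lap.memLp2
    have b : Integrable fun x => |φ x| * ψ x := MemLp.integrable_mul h.tst.memLp2.norm hψ.memLp2
    rw [← integral_const_mul, ← integral_add a (b.const_mul Λ)]
    refine integral_congr_ae (Eventually.of_forall fun x => ?_)
    show |φ x| * (lap ψ x + Λ * ψ x) = |φ x| * lap ψ x + Λ * (|φ x| * ψ x)
    ring
  have h6 := mul_le_mul_of_nonneg_left h3 hΛ
  unfold Q
  rw [h5]
  linarith

theorem IsMin.abs_subsolution {Ω : Set (Eu n)} (hb : Bornology.IsBounded Ω) {τ : ℝ} (hτ : 0 ≤ τ)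
    (hΛ : 0 ≤ ev Ω τ) {u : Eu n → ℝ} (h : IsMin Ω τ u)
    {χ : Eu n → ℝ} (hχ : Tst χ) (hχ1 : ∀ x ∈ Ω, χ x = 1) {ψ : Eu n → ℝ} (hψ : Tst ψ)
    (hψ0 : ∀ x, 0 ≤ ψ x) :
    -|τ * ∫ x, u x * χ x| * (∫ x, ψ x) ≤ ∫ x, |u x| * (lap ψ x + ev Ω τ * ψ x) := by
  obtain ⟨φ, h1, h2, h3⟩ := h
  obtain ⟨V, hV0, hV⟩ := exists_mean_bound hb
  obtain ⟨C, hC0, hC⟩ := hψ.bdd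
  obtain ⟨M, hM0, hM⟩ := IsMin.energy_bdd hτ h2 h3
  have key : ∀ ε : ℝ, 0 < ε → -|τ * ∫ x, u x * χ x| * (∫ x, ψ x) - ε * (∫ x, |lap ψ x|)
      - ∫ x, |u x| * (lap ψ x + ev Ω τ * ψ x) ≤ 0 := by
    intro ε hε
    have hq := IsMin.tendsto_Q hτ h1 h3 (ψ := fun k x => ψ x * dreg ε (φ k x))
      (fun k => ((h1 k).comp (contDiff_dreg hε) (dreg_zero ε)).mul_left hψ.smooth)
      (fun k => ((h1 k).test_energy hψ hC hε hτ hΛ hV0 hV).trans (by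
        have := mul_le_mul_of_nonneg_left (hM k) (show 0 ≤ 2 * (C / ε) ^ 2 by positivity)
        exact add_le_add_left (add_le_add_left this _) _))
    have hl := ((((h2.mul hχ.memLp2).const_mul τ).abs.neg.mul_const (∫ x, ψ x)).sub_const
      (ε * ∫ x, |lap ψ x|)).sub (h2.abs.mul (hψ.lap.add (hψ.const_mul (ev Ω τ))).memLp2)
    refine le_of_tendsto_of_tendsto' hl hq fun k => ?_
    have := (h1 k).test_lower (τ := τ) hψ hψ0 hε hΛ
    rwa [← integral_congr_ae (Eventually.of_forall ((h1 k).mul_cutoff hχ1))] at this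
  have hlim : Tendsto (fun ε : ℝ => -|τ * ∫ x, u x * χ x| * (∫ x, ψ x) - ε * (∫ x, |lap ψ x|)
      - ∫ x, |u x| * (lap ψ x + ev Ω τ * ψ x)) (𝓝[>] 0)
      (𝓝 (-|τ * ∫ x, u x * χ x| * (∫ x, ψ x) - 0 * (∫ x, |lap ψ x|)
      - ∫ x, |u x| * (lap ψ x + ev Ω τ * ψ x))) := by
    refine Tendsto.mono_left ?_ nhdsWithin_le_nhds
    exact ((tendsto_id.mul_const _).const_sub _).sub_const _
  have := le_of_tendsto hlim (by filter_upwards [self_mem_nhdsWithin] with ε hε using key ε hε)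
  linarith

theorem IsMin.abs {Ω : Set (Eu n)} (hb : Bornology.IsBounded Ω)
    {u : Eu n → ℝ} (h : IsMin Ω 0 u) : IsMin Ω 0 fun x => |u x| := by
  obtain ⟨φ, h1, h2, h3⟩ := h
  obtain ⟨χ, hχ, hχ1⟩ := exists_cutoff hb
  have hε : ∀ k : ℕ, 0 < 1 / ((k : ℝ) + 1) := fun k => by positivity
  have ha : ∀ k : ℕ, Adm Ω fun x => reg (1 / (k + 1)) (φ k x) := fun k =>
    (h1 k).comp (contDiff_reg (hε k)) (reg_zero (hε k))
  have hL : L2T (fun (k : ℕ) x => reg (1 / (k + 1)) (φ k x)) fun x => |u x| := by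
    refine h2.abs.trans (fun k => (ha k).tst.memLp2) ?_
    have : Tendsto (fun k : ℕ => (1 / ((k : ℝ) + 1)) ^ 2 * ∫ x, χ x ^ 2) atTop (𝓝 0) := by
      have := ((tendsto_one_div_add_atTop_nhds_zero_nat (𝕜 := ℝ)).pow 2).mul_const (∫ x, χ x ^ 2)
      simpa using this
    refine squeeze_zero (fun k => integral_nonneg fun x => sq_nonneg _) (fun k => ?_) this
    rw [← integral_const_mul]
    refine integral_mono (integrable_sq_sub (ha k).tst.memLp2 (h1 k).tst.memLp2.norm)
      (hχ.memLp2.integrable_sq.const_mul _) fun x => ?_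
    show (reg (1 / (k + 1)) (φ k x) - |φ k x|) ^ 2 ≤ (1 / ((k : ℝ) + 1)) ^ 2 * χ x ^ 2
    by_cases hx : x ∈ Ω
    · rw [hχ1 x hx, one_pow, mul_one]
      exact sq_le_sq.2 ((abs_reg_sub (hε k) _).trans (le_abs_self _))
    · rw [(h1 k).zero hx, reg_zero (hε k)]
      simp only [abs_zero, sub_zero, ne_eq, OfNat.ofNat_ne_zero, not_false_eq_true, zero_pow]
      positivity
  refine ⟨_, ha, hL, ?_⟩
  have hup : Tendsto (fun k => Q 0 (ev Ω 0) (φ k) (φ k)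
      + ev Ω 0 * ((∫ x, φ k x ^ 2) - ∫ x, (reg (1 / (k + 1)) (φ k x)) ^ 2)) atTop (𝓝 0) := by
    have h4 := h3.add ((h2.sq.sub hL.sq).const_mul (ev Ω 0))
    simpa using h4
  refine squeeze_zero (fun k => Q_ev_nonneg le_rfl _ (ha k)) (fun k => ?_) hup
  have h5 : ∑ i, ∫ x, pd i (fun x => reg (1 / (k + 1)) (φ k x)) x ^ 2 ≤ ∑ i, ∫ x, pd i (φ k) x ^ 2 := by
    refine Finset.sum_le_sum fun i _ => integral_mono ((ha k).tst.pd i).memLp2.integrable_sq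
      ((h1 k).tst.pd i).memLp2.integrable_sq fun x => ?_
    show pd i (fun x => reg (1 / (k + 1)) (φ k x)) x ^ 2 ≤ pd i (φ k) x ^ 2
    rw [pd_comp_tst (h1 k).tst (contDiff_reg (hε k)), deriv_reg (hε k)]
    refine sq_le_sq.2 ?_
    rw [abs_mul]
    exact mul_le_of_le_one_left (abs_nonneg _) (abs_dreg_le (hε k) _)
  rw [Q_self, Q_self]
  linarith

theorem IsMin.exists_limit {Ω : Set (Eu n)} (hΩ : IsOpen Ω) (hne : Ω.Nonempty)
    (hb : Bornology.IsBounded Ω) {τ : ℕ → ℝ} (hτ : ∀ j, 0 ≤ τ j) (hτ0 : Tendsto τ atTop (𝓝 0))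
    {u : ℕ → Eu n → ℝ} (h : ∀ j, IsMin Ω (τ j) (u j)) (hu : ∀ j, ∫ x, u j x ^ 2 = 1) :
    ∃ w, IsMin Ω 0 w ∧ ∃ θ : ℕ → ℕ, StrictMono θ ∧ L2T (fun j => u (θ j)) w := by
  obtain ⟨V, hV0, hV⟩ := exists_mean_bound hb
  have hε : ∀ k : ℕ, 0 < 1 / ((k : ℝ) + 1) := fun k => by positivity
  have : ∀ j, ∃ φ, Adm Ω φ ∧ ∫ x, (φ x - u j x) ^ 2 < 1 / (j + 1)
      ∧ Q (τ j) (ev Ω (τ j)) φ φ < 1 / (j + 1) ∧ ∫ x, φ x ^ 2 < 2 := by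
    intro j
    obtain ⟨φ, h1, h2, h3⟩ := h j
    have h4 := h2.sq
    rw [hu] at h4
    obtain ⟨k, a, b, c⟩ := (((tendsto_order.1 h2.2.2).2 _ (hε j)).and
      (((tendsto_order.1 h3).2 _ (hε j)).and ((tendsto_order.1 h4).2 2 (by norm_num)))).exists
    exact ⟨φ k, h1 k, a, b, c⟩
  choose φ h1 h2 h3 h4 using this
  have hk : ∀ k : ℕ, 1 / ((k : ℝ) + 1) ≤ 1 := fun k => by
    rw [div_le_one (by positivity)]; linarith [(k.cast_nonneg : (0 : ℝ) ≤ k)]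
  obtain ⟨T, hT⟩ := hτ0.bddAbove_range
  have hevb : ∀ j, ev Ω (τ j) ≤ ev Ω 0 + T * V := fun j =>
    (ev_le_add hΩ hne hV (hτ j)).trans
      (by have := mul_le_mul_of_nonneg_right (hT (mem_range_self j)) hV0; linarith)
  have hn : ∀ j, 0 ≤ ∫ x, φ j x ^ 2 := fun j => integral_nonneg fun x => sq_nonneg _
  obtain ⟨w, θ, hθ, hw⟩ := rellich_adm hb h1 (fun j => (h4 j).le)
    (C' := 1 + |ev Ω 0 + T * V| * 2) fun j => by
      have := h3 j
      rw [Q_self] at this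
      have a := mul_nonneg (hτ j) (sq_nonneg (∫ x, φ j x))
      have b := mul_le_mul ((hevb j).trans (le_abs_self _)) (h4 j).le (hn j) (abs_nonneg _)
      linarith [hk j]
  refine ⟨w, ⟨_, fun k => h1 _, hw, ?_⟩, θ, hθ, hw.trans (fun k => (h _).memLp) ?_⟩
  · have hup : Tendsto (fun k => 1 / ((θ k : ℝ) + 1) + τ (θ k) * V * 2) atTop (𝓝 0) := by
      have := ((tendsto_one_div_add_atTop_nhds_zero_nat (𝕜 := ℝ)).comp hθ.tendsto_atTop).add
        (((hτ0.comp hθ.tendsto_atTop).mul_const V).mul_const 2)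
      simpa using this
    refine squeeze_zero (fun k => Q_ev_nonneg le_rfl _ (h1 _)) (fun k => ?_) hup
    have a := h3 (θ k)
    have b := mul_nonneg (hτ (θ k)) (sq_nonneg (∫ x, φ (θ k) x))
    have c := mul_le_mul_of_nonneg_right (ev_le_add hΩ hne hV (hτ (θ k))) (hn (θ k))
    have d := mul_le_mul_of_nonneg_left (h4 (θ k)).le (mul_nonneg (hτ (θ k)) hV0)
    rw [Q_self] at a ⊢
    linarith
  · refine squeeze_zero (fun k => integral_nonneg fun x => sq_nonneg _) (fun k => ?_)
      ((tendsto_one_div_add_atTop_nhds_zero_nat (𝕜 := ℝ)).comp hθ.tendsto_atTop)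
    refine le_trans (le_of_eq ?_) (h2 (θ k)).le
    refine integral_congr_ae (Eventually.of_forall fun x => ?_)
    show (u (θ k) x - φ (θ k) x) ^ 2 = (φ (θ k) x - u (θ k) x) ^ 2
    ring

/-- A function vanishing off `Ω`, solving `(lap + Λ) u = Λ κ` in `Ω`, and whose absolute value is a
weak subsolution on the whole space. -/
structure Eig (Ω : Set (Eu n)) (Λ κ : ℝ) (u : Eu n → ℝ) : Prop where
  zero : ∀ x, x ∉ Ω → u x = 0
  helm : Helm Λ Ω fun x => u x - κ
  sub : ∀ ψ, Tst ψ → (∀ x, 0 ≤ ψ x) →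
    -(Λ * |κ|) * (∫ x, ψ x) ≤ ∫ x, |u x| * (lap ψ x + Λ * ψ x)
  memLp : MemLp u 2
  norm : ∫ x, u x ^ 2 = 1

lemma Eig.const_mul {Ω : Set (Eu n)} {Λ κ : ℝ} {u : Eu n → ℝ} (h : Eig Ω Λ κ u) {s : ℝ}
    (hs : |s| = 1) : Eig Ω Λ (s * κ) fun x => s * u x := by
  have h2 : s ^ 2 = 1 := by rw [← sq_abs, hs, one_pow]
  refine ⟨fun x hx => by rw [h.zero x hx, mul_zero], ?_, fun ψ h1 h3 => ?_, h.memLp.const_mul s, ?_⟩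
  · have := h.helm.const_mul s
    simpa only [mul_sub] using this
  · simpa only [abs_mul, hs, one_mul] using h.sub ψ h1 h3
  · simpa only [mul_pow, h2, one_mul] using h.norm

lemma integral_lap_eq_zero {k : Eu n → ℝ} (hk : Tst k) : ∫ z, lap k z = 0 := by
  have := integral_mul_lap (f := fun _ => (1:ℝ)) contDiff_const hk
  simpa [pd_const] using this

lemma MemLp.locInt {u : Eu n → ℝ} (h : MemLp u 2) : LocallyIntegrable u :=
  h.locallyIntegrable (by norm_num)

lemma IsMin.exists_eig (i₀ : Fin n) {Ω : Set (Eu n)} (hΩ : IsOpen Ω) (hb : Bornology.IsBounded Ω)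
    {τ : ℝ} (hτ : 0 ≤ τ) (hΛ : 0 < ev Ω τ) {u : Eu n → ℝ} (h : IsMin Ω τ u) (hu : ∫ x, u x ^ 2 = 1)
    {χ : Eu n → ℝ} (hχ : Tst χ) (hχ1 : ∀ x ∈ Ω, χ x = 1) :
    ∃ v, u =ᵐ[volume] v ∧ Eig Ω (ev Ω τ) (τ * (∫ x, u x * χ x) / ev Ω τ) v := by
  classical
  set Λ := ev Ω τ
  set κ := τ * (∫ x, u x * χ x) / Λ
  have hκ : τ * (∫ x, u x * χ x) = Λ * κ := by simp only [κ]; field_simp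
  have hw : WHelm Λ Ω fun x => u x - κ := by
    intro z hz hzs
    have hz2 : Tst fun x => lap z x + Λ * z x := hz.lap.add (hz.const_mul Λ)
    have h1 := h.weak hτ hχ hχ1 ⟨hz, hzs⟩
    have h2 : ∫ x, (lap z x + Λ * z x) = Λ * ∫ x, z x := by
      rw [integral_add hz.lap.int (hz.int.const_mul Λ), integral_lap_eq_zero hz, zero_add,
        integral_const_mul]
    simp_rw [sub_mul]
    have h3 : Integrable fun x => u x * (lap z x + Λ * z x) :=
      MemLp.integrable_mul h.memLp hz2.memLp2
    rw [integral_sub h3 (hz2.int.const_mul κ),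
      integral_const_mul, h2, h1, hκ]
    ring
  obtain ⟨f, hf, hfu⟩ := weyl i₀ hΛ.le hΩ (u := fun x => u x - κ)
    ((MemLp.locInt h.memLp).sub (locallyIntegrable_const κ)) hw
  have hae : u =ᵐ[volume] fun x => if x ∈ Ω then f x + κ else 0 := by
    filter_upwards [hfu, h.eq_zero hΩ] with x h1 h2
    by_cases hx : x ∈ Ω
    · rw [if_pos hx, ← h1 hx]; ring
    · rw [if_neg hx, h2 hx]
  refine ⟨_, hae, fun x hx => if_neg hx, hf.congr fun x hx => ?_, fun ψ hψ hψ0 => ?_,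
    h.memLp.ae_eq hae, ?_⟩
  · filter_upwards [hΩ.mem_nhds hx] with y hy
    rw [if_pos hy]; ring
  · have h1 := h.abs_subsolution hb hτ hΛ.le hχ hχ1 hψ hψ0
    rw [hκ, abs_mul, abs_of_pos hΛ] at h1
    refine h1.trans (le_of_eq (integral_congr_ae ?_))
    filter_upwards [hae] with x hx
    rw [← hx]
  · rw [← hu]
    refine integral_congr_ae ?_
    filter_upwards [hae] with x hx
    rw [← hx]

lemma Helm.continuousOn {Λ : ℝ} {U : Set (Eu n)} {f : Eu n → ℝ} (h : Helm Λ U f) :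
    ContinuousOn f U := fun x hx => (h.sm x hx).cont.continuousWithinAt

/-- First Dirichlet eigenfunctions do not change sign. -/
lemma IsMin.exists_pos (i₀ : Fin n) {Ω : Set (Eu n)} (hΩ : IsOpen Ω) (hΩc : IsPreconnected Ω)
    (hne : Ω.Nonempty) (hb : Bornology.IsBounded Ω) {w : Eu n → ℝ} (h : IsMin Ω 0 w)
    (hw : ∫ x, w x ^ 2 = 1) :
    ∃ s : ℝ, |s| = 1 ∧ ∃ f, Helm (ev Ω 0) Ω f ∧ (∀ x ∈ Ω, 0 < f x) ∧ (∀ x, x ∉ Ω → f x = 0) ∧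
      (fun x => s * w x) =ᵐ[volume] f := by
  have hΛ := ev_pos i₀ hΩ hne hb (le_refl (0:ℝ))
  obtain ⟨χ, hχ, hχ1⟩ := exists_cutoff hb
  obtain ⟨f, hfw, hf⟩ := h.exists_eig i₀ hΩ hb le_rfl hΛ hw hχ hχ1
  obtain ⟨g, hgw, hg⟩ := (h.abs hb).exists_eig i₀ hΩ hb le_rfl hΛ (by simpa only [sq_abs]) hχ hχ1
  have hf' : Helm (ev Ω 0) Ω f := by simpa using hf.helm
  have hg' : Helm (ev Ω 0) Ω g := by simpa using hg.helm
  have hfg : EqOn (fun x => |f x|) g Ω := by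
    refine Measure.eqOn_open_of_ae_eq (μ := volume) ?_ hΩ hf'.continuousOn.abs hg'.continuousOn
    refine ae_restrict_of_ae ?_
    filter_upwards [hfw, hgw] with x h1 h2
    rw [← h1, ← h2]
  have hpos : ∀ x ∈ Ω, 0 < g x := by
    by_contra! hcon
    obtain ⟨x, hx, hx0⟩ := hcon
    have hnn : ∀ x ∈ Ω, 0 ≤ g x := fun x hx => by rw [← hfg hx]; exact abs_nonneg _
    have h0 := hg'.strong_min i₀ hΛ.le hΩ hΩc hnn hx (le_antisymm hx0 (hnn x hx))
    have : ∫ x, g x ^ 2 = 0 := by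
      refine integral_eq_zero_of_ae (Eventually.of_forall fun y => ?_)
      show g y ^ 2 = 0
      by_cases hy : y ∈ Ω
      · rw [h0 y hy]; norm_num
      · rw [hg.zero y hy]; norm_num
    rw [hg.norm] at this
    exact one_ne_zero this
  have hs : ∃ s : ℝ, |s| = 1 ∧ ∀ x ∈ Ω, 0 < s * f x := by
    have hf0 : ∀ x ∈ Ω, f x ≠ 0 := fun x hx => by
      have := hpos x hx
      rw [← hfg hx] at this
      exact abs_pos.1 this
    obtain ⟨x₀, hx₀⟩ := hne
    rcases lt_or_gt_of_ne (hf0 x₀ hx₀) with h1 | h1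
    · refine ⟨-1, by simp, fun x hx => ?_⟩
      by_contra hcon
      obtain ⟨y, hy, hy0⟩ := hΩc.intermediate_value hx₀ hx hf'.continuousOn
        (show (0:ℝ) ∈ Icc _ _ from ⟨h1.le, by linarith⟩)
      exact hf0 y hy hy0
    · refine ⟨1, by simp, fun x hx => ?_⟩
      by_contra hcon
      obtain ⟨y, hy, hy0⟩ := hΩc.intermediate_value hx hx₀ hf'.continuousOn
        (show (0:ℝ) ∈ Icc _ _ from ⟨by linarith, h1.le⟩)
      exact hf0 y hy hy0
  obtain ⟨s, hs1, hs⟩ := hs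
  refine ⟨s, hs1, fun x => s * f x, hf'.const_mul s, hs, fun x hx => by simp [hf.zero x hx], ?_⟩
  filter_upwards [hfw] with x hx
  rw [hx]

/-- Solutions with small positive constant Dirichlet defect, converging to a positive function. -/
theorem exists_eig_seq (i₀ : Fin n) {Ω : Set (Eu n)} (hΩ : IsOpen Ω) (hΩc : IsPreconnected Ω)
    (hne : Ω.Nonempty) (hb : Bornology.IsBounded Ω) :
    ∃ (Λ κ : ℕ → ℝ) (u : ℕ → Eu n → ℝ) (w : Eu n → ℝ) (Λ₀ Λ₁ : ℝ),
      (∀ j, Eig Ω (Λ j) (κ j) (u j)) ∧ (∀ j, 0 < Λ j) ∧ (∀ j, Λ j ≤ Λ₁) ∧ (∀ j, 0 < κ j) ∧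
      Tendsto κ atTop (𝓝 0) ∧ 0 ≤ Λ₀ ∧ Helm Λ₀ Ω w ∧ (∀ x ∈ Ω, 0 < w x) ∧ (∀ x, x ∉ Ω → w x = 0) ∧
      L2T u w := by
  obtain ⟨V, hV0, hV⟩ := exists_mean_bound hb
  obtain ⟨χ, hχ, hχ1⟩ := exists_cutoff hb
  set τ : ℕ → ℝ := fun j => 1 / ((j : ℝ) + 1)
  have hτ : ∀ j, 0 < τ j := fun j => by simp only [τ]; positivity
  have hτ1 : ∀ j, τ j ≤ 1 := fun j => by
    simp only [τ]
    rw [div_le_one (by positivity)]; linarith [(j.cast_nonneg : (0 : ℝ) ≤ j)]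
  have hτ0 : Tendsto τ atTop (𝓝 0) := tendsto_one_div_add_atTop_nhds_zero_nat (𝕜 := ℝ)
  choose u h1 h2 using fun j => exists_isMin hΩ hne hb (hτ j).le
  obtain ⟨w₀, hw₀, θ, hθ, hL⟩ := IsMin.exists_limit hΩ hne hb (fun j => (hτ j).le) hτ0 h1 h2
  have hw₀1 : ∫ x, w₀ x ^ 2 = 1 := by
    refine tendsto_nhds_unique hL.sq ?_
    simp only [h2]
    exact tendsto_const_nhds
  obtain ⟨s, hs, w, hw, hwpos, hw0, hwae⟩ := hw₀.exists_pos i₀ hΩ hΩc hne hb hw₀1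
  have hΛ0 := ev_pos i₀ hΩ hne hb (le_refl (0:ℝ))
  have hΛ : ∀ j, 0 < ev Ω (τ j) := fun j => ev_pos i₀ hΩ hne hb (hτ j).le
  choose v hv1 hv2 using fun j => (h1 j).exists_eig i₀ hΩ hb (hτ j).le (hΛ j) (h2 j) hχ hχ1
  have hm : Tendsto (fun j => s * ∫ x, u (θ j) x * χ x) atTop (𝓝 (s * ∫ x, w₀ x * χ x)) :=
    (hL.mul hχ.memLp2).const_mul s
  have hmpos : 0 < s * ∫ x, w₀ x * χ x := by
    rw [← integral_const_mul]
    have e : ∫ x, s * (w₀ x * χ x) = ∫ x, w x := by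
      refine integral_congr_ae ?_
      filter_upwards [hwae] with x hx
      rw [← mul_assoc, hx]
      by_cases hxΩ : x ∈ Ω
      · rw [hχ1 x hxΩ, mul_one]
      · rw [hw0 x hxΩ, zero_mul]
    have hnn : ∀ x, 0 ≤ w x := fun x => by
      by_cases hxΩ : x ∈ Ω
      · exact (hwpos x hxΩ).le
      · exact (hw0 x hxΩ).ge
    have hInt : Integrable w := by
      have a : Integrable fun x => s * (w₀ x * χ x) :=
        (MemLp.integrable_mul hw₀.memLp hχ.memLp2).const_mul s
      refine a.congr ?_
      filter_upwards [hwae] with x hx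
      rw [← mul_assoc, hx]
      by_cases hxΩ : x ∈ Ω
      · rw [hχ1 x hxΩ, mul_one]
      · rw [hw0 x hxΩ, zero_mul]
    rw [e, integral_pos_iff_support_of_nonneg hnn hInt]
    refine lt_of_lt_of_le (hΩ.measure_pos volume hne) (measure_mono fun x hx => (hwpos x hx).ne')
  obtain ⟨N, hN⟩ := eventually_atTop.1 ((tendsto_order.1 hm).1 0 hmpos)
  have hidx : StrictMono fun j => θ (j + N) := fun a b hab => hθ (by omega)
  refine ⟨fun j => ev Ω (τ (θ (j + N))),
    fun j => s * (τ (θ (j + N)) * (∫ x, u (θ (j + N)) x * χ x) / ev Ω (τ (θ (j + N)))),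
    fun j x => s * v (θ (j + N)) x, w, ev Ω 0, ev Ω 0 + V, fun j => (hv2 _).const_mul hs,
    fun j => hΛ _, fun j => ?_, fun j => ?_, ?_, hΛ0.le, hw, hwpos, hw0, ?_⟩
  · refine (ev_le_add hΩ hne hV (hτ _).le).trans ?_
    have := mul_le_mul_of_nonneg_right (hτ1 (θ (j + N))) hV0
    linarith
  · have := mul_pos (hτ (θ (j + N))) (hN (j + N) (by omega))
    have := div_pos this (hΛ (θ (j + N)))
    show 0 < s * (τ (θ (j + N)) * (∫ x, u (θ (j + N)) x * χ x) / ev Ω (τ (θ (j + N))))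
    rw [← mul_div_assoc, mul_left_comm]
    exact this
  · have a := (hτ0.comp hidx.tendsto_atTop).mul (hm.comp (tendsto_add_atTop_nat N))
    rw [zero_mul] at a
    have b := a.abs.div_const (ev Ω 0)
    rw [abs_zero, zero_div] at b
    refine squeeze_zero_norm (fun j => ?_) b
    simp only [Function.comp]
    rw [Real.norm_eq_abs, ← mul_div_assoc, abs_div, abs_of_pos (hΛ _),
      show s * (τ (θ (j + N)) * ∫ x, u (θ (j + N)) x * χ x)
        = τ (θ (j + N)) * (s * ∫ x, u (θ (j + N)) x * χ x) by ring]
    exact div_le_div_of_nonneg_left (abs_nonneg _) hΛ0 (ev_zero_le hΩ hne (hτ _).le)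
  · refine ⟨fun j => (hv2 _).memLp.const_mul s, (hw₀.memLp.const_mul s).ae_eq hwae, ?_⟩
    have := hL.2.2.comp (tendsto_add_atTop_nat N)
    refine this.congr fun j => ?_
    simp only [Function.comp]
    refine integral_congr_ae ?_
    filter_upwards [hwae, hv1 (θ (j + N))] with x hx hx2
    have h3 : s ^ 2 = 1 := by rw [← sq_abs, hs, one_pow]
    rw [← hx, ← hx2, ← mul_sub, mul_pow, h3, one_mul]

lemma rad_integral_pos {S : ℝ → ℝ} (hS : Prof S) (hS0 : 0 < S 0) : 0 < ∫ z : Eu n, rad S z := by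
  refine Continuous.integral_pos_of_hasCompactSupport_nonneg_nonzero (x := 0) hS.tst.cont hS.tst.cs
    hS.rad_nonneg ?_
  simp only [rad, norm_zero, ne_eq, OfNat.ofNat_ne_zero, not_false_eq_true, zero_pow]
  exact hS0.ne'

lemma MemLp.hasCompactSupport_of_zero {Ω : Set (Eu n)} (hb : Bornology.IsBounded Ω) {u : Eu n → ℝ}
    (h : ∀ x, x ∉ Ω → u x = 0) : HasCompactSupport u := by
  refine HasCompactSupport.intro hb.isCompact_closure fun x hx => h x fun hx' => hx (subset_closure hx')

/-- The mollified absolute value of a solution. -/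
def mabs (u : Eu n → ℝ) (j : ℕ) : Eu n → ℝ := cv (fun x => |u x|) (moll j)

lemma Eig.abs_locInt {Ω : Set (Eu n)} {Λ κ : ℝ} {u : Eu n → ℝ} (h : Eig Ω Λ κ u) :
    LocallyIntegrable fun x => |u x| := MemLp.locInt h.memLp.norm

lemma Eig.mabs_tst {Ω : Set (Eu n)} (hb : Bornology.IsBounded Ω) {Λ κ : ℝ} {u : Eu n → ℝ}
    (h : Eig Ω Λ κ u) (j : ℕ) : Tst (mabs u j) := by
  refine ⟨cv_contDiff h.abs_locInt (moll_tst j), cv_cs (MemLp.hasCompactSupport_of_zero hb ?_) (moll_tst j).cs⟩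
  intro x hx
  rw [h.zero x hx, abs_zero]

lemma mabs_nonneg (u : Eu n → ℝ) (j : ℕ) (x : Eu n) : 0 ≤ mabs u j x :=
  integral_nonneg fun _ => mul_nonneg (abs_nonneg _) (moll_nonneg j _)

lemma Eig.lap_mabs {Ω : Set (Eu n)} {Λ κ : ℝ} {u : Eu n → ℝ}
    (h : Eig Ω Λ κ u) (j : ℕ) (x : Eu n) : -(Λ * |κ|) - Λ * mabs u j x ≤ lap (mabs u j) x := by
  have hk := moll_tst (n := n) j
  have h1 := h.sub _ (hk.comp_sub x) fun _ => moll_nonneg j _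
  simp_rw [lap_comp_sub hk, mul_add] at h1
  rw [integral_add (cv_integrable h.abs_locInt hk.lap.cont hk.lap.cs x),
    integral_sub_left_eq_self (fun y => moll j y), moll_integral] at h1
  · have e : ∫ y, |u y| * (Λ * moll j (x - y)) = Λ * mabs u j x := by
      rw [mabs, cv, ← integral_const_mul]; congr 1; funext y; ring
    rw [e] at h1
    rw [mabs, lap_cv h.abs_locInt hk]
    change _ ≤ cv (fun x => |u x|) (lap (moll j)) x + _ at h1
    unfold mabs at h1
    linarith
  · exact ((cv_integrable h.abs_locInt hk.cont hk.cs x).const_mul Λ).congr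
      (Eventually.of_forall fun y => by ring)

theorem exists_sup_bound {Ω : Set (Eu n)} (hb : Bornology.IsBounded Ω) {Λ₁ : ℝ} (hΛ₁ : 0 ≤ Λ₁) :
    ∃ C, 0 ≤ C ∧ ∀ Λ κ u, 0 ≤ Λ → Λ ≤ Λ₁ → |κ| ≤ 1 → Eig Ω Λ κ u → ∀ j x, mabs u j x ≤ C := by
  obtain ⟨S, hS, hS0⟩ := exists_prof
  obtain ⟨χ, hχ, hχ1⟩ := exists_cutoff hb
  set I := ∫ z : Eu n, rad S z
  have hI : 0 < I := rad_integral_pos hS hS0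
  set J := ∫ z : Eu n, rad (nxt S) z
  have hJ : 0 ≤ J := integral_nonneg fun z => hS.nxt.rad_nonneg z
  set X := √(∫ x, χ x ^ 2)
  have hX : 0 ≤ X := Real.sqrt_nonneg _
  obtain ⟨r, hr, hrΛ⟩ : ∃ r > 0, r ^ 2 * (Λ₁ * J) ≤ I := by
    refine ⟨√(I / (Λ₁ * J + 1)), Real.sqrt_pos.2 (by positivity), ?_⟩
    rw [Real.sq_sqrt (by positivity), div_mul_eq_mul_div, div_le_iff₀ (by positivity)]
    nlinarith
  refine ⟨(4 * ((r ^ n)⁻¹ * X + r ^ 2 / 4 * (Λ₁ * J)) / I), by positivity, fun Λ κ u h0 h1 hκ h j x => ?_⟩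
  have hT := h.mabs_tst hb j
  obtain ⟨x₀, hx₀⟩ := hT.cont.exists_forall_ge_of_hasCompactSupport hT.cs
  refine (hx₀ x).trans ?_
  set W := mabs u j
  set M := W x₀
  have hM : 0 ≤ M := mabs_nonneg u j x₀
  have hmass : ∫ y, W y ≤ X := by
    have hu : Integrable fun x => |u x| :=
      (MemLp.integrable_mul h.memLp.norm hχ.memLp2).congr (Eventually.of_forall fun x => by
        by_cases hx : x ∈ Ω
        · simp [hχ1 x hx]
        · simp [h.zero x hx])
    have e : ∫ y, W y = (∫ y, |u y|) * ∫ y : Eu n, moll j y :=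
      integral_convolution (ContinuousLinearMap.mul ℝ ℝ) hu (moll_tst j).int
    rw [e, moll_integral, mul_one]
    have e2 := sq_integral_mul_le h.memLp.norm hχ.memLp2
    have e3 : ∫ x, ‖u x‖ * χ x = ∫ x, |u x| := by
      refine integral_congr_ae (Eventually.of_forall fun x => ?_)
      by_cases hx : x ∈ Ω
      · simp [hχ1 x hx]
      · simp [h.zero x hx]
    simp only [Real.norm_eq_abs, sq_abs, h.norm, one_mul] at e2 e3
    rw [e3] at e2
    exact (le_abs_self _).trans (Real.abs_le_sqrt e2)
  set c := (Λ * M + Λ) * J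
  have hmono : MonotoneOn (fun s => avg S W x₀ s + s ^ 2 / 4 * c) (Ici 0) := by
    have hd : ∀ s, HasDerivAt (fun s => avg S W x₀ s + s ^ 2 / 4 * c)
        (s / 2 * (∫ z, lap W (x₀ + s • z) * rad (nxt S) z) + s / 2 * c) s := fun s => by
      refine (avg_hasDerivAt hS hT x₀ s).add ?_
      have := ((hasDerivAt_pow 2 s).div_const 4).mul_const c
      exact this.congr_deriv (by push_cast; ring)
    refine monotoneOn_of_deriv_nonneg (convex_Ici 0) (fun s _ => (hd s).continuousAt.continuousWithinAt)
      (fun s _ => (hd s).differentiableAt.differentiableWithinAt) fun s hs => ?_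
    rw [(hd s).deriv, ← mul_add]
    rw [interior_Ici] at hs
    refine mul_nonneg (by linarith [mem_Ioi.1 hs]) ?_
    have e : ∫ z : Eu n, -(Λ * M + Λ) * rad (nxt S) z ≤ ∫ z, lap W (x₀ + s • z) * rad (nxt S) z := by
      refine integral_mono (hS.nxt.tst.int.const_mul _)
        (Tst.mul_left (contDiff_affine hT.lap.smooth x₀ s) hS.nxt.tst).int fun z => ?_
      refine mul_le_mul_of_nonneg_right ?_ (hS.nxt.rad_nonneg z)
      have a := h.lap_mabs j (x₀ + s • z)
      have b := mul_le_mul_of_nonneg_left (hx₀ (x₀ + s • z)) h0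
      have b' := mul_le_mul_of_nonneg_left hκ h0
      change _ ≤ lap W _ at a
      change Λ * W (x₀ + s • z) ≤ Λ * M at b
      change -(Λ * |κ|) - Λ * W (x₀ + s • z) ≤ _ at a
      linarith
    rw [integral_const_mul] at e
    simp only [c]
    linarith
  have h2 := hmono (mem_Ici.2 le_rfl) (show r ∈ Ici (0:ℝ) from hr.le) hr.le
  simp only [avg_zero_radius] at h2
  have h3 : avg S W x₀ r ≤ (r ^ n)⁻¹ * X := by
    have e : ∫ z, W (x₀ + r • z) = (r ^ n)⁻¹ * ∫ y, W y := by
      have := integral_affine W hr x₀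
      rw [← this]
      congr 1; funext z; rw [add_comm]
    have e1 : avg S W x₀ r ≤ ∫ z, W (x₀ + r • z) := by
      refine integral_mono (Tst.mul_left (contDiff_affine hT.smooth x₀ r) hS.tst).int ?_ fun z => ?_
      · have := (hT.int.comp_add_left x₀).comp_smul hr.ne'
        exact this
      · exact mul_le_of_le_one_right (mabs_nonneg u j _) (hS.le_one _ (sq_nonneg _))
    rw [e] at e1
    exact e1.trans (mul_le_mul_of_nonneg_left hmass (by positivity))
  rw [le_div_iff₀ hI]
  have h4 : r ^ 2 / 4 * c ≤ M * I / 4 + r ^ 2 / 4 * (Λ₁ * J) := by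
    have e1 : Λ * J ≤ Λ₁ * J := mul_le_mul_of_nonneg_right h1 hJ
    have e2 := mul_le_mul_of_nonneg_left e1 (sq_nonneg r)
    have e3 := mul_le_mul_of_nonneg_left (e2.trans hrΛ) hM
    simp only [c]
    nlinarith
  change M * I + _ ≤ _ at h2
  nlinarith

/-- The gradient vector. -/
def gr (g : Eu n → ℝ) (x : Eu n) : Eu n := (InnerProductSpace.toDual ℝ (Eu n)).symm (fderiv ℝ g x)

lemma inner_gr (g : Eu n → ℝ) (x v : Eu n) : ⟪gr g x, v⟫ = fderiv ℝ g x v :=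
  InnerProductSpace.toDual_symm_apply

lemma norm_gr (g : Eu n → ℝ) (x : Eu n) : ‖gr g x‖ = ‖fderiv ℝ g x‖ :=
  LinearIsometryEquiv.norm_map _ _

lemma contDiff_gr {g : Eu n → ℝ} (hg : ContDiff ℝ ∞ g) : ContDiff ℝ ∞ (gr g) :=
  (InnerProductSpace.toDual ℝ (Eu n)).symm.contDiff.comp (hg.fderiv_right (by simp))

lemma sum_pd_sq (g : Eu n → ℝ) (x : Eu n) : ∑ i, pd i g x ^ 2 = ‖gr g x‖ ^ 2 := by
  rw [EuclideanSpace.real_norm_sq_eq]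
  refine Finset.sum_congr rfl fun i _ => ?_
  have : pd i g x = ⟪gr g x, bv i⟫ := (inner_gr g x _).symm
  rw [this, bv, EuclideanSpace.inner_single_right]
  simp

lemma fderiv_gr (g : Eu n → ℝ) (x : Eu n) : fderiv ℝ g x (gr g x) = ‖gr g x‖ ^ 2 := by
  rw [← inner_gr, real_inner_self_eq_norm_sq]

lemma exists_lip {G : Type*} [NormedAddCommGroup G] [NormedSpace ℝ G] {F : Eu n → G}
    (hF : ContDiff ℝ ∞ F) (R : ℝ) :
    ∃ L, ∀ x y, ‖x‖ ≤ R → ‖y‖ ≤ R → ‖F x - F y‖ ≤ L * ‖x - y‖ := by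
  obtain ⟨L, hL⟩ := (isCompact_closedBall (0 : Eu n) R).exists_bound_of_continuousOn
    (hF.continuous_fderiv (by simp)).continuousOn
  refine ⟨L, fun x y hx hy => (convex_closedBall (0 : Eu n) R).norm_image_sub_le_of_norm_fderiv_le
    (fun z _ => hF.differentiable (by simp) z) hL ?_ ?_⟩
  · simpa using hy
  · simpa using hx

/-- Quantitative bounds for a defining function. -/
structure Geo (g : Eu n → ℝ) (R L a t : ℝ) : Prop where
  sm : ContDiff ℝ ∞ g
  one_le : 1 ≤ L
  a_pos : 0 < a
  t_pos : 0 < t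
  t_le : t ≤ 1
  bdd : ∀ x, -t ≤ g x → ‖x‖ ≤ R
  lip : ∀ x y, ‖x‖ ≤ R + 1 → ‖y‖ ≤ R + 1 → |g x - g y| ≤ L * ‖x - y‖
  glip : ∀ x y, ‖x‖ ≤ R + 1 → ‖y‖ ≤ R + 1 → ‖gr g x - gr g y‖ ≤ L * ‖x - y‖
  lap_le : ∀ x, ‖x‖ ≤ R + 1 → |lap g x| ≤ L
  gr_le : ∀ x, ‖x‖ ≤ R + 1 → ‖gr g x‖ ≤ L
  val : ∀ x, ‖x‖ ≤ R + 1 → |g x| ≤ L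
  reg : ∀ x, |g x| ≤ t → a ≤ ‖gr g x‖ ^ 2
  near : ∀ x, 0 < g x → ∃ x₀, g x₀ = 0 ∧ ‖x - x₀‖ ≤ g x

lemma DefFn.exists_geo {c : Set (Eu n)} {g : Eu n → ℝ} (hg : DefFn c g) (hc : IsCompact c)
    (hne : c.Nonempty) : ∃ R L a t, Geo g R L a t := by
  obtain ⟨R₀, hR₀⟩ := hg.neg
  obtain ⟨R₁, hR₁⟩ := hc.isBounded.subset_ball 0
  set R := max R₀ R₁
  obtain ⟨L₁, h1⟩ := exists_lip hg.sm (R + 1)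
  obtain ⟨L₂, h2⟩ := exists_lip (contDiff_gr hg.sm) (R + 1)
  have hcp := isCompact_closedBall (0 : Eu n) (R + 1)
  obtain ⟨L₃, h3⟩ := hcp.exists_bound_of_continuousOn (contDiff_lap hg.sm).continuous.continuousOn
  obtain ⟨L₄, h4⟩ := hcp.exists_bound_of_continuousOn (contDiff_gr hg.sm).continuous.continuousOn
  obtain ⟨L₅, h5⟩ := hcp.exists_bound_of_continuousOn hg.sm.continuous.continuousOn
  obtain ⟨t, ht, htN⟩ := hg.exists_collar hc hne (N := {x | gr g x ≠ 0} ∩ Metric.ball 0 R₁)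
    ((isOpen_ne_fun (contDiff_gr hg.sm).continuous continuous_const).inter Metric.isOpen_ball)
    fun x hx => ⟨fun h0 => by
      have := hg.reg x ((hg.zero x).2 hx)
      rw [← norm_eq_zero, norm_gr, norm_eq_zero] at h0
      exact this h0, hR₁ hx⟩
  have hK : IsCompact {x : Eu n | |g x| ≤ t} := by
    refine (isCompact_closedBall (0 : Eu n) R₁).of_isClosed_subset
      (isClosed_le hg.sm.continuous.abs continuous_const) fun x hx => ?_
    exact Metric.ball_subset_closedBall (htN x hx).2
  obtain ⟨x₀, hx₀⟩ := hne
  obtain ⟨m, hm, hmin⟩ := hK.exists_isMinOn ⟨x₀, by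
    show |g x₀| ≤ t; rw [(hg.zero x₀).2 hx₀, abs_zero]; exact ht.le⟩
    ((contDiff_gr hg.sm).continuous.norm.pow 2).continuousOn
  set L := 1 + |L₁| + |L₂| + |L₃| + |L₄| + |L₅|
  have e1 := abs_nonneg L₁
  have e2 := abs_nonneg L₂
  have e3 := abs_nonneg L₃
  have e4 := abs_nonneg L₄
  have e5 := abs_nonneg L₅
  have f1 := le_abs_self L₁
  have f2 := le_abs_self L₂
  have f3 := le_abs_self L₃
  have f4 := le_abs_self L₄
  have f5 := le_abs_self L₅
  refine ⟨R, L, ‖gr g m‖ ^ 2, min t 1, hg.sm, ?_, ?_, lt_min ht one_pos, min_le_right _ _, ?_, ?_, ?_, ?_, ?_, ?_, ?_, ?_⟩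
  · simp only [L]; linarith
  · have := norm_pos_iff.2 (htN m hm).1
    positivity
  · intro x hx
    by_cases h : |g x| ≤ t
    · have := (htN x h).2
      rw [mem_ball_zero_iff] at this
      exact this.le.trans (le_max_right _ _)
    · by_contra hcon
      have h6 := hR₀ x ((le_max_left _ _).trans (not_le.1 hcon).le)
      rw [abs_of_neg h6] at h
      linarith [min_le_left t 1]
  · intro x y hx hy
    refine (h1 x y hx hy).trans (mul_le_mul_of_nonneg_right ?_ (norm_nonneg _))
    simp only [L]; linarith
  · intro x y hx hy
    refine (h2 x y hx hy).trans (mul_le_mul_of_nonneg_right ?_ (norm_nonneg _))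
    simp only [L]; linarith
  · intro x hx
    have := h3 x (by simpa using hx)
    rw [Real.norm_eq_abs] at this
    simp only [L]; linarith
  · intro x hx
    have := h4 x (by simpa using hx)
    simp only [L]; linarith
  · intro x hx
    have := h5 x (by simpa using hx)
    rw [Real.norm_eq_abs] at this
    simp only [L]; linarith
  · intro x hx
    exact hmin (show |g x| ≤ t from hx.trans (min_le_left _ _))
  · intro x hx
    obtain ⟨y, hy, hxy⟩ := hc.exists_infDist_eq_dist ⟨x₀, hx₀⟩ x
    refine ⟨y, (hg.zero y).2 hy, ?_⟩
    have := hg.dist x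
    rw [hxy, abs_of_pos hx, dist_eq_norm] at this
    exact this

section
variable {g : Eu n → ℝ} {R L a t : ℝ}

lemma Geo.isOpen_pos (h : Geo g R L a t) : IsOpen {x | 0 < g x} :=
  isOpen_lt continuous_const h.sm.continuous

lemma Geo.isBounded_pos (h : Geo g R L a t) : Bornology.IsBounded {x | 0 < g x} :=
  (Metric.isBounded_closedBall (x := (0 : Eu n)) (r := R)).subset fun x hx => by
    rw [mem_closedBall_zero_iff]
    exact h.bdd x ((neg_nonpos.2 h.t_pos.le).trans (le_of_lt hx))

lemma Geo.isCompact_Icc (h : Geo g R L a t) {s : ℝ} (hs : -t ≤ s) (r : ℝ) :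
    IsCompact {x | s ≤ g x ∧ g x ≤ r} := by
  refine (isCompact_closedBall (0 : Eu n) R).of_isClosed_subset
    ((isClosed_le continuous_const h.sm.continuous).inter (isClosed_le h.sm.continuous continuous_const))
    fun x hx => ?_
  rw [mem_closedBall_zero_iff]
  exact h.bdd x (hs.trans hx.1)

lemma Geo.isCompact_ge (h : Geo g R L a t) {s : ℝ} (hs : -t ≤ s) :
    IsCompact {x | s ≤ g x} := by
  refine (isCompact_closedBall (0 : Eu n) R).of_isClosed_subset
    (isClosed_le continuous_const h.sm.continuous) fun x hx => ?_
  rw [mem_closedBall_zero_iff]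
  exact h.bdd x (hs.trans hx)

/-- The Laplacian of a quadratic expression in the defining function. -/
lemma lap_quad (hg : ContDiff ℝ ∞ g) (p q r : ℝ) (x : Eu n) :
    lap (fun y => p + q * g y + r * g y ^ 2) x
      = (q + 2 * r * g x) * lap g x + 2 * r * ‖gr g x‖ ^ 2 := by
  have hφ : ContDiff ℝ ∞ fun s : ℝ => p + q * s + r * s ^ 2 := by fun_prop
  have d1 : ∀ s : ℝ, deriv (fun s : ℝ => p + q * s + r * s ^ 2) s = q + 2 * r * s := fun s => by
    have := (((hasDerivAt_id s).const_mul q).const_add p).add ((hasDerivAt_pow 2 s).const_mul r)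
    refine (this.congr_deriv ?_).deriv
    push_cast; ring
  have d2 : ∀ s : ℝ, deriv (deriv fun s : ℝ => p + q * s + r * s ^ 2) s = 2 * r := fun s => by
    have : (deriv fun s : ℝ => p + q * s + r * s ^ 2) = fun s => q + 2 * r * s := funext d1
    rw [this]
    have := ((hasDerivAt_id s).const_mul (2 * r)).const_add q
    refine (this.congr_deriv ?_).deriv
    ring
  have := lap_comp hφ (smAt_of_contDiff hg x)
  rw [d1, d2, sum_pd_sq] at this
  exact this

end

section
variable {g : Eu n → ℝ} {R L a t : ℝ}

/-- Coefficient of the quadratic correction in the boundary barriers. -/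
def bq (L a : ℝ) : ℝ := (2 * L + 1) / (2 * a)

lemma Geo.bq_pos (h : Geo g R L a t) : 0 < bq L a :=
  div_pos (by linarith [h.one_le]) (by linarith [h.a_pos])

lemma Geo.bq_mul (h : Geo g R L a t) : 2 * bq L a * a = 2 * L + 1 := by
  have := h.a_pos
  unfold bq
  field_simp

lemma Geo.norm_le (h : Geo g R L a t) {x : Eu n} (hx : -t ≤ g x) : ‖x‖ ≤ R + 1 := by
  linarith [h.bdd x hx]

lemma Geo.lap_upper (h : Geo g R L a t) {A η : ℝ} (hA : 0 ≤ A) {x : Eu n} (hx : |g x| ≤ t)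
    (h0 : 0 ≤ g x + η) (h1 : 2 * bq L a * (g x + η) ≤ 1) :
    lap (fun y => A * (g y + η - bq L a * (g y + η) ^ 2)) x ≤ -A := by
  have e : (fun y => A * (g y + η - bq L a * (g y + η) ^ 2))
      = fun y => A * (η - bq L a * η ^ 2) + A * (1 - 2 * bq L a * η) * g y
        + -(A * bq L a) * g y ^ 2 := by ext; ring
  rw [e, lap_quad h.sm]
  have h2 := h.reg x hx
  have h3 := abs_le.1 (h.lap_le x (h.norm_le (abs_le.1 hx).1))
  have h4 := h.bq_pos
  have h5 := h.bq_mul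
  have h6 : 0 ≤ 2 * bq L a * (g x + η) := by positivity
  have h7 : bq L a * a ≤ bq L a * ‖gr g x‖ ^ 2 := mul_le_mul_of_nonneg_left h2 h4.le
  have h8 : (1 - 2 * bq L a * (g x + η)) * lap g x ≤ L := by
    have : (1 - 2 * bq L a * (g x + η)) * lap g x ≤ (1 - 2 * bq L a * (g x + η)) * L :=
      mul_le_mul_of_nonneg_left h3.2 (by linarith)
    nlinarith [h.one_le]
  have h9 : (1 - 2 * bq L a * (g x + η)) * lap g x - 2 * (bq L a * ‖gr g x‖ ^ 2) ≤ -1 := by linarith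
  have := mul_le_mul_of_nonneg_left h9 hA
  linarith

lemma Geo.lap_lower (h : Geo g R L a t) {β : ℝ} (hβ : 0 ≤ β) {x : Eu n} (hx : |g x| ≤ t)
    (h0 : 0 ≤ g x) (h1 : 2 * bq L a * g x ≤ 1) :
    β ≤ lap (fun y => β * (g y + bq L a * g y ^ 2)) x := by
  have e : (fun y => β * (g y + bq L a * g y ^ 2))
      = fun y => 0 + β * g y + β * bq L a * g y ^ 2 := by ext; ring
  rw [e, lap_quad h.sm]
  have h2 := h.reg x hx
  have h3 := abs_le.1 (h.lap_le x (h.norm_le (abs_le.1 hx).1))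
  have h4 := h.bq_pos
  have h5 := h.bq_mul
  have h6 : 0 ≤ 2 * bq L a * g x := by positivity
  have h7 : bq L a * a ≤ bq L a * ‖gr g x‖ ^ 2 := mul_le_mul_of_nonneg_left h2 h4.le
  have h8 : -(2 * L) ≤ (1 + 2 * bq L a * g x) * lap g x := by
    have : (1 + 2 * bq L a * g x) * -L ≤ (1 + 2 * bq L a * g x) * lap g x :=
      mul_le_mul_of_nonneg_left h3.1 (by linarith)
    nlinarith [h.one_le]
  have h9 : 1 ≤ (1 + 2 * bq L a * g x) * lap g x + 2 * (bq L a * ‖gr g x‖ ^ 2) := by linarith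
  have := mul_le_mul_of_nonneg_left h9 hβ
  linarith

theorem Geo.exists_linear_bound (h : Geo g R L a t) {Λ₁ : ℝ} (hΛ₁ : 0 ≤ Λ₁) :
    ∃ A, 0 < A ∧ ∀ Λ κ u, 0 ≤ Λ → Λ ≤ Λ₁ → |κ| ≤ 1 → Eig {x | 0 < g x} Λ κ u →
      ∀ x, 0 < g x → |u x| ≤ A * g x := by
  obtain ⟨C, hC0, hC⟩ := exists_sup_bound h.isBounded_pos hΛ₁
  have hq := h.bq_pos
  have hL := h.one_le
  set t₁ := min t (1 / (4 * bq L a))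
  have ht₁ : 0 < t₁ := lt_min h.t_pos (by positivity)
  have ht₁t : t₁ ≤ t := min_le_left _ _
  have ht₁q : 2 * bq L a * (t₁ + t₁) ≤ 1 := by
    have : t₁ ≤ 1 / (4 * bq L a) := min_le_right _ _
    rw [le_div_iff₀ (by positivity)] at this
    linarith
  set A := Λ₁ * C + Λ₁ + 1 + 2 * C / t₁
  have hA1 : Λ₁ * C + Λ₁ + 1 ≤ A := le_add_of_nonneg_right (by positivity)
  have hA2 : 2 * C ≤ A * t₁ := by
    have : 2 * C / t₁ ≤ A := le_add_of_nonneg_left (by positivity)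
    rwa [div_le_iff₀ ht₁] at this
  have hA : 0 < A := by positivity
  refine ⟨A, hA, fun Λ κ u hΛ hΛ1 hκ hu => ?_⟩
  have key : ∀ η, 0 < η → η ≤ t₁ → ∀ j : ℕ, L * (1 / (j + 1 : ℝ)) ≤ η →
      ∀ x, -η ≤ g x → g x ≤ t₁ → mabs u j x ≤ A * (g x + η - bq L a * (g x + η) ^ 2) := by
    intro η hη hηt j hj x hx1 hx2
    have hW0 : ∀ x, g x = -η → mabs u j x = 0 := by
      intro x hx
      refine integral_eq_zero_of_ae (Eventually.of_forall fun y => ?_)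
      show |u y| * moll j (x - y) = 0
      by_cases hy : 0 < g y
      · rw [moll_zero j, mul_zero]
        have := h.lip y x (h.norm_le (by linarith [h.t_pos])) (h.norm_le (by linarith))
        rw [hx] at this
        have h1 := (le_abs_self _).trans this
        rw [norm_sub_rev] at h1
        have : L * (1 / (j + 1 : ℝ)) < L * ‖x - y‖ := by linarith
        exact (lt_of_mul_lt_mul_left this (by linarith)).le
      · rw [hu.zero y hy, abs_zero, zero_mul]
    have hT := hu.mabs_tst h.isBounded_pos j
    have hB : ContDiff ℝ ∞ fun y => A * (g y + η - bq L a * (g y + η) ^ 2) := by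
      have := h.sm
      fun_prop
    have := max_principle (K := {x | -η ≤ g x ∧ g x ≤ t₁}) (O := {x | -η < g x ∧ g x < t₁})
      (φ := fun x => mabs u j x - A * (g x + η - bq L a * (g x + η) ^ 2))
      (h.isCompact_Icc (by linarith) _)
      ((isOpen_lt continuous_const h.sm.continuous).inter (isOpen_lt h.sm.continuous continuous_const))
      (fun x hx => ⟨hx.1.le, hx.2.le⟩) (hT.smooth.continuous.sub hB.continuous).continuousOn
      (fun x _ => (smAt_of_contDiff hT.smooth x).sub (smAt_of_contDiff hB x)) ?_ ?_ x ⟨hx1, hx2⟩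
    · simpa using this
    · intro x ⟨h1, h2⟩
      rw [lap_sub (smAt_of_contDiff hT.smooth x) (smAt_of_contDiff hB x)]
      have e1 := h.lap_upper (η := η) hA.le (x := x) (abs_le.2 ⟨by linarith, by linarith⟩)
        (by linarith) (by nlinarith)
      have e2 := hu.lap_mabs j x
      have e3 : Λ * |κ| ≤ Λ₁ * 1 := mul_le_mul hΛ1 hκ (abs_nonneg _) hΛ₁
      have e4 : Λ * mabs u j x ≤ Λ₁ * C :=
        mul_le_mul hΛ1 (hC Λ κ u hΛ hΛ1 hκ hu j x) (mabs_nonneg u j x) hΛ₁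
      linarith
    · intro x ⟨h1, h2⟩ h3
      rcases h1.eq_or_lt with h4 | h4
      · rw [hW0 x h4.symm, ← h4]
        simp
      · have h5 : g x = t₁ := le_antisymm h2 (not_lt.1 fun h6 => h3 ⟨h4, h6⟩)
        have e4 := hC Λ κ u hΛ hΛ1 hκ hu j x
        rw [h5]
        have h6 : (t₁ + η) * (2 * bq L a * (t₁ + η)) ≤ (t₁ + η) * 1 :=
          mul_le_mul_of_nonneg_left (le_trans (by gcongr) ht₁q) (by linarith)
        have h7 : A * (t₁ / 2) ≤ A * (t₁ + η - bq L a * (t₁ + η) ^ 2) :=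
          mul_le_mul_of_nonneg_left (by linarith) hA.le
        show mabs u j x - _ ≤ 0
        linarith
  have hη : ∀ m : ℕ, ∀ᶠ j : ℕ in atTop, L * (1 / (j + 1 : ℝ)) ≤ t₁ / (m + 1) := fun m => by
    have : Tendsto (fun j : ℕ => L * (1 / (j + 1 : ℝ))) atTop (𝓝 (L * 0)) :=
      tendsto_one_div_add_atTop_nhds_zero_nat.const_mul L
    rw [mul_zero] at this
    exact (this.eventually_lt_const (by positivity)).mono fun _ h => h.le
  have hae : ∀ᵐ x, 0 < g x → |u x| ≤ A * g x := by
    filter_upwards [cv_moll_ae_tendsto hu.abs_locInt] with x hx hgx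
    by_cases hxt : g x ≤ t₁
    · have h1 : ∀ m : ℕ, |u x| ≤ A * (g x + t₁ / (m + 1)) := fun m => by
        have hm : t₁ / (m + 1) ≤ t₁ := div_le_self ht₁.le (by linarith [(Nat.cast_nonneg m : (0:ℝ) ≤ m)])
        refine le_of_tendsto hx ((hη m).mono fun j hj => ?_)
        have := key (t₁ / (m + 1)) (by positivity) hm j hj x (by
          have : 0 < t₁ / (m + 1) := by positivity
          linarith) hxt
        refine this.trans (mul_le_mul_of_nonneg_left ?_ hA.le)
        have : 0 ≤ bq L a * (g x + t₁ / (m + 1)) ^ 2 := by positivity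
        linarith
      have h2 : Tendsto (fun m : ℕ => A * (g x + t₁ / (m + 1 : ℝ))) atTop (𝓝 (A * (g x + 0))) := by
        refine (Tendsto.const_add _ ?_).const_mul A
        have := (tendsto_one_div_add_atTop_nhds_zero_nat (𝕜 := ℝ)).const_mul t₁
        rw [mul_zero] at this
        refine this.congr fun m => by ring
      rw [add_zero] at h2
      exact ge_of_tendsto' h2 h1
    · have h1 : |u x| ≤ C := le_of_tendsto' hx fun j => hC Λ κ u hΛ hΛ1 hκ hu j x
      have h2 : A * t₁ ≤ A * g x := mul_le_mul_of_nonneg_left (not_le.1 hxt).le hA.le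
      linarith
  have hcu : ContinuousOn u {x | 0 < g x} := by
    have := hu.helm.continuousOn.add (continuousOn_const (c := κ))
    exact this.congr fun x _ => by simp
  have heq := Measure.eqOn_open_of_ae_eq (μ := volume) (U := {x | 0 < g x})
    (f := fun x => max (|u x| - A * g x) 0) (g := fun _ => 0) ?_ h.isOpen_pos
    ((hcu.abs.sub (h.sm.continuous.const_smul A).continuousOn).sup continuousOn_const)
    continuousOn_const
  · intro x hx
    have := heq hx
    linarith [max_eq_right_iff.1 this]
  · rw [EventuallyEq, ae_restrict_iff' h.isOpen_pos.measurableSet]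
    filter_upwards [hae] with x hx hgx
    exact max_eq_right (by linarith [hx hgx])

end

section
variable {g : Eu n → ℝ} {R L a t : ℝ}

lemma norm_fderiv_le {f : Eu n → ℝ} {x : Eu n} {M : ℝ} (h : ∀ i, |pd i f x| ≤ M) (hM : 0 ≤ M) :
    ‖fderiv ℝ f x‖ ≤ n * M := by
  refine ContinuousLinearMap.opNorm_le_bound _ (by positivity) fun v => ?_
  rw [fderiv_eq_sum, Real.norm_eq_abs]
  refine (Finset.abs_sum_le_sum_abs _ _).trans ?_
  have : ∀ i ∈ Finset.univ, |v i * pd i f x| ≤ ‖v‖ * M := fun i _ => by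
    rw [abs_mul]
    exact mul_le_mul (PiLp.norm_apply_le v i) (h i) (abs_nonneg _) (norm_nonneg _)
  refine (Finset.sum_le_card_nsmul _ _ _ this).trans (le_of_eq ?_)
  simp; ring

lemma Eig.diff {Ω : Set (Eu n)} {Λ κ : ℝ} {u : Eu n → ℝ} (h : Eig Ω Λ κ u) {x : Eu n} (hx : x ∈ Ω) :
    DifferentiableAt ℝ u x := by
  have := (h.helm.sm x hx).diff.add_const κ
  simpa using this

lemma Eig.smAt {Ω : Set (Eu n)} {Λ κ : ℝ} {u : Eu n → ℝ} (h : Eig Ω Λ κ u) {x : Eu n} (hx : x ∈ Ω) :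
    SmAt u x := by
  have := (h.helm.sm x hx).add (smAt_const κ x)
  simpa using this

theorem Geo.exists_gradient_le (i₀ : Fin n) (h : Geo g R L a t) {Λ₁ : ℝ} (hΛ₁ : 0 ≤ Λ₁) :
    ∃ C, 0 < C ∧ ∀ Λ κ u, 0 ≤ Λ → Λ ≤ Λ₁ → |κ| ≤ 1 → Eig {x | 0 < g x} Λ κ u →
      ∀ x, 0 < g x → ‖fderiv ℝ u x‖ ≤ C := by
  obtain ⟨A, hA, hAu⟩ := h.exists_linear_bound hΛ₁
  obtain ⟨C₀, hC₀, hG⟩ := exists_gradient_bound i₀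
  have hn : 0 < n := i₀.pos
  have hL := h.one_le
  set B := 1 + Λ₁
  have hB : 0 < B := by positivity
  refine ⟨n * (C₀ * (2 * L * B) * (2 * A)), by positivity, fun Λ κ u hΛ hΛ1 hκ hu x hx => ?_⟩
  refine norm_fderiv_le (fun i => ?_) (by positivity)
  have hgL : g x ≤ L := (le_abs_self _).trans (h.val x (h.norm_le (by linarith [h.t_pos])))
  set r := g x / (2 * L * B)
  have hr : 0 < r := by positivity
  have hrB : r * (2 * L * B) = g x := div_mul_cancel₀ _ (by positivity)
  have hr2 : r * (2 * B) ≤ 1 := by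
    have : L * (r * (2 * B)) ≤ L * 1 := by linarith
    exact le_of_mul_le_mul_left this (by linarith)
  have hr1 : r ≤ 1 := by
    have : r * (2 * B) = 2 * r + 2 * (r * Λ₁) := by simp only [B]; ring
    have : 0 ≤ r * Λ₁ := by positivity
    linarith
  have hrL : L * r ≤ g x / 2 := by
    have : r * (2 * L * B) = 2 * (L * r) + 2 * (L * r * Λ₁) := by simp only [B]; ring
    have : 0 ≤ L * r * Λ₁ := by positivity
    linarith
  have hxR := h.bdd x (by linarith [h.t_pos])
  have hball : ∀ y ∈ Metric.closedBall x r, g x / 2 ≤ g y ∧ g y ≤ 2 * g x := fun y hy => by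
    rw [mem_closedBall_iff_norm] at hy
    have hyR : ‖y‖ ≤ R + 1 := by
      have := norm_add_le x (y - x)
      rw [add_sub_cancel] at this
      linarith
    have := abs_le.1 ((h.lip y x hyR (by linarith)).trans
      ((mul_le_mul_of_nonneg_left hy (by linarith)).trans hrL))
    constructor <;> linarith [this.1, this.2]
  have := hG Λ r hΛ hr (by
    have e1 : r * Λ₁ ≤ 1 := by
      have : r * (2 * B) = 2 * r + 2 * (r * Λ₁) := by simp only [B]; ring
      have : 0 ≤ r * Λ₁ := by positivity
      linarith
    calc Λ * r ^ 2 ≤ Λ₁ * r ^ 2 := by gcongr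
      _ = (r * Λ₁) * r := by ring
      _ ≤ 1 * 1 := by gcongr
      _ = 1 := by ring) {x | 0 < g x} _ h.isOpen_pos hu.helm x
    (fun y hy => by
      show 0 < g y
      linarith [(hball y hy).1]) (-κ) (A * (2 * g x)) (fun y hy => by
        rw [sub_neg_eq_add, sub_add_cancel]
        exact (hAu Λ κ u hΛ hΛ1 hκ hu y (by linarith [(hball y hy).1])).trans
          (mul_le_mul_of_nonneg_left (hball y hy).2 hA.le)) i
  have e : pd i (fun x => u x - κ) x = pd i u x := by
    simp only [pd, fderiv_sub_const]
  rw [e] at this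
  refine this.trans (le_of_eq ?_)
  rw [← hrB]
  field_simp

/-- Uniform interior positivity of an equi-Lipschitz sequence converging to a positive function. -/
theorem Geo.eventually_ge (h : Geo g R L a t) {C : ℝ} {u : ℕ → Eu n → ℝ} {w : Eu n → ℝ}
    (hd : ∀ j x, 0 < g x → DifferentiableAt ℝ (u j) x)
    (hC : ∀ᶠ j in atTop, ∀ x, 0 < g x → ‖fderiv ℝ (u j) x‖ ≤ C)
    (hw : ContinuousOn w {x | 0 < g x}) (hw0 : ∀ x, 0 < g x → 0 < w x) (hL2 : L2T u w)
    {s : ℝ} (hs : 0 < s) : ∃ m, 0 < m ∧ ∀ᶠ j in atTop, ∀ x, s ≤ g x → m ≤ u j x := by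
  have hL := h.one_le
  by_cases hne : ({x | s / 2 ≤ g x} : Set (Eu n)).Nonempty
  swap
  · refine ⟨1, one_pos, Eventually.of_forall fun j x hx => ?_⟩
    exact absurd ⟨x, show s / 2 ≤ g x by linarith⟩ hne
  obtain ⟨y₀, hy₀, hmin⟩ := (h.isCompact_ge (s := s / 2) (by linarith [h.t_pos])).exists_isMinOn hne
    (hw.mono fun x hx => (by linarith : (0:ℝ) < s / 2).trans_le hx)
  set m := w y₀
  have hm : 0 < m := hw0 y₀ (lt_of_lt_of_le (by linarith) hy₀)
  set δ := min 1 (min (s / (2 * L)) (m / (4 * (|C| + 1))))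
  have hδ : 0 < δ := by positivity
  have hδ1 : δ ≤ 1 := min_le_left _ _
  have hδL : L * δ ≤ s / 2 := by
    have : δ ≤ s / (2 * L) := (min_le_right _ _).trans (min_le_left _ _)
    rw [le_div_iff₀ (by positivity)] at this
    linarith
  have hδC : |C| * δ ≤ m / 4 := by
    have : δ ≤ m / (4 * (|C| + 1)) := (min_le_right _ _).trans (min_le_right _ _)
    rw [le_div_iff₀ (by positivity)] at this
    linarith
  have hball : ∀ x, s ≤ g x → ∀ y ∈ Metric.ball x δ, s / 2 ≤ g y := fun x hx y hy => by
    rw [mem_ball_iff_norm] at hy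
    have hxR := h.bdd x (by linarith [h.t_pos])
    have hyR : ‖y‖ ≤ R + 1 := by
      have := norm_add_le x (y - x)
      rw [add_sub_cancel] at this
      linarith
    have := abs_le.1 ((h.lip y x hyR (by linarith)).trans
      ((mul_le_mul_of_nonneg_left hy.le (by linarith)).trans hδL))
    linarith [this.1]
  set V := (volume (Metric.ball (0 : Eu n) δ)).toReal
  have hV : 0 < V := ENNReal.toReal_pos (Metric.measure_ball_pos volume _ hδ).ne' measure_ball_lt_top.ne
  refine ⟨m / 4, by positivity, ?_⟩
  filter_upwards [hC, hL2.2.2.eventually_lt_const (show 0 < (m / 2) ^ 2 * V by positivity)] with j hj hInt x hx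
  by_contra! hcon
  have hlow : ∀ y ∈ Metric.ball x δ, (m / 2) ^ 2 ≤ (u j y - w y) ^ 2 := fun y hy => by
    have h1 : ‖u j y - u j x‖ ≤ C * ‖y - x‖ :=
      (convex_ball x δ).norm_image_sub_le_of_norm_fderiv_le (𝕜 := ℝ)
        (fun z hz => hd j z (by linarith [hball x hx z hz]))
        (fun z hz => hj z (by linarith [hball x hx z hz])) (Metric.mem_ball_self hδ) hy
    have h2 : C * ‖y - x‖ ≤ |C| * δ :=
      mul_le_mul (le_abs_self _) (mem_ball_iff_norm.1 hy).le (norm_nonneg _) (abs_nonneg _)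
    have h3 := (le_abs_self _).trans h1
    have h4 : m ≤ w y := hmin (hball x hx y hy)
    have h5 : m / 2 ≤ w y - u j y := by linarith
    nlinarith
  have hsq := integrable_sq_sub (hL2.1 j) hL2.2.1
  have h1 : ∫ y in Metric.ball x δ, (m / 2) ^ 2 ≤ ∫ y, (u j y - w y) ^ 2 :=
    (setIntegral_mono_on (integrableOn_const measure_ball_lt_top.ne) hsq.integrableOn
      measurableSet_ball hlow).trans (setIntegral_le_integral hsq (Eventually.of_forall fun _ => sq_nonneg _))
  rw [setIntegral_const, smul_eq_mul, Measure.real, Measure.addHaar_ball_center] at h1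
  linarith

end

section
variable {g : Eu n → ℝ} {R L a t : ℝ}

lemma Eig.lap_eq {Ω : Set (Eu n)} {Λ κ : ℝ} {u : Eu n → ℝ} (h : Eig Ω Λ κ u) {x : Eu n} (hx : x ∈ Ω) :
    lap u x = -Λ * (u x - κ) := by
  rw [← h.helm.eq x hx, lap_sub (h.smAt hx) (smAt_const κ x), lap_const, sub_zero]

lemma continuous_of_linear_bound (hg : Continuous g) {u : Eu n → ℝ} {A : ℝ}
    (h0 : ∀ x, ¬ 0 < g x → u x = 0) (hA : ∀ x, 0 < g x → |u x| ≤ A * g x)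
    (hc : ContinuousOn u {x | 0 < g x}) : Continuous u := by
  rw [continuous_iff_continuousAt]
  intro x
  by_cases hx : 0 < g x
  · exact hc.continuousAt ((isOpen_lt continuous_const hg).mem_nhds hx)
  · rw [ContinuousAt, h0 x hx]
    refine squeeze_zero_norm (a := fun y => A * max (g y) 0) (fun y => ?_) ?_
    · by_cases hy : 0 < g y
      · rw [max_eq_left hy.le]; exact hA y hy
      · rw [h0 y hy, norm_zero, max_eq_right (not_lt.1 hy), mul_zero]
    · have : Continuous fun y => A * max (g y) 0 := by fun_prop
      have := this.tendsto x
      rwa [max_eq_right (not_lt.1 hx), mul_zero] at this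

theorem Geo.eventually_neg_le (h : Geo g R L a t) {Λ₁ : ℝ} (hΛ₁ : 0 ≤ Λ₁) {Λ κ : ℕ → ℝ}
    {u : ℕ → Eu n → ℝ} (hu : ∀ j, Eig {x | 0 < g x} (Λ j) (κ j) (u j)) (hΛ : ∀ j, 0 < Λ j)
    (hΛ1 : ∀ j, Λ j ≤ Λ₁) (hκ0 : Tendsto κ atTop (𝓝 0))
    (hge : ∀ s, 0 < s → ∃ m, 0 < m ∧ ∀ᶠ j in atTop, ∀ x, s ≤ g x → m ≤ u j x) {ε : ℝ} (hε : 0 < ε) :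
    ∀ᶠ j in atTop, ∀ x, 0 < g x → -ε ≤ u j x := by
  obtain ⟨A, hA, hAu⟩ := h.exists_linear_bound hΛ₁
  obtain ⟨m, hm, hmu⟩ := hge (ε / A) (by positivity)
  have hκ1 : ∀ᶠ j in atTop, |κ j| < 1 := by
    have := hκ0.abs
    rw [abs_zero] at this
    exact this.eventually_lt_const one_pos
  filter_upwards [hmu, hκ1] with j h1 h2 x hx
  by_cases hs : ε / A ≤ g x
  · linarith [h1 x hs]
  · have := (abs_le.1 (hAu _ _ _ (hΛ j).le (hΛ1 j) h2.le (hu j) x hx)).1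
    have h3 : A * g x ≤ ε := by
      rw [not_le, lt_div_iff₀ hA] at hs
      linarith
    linarith

theorem Geo.linear_lower (h : Geo g R L a t) {Λ₁ : ℝ} (hΛ₁ : 0 ≤ Λ₁) {Λ κ : ℕ → ℝ}
    {u : ℕ → Eu n → ℝ} (hu : ∀ j, Eig {x | 0 < g x} (Λ j) (κ j) (u j)) (hΛ : ∀ j, 0 < Λ j)
    (hΛ1 : ∀ j, Λ j ≤ Λ₁) (hκ : ∀ j, 0 < κ j) (hκ0 : Tendsto κ atTop (𝓝 0))
    (hge : ∀ s, 0 < s → ∃ m, 0 < m ∧ ∀ᶠ j in atTop, ∀ x, s ≤ g x → m ≤ u j x) :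
    ∃ β t₁, 0 < β ∧ 0 < t₁ ∧ t₁ ≤ t ∧ ∀ᶠ j in atTop, ∀ x, 0 < g x → g x ≤ t₁ → β * g x ≤ u j x := by
  obtain ⟨A, hA, hAu⟩ := h.exists_linear_bound hΛ₁
  have hq := h.bq_pos
  have hL := h.one_le
  set t₁ := min t (1 / (2 * bq L a))
  have ht₁ : 0 < t₁ := lt_min h.t_pos (by positivity)
  have ht₁t : t₁ ≤ t := min_le_left _ _
  have ht₁q : 2 * bq L a * t₁ ≤ 1 := by
    have : t₁ ≤ 1 / (2 * bq L a) := min_le_right _ _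
    rw [le_div_iff₀ (by positivity)] at this
    linarith
  obtain ⟨m, hm, hmu⟩ := hge t₁ ht₁
  set β := m / (2 * t₁)
  have hβ : 0 < β := by positivity
  have hβm : β * t₁ * 2 = m := by simp only [β]; field_simp
  set ε := β / (4 * (Λ₁ + 1))
  have hε : 0 < ε := by positivity
  have hεβ : Λ₁ * (2 * ε) ≤ β / 2 := by
    have : ε * (4 * (Λ₁ + 1)) = β := div_mul_cancel₀ _ (by positivity)
    nlinarith
  refine ⟨β, t₁, hβ, ht₁, ht₁t, ?_⟩
  filter_upwards [hmu, h.eventually_neg_le hΛ₁ hu hΛ hΛ1 hκ0 hge hε,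
    hκ0.eventually_lt_const hε, hκ0.eventually_lt_const one_pos] with j h1 h2 h3 h4 x hx hxt
  have hκj : |κ j| ≤ 1 := by rw [abs_of_pos (hκ j)]; exact h4.le
  have hcu : ContinuousOn (u j) {x | 0 < g x} := fun x hx => ((hu j).diff hx).continuousAt.continuousWithinAt
  have hcu := continuous_of_linear_bound h.sm.continuous (fun x hx => (hu j).zero x hx)
    (hAu _ _ _ (hΛ j).le (hΛ1 j) hκj (hu j)) hcu
  have hB : ContDiff ℝ ∞ fun y => β * (g y + bq L a * g y ^ 2) := by
    have := h.sm
    fun_prop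
  have := max_principle (K := {x | 0 ≤ g x ∧ g x ≤ t₁}) (O := {x | 0 < g x ∧ g x < t₁})
    (φ := fun x => β * (g x + bq L a * g x ^ 2) - u j x)
    (h.isCompact_Icc (by linarith [h.t_pos]) _)
    ((isOpen_lt continuous_const h.sm.continuous).inter (isOpen_lt h.sm.continuous continuous_const))
    (fun x hx => ⟨hx.1.le, hx.2.le⟩) (hB.continuous.sub hcu).continuousOn
    (fun x hx => (smAt_of_contDiff hB x).sub ((hu j).smAt hx.1)) ?_ ?_ x ⟨hx.le, hxt⟩
  · have h5 : 0 ≤ β * (bq L a * g x ^ 2) := by positivity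
    have h6 : β * (g x + bq L a * g x ^ 2) - u j x ≤ 0 := this
    linarith
  · intro x ⟨e1, e2⟩
    rw [lap_sub (smAt_of_contDiff hB x) ((hu j).smAt e1), (hu j).lap_eq e1]
    have e3 := h.lap_lower hβ.le (x := x) (abs_le.2 ⟨by linarith [h.t_pos], by linarith⟩) e1.le
      (by nlinarith)
    have e4 : Λ j * (κ j - u j x) ≤ Λ j * (2 * ε) :=
      mul_le_mul_of_nonneg_left (by linarith [h2 x e1]) (hΛ j).le
    have e5 : Λ j * (2 * ε) ≤ Λ₁ * (2 * ε) := mul_le_mul_of_nonneg_right (hΛ1 j) (by linarith)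
    linarith
  · intro x ⟨e1, e2⟩ e3
    show β * (g x + bq L a * g x ^ 2) - u j x ≤ 0
    rcases e1.eq_or_lt with e4 | e4
    · rw [(hu j).zero x (by simp [← e4]), ← e4]
      simp
    · have h5 : g x = t₁ := le_antisymm e2 (not_lt.1 fun h6 => e3 ⟨e4, h6⟩)
      have e6 := h1 x h5.ge
      rw [h5]
      have : β * (t₁ * (2 * bq L a * t₁)) ≤ β * (t₁ * 1) := by gcongr
      nlinarith

end

section
variable {g : Eu n → ℝ} {R L a t : ℝ}

lemma pd_shift (f : Eu n → ℝ) (v : Eu n) (i : Fin n) :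
    pd i (fun y => f (y + v)) = fun y => pd i f (y + v) := by
  funext y
  simp only [pd, fderiv_comp_add_right]

lemma lap_shift (f : Eu n → ℝ) (v : Eu n) : lap (fun y => f (y + v)) = fun y => lap f (y + v) := by
  funext y
  simp only [lap, pd_shift]

lemma SmAt.shift {f : Eu n → ℝ} {v x : Eu n} (h : SmAt f (x + v)) : SmAt (fun y => f (y + v)) x := by
  have hc : Tendsto (fun y : Eu n => y + v) (𝓝 x) (𝓝 (x + v)) :=
    (continuous_id.add continuous_const).tendsto x
  filter_upwards [hc.eventually h] with y hy
  exact hy.comp y (contDiff_id.add contDiff_const).contDiffAt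

lemma lap_normSq_sub (x₀ x : Eu n) : lap (fun y => ‖y - x₀‖ ^ 2) x = 2 * n := by
  have h0 : ∀ i : Fin n, pd i (fun y : Eu n => ‖y‖ ^ 2) = fun z => 2 * z i := fun i =>
    funext fun z => pd_normSq i z
  have h1 : lap (fun y : Eu n => ‖y‖ ^ 2) = fun _ => 2 * (n : ℝ) := by
    funext z
    have : ∀ i : Fin n, pd i (pd i (fun y : Eu n => ‖y‖ ^ 2)) z = 2 := fun i => by
      rw [h0, pd]
      have : HasFDerivAt (fun z : Eu n => 2 * z i) ((2 : ℝ) • EuclideanSpace.proj i) z :=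
        (EuclideanSpace.proj (𝕜 := ℝ) i).hasFDerivAt.const_mul 2
      rw [this.fderiv]
      simp [bv]
    simp [lap, this, mul_comm]
  have := congrFun (lap_shift (fun y : Eu n => ‖y‖ ^ 2) (-x₀)) x
  simp only [h1, ← sub_eq_add_neg] at this
  exact this

/-- The defining function grows linearly along its gradient direction at a zero. -/
lemma Geo.growth (h : Geo g R L a t) {x₀ x : Eu n} (hx₀ : g x₀ = 0) {r s : ℝ} (hr : r ≤ 1 / 2)
    (hra : r * (4 * L ^ 2) ≤ a) (hs : 0 ≤ s) (hsr : s * L ≤ r) (hx : ‖x - x₀‖ ≤ r) :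
    g x + s * (a / 2) ≤ g (x + s • gr g x₀) := by
  have hL := h.one_le
  have hx₀R := h.bdd x₀ (by linarith [h.t_pos])
  have hVL : ‖gr g x₀‖ ≤ L := h.gr_le _ (by linarith)
  have hV := h.reg x₀ (by rw [hx₀, abs_zero]; exact h.t_pos.le)
  have hd : ∀ τ : ℝ, HasDerivAt (fun τ : ℝ => g (x + τ • gr g x₀) - τ * (a / 2))
      (fderiv ℝ g (x + τ • gr g x₀) (gr g x₀) - a / 2) τ := fun τ => by
    have h1 : HasDerivAt (fun τ : ℝ => x + τ • gr g x₀) (gr g x₀) τ := by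
      simpa using ((hasDerivAt_id τ).smul_const (gr g x₀)).const_add x
    have h2 := ((h.sm.differentiable (by simp)) (x + τ • gr g x₀)).hasFDerivAt.comp_hasDerivAt τ h1
    have h3 := h2.sub ((hasDerivAt_id τ).mul_const (a / 2))
    refine h3.congr_deriv (by ring)
  have hmono : MonotoneOn (fun τ : ℝ => g (x + τ • gr g x₀) - τ * (a / 2)) (Icc 0 s) := by
    refine monotoneOn_of_deriv_nonneg (convex_Icc 0 s)
      (fun τ _ => (hd τ).continuousAt.continuousWithinAt)
      (fun τ _ => (hd τ).differentiableAt.differentiableWithinAt) fun τ hτ => ?_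
    rw [interior_Icc] at hτ
    rw [(hd τ).deriv, ← inner_gr]
    have h1 : ‖x + τ • gr g x₀ - x₀‖ ≤ 2 * r := by
      have e : x + τ • gr g x₀ - x₀ = (x - x₀) + τ • gr g x₀ := by abel
      rw [e]
      refine (norm_add_le _ _).trans ?_
      rw [norm_smul, Real.norm_eq_abs, abs_of_pos hτ.1]
      have : τ * ‖gr g x₀‖ ≤ s * L := mul_le_mul hτ.2.le hVL (norm_nonneg _) hs
      linarith
    have h2 : ‖x + τ • gr g x₀‖ ≤ R + 1 := by
      have := norm_add_le x₀ (x + τ • gr g x₀ - x₀)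
      rw [add_sub_cancel] at this
      linarith
    have h3 : ‖gr g (x + τ • gr g x₀) - gr g x₀‖ ≤ L * (2 * r) :=
      (h.glip _ _ h2 (by linarith)).trans (mul_le_mul_of_nonneg_left h1 (by linarith))
    have h4 : ⟪gr g (x + τ • gr g x₀), gr g x₀⟫
        = ‖gr g x₀‖ ^ 2 + ⟪gr g (x + τ • gr g x₀) - gr g x₀, gr g x₀⟫ := by
      rw [inner_sub_left, real_inner_self_eq_norm_sq]; ring
    have h5 := (abs_le.1 (abs_real_inner_le_norm (gr g (x + τ • gr g x₀) - gr g x₀) (gr g x₀))).1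
    have h6 : ‖gr g (x + τ • gr g x₀) - gr g x₀‖ * ‖gr g x₀‖ ≤ L * (2 * r) * L :=
      mul_le_mul h3 hVL (norm_nonneg _) ((norm_nonneg _).trans h3)
    rw [h4]
    nlinarith
  have := hmono (left_mem_Icc.2 hs) (right_mem_Icc.2 hs) hs
  simp only [zero_smul, add_zero, zero_mul, sub_zero] at this
  linarith

end

section
variable {g : Eu n → ℝ} {R L a t : ℝ}

/-- A Hopf type estimate: linear growth at the boundary forces a positive gradient component. -/
theorem Geo.exists_deriv_lower (i₀ : Fin n) (h : Geo g R L a t) {Λ₁ : ℝ} (hΛ₁ : 0 ≤ Λ₁) {β t₁ : ℝ}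
    (hβ : 0 < β) (ht₁ : 0 < t₁) (ht₁t : t₁ ≤ t) :
    ∃ m t₂, 0 < m ∧ 0 < t₂ ∧ t₂ ≤ t₁ ∧ ∀ Λ κ u, 0 ≤ Λ → Λ ≤ Λ₁ → |κ| ≤ 1 →
      Eig {x | 0 < g x} Λ κ u → (∀ x, 0 < g x → g x ≤ t₁ → β * g x ≤ u x) →
      ∀ x, 0 < g x → g x ≤ t₂ → m ≤ fderiv ℝ u x (gr g x) := by
  obtain ⟨A₁, hA₁, hAu⟩ := h.exists_linear_bound hΛ₁
  obtain ⟨C, hC, hCu⟩ := h.exists_gradient_le i₀ hΛ₁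
  have hL := h.one_le
  have ha := h.a_pos
  set r := min (1 / 2) (min (a / (4 * L ^ 2)) (t₁ / (2 * L)))
  have hr : 0 < r := by positivity
  have hr1 : r ≤ 1 / 2 := min_le_left _ _
  have hra : r * (4 * L ^ 2) ≤ a := by
    have : r ≤ a / (4 * L ^ 2) := (min_le_right _ _).trans (min_le_left _ _)
    rwa [le_div_iff₀ (by positivity)] at this
  have hrt : L * (2 * r) ≤ t₁ := by
    have : r ≤ t₁ / (2 * L) := (min_le_right _ _).trans (min_le_right _ _)
    rw [le_div_iff₀ (by positivity)] at this
    linarith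
  set C₁ := C * L
  have hC₁ : 0 < C₁ := by positivity
  set m₀ := β * (a / 2)
  have hm₀ : 0 < m₀ := by positivity
  set A := m₀ + C₁
  have hA : 0 < A := by positivity
  set D := (2 * n * (A / r ^ 2) + Λ₁ * C₁ + 1) / a
  have hD : 0 < D := by positivity
  have hDa : D * a = 2 * n * (A / r ^ 2) + Λ₁ * C₁ + 1 := div_mul_cancel₀ _ ha.ne'
  set B := 2 * D * L * r
  have hB : 0 < B := by positivity
  set t₂ := min (r / 2) (min t₁ (m₀ / (2 * (A / r ^ 2 + B + C * L))))
  have ht₂ : 0 < t₂ := by positivity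
  have ht₂r : t₂ ≤ r / 2 := min_le_left _ _
  have ht₂m : t₂ * (A / r ^ 2 + B + C * L) ≤ m₀ / 2 := by
    have : t₂ ≤ m₀ / (2 * (A / r ^ 2 + B + C * L)) := (min_le_right _ _).trans (min_le_right _ _)
    rw [le_div_iff₀ (by positivity)] at this
    linarith
  refine ⟨m₀ / 2, t₂, by positivity, ht₂, (min_le_right _ _).trans (min_le_left _ _),
    fun Λ κ u hΛ hΛ1 hκ hu hlow x hx hxt => ?_⟩
  obtain ⟨x₀, hx₀, hxx₀⟩ := h.near x hx
  have hx₀R := h.bdd x₀ (by linarith [h.t_pos])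
  set V := gr g x₀
  have hVL : ‖V‖ ≤ L := h.gr_le _ (by linarith)
  have hRy : ∀ y, ‖y - x₀‖ ≤ 2 * r → ‖y‖ ≤ R + 1 := fun y hy => by
    have := norm_add_le x₀ (y - x₀)
    rw [add_sub_cancel] at this
    linarith
  have hgy : ∀ y, ‖y - x₀‖ ≤ 2 * r → |g y| ≤ L * ‖y - x₀‖ := fun y hy => by
    have := h.lip y x₀ (hRy y hy) (by linarith)
    rwa [hx₀, sub_zero] at this
  have hcu : Continuous u := continuous_of_linear_bound h.sm.continuous (fun x hx => hu.zero x hx)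
    (hAu _ _ _ hΛ hΛ1 hκ hu) fun x hx => (hu.diff hx).continuousAt.continuousWithinAt
  set b : Eu n → ℝ := fun y => m₀ - A / r ^ 2 * ‖y - x₀‖ ^ 2 + (-B * g y + D * g y ^ 2)
  have hb1 : ∀ y, ‖y - x₀‖ ≤ r → 0 ≤ g y → -B * g y + D * g y ^ 2 ≤ 0 := fun y hy hg0 => by
    have h1 := (le_abs_self _).trans (hgy y (by linarith))
    have h2 : g y ≤ L * r := h1.trans (by gcongr)
    have h3 : D * g y * g y ≤ D * g y * (L * r) := by gcongr
    have h4 : 0 ≤ D * g y * (L * r) := by positivity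
    simp only [B]
    linarith
  have hsm1 : ContDiff ℝ ∞ fun y : Eu n => m₀ - A / r ^ 2 * ‖y - x₀‖ ^ 2 :=
    contDiff_const.sub (contDiff_const.mul ((contDiff_id.sub contDiff_const).norm_sq ℝ))
  have hsm2 : ContDiff ℝ ∞ fun y : Eu n => -B * g y + D * g y ^ 2 := by
    have := h.sm
    fun_prop
  have hbs : ContDiff ℝ ∞ b := hsm1.add hsm2
  have key : ∀ s, 0 < s → s * L ≤ r → b x ≤ s⁻¹ * (u (x + s • V) - u x) := by
    intro s hs hsr
    have hgrow : ∀ y, ‖y - x₀‖ ≤ r → ∀ τ, 0 ≤ τ → τ ≤ 1 → g y + τ * s * (a / 2) ≤ g (y + (τ * s) • V) :=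
      fun y hy τ h0 h1 => h.growth hx₀ hr1 hra (by positivity) (by
        refine le_trans ?_ hsr
        gcongr
        exact mul_le_of_le_one_left hs.le h1) hy
    have hgrow1 : ∀ y, ‖y - x₀‖ ≤ r → g y + s * (a / 2) ≤ g (y + s • V) := fun y hy => by
      simpa using hgrow y hy 1 zero_le_one le_rfl
    have hsV : ‖s • V‖ ≤ s * L := by
      rw [norm_smul, Real.norm_eq_abs, abs_of_pos hs]
      gcongr
    have hz : ∀ y, ‖y - x₀‖ ≤ r → 0 < g y → |s⁻¹ * (u (y + s • V) - u y)| ≤ C₁ := fun y hy hg0 => by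
      have hseg : segment ℝ y (y + s • V) ⊆ {x | 0 < g x} := by
        rw [segment_eq_image']
        rintro _ ⟨τ, hτ, rfl⟩
        have := hgrow y hy τ hτ.1 hτ.2
        have h2 : 0 ≤ τ * s * (a / 2) := by
          have := hτ.1
          positivity
        simp only [add_sub_cancel_left, smul_smul, mem_ofPred_eq]
        linarith
      have h1 : ‖u (y + s • V) - u y‖ ≤ C * ‖y + s • V - y‖ :=
        (convex_segment y (y + s • V)).norm_image_sub_le_of_norm_fderiv_le (𝕜 := ℝ)
          (fun z hz => hu.diff (hseg hz)) (fun z hz => hCu Λ κ u hΛ hΛ1 hκ hu z (hseg hz))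
          (left_mem_segment ℝ _ _) (right_mem_segment ℝ _ _)
      rw [add_sub_cancel_left, Real.norm_eq_abs] at h1
      rw [abs_mul, abs_of_pos (inv_pos.2 hs), inv_mul_le_iff₀ hs]
      refine h1.trans ?_
      have : C * ‖s • V‖ ≤ C * (s * L) := by gcongr
      simp only [C₁]
      linarith
    have hz0 : ∀ y, ‖y - x₀‖ ≤ r → g y = 0 → m₀ ≤ s⁻¹ * (u (y + s • V) - u y) := fun y hy hg0 => by
      have h1 := hgrow1 y hy
      rw [hg0, zero_add] at h1
      have h2 : 0 < g (y + s • V) := lt_of_lt_of_le (by positivity) h1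
      have h3 : ‖y + s • V - x₀‖ ≤ 2 * r := by
        have e : y + s • V - x₀ = (y - x₀) + s • V := by abel
        rw [e]
        linarith [norm_add_le (y - x₀) (s • V)]
      have h4 : g (y + s • V) ≤ t₁ :=
        ((le_abs_self _).trans (hgy _ h3)).trans (le_trans (by gcongr) hrt)
      have h5 := hlow _ h2 h4
      rw [hu.zero y (by simp [hg0]), sub_zero, le_inv_mul_iff₀ hs]
      have h6 : β * (s * (a / 2)) ≤ β * g (y + s • V) := by gcongr
      simp only [m₀]
      linarith
    have hball : ∀ y, g y > 0 → ‖y - x₀‖ ≤ r → 0 < g (y + s • V) := fun y h1 h2 => by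
      have := hgrow1 y h2
      have : 0 < s * (a / 2) := by positivity
      linarith
    have hzs : ∀ y, g y > 0 → ‖y - x₀‖ ≤ r → SmAt (fun y => s⁻¹ * (u (y + s • V) - u y)) y :=
      fun y h1 h2 => (smAt_const s⁻¹ y).mul
        ((SmAt.shift (hu.smAt (hball y h1 h2))).sub (hu.smAt h1))
    have hzl : ∀ y, g y > 0 → ‖y - x₀‖ ≤ r → lap (fun y => s⁻¹ * (u (y + s • V) - u y)) y
        = -Λ * (s⁻¹ * (u (y + s • V) - u y)) := fun y h1 h2 => by
      have e1 := (SmAt.shift (hu.smAt (hball y h1 h2)) : SmAt (fun y => u (y + s • V)) y)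
      rw [lap_const_mul, lap_sub e1 (hu.smAt h1), lap_shift]
      simp only []
      rw [hu.lap_eq (hball y h1 h2), hu.lap_eq h1]
      ring
    have hK : IsCompact {y | ‖y - x₀‖ ≤ r ∧ 0 ≤ g y} := by
      have : {y | ‖y - x₀‖ ≤ r ∧ 0 ≤ g y} = Metric.closedBall x₀ r ∩ {y | 0 ≤ g y} := by
        ext y; simp [dist_eq_norm]
      rw [this]
      exact (isCompact_closedBall x₀ r).inter_right (isClosed_le continuous_const h.sm.continuous)
    have := max_principle hK (O := {y | ‖y - x₀‖ < r ∧ 0 < g y})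
      (φ := fun y => b y - s⁻¹ * (u (y + s • V) - u y))
      ((isOpen_lt (f := fun y : Eu n => ‖y - x₀‖) (by fun_prop) continuous_const).inter (isOpen_lt continuous_const h.sm.continuous))
      (fun y hy => ⟨hy.1.le, hy.2.le⟩)
      (by have := hbs.continuous; exact Continuous.continuousOn (by fun_prop))
      (fun y hy => (smAt_of_contDiff hbs y).sub (hzs y hy.2 hy.1.le)) ?_ ?_ x ⟨by linarith, hx.le⟩
    · simpa using this
    · intro y ⟨h1, h2⟩
      have e0 := abs_le.1 (hz y h1.le h2)
      rw [lap_sub (smAt_of_contDiff hbs y) (hzs y h2 h1.le), hzl y h2 h1.le]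
      have hgyr : g y ≤ L * r := ((le_abs_self _).trans (hgy y (by linarith))).trans (by gcongr)
      have hyt : |g y| ≤ t := by rw [abs_of_pos h2]; linarith
      have e1 : lap b y = -(A / r ^ 2 * (2 * n)) + ((-B + 2 * D * g y) * lap g y + 2 * D * ‖gr g y‖ ^ 2) := by
        rw [lap_add (smAt_of_contDiff hsm1 y) (smAt_of_contDiff hsm2 y)]
        have e2 := lap_quad h.sm 0 (-B) D y
        simp only [zero_add] at e2
        have hN : ContDiff ℝ ∞ fun y : Eu n => ‖y - x₀‖ ^ 2 :=
          (contDiff_id.sub contDiff_const).norm_sq ℝ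
        rw [e2, lap_sub (smAt_const m₀ y) (smAt_of_contDiff (contDiff_const.mul hN) y), lap_const,
          lap_const_mul, lap_normSq_sub]
        ring
      have e3 := abs_le.1 (h.lap_le y (hRy y (by linarith)))
      have e4 := h.reg y hyt
      have e5 : -(2 * D * (L * r) * L) ≤ (-B + 2 * D * g y) * lap g y := by
        have f1 : (2 * D * (L * r - g y)) * lap g y ≤ (2 * D * (L * r - g y)) * L := by
          have : 0 ≤ L * r - g y := by linarith
          exact mul_le_mul_of_nonneg_left e3.2 (by positivity)
        have f2 : 0 ≤ 2 * D * g y * L := by positivity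
        simp only [B]
        linarith
      have e6 : D * a ≤ D * ‖gr g y‖ ^ 2 := by gcongr
      have e7 : D * (r * (4 * L ^ 2)) ≤ D * a := by gcongr
      have e8 : Λ * -(s⁻¹ * (u (y + s • V) - u y)) ≤ Λ₁ * C₁ :=
        (mul_le_mul_of_nonneg_left (by linarith [e0.1]) hΛ).trans (mul_le_mul_of_nonneg_right hΛ1 hC₁.le)
      have e9 : 0 < D * a := by positivity
      rw [e1]
      linarith
    · intro y ⟨h1, h2⟩ h3
      show m₀ - A / r ^ 2 * ‖y - x₀‖ ^ 2 + (-B * g y + D * g y ^ 2) - _ ≤ 0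
      rcases h2.eq_or_lt with h4 | h4
      · have := hz0 y h1 h4.symm
        rw [← h4]
        have : 0 ≤ A / r ^ 2 * ‖y - x₀‖ ^ 2 := by positivity
        linarith
      · have h5 : ‖y - x₀‖ = r := le_antisymm h1 (not_lt.1 fun h6 => h3 ⟨h6, h4⟩)
        have h6 := (abs_le.1 (hz y h1 h4)).1
        have h7 := hb1 y h1 h2
        have h8 : A / r ^ 2 * ‖y - x₀‖ ^ 2 = A := by rw [h5]; field_simp
        rw [h8]
        linarith
  have hlim : b x ≤ fderiv ℝ u x V := by
    have h1 : HasDerivAt (fun τ : ℝ => x + τ • V) V 0 := by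
      simpa using ((hasDerivAt_id (0 : ℝ)).smul_const V).const_add x
    have h2 : HasDerivAt (fun τ : ℝ => u (x + τ • V)) (fderiv ℝ u x V) 0 := by
      have h3 : HasFDerivAt u (fderiv ℝ u x) (x + (0 : ℝ) • V) := by
        rw [zero_smul, add_zero]
        exact (hu.diff hx).hasFDerivAt
      exact h3.comp_hasDerivAt 0 h1
    have h4 := h2.tendsto_slope_zero_right
    simp only [zero_add, zero_smul, add_zero, smul_eq_mul] at h4
    refine ge_of_tendsto h4 ?_
    filter_upwards [Ioo_mem_nhdsGT (show (0 : ℝ) < r / L by positivity)] with s hs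
    exact key s hs.1 ((le_div_iff₀ (by linarith)).1 hs.2.le)
  have hfin : fderiv ℝ u x V - C * L * t₂ ≤ fderiv ℝ u x (gr g x) := by
    have e : fderiv ℝ u x V = fderiv ℝ u x (gr g x) + fderiv ℝ u x (V - gr g x) := by
      rw [map_sub]; ring
    have h1 := (le_abs_self _).trans ((fderiv ℝ u x).le_opNorm (V - gr g x))
    have h2 := hCu Λ κ u hΛ hΛ1 hκ hu x hx
    have h3 : ‖V - gr g x‖ ≤ L * t₂ := by
      refine (h.glip x₀ x (by linarith) (hRy x (by linarith))).trans ?_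
      rw [norm_sub_rev]
      gcongr
      linarith
    have h4 : ‖fderiv ℝ u x‖ * ‖V - gr g x‖ ≤ C * (L * t₂) :=
      mul_le_mul h2 h3 (norm_nonneg _) hC.le
    rw [e]
    linarith
  have hbx : m₀ - A / r ^ 2 * t₂ - B * t₂ ≤ b x := by
    have h1 : ‖x - x₀‖ ≤ t₂ := hxx₀.trans hxt
    have h2 : ‖x - x₀‖ ^ 2 ≤ t₂ := by nlinarith [norm_nonneg (x - x₀)]
    have h3 : A / r ^ 2 * ‖x - x₀‖ ^ 2 ≤ A / r ^ 2 * t₂ := by gcongr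
    have h4 : B * g x ≤ B * t₂ := by gcongr
    have h5 : 0 ≤ D * g x ^ 2 := by positivity
    show _ ≤ m₀ - A / r ^ 2 * ‖x - x₀‖ ^ 2 + (-B * g x + D * g x ^ 2)
    linarith
  linarith

end

/-- A Helmholtz solution with a regular nodal hypersurface parallel to the given one. -/
theorem DefFn.exists_helm (i₀ : Fin n) {c : Set (Eu n)} {g : Eu n → ℝ} (hg : DefFn c g)
    (hc : IsCompact c) (hcc : IsConnected c) : ∃ R L a t Λ s t₂ f, Geo g R L a t ∧ 0 < Λ ∧
      0 < s ∧ s < t₂ ∧ t₂ ≤ t ∧ Helm Λ {x | 0 < g x} f ∧ (∀ x, 0 < g x → g x ≤ s → f x < 0) ∧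
      (∀ x, t₂ ≤ g x → 0 < f x) ∧ ∀ x, 0 < g x → g x ≤ t₂ → 0 < fderiv ℝ f x (gr g x) := by
  obtain ⟨R, L, a, t, h⟩ := hg.exists_geo hc hcc.nonempty
  obtain ⟨Λ, κ, u, w, Λ₀, Λ₁, hu, hΛ, hΛ1, hκ, hκ0, -, hw, hw0, -, hL2⟩ :=
    exists_eig_seq i₀ h.isOpen_pos (hg.isPreconnected_pos hcc) (hg.exists_pos hcc.nonempty)
      h.isBounded_pos
  have hΛ₁ : 0 ≤ Λ₁ := (hΛ 0).le.trans (hΛ1 0)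
  obtain ⟨A, hA, hAu⟩ := h.exists_linear_bound hΛ₁
  obtain ⟨C, hC, hCu⟩ := h.exists_gradient_le i₀ hΛ₁
  have hκ1 : ∀ᶠ j in atTop, |κ j| ≤ 1 :=
    (hκ0.eventually_lt_const one_pos).mono fun j hj => by rw [abs_of_pos (hκ j)]; exact hj.le
  have hge : ∀ s, 0 < s → ∃ m, 0 < m ∧ ∀ᶠ j in atTop, ∀ x, s ≤ g x → m ≤ u j x := fun s hs =>
    h.eventually_ge (fun j x hx => (hu j).diff hx)
      (hκ1.mono fun j hj x hx => hCu _ _ _ (hΛ j).le (hΛ1 j) hj (hu j) x hx)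
      hw.continuousOn hw0 hL2 hs
  obtain ⟨β, t₁, hβ, ht₁, ht₁t, hlow⟩ := h.linear_lower hΛ₁ hu hΛ hΛ1 hκ hκ0 hge
  obtain ⟨m, t₂, hm, ht₂, ht₂t, hder⟩ := h.exists_deriv_lower i₀ hΛ₁ hβ ht₁ ht₁t
  obtain ⟨m₂, hm₂, hpos⟩ := hge t₂ ht₂
  obtain ⟨j, h1, h2, h3, h4⟩ := (hlow.and (hpos.and (hκ1.and (hκ0.eventually_lt_const hm₂)))).exists
  refine ⟨R, L, a, t, Λ j, min (t₂ / 2) (κ j / (2 * A)), t₂, fun x => u j x - κ j, h, hΛ j,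
    lt_min (by positivity) (div_pos (hκ j) (by positivity)),
    (min_le_left _ _).trans_lt (by linarith), ht₂t.trans ht₁t, (hu j).helm, ?_, ?_, ?_⟩
  · intro x hx hxs
    have e1 : g x ≤ κ j / (2 * A) := hxs.trans (min_le_right _ _)
    rw [le_div_iff₀ (by positivity)] at e1
    have e2 := (abs_le.1 (hAu _ _ _ (hΛ j).le (hΛ1 j) h3 (hu j) x hx)).2
    linarith [hκ j]
  · intro x hx
    linarith [h2 x hx]
  · intro x hx hxt
    rw [fderiv_sub_const]
    exact hm.trans_le (hder _ _ _ (hΛ j).le (hΛ1 j) h3 (hu j) h1 x hx hxt)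

/-- Periodic solutions of `y'' + o² y = η`, together with their Fourier coefficients. -/
theorem exists_periodic_ode {η : ℝ → ℂ} (hη : Continuous η) {o : ℂ}
    (ho : Complex.exp (o * Complex.I) ≠ 1) : ∃ y : ℝ → ℂ, Continuous y ∧
      (∀ k : ℤ, ∫ t in (0 : ℝ)..1, η t * Complex.exp (-(2 * π * k * t * Complex.I))
        = (o ^ 2 - (2 * π * k) ^ 2) * ∫ t in (0 : ℝ)..1, y t * Complex.exp (-(2 * π * k * t * Complex.I))) ∧
      ∀ a b : ℝ, (∀ t ∈ Icc a b, η t = 0) → ∃ A B : ℂ, ∀ t ∈ Icc a b,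
        y t = A * Complex.exp (o * t * Complex.I) + B * Complex.exp (-(o * t * Complex.I)) := by
  have ho0 : o ≠ 0 := by rintro rfl; simp at ho
  have hI := Complex.I_ne_zero
  set e : ℝ → ℂ := fun t => Complex.exp (o * t * Complex.I)
  set e' : ℝ → ℂ := fun t => Complex.exp (-(o * t * Complex.I))
  have hee : ∀ t, e t * e' t = 1 := fun t => by simp only [e, e', ← Complex.exp_add]; simp
  have he : Continuous e := by fun_prop
  have he' : Continuous e' := by fun_prop
  have hcast : ∀ t : ℝ, HasDerivAt (fun t : ℝ => (t : ℂ)) 1 t := fun t => Complex.ofRealCLM.hasDerivAt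
  have hde : ∀ t, HasDerivAt e (o * Complex.I * e t) t := fun t => by
    have := (((hcast t).const_mul o).mul_const Complex.I).cexp
    exact this.congr_deriv (by ring)
  have hde' : ∀ t, HasDerivAt e' (-(o * Complex.I) * e' t) t := fun t => by
    have := (((hcast t).const_mul o).mul_const Complex.I).neg.cexp
    exact this.congr_deriv (by simp only [e', Pi.neg_apply]; ring)
  set p : ℝ → ℂ := fun t => e' t * η t / (2 * Complex.I * o)
  set q : ℝ → ℂ := fun t => -(e t * η t / (2 * Complex.I * o))
  have hp : Continuous p := (he'.mul hη).div_const _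
  have hq : Continuous q := ((he.mul hη).div_const _).neg
  set P₀ : ℂ := e 1 * (∫ s in (0 : ℝ)..1, p s) / (1 - e 1)
  set Q₀ : ℂ := e' 1 * (∫ s in (0 : ℝ)..1, q s) / (1 - e' 1)
  set P : ℝ → ℂ := fun t => P₀ + ∫ s in (0 : ℝ)..t, p s
  set Q : ℝ → ℂ := fun t => Q₀ + ∫ s in (0 : ℝ)..t, q s
  have hP : ∀ t, HasDerivAt P (p t) t := fun t =>
    (intervalIntegral.integral_hasDerivAt_right (hp.intervalIntegrable _ _)
      hp.aestronglyMeasurable.stronglyMeasurableAtFilter hp.continuousAt).const_add _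
  have hQ : ∀ t, HasDerivAt Q (q t) t := fun t =>
    (intervalIntegral.integral_hasDerivAt_right (hq.intervalIntegrable _ _)
      hq.aestronglyMeasurable.stronglyMeasurableAtFilter hq.continuousAt).const_add _
  have h1e : 1 - e 1 ≠ 0 := by
    intro h
    exact ho (by rw [sub_eq_zero] at h; simpa [e] using h.symm)
  have h1e' : 1 - e' 1 ≠ 0 := by
    intro h
    have := hee 1
    rw [sub_eq_zero] at h
    rw [← h, mul_one] at this
    exact h1e (by rw [this, sub_self])
  have hPb : e 1 * P 1 = P 0 := by
    simp only [P, intervalIntegral.integral_same, P₀]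
    field_simp
    ring
  have hQb : e' 1 * Q 1 = Q 0 := by
    simp only [Q, intervalIntegral.integral_same, Q₀]
    field_simp
    ring
  set y : ℝ → ℂ := fun t => e t * P t + e' t * Q t
  set y' : ℝ → ℂ := fun t => o * Complex.I * (e t * P t - e' t * Q t)
  have hcan : ∀ t, e t * p t + e' t * q t = 0 := fun t => by simp only [p, q]; ring
  have hcan' : ∀ t, o * Complex.I * (e t * p t - e' t * q t) = η t := fun t => by
    have : o * Complex.I * (e t * p t - e' t * q t) = e t * e' t * η t := by
      simp only [p, q]
      field_simp
      ring
    rw [this, hee, one_mul]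
  have hy : ∀ t, HasDerivAt y (y' t) t := fun t => by
    refine (((hde t).mul (hP t)).add ((hde' t).mul (hQ t))).congr_deriv ?_
    linear_combination hcan t
  have hy' : ∀ t, HasDerivAt y' (η t - o ^ 2 * y t) t := fun t => by
    refine ((((hde t).mul (hP t)).sub ((hde' t).mul (hQ t))).const_mul (o * Complex.I)).congr_deriv ?_
    simp only [y]
    linear_combination hcan' t + o ^ 2 * (e t * P t + e' t * Q t) * Complex.I_sq
  have hyc : Continuous y := continuous_iff_continuousAt.2 fun t => (hy t).continuousAt
  have hy01 : y 1 = y 0 := by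
    simp only [y]
    rw [hPb, hQb]; simp [e, e']
  have hy01' : y' 1 = y' 0 := by
    simp only [y']
    rw [hPb, hQb]; simp [e, e']
  refine ⟨y, hyc, fun k => ?_, fun a b hab => ?_⟩
  · set z : ℝ → ℂ := fun t => Complex.exp (-(2 * π * k * t * Complex.I))
    have hz : ∀ t, HasDerivAt z (-(2 * π * k * Complex.I) * z t) t := fun t => by
      have := (((hcast t).const_mul (2 * π * k : ℂ)).mul_const Complex.I).neg.cexp
      exact this.congr_deriv (by simp only [z, Pi.neg_apply]; ring)
    have hzc : Continuous z := by fun_prop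
    have hz1 : z 1 = z 0 := by
      simp only [z]
      rw [Complex.exp_eq_exp_iff_exists_int]
      exact ⟨-k, by push_cast; ring⟩
    have hw : ∀ t, HasDerivAt (fun t => (y' t + 2 * π * k * Complex.I * y t) * z t)
        (η t * z t - (o ^ 2 - (2 * π * k) ^ 2) * (y t * z t)) t := fun t => by
      refine (((hy' t).add ((hy t).const_mul (2 * π * k * Complex.I))).mul (hz t)).congr_deriv ?_
      simp only [Pi.add_apply]
      linear_combination (-(2 * π * k) ^ 2 * y t * z t) * Complex.I_sq
    have hi : Continuous fun t => η t * z t := hη.mul hzc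
    have hj : Continuous fun t => (o ^ 2 - (2 * π * k) ^ 2) * (y t * z t) := continuous_const.mul (hyc.mul hzc)
    have := intervalIntegral.integral_eq_sub_of_hasDerivAt (a := 0) (b := 1) (fun t _ => hw t)
      ((hi.sub hj).intervalIntegrable _ _)
    rw [intervalIntegral.integral_sub (hi.intervalIntegrable _ _) (hj.intervalIntegrable _ _), hy01, hy01',
      hz1, sub_self, sub_eq_zero, intervalIntegral.integral_const_mul] at this
    exact this
  · refine ⟨P a, Q a, fun t ht => ?_⟩
    have hat : a ≤ t := ht.1
    have hInt : ∀ f : ℝ → ℂ, Continuous f → (∀ s ∈ Icc a b, f s = 0) →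
        ∫ s in (0 : ℝ)..t, f s = ∫ s in (0 : ℝ)..a, f s := fun f hf h0 => by
      rw [← intervalIntegral.integral_add_adjacent_intervals (hf.intervalIntegrable 0 a)
        (hf.intervalIntegrable a t)]
      have : ∫ s in a..t, f s = ∫ s in a..t, (0 : ℂ) := by
        refine intervalIntegral.integral_congr fun s hs => ?_
        rw [uIcc_of_le hat] at hs
        exact h0 s ⟨hs.1, hs.2.trans ht.2⟩
      rw [this]; simp
    have h1 : P t = P a := by
      simp only [P]
      rw [hInt p hp fun s hs => by simp [p, hab s hs]]
    have h2 : Q t = Q a := by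
      simp only [Q]
      rw [hInt q hq fun s hs => by simp [q, hab s hs]]
    simp only [y, h1, h2, e, e']
    ring

lemma HilbertBasis.exists_resolvent {ι H : Type*} [NormedAddCommGroup H] [InnerProductSpace ℂ H]
    (b : HilbertBasis ι ℂ H) {w : ι → ℝ} (hw : ∀ k, 1 ≤ |w k|) (h : H) :
    ∃ v : H, ∀ F G : H, (∀ k, b.repr G k = w k * b.repr F k) → inner ℂ v G = inner ℂ h F := by
  have hm : Memℓp (fun k => b.repr h k / (w k : ℂ)) 2 := by
    have hs := (lp.memℓp (b.repr h)).summable (by norm_num)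
    refine memℓp_gen (Summable.of_nonneg_of_le (fun k => by positivity) (fun k => ?_) hs)
    rw [norm_div, Complex.norm_real, Real.norm_eq_abs]
    exact Real.rpow_le_rpow (by positivity) (div_le_self (norm_nonneg _) (hw k)) (by norm_num)
  refine ⟨b.repr.symm ⟨_, hm⟩, fun F G hFG => ?_⟩
  rw [← b.repr.inner_map_map, ← b.repr.inner_map_map h F, lp.inner_eq_tsum, lp.inner_eq_tsum]
  refine tsum_congr fun k => ?_
  have hk : (w k : ℂ) ≠ 0 := by
    intro h0
    have := hw k
    rw [Complex.ofReal_eq_zero.1 h0] at this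
    norm_num at this
  rw [hFG, LinearIsometryEquiv.apply_symm_apply]
  simp only [RCLike.inner_apply, map_div₀, Complex.conj_ofReal]
  field_simp

lemma inner_toLp {α : Type*} [MeasurableSpace α] {μ : Measure α} (v : Lp ℂ 2 μ) {f : α → ℂ}
    (hf : MemLp f 2 μ) : inner ℂ v hf.toLp = ∫ x, (starRingEnd ℂ) (v x) * f x ∂μ := by
  rw [L2.inner_def]
  refine integral_congr_ae ?_
  filter_upwards [hf.coeFn_toLp] with x h1
  rw [h1]; simp [mul_comm]

lemma integral_cube_prod (f : Fin n → ℝ → ℂ) :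
    ∫ x, ∏ i, f i (x i) ∂cm n = ∏ i, ∫ t in (0 : ℝ)..1, f i t := by
  have h3 := (PiLp.volume_preserving_toLp (Fin n)).restrict_preimage (measurableSet_cube (n := n))
  have e : WithLp.toLp 2 ⁻¹' (cube n) = univ.pi fun _ : Fin n => Ioc (0 : ℝ) 1 := by
    ext x; simp [cube]
  rw [e, volume_pi, Measure.restrict_pi_pi] at h3
  rw [cm, ← h3.integral_comp (MeasurableEquiv.toLp 2 (Fin n → ℝ)).measurableEmbedding,
    integral_fintype_prod_eq_prod]
  refine Finset.prod_congr rfl fun i _ => ?_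
  rw [intervalIntegral.integral_of_le zero_le_one]

lemma pw_add (v w x : Eu n) : pw (v + w) x = pw v x * pw w x := by
  rw [pw, pw, pw, ← Complex.exp_add, inner_add_right]; push_cast; ring_nf

lemma conj_pw (v x : Eu n) : (starRingEnd ℂ) (pw v x) = pw (-v) x := by
  rw [pw, pw, ← Complex.exp_conj]; simp

lemma pw_fv (k : Fin n → ℤ) (x : Eu n) : pw (fv k) x = ∏ j, Complex.exp (2 * π * k j * x j * Complex.I) := by
  rw [← Complex.exp_sum, pw]
  congr 1
  simp only [PiLp.inner_apply, fv, RCLike.inner_apply, conj_trivial]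
  push_cast
  rw [Finset.sum_mul]

lemma fv_neg (k : Fin n → ℤ) : fv (-k) = -fv k := by
  ext i; simp [fv]

lemma fv_add (k m : Fin n → ℤ) : fv (k + m) = fv k + fv m := by
  ext i; simp [fv]; ring

lemma integral_exp_int {q : ℤ} (hq : q ≠ 0) : ∫ t in (0 : ℝ)..1, Complex.exp (2 * π * q * t * Complex.I) = 0 := by
  have hc : (2 * π * q * Complex.I : ℂ) ≠ 0 := by simp [hq, Real.pi_ne_zero]
  have := integral_exp_mul_complex (a := 0) (b := 1) hc
  have e : ∀ t : ℝ, (2 * π * q * t * Complex.I : ℂ) = 2 * π * q * Complex.I * t := fun t => by ring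
  simp_rw [e, this]
  have : Complex.exp (2 * π * q * Complex.I * (1 : ℝ)) = Complex.exp (2 * π * q * Complex.I * (0 : ℝ)) := by
    rw [Complex.exp_eq_exp_iff_exists_int]
    exact ⟨q, by push_cast; ring⟩
  rw [this, sub_self, zero_div]

lemma memLp_sep {y : ℝ → ℂ} (hy : Continuous y) (i : Fin n) (v : Eu n) :
    MemLp (fun x : Eu n => y (x i) * pw v x) 2 (cm n) := by
  obtain ⟨C, hC⟩ := (isCompact_Icc (a := (0 : ℝ)) (b := 1)).exists_bound_of_continuousOn hy.continuousOn
  have hc : Continuous fun x : Eu n => y (x i) * pw v x :=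
    (hy.comp (by fun_prop)).mul (continuous_pw v)
  refine MemLp.of_bound hc.aestronglyMeasurable C ?_
  filter_upwards [ae_restrict_mem measurableSet_cube] with x hx
  rw [norm_mul, norm_pw, mul_one]
  exact hC _ (Ioc_subset_Icc_self (hx i))

lemma repr_sep (i : Fin n) {m : Fin n → ℤ} (hm : m i = 0) (k : Fin n → ℤ) :
    ∃ c : ℂ, (∀ (y : ℝ → ℂ) (hy : Continuous y), (fb n).repr (memLp_sep hy i (fv m)).toLp k
      = c * ∫ t in (0 : ℝ)..1, y t * Complex.exp (-(2 * π * k i * t * Complex.I))) ∧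
      (c ≠ 0 → ∀ j ≠ i, k j = m j) := by
  refine ⟨∏ j ∈ Finset.univ.erase i, ∫ t in (0 : ℝ)..1, Complex.exp (2 * π * (m j - k j : ℤ) * t * Complex.I),
    fun y hy => ?_, fun hc j hj => ?_⟩
  · rw [fb_repr_toLp]
    have : ∀ x : Eu n, (starRingEnd ℂ) (pw (fv k) x) * (y (x i) * pw (fv m) x)
        = ∏ j, (fun t : ℝ => (if j = i then y t else 1) * Complex.exp (2 * π * (m j - k j : ℤ) * t * Complex.I)) (x j) := by
      intro x
      rw [Finset.prod_mul_distrib, Finset.prod_ite_eq' Finset.univ i, if_pos (Finset.mem_univ _), conj_pw,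
        mul_left_comm, ← pw_add, ← fv_neg, ← fv_add, pw_fv]
      congr 1
      refine Finset.prod_congr rfl fun j _ => ?_
      simp only [Pi.add_apply, Pi.neg_apply]
      congr 2
      push_cast; ring
    simp_rw [this]
    rw [integral_cube_prod fun j t => (if j = i then y t else 1) * Complex.exp (2 * π * (m j - k j : ℤ) * t * Complex.I),
      ← Finset.prod_erase_mul _ _ (Finset.mem_univ i)]
    congr 1
    · refine Finset.prod_congr rfl fun j hj => ?_
      simp [Finset.ne_of_mem_erase hj]
    · refine intervalIntegral.integral_congr fun t _ => ?_
      simp [hm]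
  · by_contra hne
    refine hc (Finset.prod_eq_zero (Finset.mem_erase.2 ⟨hj, Finset.mem_univ _⟩) (integral_exp_int ?_))
    rw [sub_ne_zero]; exact fun h => hne h.symm

lemma norm_sq_fv (k : Fin n → ℤ) : ‖fv k‖ ^ 2 = ∑ i, (2 * π * k i) ^ 2 := by
  rw [EuclideanSpace.norm_sq_eq]; simp only [fv, Real.norm_eq_abs, sq_abs]

lemma integral_cexp_eq_zero {h : Eu n → ℝ} (hi : Integrable h) {R : ℝ} (hR : ∀ x, R < ‖x‖ → h x = 0)
    {Λ : ℝ} (hΛ : 0 < Λ)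
    (hc : ∀ v : Eu n, ‖v‖ ^ 2 = Λ → ∫ x, h x * Real.cos ⟪x, v⟫ = 0)
    (hs : ∀ v : Eu n, ‖v‖ ^ 2 = Λ → ∫ x, h x * Real.sin ⟪x, v⟫ = 0)
    {a b : Eu n} (ha : ‖a‖ = 1) (hb : ‖b‖ = 1) (hab : ⟪a, b⟫ = 0) {o μ : ℂ} (ho : o ^ 2 + μ ^ 2 = Λ) :
    ∫ x, (h x : ℂ) * Complex.exp ((o * (⟪x, a⟫ : ℝ) + μ * (⟪x, b⟫ : ℝ)) * Complex.I) = 0 := by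
  set s : ℝ := √Λ with hs_def
  have hs2 : s ^ 2 = Λ := Real.sq_sqrt hΛ.le
  have hs0 : 0 < s := Real.sqrt_pos.2 hΛ
  have hsc : (s : ℂ) ≠ 0 := by exact_mod_cast hs0.ne'
  have hs2c : (s : ℂ) ^ 2 = Λ := by exact_mod_cast hs2
  set G : ℂ → Eu n → ℂ := fun θ x =>
    Complex.exp ((s * Complex.cos θ * (⟪x, a⟫ : ℝ) + s * Complex.sin θ * (⟪x, b⟫ : ℝ)) * Complex.I)
  set G' : ℂ → Eu n → ℂ := fun θ x => G θ x *
    ((s * (-Complex.sin θ) * (⟪x, a⟫ : ℝ) + s * Complex.cos θ * (⟪x, b⟫ : ℝ)) * Complex.I)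
  have hG : Continuous fun p : ℂ × Eu n => G p.1 p.2 := by
    have := Complex.continuous_cos; have := Complex.continuous_sin
    fun_prop
  have hG' : Continuous fun p : ℂ × Eu n => G' p.1 p.2 := by
    have := Complex.continuous_cos; have := Complex.continuous_sin
    fun_prop
  have hGG : ∀ θ x, HasDerivAt (fun θ => G θ x) (G' θ x) θ := fun θ x =>
    (((((Complex.hasDerivAt_cos θ).const_mul (s : ℂ)).mul_const _).add
      (((Complex.hasDerivAt_sin θ).const_mul (s : ℂ)).mul_const _)).mul_const _).cexp
  have hbd : ∀ (F : ℂ → Eu n → ℂ), (Continuous fun p : ℂ × Eu n => F p.1 p.2) → ∀ θ₀ : ℂ, ∃ C : ℝ,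
      ∀ θ ∈ Metric.ball θ₀ 1, ∀ x, ‖(h x : ℂ) * F θ x‖ ≤ C * ‖h x‖ := fun F hF θ₀ => by
    obtain ⟨C, hC⟩ := ((isCompact_closedBall θ₀ 1).prod
      (isCompact_closedBall (0 : Eu n) R)).exists_bound_of_continuousOn hF.continuousOn
    refine ⟨C, fun θ hθ x => ?_⟩
    rw [norm_mul, mul_comm, Complex.norm_real]
    by_cases hx : ‖x‖ ≤ R
    · exact mul_le_mul_of_nonneg_right
        (hC (θ, x) ⟨Metric.ball_subset_closedBall hθ, by simpa using hx⟩) (norm_nonneg _)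
    · rw [hR x (not_le.1 hx)]; simp
  have hm : ∀ (F : ℂ → Eu n → ℂ), (Continuous fun p : ℂ × Eu n => F p.1 p.2) → ∀ θ,
      AEStronglyMeasurable (fun x => (h x : ℂ) * F θ x) := fun F hF θ =>
    (Complex.continuous_ofReal.comp_aestronglyMeasurable hi.aestronglyMeasurable).mul
      (by fun_prop : Continuous (F θ)).aestronglyMeasurable
  set E : ℂ → ℂ := fun θ => ∫ x, (h x : ℂ) * G θ x
  have hE : Differentiable ℂ E := fun θ₀ => by
    obtain ⟨C, hC⟩ := hbd G' hG' θ₀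
    obtain ⟨C', hC'⟩ := hbd G hG θ₀
    refine (hasDerivAt_integral_of_dominated_loc_of_deriv_le (F := fun θ x => (h x : ℂ) * G θ x)
      (F' := fun θ x => (h x : ℂ) * G' θ x) (bound := fun x => C * ‖h x‖)
      (Metric.ball_mem_nhds θ₀ one_pos)
      (Eventually.of_forall fun θ => hm G hG θ) ?_ (hm G' hG' θ₀)
      (Eventually.of_forall fun x θ hθ => hC θ hθ x) (hi.norm.const_mul C)
      (Eventually.of_forall fun x θ _ => (hGG θ x).const_mul _)).2.differentiableAt
    exact Integrable.mono' (hi.norm.const_mul C') (hm G hG θ₀)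
      (Eventually.of_forall (hC' θ₀ (Metric.mem_ball_self one_pos)))
  have hreal : ∀ θ : ℝ, E θ = 0 := fun θ => by
    set v : Eu n := (s * Real.cos θ) • a + (s * Real.sin θ) • b
    have hv : ‖v‖ ^ 2 = Λ := by
      rw [norm_add_sq_real, norm_smul, norm_smul, real_inner_smul_left, real_inner_smul_right, hab, ha, hb]
      simp only [Real.norm_eq_abs, mul_one, sq_abs, mul_zero, add_zero]
      rw [← hs2]
      linear_combination s ^ 2 * Real.sin_sq_add_cos_sq θ
    have e : ∀ x, (h x : ℂ) * G θ x = ((h x * Real.cos ⟪x, v⟫ : ℝ) : ℂ) + ((h x * Real.sin ⟪x, v⟫ : ℝ) : ℂ) * Complex.I := by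
      intro x
      have : (s * Complex.cos θ * (⟪x, a⟫ : ℝ) + s * Complex.sin θ * (⟪x, b⟫ : ℝ)) = ((⟪x, v⟫ : ℝ) : ℂ) := by
        rw [inner_add_right, inner_smul_right, inner_smul_right]; push_cast; ring
      simp only [G]
      rw [this, Complex.exp_mul_I]
      push_cast; ring
    have hcv : Integrable fun x => h x * Real.cos ⟪x, v⟫ :=
      hi.mul_bdd (c := 1) (by fun_prop : Continuous fun x : Eu n => Real.cos ⟪x, v⟫).aestronglyMeasurable
        (Eventually.of_forall fun x => Real.abs_cos_le_one _)
    have hsv : Integrable fun x => h x * Real.sin ⟪x, v⟫ :=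
      hi.mul_bdd (c := 1) (by fun_prop : Continuous fun x : Eu n => Real.sin ⟪x, v⟫).aestronglyMeasurable
        (Eventually.of_forall fun x => Real.abs_sin_le_one _)
    simp only [E]
    simp_rw [e]
    rw [integral_add hcv.ofReal (hsv.ofReal.mul_const _), integral_mul_const, integral_complex_ofReal,
      integral_complex_ofReal, hc v hv, hs v hv]
    simp
  have hE0 : ∀ θ, E θ = 0 := fun θ => by
    have ha : AnalyticOnNhd ℂ E univ := hE.differentiableOn.analyticOnNhd isOpen_univ
    refine ha.eqOn_zero_of_preconnected_of_frequently_eq_zero isPreconnected_univ (mem_univ 0) ?_ (mem_univ θ)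
    have ht : Tendsto (fun t : ℝ => (t : ℂ)) (𝓝[≠] 0) (𝓝[≠] 0) := by
      refine tendsto_nhdsWithin_iff.2 ⟨?_, ?_⟩
      · exact (Complex.continuous_ofReal.tendsto' 0 0 (by simp)).mono_left nhdsWithin_le_nhds
      · filter_upwards [self_mem_nhdsWithin] with t ht
        simpa using ht
    exact ht.frequently (Eventually.of_forall hreal).frequently
  obtain ⟨θ, hθ⟩ := Complex.cos_surjective (o / s)
  have hsin : (s * Complex.sin θ) ^ 2 = μ ^ 2 := by
    have h1 := Complex.sin_sq_add_cos_sq θ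
    have h2 : s * Complex.cos θ = o := by rw [hθ]; field_simp
    linear_combination (s : ℂ) ^ 2 * h1 - (s * Complex.cos θ + o) * h2 - ho + hs2c
  have hcos : s * Complex.cos θ = o := by rw [hθ]; field_simp
  rcases sq_eq_sq_iff_eq_or_eq_neg.1 hsin with h1 | h1
  · have := hE0 θ
    simpa only [E, G, hcos, h1] using this
  · have := hE0 (-θ)
    simpa only [E, G, Complex.cos_neg, Complex.sin_neg, mul_neg, hcos, h1, neg_neg] using this

lemma Tst.helm {z : Eu n → ℝ} (hz : Tst z) (Λ : ℝ) : Tst fun x => Mono.lap z x + Λ * z x :=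
  hz.lap.add (hz.const_mul Λ)

lemma tsupport_helm_subset (z : Eu n → ℝ) (Λ : ℝ) : tsupport (fun x => lap z x + Λ * z x) ⊆ tsupport z := by
  refine closure_minimal (fun x hx => ?_) (isClosed_tsupport z)
  by_contra hxz
  refine hx ?_
  have h1 : lap z x = 0 := image_eq_zero_of_notMem_tsupport fun h => hxz (tsupport_lap_subset z h)
  simp [h1, image_eq_zero_of_notMem_tsupport hxz]

lemma Tst.repr_helm {z : Eu n → ℝ} (hz : Tst z) (hs : tsupport z ⊆ ocube n) (Λ : ℝ) (k : Fin n → ℤ) :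
    (fb n).repr (hz.helm Λ).lp k = ((Λ - ‖fv k‖ ^ 2 : ℝ) : ℂ) * (fb n).repr hz.lp k := by
  rw [Tst.repr_lp _ ((tsupport_helm_subset z Λ).trans hs), Tst.repr_lp hz hs]
  have key : ∀ g : Eu n → ℝ, ContDiff ℝ ∞ g → (∀ x, Mono.lap g x = -‖fv k‖ ^ 2 * g x) →
      ∫ x, g x * (Mono.lap z x + Λ * z x) = (Λ - ‖fv k‖ ^ 2) * ∫ x, g x * z x := fun g hg hl => by
    have h1 : Integrable fun x => g x * Mono.lap z x := (hz.lap.mul_left hg).int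
    have h2 : Integrable fun x => g x * z x := (hz.mul_left hg).int
    have e : ∀ x, g x * (Mono.lap z x + Λ * z x) = g x * Mono.lap z x + Λ * (g x * z x) := fun x => by ring
    simp_rw [e]
    rw [integral_add h1 (h2.const_mul Λ), integral_mul_lap_comm hg hz, integral_const_mul]
    simp_rw [hl, mul_assoc]
    rw [integral_const_mul]; ring
  rw [key _ (contDiff_cos_inner _) fun x => lap_cos_inner _ x,
    key _ (contDiff_sin_inner _) fun x => lap_sin_inner _ x]
  push_cast; ring

lemma exists_unit_orthogonal (hn : 2 ≤ n) (i : Fin n) {w : Eu n} (hw : w i = 0) :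
    ∃ (b : Eu n) (μ : ℝ), ‖b‖ = 1 ∧ ⟪bv i, b⟫ = 0 ∧ w = μ • b := by
  by_cases h : w = 0
  · obtain ⟨j, hj⟩ : ∃ j : Fin n, j ≠ i := by
      have : Nontrivial (Fin n) := Fin.nontrivial_iff_two_le.2 hn
      exact exists_ne i
    exact ⟨bv j, 0, by simp [bv], by simp [bv, EuclideanSpace.inner_single_left, hj.symm], by simp [h]⟩
  · have h0 : ‖w‖ ≠ 0 := norm_ne_zero_iff.2 h
    refine ⟨‖w‖⁻¹ • w, ‖w‖, ?_, ?_, ?_⟩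
    · rw [norm_smul, norm_inv, norm_norm, inv_mul_cancel₀ h0]
    · simp [bv, EuclideanSpace.inner_single_left, hw]
    · rw [smul_smul, mul_inv_cancel₀ h0, one_smul]

lemma fv_update (m : Fin n → ℤ) (i : Fin n) (q : ℤ) (x : Eu n) :
    pw (fv (Function.update m i q)) x = Complex.exp (2 * π * q * x i * Complex.I) * pw (fv (Function.update m i 0)) x := by
  rw [pw_fv, pw_fv, ← Finset.mul_prod_erase _ _ (Finset.mem_univ i), ← Finset.mul_prod_erase _ _ (Finset.mem_univ i)]
  simp only [Function.update_self, Int.cast_zero, mul_zero, zero_mul, Complex.exp_zero, one_mul]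
  congr 1
  refine Finset.prod_congr rfl fun j hj => ?_
  rw [Function.update_of_ne (Finset.ne_of_mem_erase hj), Function.update_of_ne (Finset.ne_of_mem_erase hj)]

lemma norm_sq_fv_update (m : Fin n → ℤ) (i : Fin n) (q : ℤ) :
    ‖fv (Function.update m i q)‖ ^ 2 = (2 * π * q) ^ 2 + ‖fv (Function.update m i 0)‖ ^ 2 := by
  rw [norm_sq_fv, norm_sq_fv, ← Finset.add_sum_erase _ _ (Finset.mem_univ i),
    ← Finset.add_sum_erase _ _ (Finset.mem_univ i)]
  simp only [Function.update_self, Int.cast_zero, mul_zero, ne_eq, OfNat.ofNat_ne_zero, not_false_eq_true,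
    zero_pow, zero_add]
  congr 1
  refine Finset.sum_congr rfl fun j hj => ?_
  rw [Function.update_of_ne (Finset.ne_of_mem_erase hj), Function.update_of_ne (Finset.ne_of_mem_erase hj)]

/-- A function vanishing exactly outside `[δ, 1-δ]`. -/
def edge (δ t : ℝ) : ℝ := max (δ - t) 0 + max (t - 1 + δ) 0

lemma continuous_edge (δ : ℝ) : Continuous (edge δ) := by unfold edge; fun_prop

lemma edge_eq_zero {δ t : ℝ} : edge δ t = 0 ↔ t ∈ Icc δ (1 - δ) := by
  unfold edge
  rw [add_eq_zero_iff_of_nonneg (le_max_right _ _) (le_max_right _ _), max_eq_right_iff, max_eq_right_iff, mem_Icc]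
  constructor <;> rintro ⟨h1, h2⟩ <;> constructor <;> linarith

lemma resolvent_coef (hn : 2 ≤ n) {K : Set (Eu n)} (hK : IsCompact K) (hKc : K ⊆ cube n) {δ : ℝ}
    (hδ : ∀ x ∈ K, ∀ i, x i ∈ Icc δ (1 - δ)) {Λ : ℝ} (hΛ : 0 < Λ)
    (hd : ∀ k : Fin n → ℤ, 1 ≤ |Λ - ‖fv k‖ ^ 2|) {h : Eu n → ℝ} (hh : MemLp h 2) (hK0 : ∀ x, x ∉ K → h x = 0)
    (hc : ∀ v : Eu n, ‖v‖ ^ 2 = Λ → ∫ x, h x * Real.cos ⟪x, v⟫ = 0)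
    (hs : ∀ v : Eu n, ‖v‖ ^ 2 = Λ → ∫ x, h x * Real.sin ⟪x, v⟫ = 0)
    (hm : MemLp (fun x => (h x : ℂ)) 2 (cm n))
    {v : Lp ℂ 2 (cm n)} (hv : ∀ F G : Lp ℂ 2 (cm n),
      (∀ k, (fb n).repr G k = ((Λ - ‖fv k‖ ^ 2 : ℝ) : ℂ) * (fb n).repr F k) → inner ℂ v G = inner ℂ hm.toLp F)
    (i : Fin n) (m : Fin n → ℤ) :
    ∫ x, (starRingEnd ℂ) (v x) * (edge δ (x i) * pw (fv m) x) ∂cm n = 0 := by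
  have hi : Integrable h := (integrableOn_iff_integrable_of_support_subset fun x hx => by
    by_contra hxK; exact hx (hK0 x hxK)).1 ((MemLp.locInt hh).integrableOn_isCompact hK)
  set m₀ := Function.update m i 0 with hm₀
  have hm0 : m₀ i = 0 := by simp [m₀]
  obtain ⟨o, ho⟩ := IsAlgClosed.exists_pow_nat_eq ((Λ - ‖fv m₀‖ ^ 2 : ℝ) : ℂ) two_pos
  have ho1 : Complex.exp (o * Complex.I) ≠ 1 := by
    intro h1
    obtain ⟨q, hq⟩ := Complex.exp_eq_one_iff.1 h1
    have hoq : o = 2 * π * q := by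
      have : o * Complex.I = (2 * π * q) * Complex.I := by rw [hq]; ring
      exact mul_right_cancel₀ Complex.I_ne_zero this
    have h2 : Λ - ‖fv m₀‖ ^ 2 = (2 * π * q) ^ 2 := by
      rw [hoq] at ho; exact_mod_cast ho.symm
    have := hd (Function.update m i q)
    rw [norm_sq_fv_update, ← hm₀, ← h2] at this
    norm_num at this
  have hη : Continuous fun t : ℝ => (edge δ t : ℂ) * Complex.exp (2 * π * m i * t * Complex.I) := by
    have := continuous_edge δ; fun_prop
  obtain ⟨y, hy, hyk, hyAB⟩ := exists_periodic_ode hη ho1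
  obtain ⟨A, B, hAB⟩ := hyAB δ (1 - δ) fun t ht => by rw [edge_eq_zero.2 ht]; simp
  have hmain := hv (memLp_sep hy i (fv m₀)).toLp (memLp_sep hη i (fv m₀)).toLp fun k => by
    obtain ⟨c, hc1, hc2⟩ := repr_sep i hm0 k
    refine (hc1 _ hη).trans (Eq.trans ?_ (congrArg (_ * ·) (hc1 _ hy).symm))
    simp only [hyk]
    by_cases hc0 : c = 0
    · simp [hc0]
    · have hk : Function.update k i 0 = m₀ := by
        ext j
        by_cases hj : j = i
        · subst hj; simp [hm0]
        · rw [Function.update_of_ne hj, hc2 hc0 j hj]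
      have := norm_sq_fv_update k i (k i)
      rw [Function.update_eq_self, hk] at this
      rw [ho, this]; push_cast; ring
  rw [inner_toLp, inner_toLp] at hmain
  have e1 : ∀ x : Eu n, (edge δ (x i) : ℂ) * Complex.exp (2 * π * m i * x i * Complex.I) * pw (fv m₀) x
      = edge δ (x i) * pw (fv m) x := fun x => by
    have := fv_update m i (m i) x
    rw [Function.update_eq_self] at this
    rw [this]; ring
  simp_rw [e1] at hmain
  rw [hmain]
  obtain ⟨b, μ, hb1, hb2, hb3⟩ := exists_unit_orthogonal hn i (w := fv m₀) (by simp [fv, hm0])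
  have hμ : ‖fv m₀‖ ^ 2 = μ ^ 2 := by rw [hb3, norm_smul, hb1]; simp
  obtain ⟨R, hR⟩ := hK.isBounded.exists_norm_le
  have hzero : ∀ o' : ℂ, o' ^ 2 = ((Λ - ‖fv m₀‖ ^ 2 : ℝ) : ℂ) →
      ∫ x : Eu n, (h x : ℂ) * (Complex.exp (o' * x i * Complex.I) * pw (fv m₀) x) = 0 := fun o' ho' => by
    have := integral_cexp_eq_zero hi (R := R) (fun x hx => hK0 x fun hxK => absurd (hR x hxK) (not_le.2 hx)) hΛ hc hs
      (a := bv i) (by simp [bv]) hb1 hb2 (o := o') (μ := μ) (by rw [ho', hμ]; push_cast; ring)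
    rw [← this]
    refine integral_congr_ae (Eventually.of_forall fun x => ?_)
    simp only
    rw [pw, ← Complex.exp_add, hb3, inner_smul_right]
    congr 2
    simp only [bv, EuclideanSpace.inner_single_right]
    push_cast; simp; ring
  have hInt : ∀ o' : ℂ, Integrable fun x : Eu n => (h x : ℂ) * (Complex.exp (o' * x i * Complex.I) * pw (fv m₀) x) := fun o' => by
    have hco : Continuous fun x : Eu n => Complex.exp (o' * x i * Complex.I) * pw (fv m₀) x := by
      have := continuous_pw (fv m₀); fun_prop
    obtain ⟨C, hC⟩ := hK.exists_bound_of_continuousOn hco.continuousOn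
    refine Integrable.mono' (hi.norm.const_mul C) (hi.ofReal.aestronglyMeasurable.mul hco.aestronglyMeasurable)
      (Eventually.of_forall fun x => ?_)
    by_cases hx : x ∈ K
    · rw [norm_mul, mul_comm, Complex.norm_real]
      exact mul_le_mul_of_nonneg_right (hC x hx) (norm_nonneg _)
    · simp [hK0 x hx]
  calc ∫ x, (starRingEnd ℂ) (hm.toLp _ x) * (y (x i) * pw (fv m₀) x) ∂cm n
      = ∫ x, (h x : ℂ) * (y (x i) * pw (fv m₀) x) ∂cm n := by
        refine integral_congr_ae ?_
        filter_upwards [hm.coeFn_toLp] with x hx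
        rw [hx, Complex.conj_ofReal]
    _ = ∫ x, (h x : ℂ) * (y (x i) * pw (fv m₀) x) :=
        setIntegral_cube fun x hx => by rw [hK0 x fun hxK => hx (hKc hxK)]; simp
    _ = ∫ x : Eu n, (A * ((h x : ℂ) * (Complex.exp (o * x i * Complex.I) * pw (fv m₀) x))
          + B * ((h x : ℂ) * (Complex.exp (-o * x i * Complex.I) * pw (fv m₀) x))) := by
        refine integral_congr_ae (Eventually.of_forall fun x => ?_)
        by_cases hx : x ∈ K
        · simp only [hAB _ (hδ x hx i), neg_mul]; ring
        · simp [hK0 x hx]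
    _ = 0 := by
        rw [integral_add ((hInt o).const_mul A) ((hInt (-o)).const_mul B), integral_const_mul, integral_const_mul,
          hzero o ho, hzero (-o) (by rw [neg_sq, ho])]
        simp

lemma exists_margin {K : Set (Eu n)} (hK : IsCompact K) (hKc : K ⊆ ocube n) :
    ∃ δ > 0, ∀ x ∈ K, ∀ i, x i ∈ Icc δ (1 - δ) := by
  obtain ⟨δ, hδ, h⟩ := hK.exists_cthickening_subset_open isOpen_ocube hKc
  refine ⟨δ, hδ, fun x hx i => ?_⟩
  have key : ∀ s : ℝ, |s| ≤ δ → x + s • bv i ∈ ocube n := fun s hs => h (by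
    refine Metric.mem_cthickening_of_dist_le _ x δ K hx ?_
    rw [dist_eq_norm, add_sub_cancel_left, norm_smul]
    simpa [bv] using hs)
  have h1 := (key δ (abs_of_pos hδ).le i).2
  have h2 := (key (-δ) (by rw [abs_neg, abs_of_pos hδ]) i).1
  simp [bv] at h1 h2
  constructor <;> linarith

lemma ae_zero_of_coef {v : Lp ℂ 2 (cm n)} {δ : ℝ} {i : Fin n}
    (h : ∀ m : Fin n → ℤ, ∫ x, (starRingEnd ℂ) (v x) * (edge δ (x i) * pw (fv m) x) ∂cm n = 0) :
    ∀ᵐ x ∂cm n, x i ∉ Icc δ (1 - δ) → v x = 0 := by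
  have hW : MemLp (fun x => (starRingEnd ℂ) (v x) * (edge δ (x i) : ℂ)) 2 (cm n) := by
    obtain ⟨C, hC⟩ := (isCompact_Icc (a := (0 : ℝ)) (b := 1)).exists_bound_of_continuousOn
      (continuous_edge δ).continuousOn
    have hco : Continuous fun x : Eu n => (edge δ (x i) : ℂ) := by have := continuous_edge δ; fun_prop
    have hv := Lp.memLp v
    have hvs : AEStronglyMeasurable (fun x => (starRingEnd ℂ) (v x)) (cm n) :=
      Complex.continuous_conj.comp_aestronglyMeasurable hv.1
    refine MemLp.of_le_mul (c := C) hv (hvs.mul hco.aestronglyMeasurable) ?_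
    filter_upwards [ae_restrict_mem measurableSet_cube] with x hx
    rw [norm_mul, RCLike.norm_conj, mul_comm, Complex.norm_real]
    exact mul_le_mul_of_nonneg_right (hC _ (Ioc_subset_Icc_self (hx i))) (norm_nonneg _)
  have h0 : hW.toLp = 0 := by
    rw [← LinearIsometryEquiv.map_eq_zero_iff (fb n).repr]
    ext k
    rw [fb_repr_toLp]
    have := h (-k)
    rw [fv_neg] at this
    simp_rw [← conj_pw] at this
    refine Eq.trans (integral_congr_ae (Eventually.of_forall fun x => ?_)) this
    ring
  have h1 := hW.coeFn_toLp
  rw [h0] at h1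
  filter_upwards [h1, Lp.coeFn_zero ℂ 2 (cm n)] with x hx1 hx2 hx
  rw [hx2] at hx1
  have : (starRingEnd ℂ) (v x) * (edge δ (x i) : ℂ) = 0 := hx1.symm
  rcases mul_eq_zero.1 this with h3 | h3
  · exact (map_eq_zero _).1 h3
  · exact absurd (edge_eq_zero.1 (Complex.ofReal_eq_zero.1 h3)) hx

lemma runge_cube (i₀ : Fin n) (hn : 2 ≤ n) {K U : Set (Eu n)} (hK : IsCompact K) (hKc : K ⊆ ocube n)
    (hKp : IsPreconnected Kᶜ) (hU : IsOpen U) (hKU : K ⊆ U) {Λ : ℝ} (hΛ : 0 < Λ)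
    (hd : ∀ k : Fin n → ℤ, 1 ≤ |Λ - ‖fv k‖ ^ 2|) {h : Eu n → ℝ} (hh : MemLp h 2) (hK0 : ∀ x, x ∉ K → h x = 0)
    (hc : ∀ v : Eu n, ‖v‖ ^ 2 = Λ → ∫ x, h x * Real.cos ⟪x, v⟫ = 0)
    (hs : ∀ v : Eu n, ‖v‖ ^ 2 = Λ → ∫ x, h x * Real.sin ⟪x, v⟫ = 0)
    {f : Eu n → ℝ} (hf : Helm Λ U f) : ∫ x, h x * f x = 0 := by
  obtain ⟨δ, hδ0, hδ⟩ := exists_margin hK hKc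
  have hm : MemLp (fun x => (h x : ℂ)) 2 (cm n) := (hh.restrict (cube n)).ofReal
  obtain ⟨v, hv⟩ := HilbertBasis.exists_resolvent (fb n) hd hm.toLp
  have hcoef := fun i => ae_zero_of_coef fun m =>
    resolvent_coef hn hK (hKc.trans ocube_subset_cube) hδ hΛ hd hh hK0 hc hs hm hv i m
  set u : Eu n → ℝ := (cube n).indicator fun x => (v x).re with hu
  have huL : MemLp u 2 := by
    rw [hu, memLp_indicator_iff_restrict measurableSet_cube]
    exact (Lp.memLp v).re
  set D : Set (Eu n) := {x | ∀ i, x i ∈ Icc δ (1 - δ)} with hD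
  have hDc : IsClosed D := by
    have : D = ⋂ i, {x : Eu n | x i ∈ Icc δ (1 - δ)} := by ext; simp [hD]
    rw [this]
    exact isClosed_iInter fun i => isClosed_Icc.preimage (by fun_prop : Continuous fun x : Eu n => x i)
  have hDo : D ⊆ ocube n := fun x hx i => ⟨hδ0.trans_le (hx i).1, (hx i).2.trans_lt (by linarith)⟩
  have hDK : IsCompact D := Metric.isCompact_of_isClosed_isBounded hDc
    (isBounded_cube.subset (hDo.trans ocube_subset_cube))
  have hKD : K ⊆ D := fun x hx => hδ x hx
  have hu0 : ∀ᵐ x, x ∉ D → u x = 0 := by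
    have := (ae_restrict_iff' measurableSet_cube).1 (ae_all_iff.2 hcoef)
    filter_upwards [this] with x hx hxD
    by_cases hxc : x ∈ cube n
    · simp only [hD, mem_ofPred_eq, not_forall] at hxD
      obtain ⟨i, hi⟩ := hxD
      rw [hu, indicator_of_mem hxc, hx hxc i hi]; rfl
    · rw [hu, indicator_of_notMem hxc]
  have hmain : ∀ z, Tst z → tsupport z ⊆ ocube n → ∫ x, u x * (lap z x + Λ * z x) = ∫ x, h x * z x := by
    intro z hz hzs
    have h1 := hv hz.lp (hz.helm Λ).lp (hz.repr_helm hzs Λ)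
    rw [Tst.lp, Tst.lp, inner_toLp, inner_toLp] at h1
    have h2 : ∫ x, (starRingEnd ℂ) (hm.toLp _ x) * (z x : ℂ) ∂cm n = ((∫ x, h x * z x : ℝ) : ℂ) := by
      rw [← integral_complex_ofReal, ← setIntegral_cube fun x hx => by
        rw [hK0 x fun hxK => hx (ocube_subset_cube (hKc hxK))]; simp]
      refine integral_congr_ae ?_
      filter_upwards [hm.coeFn_toLp] with x hx
      rw [hx, Complex.conj_ofReal]; push_cast; rfl
    rw [h2] at h1
    have h3 := congrArg Complex.re h1
    rw [Complex.ofReal_re] at h3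
    rw [← h3]
    have hInt : Integrable (fun x => (starRingEnd ℂ) (v x) * ((lap z x + Λ * z x : ℝ) : ℂ)) (cm n) := by
      have hvc : MemLp (fun x => (starRingEnd ℂ) (v x)) 2 (cm n) :=
        (Lp.memLp v).of_le (Complex.continuous_conj.comp_aestronglyMeasurable (Lp.memLp v).1)
          (Eventually.of_forall fun x => by rw [RCLike.norm_conj])
      exact hvc.integrable_mul ((hz.helm Λ).memLp (μ := cm n))
    have h4 : (∫ x, (starRingEnd ℂ) (v x) * ((lap z x + Λ * z x : ℝ) : ℂ) ∂cm n).re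
        = ∫ x, ((starRingEnd ℂ) (v x) * ((lap z x + Λ * z x : ℝ) : ℂ)).re ∂cm n := (integral_re hInt).symm
    rw [h4, ← setIntegral_cube fun x hx => by rw [hu, indicator_of_notMem hx, zero_mul]]
    refine integral_congr_ae ?_
    filter_upwards [ae_restrict_mem measurableSet_cube] with x hx
    rw [hu, indicator_of_mem hx, Complex.re_mul_ofReal, Complex.conj_re]
  obtain ⟨χ, hχ, hχs, hχ1, -⟩ := exists_bump hDK isOpen_ocube hDo
  have hall : ∀ z, Tst z → ∫ x, u x * (lap z x + Λ * z x) = ∫ x, h x * z x := by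
    intro z hz
    have h1 := hmain (fun x => χ x * z x) (hz.mul_left hχ.smooth)
      (fun x hx => hχs (tsupport_mul_subset_left (f := χ) (g := z) hx))
    have e : ∀ x ∈ D, (fun x => χ x * z x) =ᶠ[𝓝 x] z := fun x hx => by
      filter_upwards [hχ1 x hx] with y hy
      rw [hy, one_mul]
    have h2 : ∫ x, u x * (lap z x + Λ * z x) = ∫ x, u x * (lap (fun x => χ x * z x) x + Λ * (χ x * z x)) := by
      refine integral_congr_ae ?_
      filter_upwards [hu0] with x hx
      by_cases hxD : x ∈ D
      · rw [(lap_congr (e x hxD)).eq_of_nhds, (e x hxD).eq_of_nhds]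
      · rw [hx hxD]; simp
    have h3 : ∫ x, h x * z x = ∫ x, h x * (χ x * z x) := by
      refine integral_congr_ae (Eventually.of_forall fun x => ?_)
      by_cases hxK : x ∈ K
      · have := (e x (hKD hxK)).eq_of_nhds
        simp only at this ⊢
        rw [this]
      · simp [hK0 x hxK]
    rw [h2, h3, h1]
  have hweak : WHelm Λ Kᶜ u := fun z hz hzs => by
    rw [hall z hz]
    refine integral_eq_zero_of_ae (Eventually.of_forall fun x => ?_)
    by_cases hxK : x ∈ K
    · simp [Tst.notMem hzs (fun h => h hxK)]
    · simp [hK0 x hxK]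
  obtain ⟨w, hw, hwu⟩ := weyl i₀ hΛ.le hK.isClosed.isOpen_compl (MemLp.locInt huL) hweak
  have hw0 : ∀ x ∈ Kᶜ, w x = 0 := by
    have hDco : ContinuousOn w Dᶜ := hw.continuousOn.mono (compl_subset_compl.2 hKD)
    have hwD : ∀ x ∈ Dᶜ, w x = 0 := by
      have h1 : w =ᵐ[volume.restrict Dᶜ] fun _ => (0 : ℝ) := by
        rw [EventuallyEq, ae_restrict_iff' hDc.measurableSet.compl]
        filter_upwards [hu0, hwu] with x h1 h2 hx
        rw [← h2 (fun h => hx (hKD h)), h1 hx]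
      exact Measure.eqOn_open_of_ae_eq h1 hDc.isOpen_compl hDco continuousOn_const
    have h0 : (0 : Eu n) ∈ Dᶜ := fun h => by
      have := (h i₀).1
      simp at this
      linarith
    refine hw.unique_continuation i₀ hΛ.le hK.isClosed.isOpen_compl hKp (compl_subset_compl.2 hKD h0) ?_
    filter_upwards [hDc.isOpen_compl.mem_nhds h0] with x hx using hwD x hx
  obtain ⟨F, hF, -, hFf⟩ := exists_localisation hK hU hKU fun x hx => hf.sm x hx
  have e1 : ∫ x, h x * f x = ∫ x, h x * F x := by
    refine integral_congr_ae (Eventually.of_forall fun x => ?_)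
    by_cases hxK : x ∈ K
    · simp only [(hFf x hxK).eq_of_nhds]
    · simp [hK0 x hxK]
  rw [e1, ← hall F hF]
  refine integral_eq_zero_of_ae ?_
  filter_upwards [hwu] with x hx
  by_cases hxK : x ∈ K
  · rw [(lap_congr (hFf x hxK)).eq_of_nhds, (hFf x hxK).eq_of_nhds, hf.eq x (hKU hxK)]
    simp
  · rw [hx hxK, hw0 x hxK]; simp

lemma lap_scale {f : Eu n → ℝ} (a : ℝ) (v : Eu n) (hf : ContDiff ℝ ∞ f) (x : Eu n) :
    lap (fun y => f (a • y + v)) x = a ^ 2 * lap f (a • x + v) := by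
  unfold lap
  rw [Finset.mul_sum]
  refine Finset.sum_congr rfl fun i _ => ?_
  have : pd i (fun y => f (a • y + v)) = fun y => a * pd i f (a • y + v) := funext fun y => pd_scale a v i hf y
  rw [this, pd_const_mul, pd_scale a v i (contDiff_pd hf i)]
  ring

lemma Helm.affine {Λ : ℝ} {U : Set (Eu n)} {f : Eu n → ℝ} (hf : Helm Λ U f) (a : ℝ) (v : Eu n) :
    Helm (a ^ 2 * Λ) ((fun y => a • y + v) ⁻¹' U) fun y => f (a • y + v) := by
  have key : ∀ x : Eu n, a • x + v ∈ U → ∃ F : Eu n → ℝ, ContDiff ℝ ∞ F ∧ F =ᶠ[𝓝 (a • x + v)] f ∧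
      (fun y => F (a • y + v)) =ᶠ[𝓝 x] fun y => f (a • y + v) := fun x hx => by
    obtain ⟨W, hW, hWo, hWx⟩ := eventually_nhds_iff.1 (hf.sm _ hx)
    obtain ⟨F, hF, -, hFf⟩ := exists_localisation (isCompact_singleton (x := a • x + v)) hWo
      (singleton_subset_iff.2 hWx) fun y hy => eventually_nhds_iff.2 ⟨W, hW, hWo, hy⟩
    refine ⟨F, hF.smooth, hFf _ rfl, ?_⟩
    have : ContinuousAt (fun y : Eu n => a • y + v) x := by fun_prop
    exact this.eventually (hFf _ rfl)
  constructor
  · intro x hx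
    obtain ⟨F, hF, -, h2⟩ := key x hx
    have h3 : ContDiff ℝ ∞ fun y : Eu n => F (a • y + v) := hF.comp (by fun_prop)
    exact (smAt_of_contDiff h3 x).congr h2
  · intro x hx
    obtain ⟨F, hF, h1, h2⟩ := key x hx
    rw [← (lap_congr h2).eq_of_nhds, lap_scale a v hF, (lap_congr h1).eq_of_nhds, hf.eq _ hx]
    ring

lemma exists_good_scale (n : ℕ) {Λ : ℝ} (hΛ : 0 < Λ) (r₀ : ℝ) :
    ∃ r, r₀ ≤ r ∧ ∀ k : Fin n → ℤ, 1 ≤ |r ^ 2 * Λ - ‖fv k‖ ^ 2| := by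
  obtain ⟨N, hN⟩ := exists_nat_ge (r₀ ^ 2 * Λ)
  have hpi : (1 : ℝ) ≤ π ^ 2 := by nlinarith [Real.pi_gt_three]
  refine ⟨√(4 * π ^ 2 * (N + 1 / 2) / Λ), ?_, fun k => ?_⟩
  · refine Real.le_sqrt_of_sq_le ?_
    rw [le_div_iff₀ hΛ]
    have : (0 : ℝ) ≤ N := N.cast_nonneg
    nlinarith
  · rw [Real.sq_sqrt (by positivity), div_mul_cancel₀ _ hΛ.ne', norm_sq_fv]
    have e : 4 * π ^ 2 * (N + 1 / 2 : ℝ) - ∑ i, (2 * π * k i) ^ 2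
        = 2 * π ^ 2 * ((2 * ((N : ℤ) - ∑ i, k i ^ 2) + 1 : ℤ) : ℝ) := by
      have : ∑ i, (2 * π * (k i : ℝ)) ^ 2 = 4 * π ^ 2 * ∑ i, (k i : ℝ) ^ 2 := by
        rw [Finset.mul_sum]
        exact Finset.sum_congr rfl fun i _ => by ring
      rw [this]; push_cast; ring
    rw [e, abs_mul, abs_of_pos (by positivity)]
    have h1 : (1 : ℝ) ≤ |((2 * ((N : ℤ) - ∑ i, k i ^ 2) + 1 : ℤ) : ℝ)| := by
      rw [← Int.cast_abs]
      exact_mod_cast Int.one_le_abs (by omega)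
    nlinarith

lemma MemLp.affine {u : Eu n → ℝ} (hu : MemLp u 2) {r : ℝ} (hr : r ≠ 0) (p : Eu n) :
    MemLp (fun x => u (r • x + p)) 2 := by
  have h1 : AEStronglyMeasurable (fun x => u (r • x + p)) volume := by
    refine hu.1.comp_quasiMeasurePreserving (f := fun x : Eu n => r • x + p) ?_
    have a1 := (measurePreserving_add_right (volume : Measure (Eu n)) p).quasiMeasurePreserving
    exact a1.comp (Measure.quasiMeasurePreserving_smul volume hr)
  rw [memLp_two_iff_integrable_sq h1]
  exact (hu.integrable_sq.comp_add_right p).comp_smul hr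

lemma MemLp.integrable_of_support {K : Set (Eu n)} (hK : IsCompact K) {h : Eu n → ℝ} (hh : MemLp h 2)
    (hK0 : ∀ x, x ∉ K → h x = 0) : Integrable h :=
  (integrableOn_iff_integrable_of_support_subset fun x hx => by
    by_contra hxK; exact hx (hK0 x hxK)).1 ((MemLp.locInt hh).integrableOn_isCompact hK)

theorem runge (i₀ : Fin n) (hn : 2 ≤ n) {K U : Set (Eu n)} (hK : IsCompact K)
    (hKp : IsPreconnected Kᶜ) (hU : IsOpen U) (hKU : K ⊆ U) {Λ : ℝ} (hΛ : 0 < Λ)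
    {h : Eu n → ℝ} (hh : MemLp h 2) (hK0 : ∀ x, x ∉ K → h x = 0)
    (hc : ∀ v : Eu n, ‖v‖ ^ 2 = Λ → ∫ x, h x * Real.cos ⟪x, v⟫ = 0)
    (hs : ∀ v : Eu n, ‖v‖ ^ 2 = Λ → ∫ x, h x * Real.sin ⟪x, v⟫ = 0)
    {f : Eu n → ℝ} (hf : Helm Λ U f) : ∫ x, h x * f x = 0 := by
  obtain ⟨r₀, hr₀, hcube⟩ := exists_affine_cube hK.isBounded
  obtain ⟨r, hrr, hd⟩ := exists_good_scale n hΛ r₀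
  have hr : 0 < r := hr₀.trans_le hrr
  set p : Eu n := WithLp.toLp 2 (fun _ => (1 / 2 : ℝ)) with hp
  set q : Eu n := -(r • p)
  have hAB : ∀ x : Eu n, r • (r⁻¹ • x + p) + q = x := fun x => by
    rw [smul_add, smul_smul, mul_inv_cancel₀ hr.ne', one_smul]; simp [q]
  have hBA : ∀ x : Eu n, r⁻¹ • (r • x + q) + p = x := fun x => by
    rw [smul_add, smul_smul, inv_mul_cancel₀ hr.ne', one_smul, smul_neg, smul_smul, inv_mul_cancel₀ hr.ne',
      one_smul, neg_add_cancel_right]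
  have hKim : (fun y : Eu n => r • y + q) ⁻¹' K = (fun x => r⁻¹ • x + p) '' K := by
    ext y
    refine ⟨fun hy => ⟨_, hy, hBA y⟩, ?_⟩
    rintro ⟨x, hx, rfl⟩
    simpa only [mem_preimage, hAB] using hx
  have hKcim : ((fun y : Eu n => r • y + q) ⁻¹' K)ᶜ = (fun x => r⁻¹ • x + p) '' Kᶜ := by
    ext y
    refine ⟨fun hy => ⟨_, hy, hBA y⟩, ?_⟩
    rintro ⟨x, hx, rfl⟩
    simpa only [mem_compl_iff, mem_preimage, hAB] using hx
  have hB : Continuous fun x : Eu n => r⁻¹ • x + p := by fun_prop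
  have hi : Integrable h := MemLp.integrable_of_support hK hh hK0
  have hcv : ∀ w : Eu n, Integrable fun x => h x * Real.cos ⟪x, w⟫ := fun w =>
    hi.mul_bdd (c := 1) (by fun_prop : Continuous fun x : Eu n => Real.cos ⟪x, w⟫).aestronglyMeasurable
      (Eventually.of_forall fun x => Real.abs_cos_le_one _)
  have hsv : ∀ w : Eu n, Integrable fun x => h x * Real.sin ⟪x, w⟫ := fun w =>
    hi.mul_bdd (c := 1) (by fun_prop : Continuous fun x : Eu n => Real.sin ⟪x, w⟫).aestronglyMeasurable
      (Eventually.of_forall fun x => Real.abs_sin_le_one _)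
  have hw : ∀ v : Eu n, ‖v‖ ^ 2 = r ^ 2 * Λ → ‖r⁻¹ • v‖ ^ 2 = Λ := fun v hv => by
    rw [norm_smul, mul_pow, hv, norm_inv, inv_pow, Real.norm_of_nonneg hr.le]
    field_simp
  have hin : ∀ v x : Eu n, ⟪x, v⟫ = ⟪r • x + q, r⁻¹ • v⟫ - ⟪q, r⁻¹ • v⟫ := fun v x => by
    rw [inner_add_left, real_inner_smul_left, real_inner_smul_right]
    field_simp
    ring
  have hcomb : ∀ (w : Eu n) (A B : ℝ), ‖w‖ ^ 2 = Λ →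
      ∫ x, h x * (A * Real.cos ⟪x, w⟫ + B * Real.sin ⟪x, w⟫) = 0 := fun w A B hw => by
    have e : ∀ x, h x * (A * Real.cos ⟪x, w⟫ + B * Real.sin ⟪x, w⟫)
        = A * (h x * Real.cos ⟪x, w⟫) + B * (h x * Real.sin ⟪x, w⟫) := fun x => by ring
    simp_rw [e]
    rw [integral_add ((hcv w).const_mul A) ((hsv w).const_mul B), integral_const_mul, integral_const_mul,
      hc w hw, hs w hw]
    simp
  have hmain := runge_cube i₀ hn (K := (fun y : Eu n => r • y + q) ⁻¹' K) (U := (fun y : Eu n => r • y + q) ⁻¹' U)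
    (Λ := r ^ 2 * Λ) (h := fun y => h (r • y + q)) (f := fun y => f (r • y + q))
    (by rw [hKim]; exact hK.image hB)
    (by rw [hKim]; rintro _ ⟨x, hx, rfl⟩; exact hcube r hrr x (subset_closure hx))
    (by rw [hKcim]; exact hKp.image _ hB.continuousOn) (hU.preimage (by fun_prop)) (preimage_mono hKU)
    (by positivity) hd (MemLp.affine hh hr.ne' q) (fun x hx => hK0 _ hx)
    (fun v hv => by
      have := integral_affine (fun x => h x * (Real.cos ⟪q, r⁻¹ • v⟫ * Real.cos ⟪x, r⁻¹ • v⟫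
        + Real.sin ⟪q, r⁻¹ • v⟫ * Real.sin ⟪x, r⁻¹ • v⟫)) hr q
      rw [hcomb _ _ _ (hw v hv), mul_zero] at this
      rw [← this]
      refine integral_congr_ae (Eventually.of_forall fun x => ?_)
      simp only
      rw [hin v x, Real.cos_sub]; ring)
    (fun v hv => by
      have := integral_affine (fun x => h x * (-Real.sin ⟪q, r⁻¹ • v⟫ * Real.cos ⟪x, r⁻¹ • v⟫
        + Real.cos ⟪q, r⁻¹ • v⟫ * Real.sin ⟪x, r⁻¹ • v⟫)) hr q
      rw [hcomb _ _ _ (hw v hv), mul_zero] at this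
      rw [← this]
      refine integral_congr_ae (Eventually.of_forall fun x => ?_)
      simp only
      rw [hin v x, Real.sin_sub]; ring)
    (hf.affine r q)
  rw [integral_affine (fun x => h x * f x) hr q] at hmain
  exact (mul_eq_zero.1 hmain).resolve_left (by positivity)

def waves (n : ℕ) (Λ : ℝ) : Submodule ℝ (Eu n → ℝ) :=
  Submodule.span ℝ {w | ∃ v : Eu n, ‖v‖ ^ 2 = Λ ∧
    (w = (fun x => Real.cos ⟪x, v⟫) ∨ w = fun x => Real.sin ⟪x, v⟫)}

lemma contDiff_of_mem_waves {Λ : ℝ} {p : Eu n → ℝ} (hp : p ∈ waves n Λ) : ContDiff ℝ ∞ p := by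
  induction hp using Submodule.span_induction with
  | mem w hw =>
    obtain ⟨v, -, rfl | rfl⟩ := hw
    · exact Real.contDiff_cos.comp (contDiff_id.inner ℝ contDiff_const)
    · exact Real.contDiff_sin.comp (contDiff_id.inner ℝ contDiff_const)
  | zero => exact contDiff_const
  | add p q _ _ hp hq => exact hp.add hq
  | smul a p _ hp => exact hp.const_smul a

lemma helm_of_mem_waves {Λ : ℝ} {p : Eu n → ℝ} (hp : p ∈ waves n Λ) (U : Set (Eu n)) :
    Helm Λ U p := by
  refine ⟨fun x _ => smAt_of_contDiff (contDiff_of_mem_waves hp) x, fun x _ => ?_⟩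
  induction hp using Submodule.span_induction with
  | mem w hw =>
    obtain ⟨v, rfl, rfl | rfl⟩ := hw
    · exact lap_cos_inner v x
    · exact lap_sin_inner v x
  | zero => exact (lap_const 0 x).trans (mul_zero _).symm
  | add p q hp hq h1 h2 =>
    have := lap_add (smAt_of_contDiff (contDiff_of_mem_waves hp) x)
      (smAt_of_contDiff (contDiff_of_mem_waves hq) x)
    simp only [Pi.add_apply]
    rw [mul_add, ← h1, ← h2, ← this]; rfl
  | smul a p hp h1 =>
    have : lap (a • p) x = a * lap p x := lap_const_mul ..
    rw [this, h1, Pi.smul_apply, smul_eq_mul]; ring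

lemma memLp_indicator {K : Set (Eu n)} (hK : IsCompact K) {f : Eu n → ℝ} (hf : ContinuousOn f K) :
    MemLp (K.indicator f) 2 := by
  rw [memLp_indicator_iff_restrict hK.measurableSet]
  have : IsFiniteMeasure (volume.restrict K) := isFiniteMeasure_restrict.2 hK.measure_ne_top
  obtain ⟨C, hC⟩ := hK.exists_bound_of_continuousOn hf
  exact MemLp.of_bound (hf.aestronglyMeasurable hK.measurableSet) C
    ((ae_restrict_iff' hK.measurableSet).2 (Eventually.of_forall hC))

lemma indicator_mul_comm (K : Set (Eu n)) (h f : Eu n → ℝ) (x : Eu n) :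
    K.indicator h x * f x = h x * K.indicator f x := by
  by_cases hx : x ∈ K <;> simp [hx]

theorem exists_wave_l2 (i₀ : Fin n) (hn : 2 ≤ n) {K U : Set (Eu n)} (hK : IsCompact K)
    (hKp : IsPreconnected Kᶜ) (hU : IsOpen U) (hKU : K ⊆ U) {Λ : ℝ} (hΛ : 0 < Λ)
    {f : Eu n → ℝ} (hf : Helm Λ U f) {ε : ℝ} (hε : 0 < ε) :
    ∃ p ∈ waves n Λ, ∫ x, K.indicator (fun y => f y - p y) x ^ 2 < ε ^ 2 := by
  have hfK : ContinuousOn f K := fun x hx => (hf.sm x (hKU hx)).cont.continuousWithinAt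
  have hfm := memLp_indicator hK hfK
  let S : Submodule ℝ (Lp ℝ 2 (volume : Measure (Eu n))) :=
    { carrier := {u | ∃ p ∈ waves n Λ, u =ᵐ[volume] K.indicator p}
      zero_mem' := ⟨0, zero_mem _, by
        filter_upwards [Lp.coeFn_zero ℝ 2 (volume : Measure (Eu n))] with x hx
        exact hx.trans (by simp)⟩
      add_mem' := by
        rintro u w ⟨p, hp, hup⟩ ⟨q, hq, hwq⟩
        refine ⟨p + q, add_mem hp hq, ?_⟩
        filter_upwards [Lp.coeFn_add u w, hup, hwq] with x h1 h2 h3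
        rw [h1, Pi.add_apply, h2, h3, Set.indicator_add']; rfl
      smul_mem' := by
        rintro a u ⟨p, hp, hup⟩
        refine ⟨a • p, Submodule.smul_mem _ a hp, ?_⟩
        filter_upwards [Lp.coeFn_smul a u, hup] with x h1 h2
        rw [h1, Pi.smul_apply, h2]
        by_cases hx : x ∈ K <;> simp [hx] }
  have hin : ∀ u w : Lp ℝ 2 (volume : Measure (Eu n)), ⟪u, w⟫ = ∫ x, u x * w x := fun u w => by
    rw [L2.inner_def]
    refine integral_congr_ae (Eventually.of_forall fun x => ?_)
    simp [mul_comm]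
  have hcl : hfm.toLp _ ∈ S.topologicalClosure := by
    rw [← Submodule.orthogonal_orthogonal_eq_closure, Submodule.mem_orthogonal]
    intro h hh
    have hh' : MemLp (K.indicator h) 2 := (Lp.memLp h).indicator hK.measurableSet
    have key : ∀ p ∈ waves n Λ, ∫ x, K.indicator h x * p x = 0 := fun p hp => by
      have hpm := memLp_indicator hK (contDiff_of_mem_waves hp).continuous.continuousOn
      have := (Submodule.mem_orthogonal _ _).1 hh (hpm.toLp _) ⟨p, hp, hpm.coeFn_toLp⟩
      rw [hin] at this
      rw [← this]
      refine integral_congr_ae ?_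
      filter_upwards [hpm.coeFn_toLp] with x hx
      rw [hx, indicator_mul_comm, mul_comm]
    have := runge i₀ hn hK hKp hU hKU hΛ hh' (fun x hx => Set.indicator_of_notMem hx _)
      (fun v hv => key _ (Submodule.subset_span ⟨v, hv, .inl rfl⟩))
      (fun v hv => key _ (Submodule.subset_span ⟨v, hv, .inr rfl⟩)) hf
    rw [hin, ← this]
    refine integral_congr_ae ?_
    filter_upwards [hfm.coeFn_toLp] with x hx
    rw [hx, indicator_mul_comm]
  obtain ⟨u, ⟨p, hp, hup⟩, hd⟩ := Metric.mem_closure_iff.1 hcl ε hε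
  refine ⟨p, hp, ?_⟩
  rw [dist_eq_norm] at hd
  refine lt_of_eq_of_lt ?_ (pow_lt_pow_left₀ hd (norm_nonneg _) two_ne_zero)
  rw [← real_inner_self_eq_norm_sq, hin]
  refine integral_congr_ae ?_
  filter_upwards [hfm.coeFn_toLp, Lp.coeFn_sub (hfm.toLp _) u, hup] with x h1 h2 h3
  rw [h2, Pi.sub_apply, h1, h3]
  by_cases hx : x ∈ K <;> simp [hx, sq]

theorem exists_wave (i₀ : Fin n) (hn : 2 ≤ n) {K K₀ U : Set (Eu n)} (hK : IsCompact K)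
    (hKp : IsPreconnected Kᶜ) (hU : IsOpen U) (hKU : K ⊆ U) {Λ : ℝ} (hΛ : 0 < Λ)
    {f : Eu n → ℝ} (hf : Helm Λ U f) {r₀ : ℝ} (hr₀ : 0 < r₀)
    (hK₀ : ∀ x ∈ K₀, Metric.closedBall x r₀ ⊆ K) {ε : ℝ} (hε : 0 < ε) :
    ∃ p ∈ waves n Λ, ∀ x ∈ K₀, |f x - p x| < ε ∧ ∀ i, |pd i f x - pd i p x| < ε := by
  obtain ⟨C, -, hker⟩ := exists_ker i₀
  obtain ⟨r, hr, hrr, hrΛ⟩ : ∃ r > 0, r ≤ r₀ ∧ Λ * r ^ 2 ≤ 1 := by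
    refine ⟨min r₀ (√(1 / Λ)), lt_min hr₀ (Real.sqrt_pos.2 (by positivity)), min_le_left _ _, ?_⟩
    have := pow_le_pow_left₀ (by positivity) (min_le_right r₀ (√(1 / Λ))) 2
    rw [Real.sq_sqrt (by positivity)] at this
    calc _ ≤ Λ * (1 / Λ) := by gcongr
      _ = 1 := by field_simp
  obtain ⟨k, hk, -⟩ := hker Λ r hΛ.le hr hrΛ
  set M := (∫ z, k z ^ 2) + ∑ i, ∫ z, pd i k z ^ 2 with hM
  have h0 : ∀ l : Eu n → ℝ, 0 ≤ ∫ z, l z ^ 2 := fun l => integral_nonneg fun z => sq_nonneg _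
  have hM1 : ∫ z, k z ^ 2 ≤ M := le_add_of_nonneg_right (Finset.sum_nonneg fun i _ => h0 _)
  have hM2 : ∀ i, ∫ z, pd i k z ^ 2 ≤ M := fun i =>
    (Finset.single_le_sum (f := fun i => ∫ z, pd i k z ^ 2) (fun i _ => h0 _)
      (Finset.mem_univ i)).trans (le_add_of_nonneg_left (h0 k))
  have hM0 : 0 ≤ M := (h0 k).trans hM1
  obtain ⟨p, hp, hpe⟩ := exists_wave_l2 i₀ hn hK hKp hU hKU hΛ hf
    (ε := ε / √(M + 1)) (by positivity)
  refine ⟨p, hp, fun x hx => ?_⟩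
  rw [div_pow, Real.sq_sqrt (by positivity), lt_div_iff₀ (by positivity)] at hpe
  have hps := contDiff_of_mem_waves hp
  have hgK : ContinuousOn (fun y => f y - p y) K := fun y hy =>
    ((hf.sm y (hKU hy)).cont.sub hps.continuous.continuousAt).continuousWithinAt
  have hgm := memLp_indicator hK hgK
  have hball : Metric.closedBall x r ⊆ K :=
    (Metric.closedBall_subset_closedBall hrr).trans (hK₀ x hx)
  have hxU : x ∈ U := hKU (hball (Metric.mem_closedBall_self hr.le))
  have est : ∀ l : Eu n → ℝ, Tst l → (∀ w, r < ‖w‖ → l w = 0) → ∫ z, l z ^ 2 ≤ M →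
      |cv (fun y => f y - p y) l x| < ε := fun l hl hl0 hlM => by
    have e : cv (fun y => f y - p y) l x
        = ∫ y, K.indicator (fun y => f y - p y) y * l (x - y) := by
      refine integral_congr_ae (Eventually.of_forall fun y => ?_)
      by_cases hy : y ∈ K
      · simp [hy]
      · have : l (x - y) = 0 := hl0 _ (by
          by_contra! h
          exact hy (hball (by rwa [Metric.mem_closedBall, dist_comm, dist_eq_norm])))
        simp [this]
    have h1 := sq_integral_mul_le hgm (hl.comp_sub x).memLp2
    rw [integral_sub_left_eq_self (fun y => l y ^ 2) volume x, ← e] at h1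
    refine abs_lt_of_sq_lt_sq (h1.trans_lt (lt_of_le_of_lt ?_ hpe)) hε.le
    exact mul_le_mul_of_nonneg_left (by linarith) (h0 _)
  have hg : Helm Λ U fun y => f y - p y := hf.sub (helm_of_mem_waves hp U)
  obtain ⟨h1, h2⟩ := hk.cv_eq hU hg (hball.trans hKU)
  refine ⟨?_, fun i => ?_⟩
  · rw [← h1]
    exact est k hk.tst (fun w hw => hk.zero w hw.le) hM1
  · have : pd i (fun y => f y - p y) x = pd i f x - pd i p x := by
      simp only [Mono.pd]
      rw [fderiv_fun_sub (hf.sm x hxU).diff (hps.differentiable (by simp) x)]; rfl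
    rw [← this, h2 i]
    exact est _ (hk.tst.pd i) (fun w hw => hk.pd_zero i hw) (hM2 i)

lemma exists_repr_of_mem_waves {Λ : ℝ} (hΛ : 0 < Λ) {p : Eu n → ℝ} (hp : p ∈ waves n Λ) :
    ∃ (N : ℕ) (ξ : Fin N → Metric.sphere (0 : Eu n) 1) (α β : Fin N → ℝ), ∀ x : Eu n,
      p ((√Λ)⁻¹ • x) = ∑ j, (α j * Real.cos ⟪x, (ξ j : Eu n)⟫ + β j * Real.sin ⟪x, (ξ j : Eu n)⟫) := by
  have hΛ' : 0 < √Λ := Real.sqrt_pos.2 hΛ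
  obtain ⟨N, a, w, rfl⟩ := Submodule.mem_span_set'.1 hp
  have hw : ∀ j, ∃ (ξ : Metric.sphere (0 : Eu n) 1) (b d : ℝ), ∀ x : Eu n,
      (w j : Eu n → ℝ) ((√Λ)⁻¹ • x) = b * Real.cos ⟪x, (ξ : Eu n)⟫ + d * Real.sin ⟪x, (ξ : Eu n)⟫ := by
    intro j
    obtain ⟨v, hv, h⟩ := (w j).2
    have hv' : ‖v‖ = √Λ := by rw [← hv, Real.sqrt_sq (norm_nonneg _)]
    refine ⟨⟨(√Λ)⁻¹ • v, ?_⟩, ?_⟩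
    · rw [mem_sphere_zero_iff_norm, norm_smul, hv', norm_inv, Real.norm_of_nonneg hΛ'.le,
        inv_mul_cancel₀ hΛ'.ne']
    · rcases h with h | h
      · exact ⟨1, 0, fun x => by simp [h, real_inner_smul_left, real_inner_smul_right]⟩
      · exact ⟨0, 1, fun x => by simp [h, real_inner_smul_left, real_inner_smul_right]⟩
  choose ξ b d h using hw
  refine ⟨N, ξ, fun j => a j * b j, fun j => a j * d j, fun x => ?_⟩
  rw [Finset.sum_apply]
  refine Finset.sum_congr rfl fun j _ => ?_
  rw [Pi.smul_apply, h, smul_eq_mul]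
  ring

/-- A wave is close enough in `C¹` to the given solution to inherit its signs and monotonicity. -/
lemma DefFn.exists_wave (i₀ : Fin n) (hn : 2 ≤ n) {c : Set (Eu n)} {g : Eu n → ℝ} (hg : DefFn c g)
    (hc : IsCompact c) (hcc : IsConnected c) : ∃ R L a t Λ s t₂ p, Geo g R L a t ∧ 0 < Λ ∧ 0 < s ∧
      s < t₂ ∧ t₂ ≤ t ∧ p ∈ waves n Λ ∧ (∀ x, g x = s → p x < 0) ∧ (∀ x, t₂ ≤ g x → 0 < p x) ∧
      ∀ x, s ≤ g x → g x ≤ t₂ → 0 < fderiv ℝ p x (gr g x) := by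
  obtain ⟨R, L, a, t, Λ, s', t₂, f, hG, hΛ, hs', hst, ht₂, hf, hneg, hpos, hd⟩ :=
    hg.exists_helm i₀ hc hcc
  obtain ⟨s₁, hs₁, hpre⟩ := hg.isPreconnected_lt i₀ hc hcc
  obtain ⟨s, hs, hss', hss₁⟩ : ∃ s > 0, s ≤ s' ∧ s ≤ s₁ :=
    ⟨min s' s₁, lt_min hs' hs₁, min_le_left _ _, min_le_right _ _⟩
  have ht := hG.t_pos
  have ht1 := hG.t_le
  have hL := hG.one_le
  have hcont := hG.sm.continuous
  have hfc : ∀ {x}, 0 < g x → ContinuousAt f x := fun {x} hx => (hf.sm x hx).cont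
  have hK : IsCompact {x | s / 2 ≤ g x} := hG.isCompact_ge (by linarith)
  have hK₀ : IsCompact {x | s ≤ g x} := hG.isCompact_ge (by linarith)
  have hA : IsCompact {x | s ≤ g x ∧ g x ≤ s} := hG.isCompact_Icc (by linarith) s
  have hB : IsCompact {x | t₂ ≤ g x} := hG.isCompact_ge (by linarith)
  have hC : IsCompact {x | s ≤ g x ∧ g x ≤ t₂} := hG.isCompact_Icc (by linarith) t₂
  obtain ⟨ε₁, hε₁, h₁⟩ := hA.exists_forall_le' (f := fun x => -f x) (a := 0)
    (fun x hx => (hfc (hs.trans_le hx.1)).neg.continuousWithinAt)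
    (fun x hx => neg_pos.2 (hneg x (hs.trans_le hx.1) (hx.2.trans hss')))
  obtain ⟨ε₂, hε₂, h₂⟩ := hB.exists_forall_le' (f := f) (a := 0)
    (fun x hx => (hfc (lt_of_lt_of_le (by linarith) hx)).continuousWithinAt) hpos
  have hdc : ContinuousOn (fun x => fderiv ℝ f x (gr g x)) {x | s ≤ g x ∧ g x ≤ t₂} := by
    simp_rw [fderiv_eq_sum]
    refine continuousOn_finsetSum _ fun i _ => ContinuousOn.mul ?_ fun x hx =>
      ((hf.sm x (hs.trans_le hx.1)).pd i).cont.continuousWithinAt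
    have := (contDiff_gr hG.sm).continuous
    fun_prop
  obtain ⟨ε₃, hε₃, h₃⟩ := hC.exists_forall_le' (a := 0) hdc
    fun x hx => hd x (hs.trans_le hx.1) hx.2
  have hr₀ : 0 < s / (2 * L) := by positivity
  have hr₁ : s / (2 * L) ≤ 1 := by
    rw [div_le_one (by positivity)]; linarith
  have hR : ∀ x, 0 ≤ g x → ‖x‖ ≤ R + 1 := fun x hx => by
    linarith [hG.bdd x (by linarith)]
  have hball : ∀ x ∈ {x | s ≤ g x}, Metric.closedBall x (s / (2 * L)) ⊆ {x | s / 2 ≤ g x} := by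
    intro x (hx : s ≤ g x) y hy
    rw [Metric.mem_closedBall, dist_comm, dist_eq_norm] at hy
    have hyR : ‖y‖ ≤ R + 1 := by
      have := hG.bdd x (by linarith)
      have h := norm_sub_norm_le y x
      rw [norm_sub_rev] at h
      linarith
    have h := (abs_le.1 (hG.lip x y (hR x (by linarith)) hyR)).2
    have h' : L * ‖x - y‖ ≤ s / 2 := by
      calc _ ≤ L * (s / (2 * L)) := by gcongr
        _ = s / 2 := by field_simp
    change s / 2 ≤ g y
    linarith
  obtain ⟨p, hp, hpf⟩ := Mono.exists_wave i₀ hn hK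
    (by simpa only [compl_ofPred, not_le] using hpre (s / 2) (by linarith) (by linarith))
    hG.isOpen_pos (fun x (hx : s / 2 ≤ g x) => show 0 < g x by linarith) hΛ hf hr₀ hball
    (ε := min (min ε₁ ε₂) (ε₃ / (n * L + 1))) (by positivity)
  have hpε : ∀ x, s ≤ g x → |f x - p x| < ε₁ ∧ |f x - p x| < ε₂ ∧
      ∀ i, |pd i f x - pd i p x| < ε₃ / (n * L + 1) := fun x hx => by
    obtain ⟨h, h'⟩ := hpf x hx
    simp only [lt_min_iff] at h h'
    exact ⟨h.1.1, h.1.2, fun i => (h' i).2⟩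
  refine ⟨R, L, a, t, Λ, s, t₂, p, hG, hΛ, hs, by linarith, ht₂, hp, fun x hx => ?_, fun x hx => ?_,
    fun x hx hx' => ?_⟩
  · have := h₁ x ⟨hx.ge, hx.le⟩
    linarith [(abs_lt.1 (hpε x hx.ge).1).1]
  · have := h₂ x hx
    linarith [(abs_lt.1 (hpε x (by linarith)).2.1).2]
  · have h := h₃ x ⟨hx, hx'⟩
    have hle : |fderiv ℝ f x (gr g x) - fderiv ℝ p x (gr g x)| ≤ n * (L * (ε₃ / (n * L + 1))) := by
      rw [fderiv_eq_sum, fderiv_eq_sum, ← Finset.sum_sub_distrib]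
      refine (Finset.abs_sum_le_sum_abs _ _).trans ?_
      refine (Finset.sum_le_card_nsmul _ _ (L * (ε₃ / (n * L + 1))) fun i _ => ?_).trans
        (by simp)
      rw [← mul_sub, abs_mul]
      refine mul_le_mul ?_ ((hpε x hx).2.2 i).le (abs_nonneg _) (by linarith)
      exact (PiLp.norm_apply_le (gr g x) i).trans (hG.gr_le x (hR x (by linarith)))
    have hlt : n * (L * (ε₃ / (n * L + 1))) < ε₃ := by
      rw [← mul_div_assoc, ← mul_div_assoc, div_lt_iff₀ (by positivity)]
      nlinarith
    linarith [(abs_le.1 hle).2]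

theorem exists_wave_component (i₀ : Fin n) (hn : 2 ≤ n) {c : Set (Eu n)} (hc : IsCompact c)
    (hcc : IsConnected c) (hh : IsSmoothHypersurface c) :
    ∃ Λ > 0, ∃ p ∈ waves n Λ, ∃ Ψ : Eu n → Eu n, IsDiffeo Ψ ∧
      ∃ x₀ ∈ p ⁻¹' {0}, Ψ '' c = connectedComponentIn (p ⁻¹' {0}) x₀ := by
  obtain ⟨g, hg⟩ := exists_defFn hn hc hcc.nonempty hh
  obtain ⟨R, L, a, t, Λ, s, t₂, p, hG, hΛ, hs, hst, ht₂, hp, hneg, hpos, hd⟩ :=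
    hg.exists_wave i₀ hn hc hcc
  have hps := contDiff_of_mem_waves hp
  have hgc := hG.sm.continuous
  have ht := hG.t_pos
  obtain ⟨m, hm, hm'⟩ := exists_between hst
  have hgm : ContDiff ℝ ∞ fun x => g x - m := hG.sm.sub contDiff_const
  have hfd : ∀ x, fderiv ℝ (fun x => g x - m) x = fderiv ℝ g x := fun x => fderiv_sub_const m
  have hreg : ∀ x, |g x| ≤ t → 0 < fderiv ℝ g x (gr g x) := fun x hx => by
    rw [fderiv_gr]; exact hG.a_pos.trans_le (hG.reg x hx)
  obtain ⟨Ψ₁, hΨ₁, e₁⟩ := exists_isotopy hG.sm hgm (contDiff_gr hG.sm)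
    (O := {x | -t < g x ∧ g x < t₂}) (K := {x | 0 ≤ g x ∧ g x ≤ m})
    ((isOpen_lt continuous_const hgc).inter (isOpen_lt hgc continuous_const))
    (hG.isCompact_Icc (by linarith) m) (fun x hx => ⟨by linarith [hx.1], by linarith [hx.2]⟩)
    (fun θ hθ x _ hx => by
      have : g x = θ * m := by unfold cvx at hx; linarith
      have h1 := mul_nonneg hθ.1 (hs.trans hm).le
      have h2 := mul_le_mul_of_nonneg_right hθ.2 (hs.trans hm).le
      exact ⟨by linarith, by linarith⟩)
    (fun x hx => hreg x (abs_le.2 ⟨by linarith [hx.1], by linarith [hx.2]⟩))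
    (fun x hx => by
      rw [hfd]
      exact hreg x (abs_le.2 ⟨by linarith [hx.1], by linarith [hx.2]⟩))
  have hcv : Continuous fun q : ℝ × Eu n => cvx (fun x => g x - m) p q.1 q.2 :=
    (contDiff_cvx hgm hps).continuous
  have hzc : IsCompact (Prod.snd '' (Icc (0 : ℝ) 1 ×ˢ {x | s ≤ g x ∧ g x ≤ t₂} ∩
      {q : ℝ × Eu n | cvx (fun x => g x - m) p q.1 q.2 = 0})) :=
    ((isCompact_Icc.prod (hG.isCompact_Icc (by linarith) t₂)).inter_right
      (isClosed_eq hcv continuous_const)).image continuous_snd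
  obtain ⟨Ψ₂, hΨ₂, e₂⟩ := exists_isotopy hgm hps (contDiff_gr hG.sm)
    (O := {x | s < g x ∧ g x < t₂})
    ((isOpen_lt continuous_const hgc).inter (isOpen_lt hgc continuous_const)) hzc
    (by
      rintro _ ⟨⟨θ, x⟩, ⟨⟨⟨h0, h1⟩, h2, h3⟩, h4⟩, rfl⟩
      simp only at h0 h1 h2 h3
      change (1 - θ) * (g x - m) + θ * p x = 0 at h4
      refine ⟨lt_of_le_of_ne h2 fun h => ?_, lt_of_le_of_ne h3 fun h => ?_⟩
      · have := hneg x h.symm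
        rw [← h] at h4
        nlinarith [mul_nonneg h0 (neg_nonneg.2 this.le),
          mul_nonneg (sub_nonneg.2 h1) (sub_nonneg.2 hm.le)]
      · have := hpos x h.ge
        rw [h] at h4
        nlinarith [mul_nonneg h0 this.le, mul_nonneg (sub_nonneg.2 h1) (sub_nonneg.2 hm'.le)])
    (fun θ hθ x hx h => ⟨(θ, x), ⟨⟨hθ, hx.1.le, hx.2.le⟩, h⟩, rfl⟩)
    (by
      rintro _ ⟨⟨θ, x⟩, ⟨⟨-, h2, h3⟩, -⟩, rfl⟩
      simp only at h2 h3 ⊢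
      rw [hfd]
      exact hreg x (abs_le.2 ⟨by linarith, by linarith⟩))
    (by
      rintro _ ⟨⟨θ, x⟩, ⟨⟨-, h2, h3⟩, -⟩, rfl⟩
      exact hd x h2 h3)
  have ec : {x | x ∈ {x | -t < g x ∧ g x < t₂} ∧ g x = 0} = c := by
    ext x
    rw [← hg.zero]
    exact ⟨fun h => h.2, fun h => ⟨⟨by linarith, by linarith⟩, h⟩⟩
  have em : {x | x ∈ {x | -t < g x ∧ g x < t₂} ∧ g x - m = 0}
      = {x | x ∈ {x | s < g x ∧ g x < t₂} ∧ g x - m = 0} := by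
    ext x
    exact ⟨fun ⟨h, h'⟩ => ⟨⟨by linarith, h.2⟩, h'⟩, fun ⟨h, h'⟩ => ⟨⟨by linarith, h.2⟩, h'⟩⟩
  rw [ec, em] at e₁
  have e : (Ψ₂ ∘ Ψ₁) '' c = {x | x ∈ {x | s < g x ∧ g x < t₂} ∧ p x = 0} := by
    rw [image_comp, e₁, e₂]
  have hΨ : IsDiffeo (Ψ₂ ∘ Ψ₁) := hΨ₂.comp hΨ₁
  obtain ⟨y, hy⟩ := hcc.nonempty
  have hy' := e ▸ mem_image_of_mem (Ψ₂ ∘ Ψ₁) hy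
  refine ⟨Λ, hΛ, p, hp, Ψ₂ ∘ Ψ₁, hΨ, (Ψ₂ ∘ Ψ₁) y, hy'.2, subset_antisymm ?_ ?_⟩
  · refine (hcc.isPreconnected.image _ hΨ.1.continuous.continuousOn).subset_connectedComponentIn
      (mem_image_of_mem _ hy) ?_
    rw [e]
    exact fun x hx => hx.2
  · have hsub := connectedComponentIn_subset (p ⁻¹' {0}) ((Ψ₂ ∘ Ψ₁) y)
    have := (isPreconnected_connectedComponentIn (F := p ⁻¹' {0})
      (x := (Ψ₂ ∘ Ψ₁) y)).subset_left_of_subset_union (isOpen_lt continuous_const hgc)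
      (isOpen_lt hgc continuous_const)
      (disjoint_left.2 fun x (h : s < g x) (h' : g x < s) => lt_asymm h h')
      (fun x hx => by
        have h : p x = 0 := hsub hx
        rcases lt_trichotomy s (g x) with h' | h' | h'
        · exact .inl h'
        · exact absurd (hneg x h'.symm) (by rw [h]; exact lt_irrefl _)
        · exact .inr h')
      ⟨_, mem_connectedComponentIn hy'.2, hy'.1.1⟩
    rw [e]
    intro x hx
    have h : p x = 0 := hsub hx
    refine ⟨⟨this hx, ?_⟩, h⟩
    by_contra! h'
    exact absurd (hpos x h') (by rw [h]; exact lt_irrefl _)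

end Mono

theorem stmt13 (n : ℕ) (hn : 2 ≤ n) (c : Set (EuclideanSpace ℝ (Fin n)))
    (hc : IsCompact c) (hconn : IsConnected c) (hhyp : IsSmoothHypersurface c) :
    ∃ lam : ℝ, 0 < lam ∧
      ∃ (N : ℕ) (ξ : Fin N → Metric.sphere (0 : EuclideanSpace ℝ (Fin n)) 1)
        (α β : Fin N → ℝ) (f : EuclideanSpace ℝ (Fin n) → ℝ),
        (∀ x : EuclideanSpace ℝ (Fin n),
          f x = ∑ j, (α j * Real.cos ⟪x, (ξ j : EuclideanSpace ℝ (Fin n))⟫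
            + β j * Real.sin ⟪x, (ξ j : EuclideanSpace ℝ (Fin n))⟫)) ∧
        ∃ Ψ Φ : EuclideanSpace ℝ (Fin n) → EuclideanSpace ℝ (Fin n),
          ContDiff ℝ (⊤ : ℕ∞) Ψ ∧ ContDiff ℝ (⊤ : ℕ∞) Φ ∧
          Function.LeftInverse Φ Ψ ∧ Function.RightInverse Φ Ψ ∧
          ∃ x₀ ∈ f ⁻¹' {0},
            Ψ '' ((fun y => lam • y) '' c) = connectedComponentIn (f ⁻¹' {0}) x₀ := by
  obtain ⟨Λ, hΛ, p, hp, Ψ, ⟨hΨ, Φ, hΦ, hl, hr⟩, x₀, hx₀, e⟩ :=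
    Mono.exists_wave_component ⟨0, by lia⟩ hn hc hconn hhyp
  obtain ⟨N, ξ, α, β, hrep⟩ := Mono.exists_repr_of_mem_waves hΛ hp
  have hne : √Λ ≠ 0 := (Real.sqrt_pos.2 hΛ).ne'
  have hpre : (Homeomorph.smulOfNeZero (√Λ) hne) '' (p ⁻¹' {0})
      = (fun x => p ((√Λ)⁻¹ • x)) ⁻¹' {0} := by
    ext x
    constructor
    · rintro ⟨y, hy, rfl⟩
      simpa [smul_smul, hne] using hy
    · exact fun hx => ⟨(√Λ)⁻¹ • x, hx, by simp [smul_smul, hne]⟩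
  refine ⟨1, one_pos, N, ξ, α, β, fun x => p ((√Λ)⁻¹ • x), hrep, fun x => √Λ • Ψ x,
    fun x => Φ ((√Λ)⁻¹ • x), hΨ.const_smul _, hΦ.comp (by fun_prop), fun x => ?_, fun x => ?_,
    √Λ • x₀, by simpa [smul_smul, hne] using hx₀, ?_⟩
  · simp only [smul_smul, inv_mul_cancel₀ hne, one_smul, hl x]
  · simp only [hr _, smul_smul, mul_inv_cancel₀ hne, one_smul]
  · have := (Homeomorph.smulOfNeZero (√Λ) hne).image_connectedComponentIn hx₀
    rw [hpre, ← e, Set.image_image] at this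
    simpa [Set.image_image] using this
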